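/- Let k be a finite field and X an excellent k-scheme of pure dimension at least 3 that is topologically S2. Let x in X be a point with finite residue field k(x), let pi : Xbar -> X be the normalization of X and let xbar be the (finite) preimage of x. Then the kernel of the pull-back map pi^* : Pic^loc(x, X) -> Pic^loc(xbar, Xbar) consists of torsion elements. -/

import Mathlib

open AlgebraicGeometry CategoryTheory Opposite TopologicalSpace

universe u

namespace LocalPic

/-- Restriction of invertible sections along an inclusion of opens. -/
def resU (X : Scheme.{u}) {U V : X.Opens} (h : V ≤ U) :
    (Γ(X, U))ˣ →* (Γ(X, V))ˣ :=
  Units.map (X.presheaf.map (homOfLE h).op).hom.toMonoidHom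

/-- Restriction of sections along an inclusion of opens. -/
def resS (X : Scheme.{u}) {U V : X.Opens} (h : V ≤ U) : ↥Γ(X, U) →+* ↥Γ(X, V) :=
  (X.presheaf.map (homOfLE h).op).hom

lemma resU_resU (X : Scheme.{u}) {U V W : X.Opens} (h1 : W ≤ V) (h2 : V ≤ U)
    (u : (Γ(X, U))ˣ) :
    resU X h1 (resU X h2 u) = resU X (h1.trans h2) u := by
  ext
  show (X.presheaf.map (homOfLE h1).op) ((X.presheaf.map (homOfLE h2).op) u) = _
  rw [← CategoryTheory.comp_apply, ← Functor.map_comp, ← op_comp, homOfLE_comp]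
  rfl

/-- A line bundle on the open subset `V` of a scheme `X`, presented by a Čech 1-cocycle
of invertible sections with respect to an open cover of `V`. -/
structure LineBundleOn (X : Scheme.{u}) (V : X.Opens) : Type (u + 1) where
  ι : Type u
  U : ι → X.Opens
  le : ∀ i, U i ≤ V
  covers : ∀ x ∈ V, ∃ i, x ∈ U i
  t : ∀ i j, (Γ(X, U i ⊓ U j))ˣ
  cocycle : ∀ i j k,
    resU X (inf_le_left : U i ⊓ U j ⊓ U k ≤ U i ⊓ U j) (t i j) *
      resU X (le_inf (inf_le_left.trans inf_le_right) inf_le_right :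
        U i ⊓ U j ⊓ U k ≤ U j ⊓ U k) (t j k) =
    resU X (le_inf (inf_le_left.trans inf_le_left) inf_le_right :
        U i ⊓ U j ⊓ U k ≤ U i ⊓ U k) (t i k)

namespace LineBundleOn

variable {X Y : Scheme.{u}} {V : X.Opens}

lemma cocycle_res (L : LineBundleOn X V) (i j k : L.ι) {W : X.Opens}
    (h : W ≤ L.U i ⊓ L.U j ⊓ L.U k)
    (h1 : W ≤ L.U i ⊓ L.U j) (h2 : W ≤ L.U j ⊓ L.U k) (h3 : W ≤ L.U i ⊓ L.U k) :
    resU X h1 (L.t i j) * resU X h2 (L.t j k) = resU X h3 (L.t i k) := by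
  have e := congrArg (resU X h) (L.cocycle i j k)
  rw [map_mul, resU_resU, resU_resU, resU_resU] at e
  exact e

/-- Tensor powers of a line bundle. -/
def pow (L : LineBundleOn X V) (n : ℕ) : LineBundleOn X V where
  ι := L.ι
  U := L.U
  le := L.le
  covers := L.covers
  t i j := (L.t i j) ^ n
  cocycle i j k := by rw [map_pow, map_pow, map_pow, ← mul_pow, L.cocycle]

/-- The inverse (dual) of a line bundle. -/
def inv (L : LineBundleOn X V) : LineBundleOn X V where
  ι := L.ι
  U := L.U
  le := L.le
  covers := L.covers
  t i j := (L.t i j)⁻¹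
  cocycle i j k := by rw [map_inv, map_inv, map_inv, ← mul_inv, L.cocycle]

/-- A line bundle is trivial if its cocycle is a coboundary, i.e. if it admits a
nowhere vanishing global section. -/
def IsTrivial (L : LineBundleOn X V) : Prop :=
  ∃ s : ∀ i, (Γ(X, L.U i))ˣ, ∀ i j,
    L.t i j = resU X inf_le_left (s i) * (resU X inf_le_right (s j))⁻¹

/-- A line bundle is torsion if some positive tensor power of it is trivial. -/
def IsTorsion (L : LineBundleOn X V) : Prop :=
  ∃ n : ℕ, 0 < n ∧ IsTrivial (L.pow n)

def preimage_inf_le (f : Y ⟶ X) (A B : X.Opens) :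
    f ⁻¹ᵁ A ⊓ f ⁻¹ᵁ B ≤ f ⁻¹ᵁ (A ⊓ B) := by
  intro x hx
  have hx' : x ∈ (↑(f ⁻¹ᵁ A ⊓ f ⁻¹ᵁ B) : Set Y) := hx
  rw [Opens.coe_inf] at hx'
  exact ⟨hx'.1, hx'.2⟩

/-- Mapping invertible sections along the pull-back of sections of a morphism. -/
def mapU (f : Y ⟶ X) {U : X.Opens} {W : Y.Opens} (e : W ≤ f ⁻¹ᵁ U) :
    (Γ(X, U))ˣ →* (Γ(Y, W))ˣ :=
  Units.map (f.appLE U W e).hom.toMonoidHom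

lemma resU_mapU (f : Y ⟶ X) {U : X.Opens} {W W' : Y.Opens} (e : W ≤ f ⁻¹ᵁ U)
    (h : W' ≤ W) (u : (Γ(X, U))ˣ) :
    resU Y h (mapU f e u) = mapU f (h.trans e) u := by
  ext
  show (Y.presheaf.map (homOfLE h).op) ((f.appLE U W e) u) = (f.appLE U W' _) u
  rw [← CategoryTheory.comp_apply, Scheme.Hom.appLE_map]

lemma mapU_resU (f : Y ⟶ X) {U U' : X.Opens} {W : Y.Opens} (hU : U' ≤ U)
    (e : W ≤ f ⁻¹ᵁ U') (e' : W ≤ f ⁻¹ᵁ U) (u : (Γ(X, U))ˣ) :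
    mapU f e (resU X hU u) = mapU f e' u := by
  ext
  show (f.appLE U' W e) ((X.presheaf.map (homOfLE hU).op) u) = (f.appLE U W e') u
  rw [← CategoryTheory.comp_apply, Scheme.Hom.map_appLE]

/-- Pullback of a line bundle along a morphism of schemes. -/
def pullback (f : Y ⟶ X) (L : LineBundleOn X V) : LineBundleOn Y (f ⁻¹ᵁ V) where
  ι := L.ι
  U i := f ⁻¹ᵁ L.U i
  le i x hx := L.le i hx
  covers x hx := by
    obtain ⟨i, hi⟩ := L.covers (f.base x) hx
    exact ⟨i, hi⟩
  t i j := mapU f (preimage_inf_le f (L.U i) (L.U j)) (L.t i j)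
  cocycle i j k := by
    rw [resU_mapU, resU_mapU, resU_mapU,
        ← mapU_resU f (inf_le_left : L.U i ⊓ L.U j ⊓ L.U k ≤ L.U i ⊓ L.U j),
        ← mapU_resU f (le_inf (inf_le_left.trans inf_le_right) inf_le_right :
          L.U i ⊓ L.U j ⊓ L.U k ≤ L.U j ⊓ L.U k),
        ← mapU_resU f (le_inf (inf_le_left.trans inf_le_left) inf_le_right :
          L.U i ⊓ L.U j ⊓ L.U k ≤ L.U i ⊓ L.U k),
        ← map_mul, L.cocycle]
    all_goals
      intro x hx
      have hx' : x ∈ (↑(f ⁻¹ᵁ L.U i ⊓ f ⁻¹ᵁ L.U j ⊓ f ⁻¹ᵁ L.U k) : Set Y) := hx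
      rw [Opens.coe_inf, Opens.coe_inf] at hx'
      exact ⟨⟨hx'.1.1, hx'.1.2⟩, hx'.2⟩

/-- Tensor product of two line bundles on the same open set. -/
def mul (L M : LineBundleOn X V) : LineBundleOn X V where
  ι := L.ι × M.ι
  U p := L.U p.1 ⊓ M.U p.2
  le p := inf_le_left.trans (L.le p.1)
  covers x hx := by
    obtain ⟨i, hi⟩ := L.covers x hx
    obtain ⟨a, ha⟩ := M.covers x hx
    exact ⟨(i, a), ⟨hi, ha⟩⟩
  t p q := resU X (le_inf (inf_le_left.trans inf_le_left) (inf_le_right.trans inf_le_left))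
      (L.t p.1 q.1) *
    resU X (le_inf (inf_le_left.trans inf_le_right) (inf_le_right.trans inf_le_right))
      (M.t p.2 q.2)
  cocycle := by
    rintro ⟨i, a⟩ ⟨j, b⟩ ⟨k, c⟩
    simp only [map_mul, resU_resU]
    rw [mul_mul_mul_comm,
      L.cocycle_res i j k (h := le_inf (le_inf
        ((inf_le_left.trans inf_le_left).trans inf_le_left)
        ((inf_le_left.trans inf_le_right).trans inf_le_left))
        (inf_le_right.trans inf_le_left)),
      M.cocycle_res a b c (h := le_inf (le_inf
        ((inf_le_left.trans inf_le_left).trans inf_le_right)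
        ((inf_le_left.trans inf_le_right).trans inf_le_right))
        (inf_le_right.trans inf_le_right))]

/-- Restriction of a line bundle to a smaller open set. -/
def restrict (L : LineBundleOn X V) {V' : X.Opens} (h : V' ≤ V) : LineBundleOn X V' where
  ι := L.ι
  U i := L.U i ⊓ V'
  le i := inf_le_right
  covers x hx := by
    obtain ⟨i, hi⟩ := L.covers x (h hx)
    exact ⟨i, ⟨hi, hx⟩⟩
  t i j := resU X (le_inf (inf_le_left.trans inf_le_left)
      (inf_le_right.trans inf_le_left)) (L.t i j)
  cocycle i j k := by
    simp only [resU_resU]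
    exact L.cocycle_res i j k (h := le_inf (le_inf
      (inf_le_left.trans (inf_le_left.trans inf_le_left))
      (inf_le_left.trans (inf_le_right.trans inf_le_left)))
      (inf_le_right.trans inf_le_left)) _ _ _

/-- Two line bundles are isomorphic iff `L ⊗ M⁻¹` is trivial. -/
def Isomorphic (L M : LineBundleOn X V) : Prop :=
  IsTrivial (mul L (inv M))

end LineBundleOn

/-- A morphism of schemes is a universal homeomorphism if every base change of it is a
homeomorphism on underlying topological spaces. -/
def IsUnivHomeomorph {X Y : Scheme.{u}} (f : X ⟶ Y) : Prop :=
  ∀ (Z : Scheme.{u}) (g : Z ⟶ Y), IsHomeomorph ⇑(Limits.pullback.snd f g).base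

/-! ### Ring-theoretic conditions -/

/-- A commutative ring is catenary if heights add up along inclusions of primes;
equivalently, all saturated chains of primes between two fixed primes have the
same length. -/
def IsCatenaryRing (R : Type u) [CommRing R] : Prop :=
  ∀ p q r : PrimeSpectrum R, p ≤ q → q ≤ r →
    Order.krullDim (Set.Icc p q) + Order.krullDim (Set.Icc q r) =
      Order.krullDim (Set.Icc p r)

/-- A commutative ring is universally catenary if every finitely generated algebra
over it is catenary. -/
def IsUniversallyCatenary (R : Type u) [CommRing R] : Prop :=
  ∀ (n : ℕ) (I : Ideal (MvPolynomial (Fin n) R)),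
    IsCatenaryRing (MvPolynomial (Fin n) R ⧸ I)

/-- A local ring is regular if it is Noetherian and its Krull dimension equals the
dimension of the cotangent space over the residue field. -/
def IsRegularLocal (R : Type u) [CommRing R] [IsLocalRing R] : Prop :=
  IsNoetherianRing R ∧
    ringKrullDim R =
      Module.finrank (IsLocalRing.ResidueField R) (IsLocalRing.CotangentSpace R)

/-- A commutative ring is regular if all its localizations at primes are regular local
rings. -/
def IsRegularRing (R : Type u) [CommRing R] : Prop :=
  ∀ p : PrimeSpectrum R, IsRegularLocal (Localization.AtPrime p.asIdeal)

/-- A Noetherian ring has geometrically regular formal fibers (is a G-ring) if for every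
prime `p`, the fibers of `R_p → (R_p)^` are geometrically regular: for every prime `q`
of `R_p` and every finite field extension `L` of `κ(q)`, the ring `L ⊗ (R_p)^` is
regular. -/
def HasGeomRegularFormalFibers (R : Type u) [CommRing R] : Prop :=
  ∀ p : PrimeSpectrum R,
    letI A := Localization.AtPrime p.asIdeal
    ∀ (q : PrimeSpectrum A) (L : Type u) (_ : Field L)
      (_ : Algebra (FractionRing (A ⧸ q.asIdeal)) L)
      (_ : Module.Finite (FractionRing (A ⧸ q.asIdeal)) L),
      letI : Algebra A L :=
        ((algebraMap (FractionRing (A ⧸ q.asIdeal)) L).comp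
          ((algebraMap (A ⧸ q.asIdeal) (FractionRing (A ⧸ q.asIdeal))).comp
            (Ideal.Quotient.mk q.asIdeal))).toAlgebra
      IsRegularRing
        (TensorProduct A L (AdicCompletion (IsLocalRing.maximalIdeal A) A))

/-- A Noetherian ring is J-2 if the regular locus is open in the spectrum of every
finitely generated algebra over it. -/
def HasOpenRegularLoci (R : Type u) [CommRing R] : Prop :=
  ∀ (n : ℕ) (I : Ideal (MvPolynomial (Fin n) R)),
    IsOpen {p : PrimeSpectrum (MvPolynomial (Fin n) R ⧸ I) |
      IsRegularLocal (Localization.AtPrime p.asIdeal)}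

/-- An excellent ring: Noetherian, universally catenary, with geometrically regular
formal fibers, and with open regular loci in finite type algebras. -/
def IsExcellentRing (R : Type u) [CommRing R] : Prop :=
  IsNoetherianRing R ∧ IsUniversallyCatenary R ∧
    HasGeomRegularFormalFibers R ∧ HasOpenRegularLoci R

/-- An excellent scheme: all rings of sections over affine opens are excellent. -/
def IsExcellentScheme (X : Scheme.{u}) : Prop :=
  ∀ U : X.Opens, IsAffineOpen U → IsExcellentRing ↥Γ(X, U)

/-- `depth ≥ n` for a local ring: there is a weakly regular sequence of length `n`
inside the maximal ideal. -/
def DepthGE (R : Type u) [CommRing R] [IsLocalRing R] (n : ℕ) : Prop :=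
  ∃ rs : List R, rs.length = n ∧ (∀ r ∈ rs, r ∈ IsLocalRing.maximalIdeal R) ∧
    RingTheory.Sequence.IsWeaklyRegular R rs

/-- Serre's condition `S2` for a scheme: for every point, the depth of the local ring is
at least `min 2 (dim)`. -/
def IsS2Scheme (X : Scheme.{u}) : Prop :=
  ∀ (x : X) (n : ℕ), (n : WithBot (WithTop ℕ)) ≤
      min 2 (ringKrullDim (X.presheaf.stalk x)) → DepthGE (X.presheaf.stalk x) n

/-- A point of a scheme is an associated point if the maximal ideal of the local ring at
the point is an associated prime of the local ring. -/
def IsAssocPoint (X : Scheme.{u}) (x : X) : Prop :=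
  (IsLocalRing.maximalIdeal (X.presheaf.stalk x)).IsPrime ∧
    ∃ y : X.presheaf.stalk x, IsLocalRing.maximalIdeal (X.presheaf.stalk x) =
      (Submodule.span (X.presheaf.stalk x) {y}).annihilator

/-- A scheme has pure dimension `≥ n` if all its associated points have the same
dimension `d ≥ n` (where the dimension of a point is the dimension of its closure). -/
def PureDimGE (X : Scheme.{u}) (n : ℕ) : Prop :=
  ∃ d : WithBot ℕ∞, (n : WithBot ℕ∞) ≤ d ∧
    ∀ x : X, IsAssocPoint X x → topologicalKrullDim (closure {x} : Set X) = d

/-- A closed subset has codimension `≥ n` if every one of its points admits a strictly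
increasing chain of generalizations of length `n`. -/
def CodimGE {T : Type u} [TopologicalSpace T] (Z : Set T) (n : ℕ) : Prop :=
  ∀ z ∈ Z, ∃ c : Fin (n + 1) → T, c 0 = z ∧
    ∀ i : Fin n, c i.succ ⤳ c i.castSucc ∧ c i.succ ≠ c i.castSucc

/-- A point is a maximal (generic) point if nothing generalizes it strictly. -/
def IsMaxGeneric {T : Type u} [TopologicalSpace T] (x : T) : Prop :=
  ∀ y : T, y ⤳ x → y = x

/-- A scheme is topologically `S2` if every finite morphism `g : Y ⟶ X` which is a
universal homeomorphism away from a closed subset of codimension `≥ 2` and such that no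
irreducible component of `Y` lies over that subset, is a universal homeomorphism. -/
def IsTopologicallyS2 (X : Scheme.{u}) : Prop :=
  ∀ (Y : Scheme.{u}) (g : Y ⟶ X), IsFinite g →
    (∃ (Z : Set X) (hZ : IsClosed Z), CodimGE Z 2 ∧
      IsUnivHomeomorph (morphismRestrict g ⟨Zᶜ, hZ.isOpen_compl⟩) ∧
      (∀ η : Y, IsMaxGeneric η → g.base η ∉ Z)) →
    IsUnivHomeomorph g

/-- A scheme is weakly normal if it is reduced and every finite universal homeomorphism
from a reduced scheme which is an isomorphism at all generic points is an isomorphism. -/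
def IsWeaklyNormal (X : Scheme.{u}) : Prop :=
  IsReduced X ∧ ∀ (X' : Scheme.{u}) (f : X' ⟶ X), IsFinite f → IsUnivHomeomorph f →
    IsReduced X' → (∀ η : X', IsMaxGeneric η → IsIso (f.stalkMap η)) → IsIso f

/-- A scheme is normal if all of its local rings are integrally closed domains. -/
def IsNormalScheme (X : Scheme.{u}) : Prop :=
  ∀ x : X, IsDomain (X.presheaf.stalk x) ∧ IsIntegrallyClosed (X.presheaf.stalk x)

/-- `ν : Xb ⟶ X` is the normalization of `X`: it is an affine morphism, and over every
affine open `U ⊆ X` the ring of sections of `Xb` is the integral closure of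
`Γ(X, U)/nil` in its total ring of fractions. -/
def IsNormalization {Xb X : Scheme.{u}} (ν : Xb ⟶ X) : Prop :=
  IsAffineHom ν ∧
  ∀ U : X.Opens, IsAffineOpen U →
    ∃ ψ : ↥Γ(Xb, ν ⁻¹ᵁ U) →+*
        FractionRing (↥Γ(X, U) ⧸ nilradical ↥Γ(X, U)),
      Function.Injective ψ ∧
      ψ.comp (ν.app U).hom =
        (algebraMap (↥Γ(X, U) ⧸ nilradical ↥Γ(X, U))
          (FractionRing (↥Γ(X, U) ⧸ nilradical ↥Γ(X, U)))).comp
          (Ideal.Quotient.mk (nilradical ↥Γ(X, U))) ∧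
      ψ.range =
        (integralClosure (↥Γ(X, U) ⧸ nilradical ↥Γ(X, U))
          (FractionRing (↥Γ(X, U) ⧸ nilradical ↥Γ(X, U)))).toSubring



section Norm

lemma fix_pow {F Ω : Type*} [Field F] [Field Ω] [Algebra F Ω] [IsAlgClosed Ω]
    [Algebra.IsAlgebraic F Ω] (p : ℕ) [ExpChar F p] (x : Ω)
    (hx : ∀ τ : Ω ≃ₐ[F] Ω, τ x = x) : ∃ n : ℕ, ∃ y : F, algebraMap F Ω y = x ^ p ^ n := by
  classical
  have : Normal F Ω := normal_iff.mpr fun y =>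
    ⟨(Algebra.IsAlgebraic.isAlgebraic y).isIntegral, IsAlgClosed.splits _⟩
  have : x ∈ perfectClosure F Ω := by
    rw [mem_perfectClosure_iff_natSepDegree_eq_one, Polynomial.natSepDegree_eq_of_isAlgClosed Ω,
      Finset.card_eq_one]
    have hint : IsIntegral F x := (Algebra.IsAlgebraic.isAlgebraic x).isIntegral
    refine ⟨x, ?_⟩
    ext y
    simp only [Multiset.mem_toFinset, Finset.mem_singleton]
    constructor
    · intro hy
      have hy' : (minpoly F x).aeval y = 0 := by
        have := (Polynomial.mem_aroots'.mp hy).2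
        simpa using this
      obtain ⟨τ, hτ⟩ := minpoly.exists_algEquiv_of_root (K := F) (L := Ω)
        (Algebra.IsAlgebraic.isAlgebraic x) hy'
      exact τ.injective (by rw [hτ, hx])
    · rintro rfl
      rw [Polynomial.mem_aroots]
      exact ⟨minpoly.ne_zero hint, minpoly.aeval _ _⟩
  obtain ⟨n, y, hy⟩ := (mem_perfectClosure_iff_pow_mem p).1 this
  exact ⟨n, y, hy⟩

lemma exists_conj {K E Ω : Type*} [Field K] [CommRing E] [Algebra K E] [Field Ω] [Algebra K Ω]
    [IsAlgClosed Ω] [Algebra.IsAlgebraic K Ω] (φ φ' : E →ₐ[K] Ω)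
    (h : RingHom.ker φ ≤ RingHom.ker φ') : ∃ τ : Ω ≃ₐ[K] Ω, ∀ e, τ (φ e) = φ' e := by
  let F : IntermediateField K Ω := Subalgebra.toIntermediateField' φ.range
    (Subalgebra.isField_of_algebraic φ.range)
  have hlift : ∃ ψ : φ.range →ₐ[K] Ω, ∀ e, ψ (φ.rangeRestrict e) = φ' e := by
    refine ⟨AlgHom.liftOfSurjective φ.rangeRestrict φ.rangeRestrict_surjective φ' ?_, ?_⟩
    · intro a ha
      apply h
      have : φ.rangeRestrict.toRingHom a = 0 := ha
      have := congrArg Subtype.val this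
      exact this
    · intro e
      exact AlgHom.liftOfSurjective_apply _ _ _ _ e
  obtain ⟨ψ, hψ⟩ := hlift
  let ψ' : F →ₐ[K] Ω := ψ
  obtain ⟨θ, hθ⟩ := IntermediateField.exists_algHom_of_splits (F := K) (E := Ω) (K := Ω)
    (fun s => ⟨(Algebra.IsAlgebraic.isAlgebraic s).isIntegral, IsAlgClosed.splits _⟩) ψ'
  refine ⟨AlgEquiv.ofBijective θ (Algebra.IsAlgebraic.algHom_bijective θ), fun e => ?_⟩
  have := DFunLike.congr_fun hθ ⟨φ e, ⟨e, rfl⟩⟩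
  exact this.trans (hψ e)

lemma eq_lemma {K E Ω : Type*} [Field K] [CommRing E] [Algebra K E] [Module.Finite K E]
    [Field Ω] [Algebra K Ω] [IsAlgClosed Ω] [Algebra.IsAlgebraic K Ω] (p : ℕ) [ExpChar K p]
    (B : Subalgebra K E) (h : (E →ₐ[K] Ω) → Ω)
    (hB : ∀ φ φ' : E →ₐ[K] Ω, (∀ b ∈ B, φ b = φ' b) → h φ = h φ')
    (heq : ∀ (τ : Ω ≃ₐ[K] Ω) (φ : E →ₐ[K] Ω), h (τ.toAlgHom.comp φ) = τ (h φ)) :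
    ∃ N : ℕ, ∃ u ∈ B, ∀ φ : E →ₐ[K] Ω, φ u = h φ ^ p ^ N := by
  classical
  have hex : ExpChar Ω p := expChar_of_injective_algebraMap (algebraMap K Ω).injective p
  -- pointwise
  have h1 : ∀ φ : E →ₐ[K] Ω, ∃ n : ℕ, ∃ b ∈ B, φ b = h φ ^ p ^ n := by
    intro φ
    let F : IntermediateField K Ω := Subalgebra.toIntermediateField' (B.map φ)
      (Subalgebra.isField_of_algebraic _)
    have : Algebra.IsAlgebraic F Ω := Algebra.IsAlgebraic.tower_top (K := K) F
    have : ExpChar F p := expChar_of_injective_algebraMap (algebraMap K F).injective p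
    obtain ⟨n, y, hy⟩ := fix_pow (F := F) (Ω := Ω) p (h φ) (fun τ => by
      have := heq (τ.restrictScalars K) φ
      rw [AlgEquiv.restrictScalars_apply] at this
      rw [← this]
      apply hB
      intro b hb
      have : τ (algebraMap F Ω ⟨φ b, ⟨b, hb, rfl⟩⟩) = _ := τ.commutes _
      exact this)
    obtain ⟨b, hb, hb'⟩ := y.2
    exact ⟨n, b, hb, by rw [← hy]; exact hb'⟩
  choose n b hbB hb using h1
  obtain ⟨N, hN⟩ : ∃ N, ∀ φ, n φ ≤ N := by
    obtain ⟨N, hN⟩ := (Set.finite_range n).bddAbove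
    exact ⟨N, fun φ => hN ⟨φ, rfl⟩⟩
  have h2 : ∀ φ : E →ₐ[K] Ω, ∃ b : B, φ b = h φ ^ p ^ N := by
    intro φ
    refine ⟨⟨b φ ^ p ^ (N - n φ), pow_mem (hbB φ) _⟩, ?_⟩
    rw [map_pow, hb, ← pow_mul, ← pow_add, Nat.add_sub_cancel' (hN φ)]
  choose c hc using h2
  let k : (E →ₐ[K] Ω) → Ideal B := fun φ => RingHom.ker (φ.comp B.val)
  have hconj : ∀ φ φ', k φ = k φ' → φ' (c φ) = h φ' ^ p ^ N := by
    intro φ φ' hk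
    obtain ⟨τ, hτ⟩ := exists_conj (φ.comp B.val) (φ'.comp B.val) hk.le
    have e1 : φ' (c φ) = τ (φ (c φ)) := (hτ (c φ)).symm
    have e2 : h φ' = τ (h φ) := by
      rw [← heq]
      apply hB
      intro b hb
      exact (hτ ⟨b, hb⟩).symm
    rw [e1, hc, e2, map_pow]
  have hmax : ∀ φ, (k φ).IsMaximal := by
    intro φ
    have : IsArtinianRing B := IsArtinianRing.of_finite K B
    have : (k φ).IsPrime := RingHom.ker_isPrime _
    exact IsArtinianRing.isMaximal_of_isPrime _
  have : Finite (Set.range k) := Set.finite_range k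
  choose φs hφs using fun i : Set.range k => i.2
  obtain ⟨u, hu⟩ := Ideal.exists_forall_sub_mem_ideal (I := fun i : Set.range k => i.1)
    (fun i j hij => by
      obtain ⟨φi, hi⟩ := i.2
      obtain ⟨φj, hj⟩ := j.2
      have h1 := hmax φi
      have h2 := hmax φj
      rw [hi] at h1
      rw [hj] at h2
      exact Ideal.isCoprime_of_isMaximal (fun h => hij (Subtype.ext h))) (fun i => c (φs i))
  refine ⟨N, u, u.2, fun φ => ?_⟩
  rw [← hconj (φs ⟨k φ, φ, rfl⟩) φ (hφs _)]
  have := hu ⟨k φ, φ, rfl⟩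
  have : φ (u - c (φs ⟨k φ, φ, rfl⟩) : B) = 0 := this
  push_cast at this
  rwa [map_sub, sub_eq_zero] at this

/-- elements all of whose geometric values are integral are integral. -/
lemma integral_of_values {R K E Ω : Type*} [CommRing R] [Field K] [Algebra R K] [CommRing E]
    [Algebra K E] [Algebra R E] [IsScalarTower R K E] [Module.Finite K E]
    [Field Ω] [Algebra K Ω] [IsAlgClosed Ω] [Algebra R Ω] [IsScalarTower R K Ω]
    [Algebra.IsAlgebraic K Ω] (e : E)
    (h : ∀ φ : E →ₐ[K] Ω, IsIntegral R (φ e)) : IsIntegral R e := by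
  classical
  choose g hg hg' using h
  have := Fintype.ofFinite (E →ₐ[K] Ω)
  let G : Polynomial R := ∏ φ, g φ
  have hG : G.Monic := Polynomial.monic_prod_of_monic _ _ (fun φ _ => hg φ)
  have hnil : IsNilpotent (Polynomial.aeval e G) := by
    rw [← mem_nilradical, nilradical_eq_sInf, Ideal.mem_sInf]
    intro P hP
    have hP : P.IsPrime := hP
    have hmax : P.IsMaximal := by
      have : IsArtinianRing E := IsArtinianRing.of_finite K E
      exact IsArtinianRing.isMaximal_of_isPrime _
    let _ := Ideal.Quotient.field P
    let ψ : (E ⧸ P) →ₐ[K] Ω := IsAlgClosed.lift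
    let φ : E →ₐ[K] Ω := ψ.comp (Ideal.Quotient.mkₐ K P)
    rw [← Ideal.Quotient.eq_zero_iff_mem]
    apply ψ.injective
    rw [map_zero]
    have h1 : φ (Polynomial.aeval e G) = Polynomial.aeval (φ e) G := by
      exact (Polynomial.aeval_algHom_apply (φ.restrictScalars R) e G).symm
    have h2 : ψ (Ideal.Quotient.mk P (Polynomial.aeval e G)) = Polynomial.aeval (φ e) G := h1
    refine Eq.trans h2 ?_
    rw [map_prod]
    exact Finset.prod_eq_zero (Finset.mem_univ φ) (hg' φ)
  obtain ⟨n, hn⟩ := hnil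
  exact ⟨G ^ n, hG.pow n, by rw [← Polynomial.aeval_def, map_pow, hn]⟩

lemma nilp_of_values {K E Ω : Type*} [Field K] [CommRing E]
    [Algebra K E] [Module.Finite K E]
    [Field Ω] [Algebra K Ω] [IsAlgClosed Ω] (e : E)
    (h : ∀ φ : E →ₐ[K] Ω, φ e = 0) : IsNilpotent e := by
  rw [← mem_nilradical, nilradical_eq_sInf, Ideal.mem_sInf]
  intro P hP
  have hP : P.IsPrime := hP
  have hmax : P.IsMaximal := by
    have : IsArtinianRing E := IsArtinianRing.of_finite K E
    exact IsArtinianRing.isMaximal_of_isPrime _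
  let _ := Ideal.Quotient.field P
  let ψ : (E ⧸ P) →ₐ[K] Ω := IsAlgClosed.lift
  rw [← Ideal.Quotient.eq_zero_iff_mem]
  apply ψ.injective
  rw [map_zero]
  exact h (ψ.comp (Ideal.Quotient.mkₐ K P))

lemma eq_lemma2 {K E Ω : Type*} [Field K] [CommRing E] [Algebra K E] [Module.Finite K E]
    [Field Ω] [Algebra K Ω] [IsAlgClosed Ω] [Algebra.IsAlgebraic K Ω] (p : ℕ) [Fact p.Prime]
    [CharP K p] [Nontrivial E]
    (B D : Subalgebra K E) (h : (E →ₐ[K] Ω) → Ω)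
    (hB : ∀ φ φ' : E →ₐ[K] Ω, (∀ b ∈ B, φ b = φ' b) → h φ = h φ')
    (hD : ∀ φ φ' : E →ₐ[K] Ω, (∀ b ∈ D, φ b = φ' b) → h φ = h φ')
    (heq : ∀ (τ : Ω ≃ₐ[K] Ω) (φ : E →ₐ[K] Ω), h (τ.toAlgHom.comp φ) = τ (h φ)) :
    ∃ N : ℕ, ∃ u, u ∈ B ∧ u ∈ D ∧ ∀ φ : E →ₐ[K] Ω, φ u = h φ ^ p ^ N := by
  have : ExpChar K p := ExpChar.prime Fact.out
  have : CharP E p := charP_of_injective_algebraMap (algebraMap K E).injective p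
  obtain ⟨N1, u1, hu1, h1⟩ := eq_lemma p B h hB heq
  obtain ⟨N2, u2, hu2, h2⟩ := eq_lemma p D h hD heq
  obtain ⟨n, hn⟩ : IsNilpotent (u1 ^ p ^ N2 - u2 ^ p ^ N1) := by
    apply nilp_of_values (K := K) (Ω := Ω)
    intro φ
    rw [map_sub, map_pow, map_pow, h1, h2, ← pow_mul, ← pow_mul, mul_comm, sub_self]
  have hn' : (u1 ^ p ^ N2 - u2 ^ p ^ N1) ^ p ^ n = 0 :=
    pow_eq_zero_of_le (Nat.lt_pow_self (Fact.out : p.Prime).one_lt).le hn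
  rw [sub_pow_char_pow, sub_eq_zero] at hn'
  refine ⟨N1 + N2 + n, (u1 ^ p ^ N2) ^ p ^ n, pow_mem (pow_mem hu1 _) _, ?_, fun φ => ?_⟩
  · rw [hn']
    exact pow_mem (pow_mem hu2 _) _
  · rw [map_pow, map_pow, h1, ← pow_mul, ← pow_mul, pow_add, pow_add, mul_assoc]

/-- The norm lemma. -/
lemma norm_lemma {R K E : Type*} [CommRing R] [Field K] [Algebra R K] [CommRing E]
    [Algebra K E] [Algebra R E] [IsScalarTower R K E] [Module.Finite K E]
    (p : ℕ) [Fact p.Prime] [CharP K p] (B D : Subalgebra K E) (f f' b b' c c' : E)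
    (hff : f * f' = 1) (hf : IsIntegral R f) (hf' : IsIntegral R f')
    (hb : b ∈ B) (hb' : b' ∈ B) (hbb : b * b' = 1)
    (hc : c ∈ D) (hc' : c' ∈ D) (hcc : c * c' = 1) (hbc : f = b * c) :
    ∃ n : ℕ, 0 < n ∧ ∃ b₁ b₂ c₁ c₂ : E, b₁ ∈ B ∧ b₂ ∈ B ∧ b₁ * b₂ = 1 ∧
      c₁ ∈ D ∧ c₂ ∈ D ∧ c₁ * c₂ = 1 ∧ IsIntegral R b₁ ∧ IsIntegral R b₂ ∧
      IsIntegral R c₁ ∧ IsIntegral R c₂ ∧ f ^ n = b₁ * c₁ := by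
  classical
  rcases subsingleton_or_nontrivial E with hE | hE
  · refine ⟨1, one_pos, 1, 1, 1, 1, B.one_mem, B.one_mem, Subsingleton.elim _ _, D.one_mem,
      D.one_mem, Subsingleton.elim _ _, isIntegral_one, isIntegral_one, isIntegral_one,
      isIntegral_one, Subsingleton.elim _ _⟩
  let Ω := AlgebraicClosure K
  have : ExpChar K p := ExpChar.prime Fact.out
  have : CharP E p := charP_of_injective_algebraMap (algebraMap K E).injective p
  have := Fintype.ofFinite (E →ₐ[K] Ω)
  let r : (E →ₐ[K] Ω) → (E →ₐ[K] Ω) → Prop := fun φ φ' =>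
    (∀ x ∈ B, φ x = φ' x) ∨ (∀ x ∈ D, φ x = φ' x)
  let cls : (E →ₐ[K] Ω) → Finset (E →ₐ[K] Ω) := fun φ =>
    Finset.univ.filter fun φ' => Relation.EqvGen r φ φ'
  have hcls : ∀ φ φ', Relation.EqvGen r φ φ' → cls φ = cls φ' := by
    intro φ φ' h
    ext ψ
    simp only [cls, Finset.mem_filter, Finset.mem_univ, true_and]
    exact ⟨fun h' => (h.symm).trans _ _ _ h', fun h' => h.trans _ _ _ h'⟩
  have hself : ∀ φ, φ ∈ cls φ := fun φ => by
    simp only [cls, Finset.mem_filter, Finset.mem_univ, true_and]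
    exact Relation.EqvGen.refl _
  have hr : ∀ (τ : Ω ≃ₐ[K] Ω) φ φ', Relation.EqvGen r φ φ' →
      Relation.EqvGen r (τ.toAlgHom.comp φ) (τ.toAlgHom.comp φ') := by
    intro τ φ φ' h
    induction h with
    | rel x y h =>
      refine Relation.EqvGen.rel _ _ ?_
      rcases h with h | h
      · exact Or.inl fun z hz => congrArg τ (h z hz)
      · exact Or.inr fun z hz => congrArg τ (h z hz)
    | refl x => exact Relation.EqvGen.refl _
    | symm x y _ ih => exact ih.symm
    | trans x y z _ _ ih1 ih2 => exact ih1.trans _ _ _ ih2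
  have htau : ∀ (τ : Ω ≃ₐ[K] Ω) (φ : E →ₐ[K] Ω), τ.symm.toAlgHom.comp (τ.toAlgHom.comp φ) = φ := by
    intro τ φ
    ext z
    exact τ.symm_apply_apply _
  have htau' : ∀ (τ : Ω ≃ₐ[K] Ω) (φ : E →ₐ[K] Ω), τ.toAlgHom.comp (τ.symm.toAlgHom.comp φ) = φ := by
    intro τ φ
    ext z
    exact τ.apply_symm_apply _
  have hclst : ∀ (τ : Ω ≃ₐ[K] Ω) φ, cls (τ.toAlgHom.comp φ) =
      (cls φ).image (fun ψ => τ.toAlgHom.comp ψ) := by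
    intro τ φ
    ext ψ
    simp only [cls, Finset.mem_filter, Finset.mem_univ, true_and, Finset.mem_image]
    constructor
    · intro h
      refine ⟨τ.symm.toAlgHom.comp ψ, ?_, htau' τ ψ⟩
      have := hr τ.symm _ _ h
      rwa [htau] at this
    · rintro ⟨ψ', h, rfl⟩
      exact hr τ _ _ h
  have hinj : ∀ (τ : Ω ≃ₐ[K] Ω), Function.Injective
      (fun ψ : E →ₐ[K] Ω => τ.toAlgHom.comp ψ) := by
    intro τ ψ ψ' h
    rw [← htau τ ψ, ← htau τ ψ']
    exact congrArg _ h
  have hcard : ∀ (τ : Ω ≃ₐ[K] Ω) φ, (cls (τ.toAlgHom.comp φ)).card = (cls φ).card := by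
    intro τ φ
    rw [hclst, Finset.card_image_of_injective _ (hinj τ)]
  let M := (Fintype.card (E →ₐ[K] Ω)).factorial
  have hM : 0 < M := Nat.factorial_pos _
  have hdvd : ∀ φ, (cls φ).card ∣ M := fun φ =>
    Nat.dvd_factorial (Finset.card_pos.2 ⟨φ, hself φ⟩) (Finset.card_le_univ _)
  -- averaging of an element
  let av : E → (E →ₐ[K] Ω) → Ω := fun z φ => (∏ ψ ∈ cls φ, ψ z) ^ (M / (cls φ).card)
  have hav1 : ∀ z φ φ', Relation.EqvGen r φ φ' → av z φ = av z φ' := by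
    intro z φ φ' h
    simp only [av, hcls φ φ' h]
  have hav2 : ∀ z (τ : Ω ≃ₐ[K] Ω) (φ : E →ₐ[K] Ω), av z (τ.toAlgHom.comp φ) = τ (av z φ) := by
    intro z τ φ
    simp only [av]
    rw [hcard, map_pow, map_prod, hclst, Finset.prod_image (fun a _ b _ h => hinj τ h)]
    rfl
  have key : ∀ z, ∃ N : ℕ, ∃ u, u ∈ B ∧ u ∈ D ∧ ∀ φ : E →ₐ[K] Ω, φ u = av z φ ^ p ^ N := by
    intro z
    exact eq_lemma2 p B D (av z) (fun φ φ' h => hav1 z _ _ (.rel _ _ (Or.inl h)))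
      (fun φ φ' h => hav1 z _ _ (.rel _ _ (Or.inr h))) (hav2 z)
  -- integrality
  have hφ1 : ∀ (φ : E →ₐ[K] Ω), φ b * φ b' = 1 := fun φ => by rw [← map_mul, hbb, map_one]
  have hφ2 : ∀ (φ : E →ₐ[K] Ω), φ c * φ c' = 1 := fun φ => by rw [← map_mul, hcc, map_one]
  have hφ3 : ∀ (φ : E →ₐ[K] Ω), φ f * φ f' = 1 := fun φ => by rw [← map_mul, hff, map_one]
  have hφ4 : ∀ (φ : E →ₐ[K] Ω), φ f = φ b * φ c := fun φ => by rw [← map_mul, hbc]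
  have hφ5 : ∀ (φ : E →ₐ[K] Ω), φ c = φ f * φ b' := fun φ => by
    rw [hφ4]; linear_combination -(φ c) * hφ1 φ
  have hφ6 : ∀ (φ : E →ₐ[K] Ω), φ c' = φ f' * φ b := fun φ => by
    have h3 := hφ3 φ
    rw [hφ4] at h3
    linear_combination -(φ c') * h3 + φ f' * φ b * hφ2 φ
  have hφf : ∀ (φ : E →ₐ[K] Ω), IsIntegral R (φ f) := fun φ => hf.map (φ.restrictScalars R)
  have hφf' : ∀ (φ : E →ₐ[K] Ω), IsIntegral R (φ f') := fun φ => hf'.map (φ.restrictScalars R)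
  have hD1 : ∀ φ φ' : E →ₐ[K] Ω, (∀ x ∈ D, φ x = φ' x) → φ b * φ' b' = φ f * φ' f' := by
    intro φ φ' h
    have e1 : φ b = φ f * φ c' := by
      rw [hφ4, mul_assoc, hφ2, mul_one]
    have e2 : φ' b' = φ' f' * φ' c := by
      have : φ' f' * (φ' b * φ' c) * φ' b' = φ' b' := by
        rw [← hφ4, mul_comm (φ' f'), hφ3, one_mul]
      rw [← this]
      linear_combination (φ' f' * φ' c) * hφ1 φ'
    have e3 : φ c' * φ' c = 1 := by rw [← h c hc, mul_comm, hφ2]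
    rw [e1, e2]
    linear_combination (φ f * φ' f') * e3
  have hint : ∀ φ φ' : E →ₐ[K] Ω, Relation.EqvGen r φ φ' →
      IsIntegral R (φ b * φ' b') ∧ IsIntegral R (φ' b * φ b') := by
    intro φ φ' h
    induction h with
    | rel x y h =>
      rcases h with h | h
      · constructor
        · rw [h b hb, hφ1]
          exact isIntegral_one
        · rw [h b' hb', hφ1]
          exact isIntegral_one
      · constructor
        · rw [hD1 _ _ h]
          exact (hφf _).mul (hφf' _)
        · rw [hD1 _ _ (fun x hx => (h x hx).symm)]
          exact (hφf _).mul (hφf' _)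
    | refl x => rw [hφ1]; exact ⟨isIntegral_one, isIntegral_one⟩
    | symm x y _ ih => exact ⟨ih.2, ih.1⟩
    | trans x y z _ _ ih1 ih2 =>
      constructor
      · have : x b * z b' = (x b * y b') * (y b * z b') := by
          linear_combination -(x b * z b') * hφ1 y
        rw [this]
        exact ih1.1.mul ih2.1
      · have : z b * x b' = (z b * y b') * (y b * x b') := by
          linear_combination -(z b * x b') * hφ1 y
        rw [this]
        exact ih2.2.mul ih1.2
  have hpow : ∀ z φ, φ z ^ M = (∏ _ψ ∈ cls φ, φ z) ^ (M / (cls φ).card) := by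
    intro z φ
    rw [Finset.prod_const, ← pow_mul, Nat.mul_div_cancel' (hdvd φ)]
  have hI1 : ∀ φ : E →ₐ[K] Ω, IsIntegral R (φ b ^ M * av b' φ) := by
    intro φ
    rw [hpow]
    simp only [av]
    rw [← mul_pow, ← Finset.prod_mul_distrib]
    refine (IsIntegral.prod _ fun ψ hψ => (hint φ ψ ?_).1).pow _
    simpa [cls] using hψ
  have hI2 : ∀ φ : E →ₐ[K] Ω, IsIntegral R (φ b' ^ M * av b φ) := by
    intro φ
    rw [hpow]
    simp only [av]
    rw [← mul_pow, ← Finset.prod_mul_distrib]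
    refine (IsIntegral.prod _ fun ψ hψ => ?_).pow _
    rw [mul_comm]
    refine (hint φ ψ ?_).2
    simpa [cls] using hψ
  have hav3 : ∀ φ, av b φ * av b' φ = 1 := by
    intro φ
    simp only [av]
    rw [← mul_pow, ← Finset.prod_mul_distrib, Finset.prod_eq_one (fun ψ _ => hφ1 ψ), one_pow]
  clear_value av
  obtain ⟨N1, u1, hu1, hu1', h1⟩ := key b
  obtain ⟨N2, u2, hu2, hu2', h2⟩ := key b'
  obtain ⟨n, hn⟩ : IsNilpotent (u1 ^ p ^ N2 * u2 ^ p ^ N1 - 1) := by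
    apply nilp_of_values (K := K) (Ω := Ω)
    intro φ
    rw [map_sub, map_mul, map_pow, map_pow, h1, h2, ← pow_mul, ← pow_mul, mul_comm (p ^ N2),
      ← mul_pow, hav3, one_pow, map_one, sub_self]
  have hn' : (u1 ^ p ^ N2 * u2 ^ p ^ N1 - 1) ^ p ^ n = 0 :=
    pow_eq_zero_of_le (Nat.lt_pow_self (Fact.out : p.Prime).one_lt).le hn
  rw [sub_pow_char_pow, sub_eq_zero, one_pow, mul_pow] at hn'
  set Q := p ^ N1 * p ^ N2 * p ^ n with hQ
  have hQ0 : 0 < Q := by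
    have := (Fact.out : p.Prime).pos
    positivity
  set u := (u1 ^ p ^ N2) ^ p ^ n with hu
  set v := (u2 ^ p ^ N1) ^ p ^ n with hv
  have huφ : ∀ φ : E →ₐ[K] Ω, φ u = av b φ ^ Q := fun φ => by
    rw [hu, map_pow, map_pow, h1, ← pow_mul, ← pow_mul, hQ, mul_assoc]
  have hvφ : ∀ φ : E →ₐ[K] Ω, φ v = av b' φ ^ Q := fun φ => by
    rw [hv, map_pow, map_pow, h2, ← pow_mul, ← pow_mul, hQ]
    ring_nf
  have huB : u ∈ B := pow_mem (pow_mem hu1 _) _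
  have huD : u ∈ D := pow_mem (pow_mem hu1' _) _
  have hvB : v ∈ B := pow_mem (pow_mem hu2 _) _
  have hvD : v ∈ D := pow_mem (pow_mem hu2' _) _
  refine ⟨M * Q, Nat.mul_pos hM hQ0, b ^ (M * Q) * v, b' ^ (M * Q) * u, c ^ (M * Q) * u,
    c' ^ (M * Q) * v, B.mul_mem (pow_mem hb _) hvB, B.mul_mem (pow_mem hb' _) huB, ?_,
    D.mul_mem (pow_mem hc _) huD, D.mul_mem (pow_mem hc' _) hvD, ?_, ?_, ?_, ?_, ?_, ?_⟩
  · rw [mul_mul_mul_comm, ← mul_pow, hbb, one_pow, one_mul, mul_comm, hn']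
  · rw [mul_mul_mul_comm, ← mul_pow, hcc, one_pow, one_mul, hn']
  · refine integral_of_values (K := K) (Ω := Ω) _ fun φ => ?_
    rw [map_mul, map_pow, hvφ, pow_mul, ← mul_pow]
    exact (hI1 φ).pow _
  · refine integral_of_values (K := K) (Ω := Ω) _ fun φ => ?_
    rw [map_mul, map_pow, huφ, pow_mul, ← mul_pow]
    exact (hI2 φ).pow _
  · refine integral_of_values (K := K) (Ω := Ω) _ fun φ => ?_
    have := hφ5 φ
    rw [map_mul, map_pow, huφ, pow_mul, this, ← mul_pow, mul_pow (φ f), mul_assoc]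
    exact (((hφf φ).pow _).mul (hI2 φ)).pow _
  · refine integral_of_values (K := K) (Ω := Ω) _ fun φ => ?_
    have := hφ6 φ
    rw [map_mul, map_pow, hvφ, pow_mul, this, ← mul_pow, mul_pow (φ f'), mul_assoc]
    exact (((hφf' φ).pow _).mul (hI1 φ)).pow _
  · rw [hbc, mul_pow]
    linear_combination -(b ^ (M * Q) * c ^ (M * Q)) * hn'
end Norm

section Claim
universe u₁ u₂

/-- The generic fibre of a finite algebra at a prime. -/
lemma generic_fiber {R : Type u₁} {E : Type u₂} [CommRing R] [CommRing E] [Algebra R E]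
    [Module.Finite R E] (ζ : Ideal R) [ζ.IsPrime] (p : ℕ) [Fact p.Prime] [CharP R p] :
    ∃ (K : Type u₁) (_ : Field K) (_ : Algebra R K) (EK : Type u₂) (_ : CommRing EK)
      (_ : Algebra K EK) (_ : Algebra R EK) (_ : IsScalarTower R K EK) (_ : Module.Finite K EK)
      (θ : E →ₐ[R] EK), CharP K p ∧ (∀ ρ : R, algebraMap R K ρ = 0 ↔ ρ ∈ ζ) ∧
      (∀ a : K, ∃ ρ : R, ρ ∉ ζ ∧ ∃ s : R, ρ • a = algebraMap R K s) ∧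
      (∀ e, θ e = 0 → ∃ ρ : R, ρ ∉ ζ ∧ ρ • e ∈ ζ.map (algebraMap R E)) ∧
      (∀ y : EK, ∃ ρ : R, ρ ∉ ζ ∧ ∃ e, ρ • y = θ e) := by
  let R' := R ⧸ ζ
  let E' := E ⧸ ζ.map (algebraMap R E)
  let S := nonZeroDivisors R'
  let K := FractionRing R'
  let EK := Localization (Algebra.algebraMapSubmonoid E' S)
  have hmem : ∀ ρ : R, ρ ∉ ζ ↔ Ideal.Quotient.mk ζ ρ ∈ S := by
    intro ρ
    rw [mem_nonZeroDivisors_iff_ne_zero, ne_eq, Ideal.Quotient.eq_zero_iff_mem]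
  have hfin : Module.Finite R' E' := Module.Finite.of_restrictScalars_finite R R' E'
  have t1 : IsScalarTower R R' K := inferInstance
  have t2 : IsScalarTower R' K EK := inferInstance
  have t3 : IsScalarTower R R' EK := inferInstance
  have t4 : IsScalarTower R K EK := by
    refine IsScalarTower.of_algebraMap_eq fun r => ?_
    rw [IsScalarTower.algebraMap_apply R R' EK, IsScalarTower.algebraMap_apply R R' K,
      IsScalarTower.algebraMap_apply R' K EK]
  have hfin2 : Module.Finite K EK := Module.Finite.of_isLocalization R' E' S
  have hker : ∀ ρ : R, algebraMap R K ρ = 0 ↔ ρ ∈ ζ := by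
    intro ρ
    rw [IsScalarTower.algebraMap_apply R R' K, map_eq_zero_iff _ (IsFractionRing.injective R' K)]
    exact Ideal.Quotient.eq_zero_iff_mem
  have hchar : CharP K p := by
    have h0 : (p : R) = 0 := CharP.cast_eq_zero R p
    have h1 : (p : K) = 0 := by
      have := congrArg (algebraMap R K) h0
      rwa [map_natCast, map_zero] at this
    exact (CharP.charP_iff_prime_eq_zero Fact.out).2 h1
  let θ : E →ₐ[R] EK := (IsScalarTower.toAlgHom R E' EK).comp (Ideal.Quotient.mkₐ R _)
  refine ⟨K, inferInstance, inferInstance, EK, inferInstance, inferInstance, inferInstance,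
    t4, hfin2, θ, hchar, hker, ?_, ?_, ?_⟩
  · intro a
    obtain ⟨⟨s, t⟩, hst⟩ := IsLocalization.surj S a
    obtain ⟨s, rfl⟩ := Ideal.Quotient.mk_surjective s
    obtain ⟨t, ht⟩ := t
    obtain ⟨t, rfl⟩ := Ideal.Quotient.mk_surjective t
    refine ⟨t, (hmem t).2 ht, s, ?_⟩
    rw [Algebra.smul_def, mul_comm]
    exact hst
  · intro e he
    have : algebraMap E' EK (Ideal.Quotient.mk _ e) = 0 := he
    rw [IsLocalization.map_eq_zero_iff (Algebra.algebraMapSubmonoid E' S)] at this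
    obtain ⟨⟨_, t, ht, rfl⟩, h⟩ := this
    obtain ⟨t, rfl⟩ := Ideal.Quotient.mk_surjective t
    refine ⟨t, (hmem t).2 ht, ?_⟩
    rw [← Ideal.Quotient.eq_zero_iff_mem, Algebra.smul_def, map_mul]
    exact h
  · intro y
    obtain ⟨⟨s, t⟩, hst⟩ := IsLocalization.surj (Algebra.algebraMapSubmonoid E' S) y
    obtain ⟨_, t, ht, rfl⟩ := t
    obtain ⟨s, rfl⟩ := Ideal.Quotient.mk_surjective s
    obtain ⟨t, rfl⟩ := Ideal.Quotient.mk_surjective t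
    refine ⟨t, (hmem t).2 ht, s, ?_⟩
    rw [Algebra.smul_def, mul_comm]
    exact hst

/-- Artin-Rees plus Frobenius. -/
lemma add_lemma {R E : Type*} [CommRing R] [IsNoetherianRing R] [CommRing E] [Algebra R E]
    [Module.Finite R E] (p : ℕ) [Fact p.Prime] [CharP E p] (B D : Subalgebra R E) (J : Ideal R)
    (β γ : E) (hβ : β ∈ B) (hγ : γ ∈ D) (h : β - γ ∈ J.map (algebraMap R E)) :
    ∃ N : ℕ, ∃ x ∈ J • Subalgebra.toSubmodule B, ∃ y ∈ J • Subalgebra.toSubmodule D,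
      β ^ p ^ N - x = γ ^ p ^ N + y := by
  obtain ⟨c, hc⟩ := Ideal.exists_pow_inf_eq_pow_smul J
    (Subalgebra.toSubmodule B ⊔ Subalgebra.toSubmodule D)
  have hlt : c + 1 < p ^ (c + 1) := Nat.lt_pow_self (Fact.out : p.Prime).one_lt
  have h1 : β ^ p ^ (c + 1) - γ ^ p ^ (c + 1) ∈
      (J ^ (p ^ (c + 1)) • (⊤ : Submodule R E)) ⊓
        (Subalgebra.toSubmodule B ⊔ Subalgebra.toSubmodule D) := by
    constructor
    · rw [← sub_pow_char_pow, Ideal.smul_top_eq_map, Ideal.map_pow]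
      exact Ideal.pow_mem_pow h _
    · exact sub_mem (Submodule.mem_sup_left (pow_mem hβ _)) (Submodule.mem_sup_right (pow_mem hγ _))
  rw [hc _ (by lia)] at h1
  have h2 : β ^ p ^ (c + 1) - γ ^ p ^ (c + 1) ∈
      J • (Subalgebra.toSubmodule B ⊔ Subalgebra.toSubmodule D) := by
    refine Submodule.smul_mono (Ideal.pow_le_self (by lia)) inf_le_right h1
  rw [Submodule.smul_sup, Submodule.mem_sup] at h2
  obtain ⟨x, hx, y, hy, hxy⟩ := h2
  exact ⟨c + 1, x, hx, y, hy, by linear_combination -hxy⟩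

lemma smul_mul_mem {R E : Type*} [CommRing R] [CommRing E] [Algebra R E] (B : Subalgebra R E)
    (J : Ideal R) {b x : E} (hb : b ∈ B) (hx : x ∈ J • Subalgebra.toSubmodule B) :
    b * x ∈ J • Subalgebra.toSubmodule B := by
  induction hx using Submodule.smul_induction_on' with
  | smul r hr n hn =>
    rw [mul_smul_comm]
    exact Submodule.smul_mem_smul hr (B.mul_mem hb hn)
  | add x _ y _ h1 h2 => rw [mul_add]; exact add_mem h1 h2

lemma smul_sub_le {R E : Type*} [CommRing R] [CommRing E] [Algebra R E] (B : Subalgebra R E)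
    (J : Ideal R) : J • Subalgebra.toSubmodule B ≤ Subalgebra.toSubmodule B :=
  Submodule.smul_le_right

lemma smul_sub_map {R E : Type*} [CommRing R] [CommRing E] [Algebra R E] (B : Subalgebra R E)
    (J : Ideal R) {x : E} (hx : x ∈ J • Subalgebra.toSubmodule B) :
    x ∈ J.map (algebraMap R E) := by
  have : x ∈ J • (⊤ : Submodule R E) := Submodule.smul_mono le_rfl le_top hx
  rwa [Ideal.smul_top_eq_map] at this

lemma unit_near {R E : Type*} [CommRing R] [IsNoetherianRing R] [IsLocalRing R] [CommRing E]
    [Algebra R E] [Module.Finite R E] (B : Subalgebra R E) {b b' b₁ : E} (hb : b ∈ B)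
    (hb' : b' ∈ B) (hbb : b * b' = 1)
    (h : b₁ - b ∈ IsLocalRing.maximalIdeal R • Subalgebra.toSubmodule B) :
    b₁ ∈ B ∧ ∃ b₂ ∈ B, b₁ * b₂ = 1 := by
  have hb₁ : b₁ ∈ B := by
    have := B.add_mem (smul_sub_le B _ h) hb
    simpa using this
  refine ⟨hb₁, ?_⟩
  let N : Submodule R E := (Subalgebra.toSubmodule B).map (LinearMap.mulLeft R b₁)
  have hle : Subalgebra.toSubmodule B ≤ N := by
    refine Submodule.le_of_le_smul_of_le_jacobson_bot (I := IsLocalRing.maximalIdeal R)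
      (IsNoetherian.noetherian _) ?_ ?_
    · rw [IsLocalRing.jacobson_eq_maximalIdeal _ bot_ne_top]
    · intro z hz
      have hz : z ∈ B := hz
      refine Submodule.mem_sup.2 ⟨b₁ * (b' * z), ⟨b' * z, B.mul_mem hb' hz, rfl⟩,
        (-(b' * z)) * (b₁ - b), smul_mul_mem B _ (B.neg_mem (B.mul_mem hb' hz)) h, ?_⟩
      linear_combination z * hbb
  obtain ⟨b₂, h2, h3⟩ := hle B.one_mem
  exact ⟨b₂, h2, h3⟩

/-- The property proved by Noetherian induction. -/
def PP {R E : Type*} [CommRing R] [CommRing E] [Algebra R E] (B D : Subalgebra R E) (f : E)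
    (I : Ideal R) : Prop :=
  ∃ n : ℕ, 0 < n ∧ ∃ b b' c c' : E, b ∈ B ∧ b' ∈ B ∧ b * b' = 1 ∧ c ∈ D ∧ c' ∈ D ∧ c * c' = 1 ∧
    f ^ n - b * c ∈ I.map (algebraMap R E)

lemma pow_cong {E : Type*} [CommRing E] (I : Ideal E) {a b : E} (h : a - b ∈ I) (n : ℕ) :
    a ^ n - b ^ n ∈ I := by
  obtain ⟨c, hc⟩ := sub_dvd_pow_sub_pow a b n
  rw [hc]
  exact I.mul_mem_right _ h

lemma caseA {R E : Type*} [CommRing R] [IsNoetherianRing R] [IsLocalRing R] [CommRing E]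
    [Algebra R E] [Module.Finite R E] (p : ℕ) [Fact p.Prime] [CharP E p]
    (B D : Subalgebra R E) (f : E) (I J₁ J₂ : Ideal R)
    (h1m : J₁ ≤ IsLocalRing.maximalIdeal R) (h2m : J₂ ≤ IsLocalRing.maximalIdeal R)
    (hJ : J₁ * J₂ ≤ I) (hP1 : PP B D f J₁) (hP2 : PP B D f J₂) : PP B D f I := by
  obtain ⟨n₁, hn₁, b₁, b₁', c₁, c₁', hb₁, hb₁', hbb₁, hc₁, hc₁', hcc₁, hf₁⟩ := hP1
  obtain ⟨n₂, hn₂, b₂, b₂', c₂, c₂', hb₂, hb₂', hbb₂, hc₂, hc₂', hcc₂, hf₂⟩ := hP2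
  -- equalize exponents
  replace hf₁ := pow_cong _ hf₁ n₂
  replace hf₂ := pow_cong _ hf₂ n₁
  rw [← pow_mul, mul_pow] at hf₁ hf₂
  rw [mul_comm n₂] at hf₂
  replace hbb₁ : b₁ ^ n₂ * b₁' ^ n₂ = 1 := by rw [← mul_pow, hbb₁, one_pow]
  replace hcc₁ : c₁ ^ n₂ * c₁' ^ n₂ = 1 := by rw [← mul_pow, hcc₁, one_pow]
  replace hbb₂ : b₂ ^ n₁ * b₂' ^ n₁ = 1 := by rw [← mul_pow, hbb₂, one_pow]
  replace hcc₂ : c₂ ^ n₁ * c₂' ^ n₁ = 1 := by rw [← mul_pow, hcc₂, one_pow]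
  replace hb₁ := pow_mem hb₁ n₂
  replace hb₁' := pow_mem hb₁' n₂
  replace hc₁ := pow_mem hc₁ n₂
  replace hc₁' := pow_mem hc₁' n₂
  replace hb₂ := pow_mem hb₂ n₁
  replace hb₂' := pow_mem hb₂' n₁
  replace hc₂ := pow_mem hc₂ n₁
  replace hc₂' := pow_mem hc₂' n₁
  generalize b₁ ^ n₂ = b₁ at *
  generalize b₁' ^ n₂ = b₁' at *
  generalize c₁ ^ n₂ = c₁ at *
  generalize c₁' ^ n₂ = c₁' at *
  generalize b₂ ^ n₁ = b₂ at *
  generalize b₂' ^ n₁ = b₂' at *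
  generalize c₂ ^ n₁ = c₂ at *
  generalize c₂' ^ n₁ = c₂' at *
  have hn : 0 < n₁ * n₂ := Nat.mul_pos hn₁ hn₂
  generalize n₁ * n₂ = n at *
  have hdiff : b₁ * b₂' - c₂ * c₁' ∈ (J₁ ⊔ J₂).map (algebraMap R E) := by
    have e : b₁ * b₂' - c₂ * c₁' = (b₂' * c₁') * ((f ^ n - b₂ * c₂) - (f ^ n - b₁ * c₁)) := by
      linear_combination (-(b₁ * b₂')) * hcc₁ + (c₂ * c₁') * hbb₂
    rw [e]
    refine Ideal.mul_mem_left _ _ (sub_mem ?_ ?_)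
    · exact Ideal.map_mono le_sup_right hf₂
    · exact Ideal.map_mono le_sup_left hf₁
  obtain ⟨N, x, hx, y, hy, hxy⟩ := add_lemma p B D _ (b₁ * b₂') (c₂ * c₁') (B.mul_mem hb₁ hb₂')
    (D.mul_mem hc₂ hc₁') hdiff
  have hsup : J₁ ⊔ J₂ ≤ IsLocalRing.maximalIdeal R := sup_le h1m h2m
  set Q := p ^ N with hQ
  have hQ0 : 0 < Q := pow_pos (Fact.out : p.Prime).pos _
  replace hf₁ := pow_cong _ hf₁ Q
  replace hf₂ := pow_cong _ hf₂ Q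
  rw [← pow_mul, mul_pow] at hf₁ hf₂
  rw [mul_pow, mul_pow] at hxy
  replace hbb₁ : b₁ ^ Q * b₁' ^ Q = 1 := by rw [← mul_pow, hbb₁, one_pow]
  replace hcc₁ : c₁ ^ Q * c₁' ^ Q = 1 := by rw [← mul_pow, hcc₁, one_pow]
  replace hbb₂ : b₂ ^ Q * b₂' ^ Q = 1 := by rw [← mul_pow, hbb₂, one_pow]
  replace hcc₂ : c₂ ^ Q * c₂' ^ Q = 1 := by rw [← mul_pow, hcc₂, one_pow]
  replace hb₁ := pow_mem hb₁ Q
  replace hb₁' := pow_mem hb₁' Q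
  replace hc₁ := pow_mem hc₁ Q
  replace hc₁' := pow_mem hc₁' Q
  replace hb₂ := pow_mem hb₂ Q
  replace hb₂' := pow_mem hb₂' Q
  replace hc₂ := pow_mem hc₂ Q
  replace hc₂' := pow_mem hc₂' Q
  generalize b₁ ^ Q = b₁ at *
  generalize b₁' ^ Q = b₁' at *
  generalize c₁ ^ Q = c₁ at *
  generalize c₁' ^ Q = c₁' at *
  generalize b₂ ^ Q = b₂ at *
  generalize b₂' ^ Q = b₂' at *
  generalize c₂ ^ Q = c₂ at *
  generalize c₂' ^ Q = c₂' at *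
  have hnQ : 0 < n * Q := Nat.mul_pos hn hQ0
  generalize n * Q = n at *
  obtain ⟨hγ, γ', hγ', hγγ⟩ := unit_near D (b := c₂ * c₁') (b' := c₁ * c₂')
    (b₁ := c₂ * c₁' + y)
    (D.mul_mem hc₂ hc₁') (D.mul_mem hc₁ hc₂')
    (by linear_combination (c₁ * c₁') * hcc₂ + hcc₁)
    (by rw [add_sub_cancel_left]; exact Submodule.smul_mono hsup le_rfl hy)
  -- differences
  have hbd : b₁ - b₂ * (b₁ * b₂' - x) ∈ J₁ • Subalgebra.toSubmodule B ⊔ J₂ • Subalgebra.toSubmodule B := by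
    rw [← Submodule.sup_smul]
    have e : b₁ - b₂ * (b₁ * b₂' - x) = b₂ * x := by linear_combination (-b₁) * hbb₂
    rw [e]
    exact smul_mul_mem B _ hb₂ hx
  have hcd : c₁ - c₂ * γ' ∈ J₁ • Subalgebra.toSubmodule D ⊔ J₂ • Subalgebra.toSubmodule D := by
    rw [← Submodule.sup_smul]
    have e : c₁ - c₂ * γ' = (γ' * c₁) * y := by
      linear_combination (-c₁) * hγγ + (c₂ * γ') * hcc₁
    rw [e]
    exact smul_mul_mem D _ (D.mul_mem hγ' hc₁) hy
  obtain ⟨j₁, hj₁, j₂, hj₂, hj⟩ := Submodule.mem_sup.1 hbd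
  obtain ⟨k₁, hk₁, k₂, hk₂, hk⟩ := Submodule.mem_sup.1 hcd
  obtain ⟨hb, b', hb', hbb⟩ := unit_near B (b₁ := b₁ - j₁) hb₁ hb₁' hbb₁ (by
    rw [sub_sub_cancel_left]
    exact neg_mem (Submodule.smul_mono h1m le_rfl hj₁))
  obtain ⟨hc, c', hc', hcc⟩ := unit_near D (b₁ := c₁ - k₁) hc₁ hc₁' hcc₁ (by
    rw [sub_sub_cancel_left]
    exact neg_mem (Submodule.smul_mono h1m le_rfl hk₁))
  have hw1 : f ^ n - (b₁ - j₁) * (c₁ - k₁) ∈ J₁.map (algebraMap R E) := by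
    have e : f ^ n - (b₁ - j₁) * (c₁ - k₁) = (f ^ n - b₁ * c₁) + ((c₁ - k₁) * j₁ + b₁ * k₁) := by
      ring
    rw [e]
    exact add_mem hf₁ (add_mem (Ideal.mul_mem_left _ _ (smul_sub_map _ _ hj₁))
      (Ideal.mul_mem_left _ _ (smul_sub_map _ _ hk₁)))
  have hw2 : f ^ n - (b₁ - j₁) * (c₁ - k₁) ∈ J₂.map (algebraMap R E) := by
    have e1 : b₁ - j₁ = b₂ * (c₂ * c₁' + y) + j₂ := by rw [← hxy]; linear_combination -hj
    have e2 : c₁ - k₁ = c₂ * γ' + k₂ := by linear_combination -hk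
    have e : f ^ n - (b₁ - j₁) * (c₁ - k₁) = (f ^ n - b₂ * c₂) +
        (-(c₂ * γ' + k₂) * j₂ + (-b₂ * (c₂ * c₁' + y)) * k₂) := by
      rw [e1, e2]
      linear_combination (-(b₂ * c₂)) * hγγ
    rw [e]
    exact add_mem hf₂ (add_mem (Ideal.mul_mem_left _ _ (smul_sub_map _ _ hj₂))
      (Ideal.mul_mem_left _ _ (smul_sub_map _ _ hk₂)))
  refine ⟨n * p, Nat.mul_pos hnQ (Fact.out : p.Prime).pos, (b₁ - j₁) ^ p, b' ^ p, (c₁ - k₁) ^ p,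
    c' ^ p, pow_mem hb _, pow_mem hb' _, by rw [← mul_pow, hbb, one_pow], pow_mem hc _,
    pow_mem hc' _, by rw [← mul_pow, hcc, one_pow], ?_⟩
  rw [pow_mul, ← mul_pow, ← sub_pow_char]
  obtain ⟨k, hk⟩ : ∃ k, p = k + 2 := ⟨p - 2, by have := (Fact.out : p.Prime).two_le; lia⟩
  rw [hk, pow_add]
  refine Ideal.mul_mem_left _ _ ?_
  rw [pow_two]
  refine Ideal.map_mono hJ ?_
  rw [Ideal.map_mul]
  exact Ideal.mul_mem_mul hw1 hw2

end Claim

section CaseB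
universe u₁ u₂

lemma common_denom {R M : Type*} [CommRing R] [AddCommGroup M] [Module R M]
    (ζ : Ideal R) [ζ.IsPrime] (N N' : Submodule R M) (hN : N.FG)
    (h : ∀ y ∈ N, ∃ ρ : R, ρ ∉ ζ ∧ ρ • y ∈ N') : ∃ ρ : R, ρ ∉ ζ ∧ ∀ y ∈ N, ρ • y ∈ N' := by
  classical
  obtain ⟨S, hS⟩ := hN
  have h' : ∀ y : S, ∃ ρ : R, ρ ∉ ζ ∧ ρ • (y : M) ∈ N' := fun y =>
    h y (hS ▸ Submodule.subset_span y.2)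
  choose ρ h1 h2 using h'
  refine ⟨∏ y, ρ y, ?_, ?_⟩
  · intro hmem
    obtain ⟨y, -, hy⟩ := (Ideal.IsPrime.prod_mem_iff (p := ζ)).1 hmem
    exact h1 y hy
  · intro y hy
    rw [← hS] at hy
    induction hy using Submodule.span_induction with
    | mem x hx =>
      rw [← Finset.prod_erase_mul _ _ (Finset.mem_univ (⟨x, hx⟩ : S)), mul_smul]
      exact Submodule.smul_mem _ _ (h2 ⟨x, hx⟩)
    | zero => simp
    | add x y _ _ hx hy => rw [smul_add]; exact add_mem hx hy
    | smul a x _ hx => rw [smul_comm]; exact Submodule.smul_mem _ _ hx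

/-- Denominators in the subalgebra generated over the fraction field. -/
lemma adjoin_denom {R K E EK : Type*} [CommRing R] [Field K] [Algebra R K] [CommRing E]
    [Algebra R E] [CommRing EK] [Algebra K EK] [Algebra R EK] [IsScalarTower R K EK]
    (ζ : Ideal R) [ζ.IsPrime] (θ : E →ₐ[R] EK) (B : Subalgebra R E)
    (hK : ∀ a : K, ∃ ρ : R, ρ ∉ ζ ∧ ∃ s : R, ρ • a = algebraMap R K s)
    (y : EK) (hy : y ∈ Algebra.adjoin K (θ '' B)) :
    ∃ ρ : R, ρ ∉ ζ ∧ ρ • y ∈ B.map θ := by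
  have hmul : ∀ {ρ₁ ρ₂ : R}, ρ₁ ∉ ζ → ρ₂ ∉ ζ → ρ₁ * ρ₂ ∉ ζ := fun h1 h2 h =>
    (Ideal.IsPrime.mem_or_mem ‹_› h).elim h1 h2
  induction hy using Algebra.adjoin_induction with
  | mem x hx =>
    obtain ⟨b, hb, rfl⟩ := hx
    exact ⟨1, ζ.ne_top_iff_one.1 (Ideal.IsPrime.ne_top ‹_›), by rw [one_smul]; exact ⟨b, hb, rfl⟩⟩
  | algebraMap a =>
    obtain ⟨ρ, hρ, s, hs⟩ := hK a
    refine ⟨ρ, hρ, ?_⟩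
    have : ρ • algebraMap K EK a = algebraMap R EK s := by
      rw [IsScalarTower.algebraMap_apply R K EK, ← hs, Algebra.algebraMap_eq_smul_one,
        Algebra.algebraMap_eq_smul_one, smul_assoc]
    rw [this]
    exact Subalgebra.algebraMap_mem _ _
  | add x y _ _ hx hy =>
    obtain ⟨ρ₁, h1, h1'⟩ := hx
    obtain ⟨ρ₂, h2, h2'⟩ := hy
    refine ⟨ρ₁ * ρ₂, hmul h1 h2, ?_⟩
    rw [smul_add]
    refine add_mem ?_ ?_
    · rw [mul_comm, mul_smul]; exact Subalgebra.smul_mem _ h1' _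
    · rw [mul_smul]; exact Subalgebra.smul_mem _ h2' _
  | mul x y _ _ hx hy =>
    obtain ⟨ρ₁, h1, h1'⟩ := hx
    obtain ⟨ρ₂, h2, h2'⟩ := hy
    refine ⟨ρ₁ * ρ₂, hmul h1 h2, ?_⟩
    rw [← smul_mul_smul_comm]
    exact mul_mem h1' h2'

lemma ext_fg {R E EK : Type*} [CommRing R] [IsNoetherianRing R] [CommRing E]
    [Algebra R E] [Module.Finite R E] [CommRing EK] [Algebra R EK] (θ : E →ₐ[R] EK)
    (B : Subalgebra R E) (b₁ b₂ : EK) (h1 : IsIntegral R b₁) (h2 : IsIntegral R b₂) :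
    (Subalgebra.toSubmodule (B.map θ ⊔ Algebra.adjoin R {b₁, b₂})).FG := by
  rw [← Subalgebra.mul_toSubmodule]
  refine Submodule.FG.mul ?_ ?_
  · rw [Subalgebra.map_toSubmodule]
    exact Submodule.FG.map _ (IsNoetherian.noetherian _)
  · exact fg_adjoin_of_finite (by simp) (by rintro x (rfl | rfl) <;> assumption)

/-- The hypothesis at a prime. -/
def HypAt {R E : Type*} [CommRing R] [CommRing E] [Algebra R E] (B D : Subalgebra R E) (f : E)
    (ζ : Ideal R) : Prop :=
  ∃ b b₁ c c₁ : E, b ∈ B ∧ b₁ ∈ B ∧ c ∈ D ∧ c₁ ∈ D ∧ ∃ ρ₁ ρ₂ ρ₃ : R, ρ₁ ∉ ζ ∧ ρ₂ ∉ ζ ∧ ρ₃ ∉ ζ ∧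
    b * b₁ = algebraMap R E ρ₁ ∧ c * c₁ = algebraMap R E ρ₂ ∧ ρ₃ • f = b * c

set_option maxHeartbeats 4000000 in
/-- The inductive step at a prime. -/
lemma caseB {R : Type u₁} {E : Type u₂} [CommRing R] [IsNoetherianRing R] [IsLocalRing R]
    [CommRing E] [Algebra R E] [Module.Finite R E] (p : ℕ) [Fact p.Prime] [CharP R p]
    (B D : Subalgebra R E) (f f' : E) (hff : f * f' = 1) (ζ : Ideal R) [ζ.IsPrime]
    (hζm : ζ ≠ IsLocalRing.maximalIdeal R) (hζ : HypAt B D f ζ)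
    (IH : ∀ J : Ideal R, ζ < J → PP B D f J) : PP B D f ζ := by
  obtain ⟨K, iK, iRK, EK, iEK, iKEK, iREK, iT, iF, θ, hchar, hker, hK, hkerθ, hsurj⟩ :=
    generic_fiber (R := R) (E := E) ζ p
  have hmul : ∀ {ρ₁ ρ₂ : R}, ρ₁ ∉ ζ → ρ₂ ∉ ζ → ρ₁ * ρ₂ ∉ ζ := fun h1 h2 h =>
    (Ideal.IsPrime.mem_or_mem ‹_› h).elim h1 h2
  -- inverse in `EK` of elements outside ζ
  have hinv : ∀ ρ : R, ρ ∉ ζ → ∃ a : K, algebraMap R EK ρ * algebraMap K EK a = 1 := by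
    intro ρ hρ
    have : algebraMap R K ρ ≠ 0 := fun h => hρ ((hker ρ).1 h)
    refine ⟨(algebraMap R K ρ)⁻¹, ?_⟩
    rw [IsScalarTower.algebraMap_apply R K EK, ← map_mul, mul_inv_cancel₀ this, map_one]
  have hint : ∀ e : E, IsIntegral R (θ e) := fun e => (Algebra.IsIntegral.isIntegral e).map θ
  have hθζ : ∀ e ∈ ζ.map (algebraMap R E), θ e = 0 := by
    intro e he
    have : ζ.map (algebraMap R E) ≤ RingHom.ker θ := by
      rw [Ideal.map_le_iff_le_comap]
      intro z hz
      show θ (algebraMap R E z) = 0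
      rw [AlgHom.commutes, IsScalarTower.algebraMap_apply R K EK, (hker z).2 hz, map_zero]
    exact this he
  obtain ⟨n₀, hn₀, b₁, b₂, c₁, c₂, hb₁, hb₂, hbb, hc₁, hc₂, hcc, ib₁, ib₂, ic₁, ic₂, hf⟩ :
      ∃ n : ℕ, 0 < n ∧ ∃ b₁ b₂ c₁ c₂ : EK, b₁ ∈ Algebra.adjoin K (θ '' B) ∧
      b₂ ∈ Algebra.adjoin K (θ '' B) ∧ b₁ * b₂ = 1 ∧
      c₁ ∈ Algebra.adjoin K (θ '' D) ∧ c₂ ∈ Algebra.adjoin K (θ '' D) ∧ c₁ * c₂ = 1 ∧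
      IsIntegral R b₁ ∧ IsIntegral R b₂ ∧
      IsIntegral R c₁ ∧ IsIntegral R c₂ ∧ θ f ^ n = b₁ * c₁ := by
    obtain ⟨b, b', c, c', hb, hb', hc, hc', ρ₁, ρ₂, ρ₃, h1, h2, h3, e1, e2, e3⟩ := hζ
    obtain ⟨a₁, ha₁⟩ := hinv ρ₁ h1
    obtain ⟨a₂, ha₂⟩ := hinv ρ₂ h2
    obtain ⟨a₃, ha₃⟩ := hinv ρ₃ h3
    have e1' : θ b * θ b' = algebraMap R EK ρ₁ := by rw [← map_mul, e1, AlgHom.commutes]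
    have e2' : θ c * θ c' = algebraMap R EK ρ₂ := by rw [← map_mul, e2, AlgHom.commutes]
    have e3' : algebraMap R EK ρ₃ * θ f = θ b * θ c := by
      rw [← map_mul, ← e3, Algebra.smul_def, map_mul, AlgHom.commutes]
    have m : ∀ {B : Subalgebra R E} {b : E}, b ∈ B → θ b ∈ Algebra.adjoin K (θ '' B) :=
      fun h => Algebra.subset_adjoin ⟨_, h, rfl⟩
    have mR : ∀ {B : Subalgebra R E} (ρ : R), algebraMap R EK ρ ∈ Algebra.adjoin K (θ '' B) := by
      intro B ρ
      rw [IsScalarTower.algebraMap_apply R K EK]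
      exact Subalgebra.algebraMap_mem _ _
    refine norm_lemma p _ _ (θ f) (θ f') (algebraMap K EK a₃ * θ b)
      (algebraMap R EK ρ₃ * (algebraMap K EK a₁ * θ b')) (θ c) (algebraMap K EK a₂ * θ c')
      (by rw [← map_mul, hff, map_one]) (hint _) (hint _)
      (mul_mem (Subalgebra.algebraMap_mem _ _) (m hb))
      (mul_mem (mR _) (mul_mem (Subalgebra.algebraMap_mem _ _) (m hb'))) ?_
      (m hc) (mul_mem (Subalgebra.algebraMap_mem _ _) (m hc')) ?_ ?_
    · linear_combination (algebraMap K EK a₃ * algebraMap R EK ρ₃ * algebraMap K EK a₁) * e1' +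
        (algebraMap K EK a₃ * algebraMap R EK ρ₃) * ha₁ + ha₃
    · linear_combination (algebraMap K EK a₂) * e2' + ha₂
    · linear_combination (algebraMap K EK a₃) * e3' - θ f * ha₃
  set Bt := B.map θ ⊔ Algebra.adjoin R {b₁, b₂} with hBt
  set Dt := D.map θ ⊔ Algebra.adjoin R {c₁, c₂} with hDt
  have hd : ∀ (B : Subalgebra R E) (b₁ b₂ : EK), b₁ ∈ Algebra.adjoin K (θ '' B) →
      b₂ ∈ Algebra.adjoin K (θ '' B) → ∀ y ∈ B.map θ ⊔ Algebra.adjoin R {b₁, b₂},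
      y ∈ Algebra.adjoin K (θ '' B) := by
    intro B b₁ b₂ h1 h2 y hy
    have : B.map θ ⊔ Algebra.adjoin R {b₁, b₂} ≤
        (Algebra.adjoin K (θ '' B)).restrictScalars R := by
      refine sup_le ?_ (Algebra.adjoin_le ?_)
      · rintro _ ⟨b, hb, rfl⟩
        exact Algebra.subset_adjoin ⟨b, hb, rfl⟩
      · rintro x (rfl | rfl) <;> assumption
    exact this hy
  obtain ⟨r₁, hr₁, hB⟩ := common_denom ζ (Subalgebra.toSubmodule Bt)
    (Subalgebra.toSubmodule (B.map θ)) (ext_fg θ B b₁ b₂ ib₁ ib₂)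
    (fun y hy => adjoin_denom ζ θ B hK y (hd B b₁ b₂ hb₁ hb₂ y hy))
  obtain ⟨r₂, hr₂, hD⟩ := common_denom ζ (Subalgebra.toSubmodule Dt)
    (Subalgebra.toSubmodule (D.map θ)) (ext_fg θ D c₁ c₂ ic₁ ic₂)
    (fun y hy => adjoin_denom ζ θ D hK y (hd D c₁ c₂ hc₁ hc₂ y hy))
  obtain ⟨r₃, hr₃, hKr⟩ := common_denom ζ (LinearMap.ker θ.toLinearMap)
    ((ζ.map (algebraMap R E)).restrictScalars R) (IsNoetherian.noetherian _)
    (fun y hy => hkerθ y hy)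
  obtain ⟨r₄, hr₄m, hr₄⟩ : ∃ r ∈ IsLocalRing.maximalIdeal R, r ∉ ζ := by
    by_contra! h
    exact hζm (le_antisymm (IsLocalRing.le_maximalIdeal (Ideal.IsPrime.ne_top ‹_›)) h)
  obtain ⟨r, hr, hrm, hB, hD, hKr⟩ : ∃ r : R, r ∉ ζ ∧ r ∈ IsLocalRing.maximalIdeal R ∧
      (∀ y ∈ Bt, ∃ b ∈ B, θ b = r • y) ∧ (∀ y ∈ Dt, ∃ b ∈ D, θ b = r • y) ∧
      (∀ e, θ e = 0 → algebraMap R E r * e ∈ ζ.map (algebraMap R E)) := by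
    refine ⟨r₁ * r₂ * r₃ * r₄, hmul (hmul (hmul hr₁ hr₂) hr₃) hr₄, Ideal.mul_mem_left _ _ hr₄m,
      ?_, ?_, ?_⟩
    · intro y hy
      have : (r₁ * r₂ * r₃ * r₄) • y ∈ B.map θ := by
        rw [show r₁ * r₂ * r₃ * r₄ = (r₂ * r₃ * r₄) * r₁ by ring, mul_smul]
        exact Subalgebra.smul_mem _ (hB y hy) _
      exact this
    · intro y hy
      have : (r₁ * r₂ * r₃ * r₄) • y ∈ D.map θ := by
        rw [show r₁ * r₂ * r₃ * r₄ = (r₁ * r₃ * r₄) * r₂ by ring, mul_smul]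
        exact Subalgebra.smul_mem _ (hD y hy) _
      exact this
    · intro e he
      have h1 : r₃ • e ∈ ζ.map (algebraMap R E) := hKr e he
      rw [show r₁ * r₂ * r₃ * r₄ = (r₁ * r₂ * r₄) * r₃ by ring, map_mul, mul_assoc,
        ← Algebra.smul_def r₃]
      exact Ideal.mul_mem_left _ _ h1
  obtain ⟨a, ha⟩ := hinv r hr
  -- Artin-Rees
  obtain ⟨c₀, hAR⟩ := Ideal.exists_pow_inf_eq_pow_smul (Ideal.span {r})
    (Subalgebra.toSubmodule B ⊔ Subalgebra.toSubmodule D ⊔ LinearMap.ker θ.toLinearMap)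
  set ϖ := algebraMap R E r with hϖ
  have hθϖ : θ ϖ = algebraMap R EK r := AlgHom.commutes _ _
  -- cancel r
  have hcancel : ∀ y z : EK, θ ϖ * y = θ ϖ * z → y = z := by
    intro y z h
    rw [hθϖ] at h
    linear_combination (algebraMap K EK a) * h - (y - z) * ha
  obtain ⟨n, hn, b', b'', c', c'', hb', hb'', hbb', hc', hc'', hcc', hfn⟩ :=
    IH (ζ ⊔ Ideal.span {r ^ (c₀ + 3)}) (by
      refine lt_of_le_of_ne le_sup_left fun h => ?_
      have : r ^ (c₀ + 3) ∈ ζ := by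
        rw [h]; exact Submodule.mem_sup_right (Ideal.mem_span_singleton_self _)
      exact hr (Ideal.IsPrime.mem_of_pow_mem ‹_› _ this))
  replace hfn := pow_cong _ hfn n₀
  rw [← pow_mul, mul_pow] at hfn
  replace hbb' : b' ^ n₀ * b'' ^ n₀ = 1 := by rw [← mul_pow, hbb', one_pow]
  replace hcc' : c' ^ n₀ * c'' ^ n₀ = 1 := by rw [← mul_pow, hcc', one_pow]
  replace hb' := pow_mem hb' n₀
  replace hb'' := pow_mem hb'' n₀
  replace hc' := pow_mem hc' n₀
  replace hc'' := pow_mem hc'' n₀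
  generalize b' ^ n₀ = b' at *
  generalize b'' ^ n₀ = b'' at *
  generalize c' ^ n₀ = c' at *
  generalize c'' ^ n₀ = c'' at *
  replace hf : θ f ^ (n * n₀) = b₁ ^ n * c₁ ^ n := by
    rw [mul_comm n, pow_mul, hf, mul_pow]
  have mBt₁ : b₁ ^ n ∈ Bt := pow_mem (hBt ▸ le_sup_right (a := B.map θ)
    (Algebra.subset_adjoin (by simp))) n
  have mBt₂ : b₂ ^ n ∈ Bt := pow_mem (hBt ▸ le_sup_right (a := B.map θ)
    (Algebra.subset_adjoin (by simp))) n
  have mDt₁ : c₁ ^ n ∈ Dt := pow_mem (hDt ▸ le_sup_right (a := D.map θ)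
    (Algebra.subset_adjoin (by simp))) n
  have mDt₂ : c₂ ^ n ∈ Dt := pow_mem (hDt ▸ le_sup_right (a := D.map θ)
    (Algebra.subset_adjoin (by simp))) n
  have mB : ∀ b ∈ B, θ b ∈ Bt := fun b hb => le_sup_left (a := B.map θ) ⟨b, hb, rfl⟩
  have mD : ∀ b ∈ D, θ b ∈ Dt := fun b hb => le_sup_left (a := D.map θ) ⟨b, hb, rfl⟩
  replace hbb : b₁ ^ n * b₂ ^ n = 1 := by rw [← mul_pow, hbb, one_pow]
  replace hcc : c₁ ^ n * c₂ ^ n = 1 := by rw [← mul_pow, hcc, one_pow]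
  clear_value Bt Dt
  generalize b₁ ^ n = b₁ at *
  generalize b₂ ^ n = b₂ at *
  generalize c₁ ^ n = c₁ at *
  generalize c₂ ^ n = c₂ at *
  have hnn : 0 < n * n₀ := Nat.mul_pos hn hn₀
  generalize n * n₀ = N at *
  rw [Ideal.map_sup, Ideal.map_span, Set.image_singleton, map_pow, ← hϖ] at hfn
  obtain ⟨z, hz, w, hw, hzw⟩ := Submodule.mem_sup.1 hfn
  obtain ⟨e, rfl⟩ := Ideal.mem_span_singleton.1 hw
  have hθ := congrArg θ hzw
  simp only [map_add, map_sub, map_mul, map_pow, hθζ z hz, zero_add, hf] at hθ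
  have hbbθ : θ b' * θ b'' = 1 := by rw [← map_mul, hbb', map_one]
  have hccθ : θ c' * θ c'' = 1 := by rw [← map_mul, hcc', map_one]
  -- β = b₁ θ b'', γ = θ c' c₂
  obtain ⟨xb, hxb, hxb'⟩ := hB (b₁ * θ b'') (mul_mem mBt₁ (mB _ hb''))
  obtain ⟨yd, hyd, hyd'⟩ := hD (θ c' * c₂) (mul_mem (mD _ hc') mDt₂)
  obtain ⟨cd, hcd, hcd'⟩ := hD c₂ mDt₂
  rw [Algebra.smul_def, ← hθϖ] at hxb' hyd' hcd'
  have hdiff : θ (xb - yd) = θ (ϖ ^ (c₀ + 3) * (e * b'' * cd)) := by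
    simp only [map_sub, map_mul, map_pow, hxb', hyd', hcd']
    linear_combination (-(θ ϖ * θ b'' * c₂)) * hθ + (θ ϖ * c₂ * θ c') * hbbθ
      - (θ ϖ * θ b'' * b₁) * hcc
  have hmem : ϖ ^ (c₀ + 3) * (e * b'' * cd) ∈
      (Ideal.span {r} ^ (c₀ + 3) • (⊤ : Submodule R E)) ⊓
      (Subalgebra.toSubmodule B ⊔ Subalgebra.toSubmodule D ⊔ LinearMap.ker θ.toLinearMap) := by
    constructor
    · rw [Ideal.span_singleton_pow, hϖ, ← map_pow, ← Algebra.smul_def]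
      exact Submodule.smul_mem_smul (Ideal.mem_span_singleton_self _) trivial
    · have : ϖ ^ (c₀ + 3) * (e * b'' * cd) =
          xb + (-yd) + (ϖ ^ (c₀ + 3) * (e * b'' * cd) - (xb - yd)) := by ring
      rw [this]
      refine add_mem (Submodule.mem_sup_left (add_mem (Submodule.mem_sup_left hxb)
        (Submodule.mem_sup_right (neg_mem hyd)))) (Submodule.mem_sup_right ?_)
      rw [LinearMap.mem_ker]
      show θ _ = 0
      rw [map_sub, hdiff, sub_self]
  rw [hAR _ (by lia), show c₀ + 3 - c₀ = 3 by lia, Ideal.span_singleton_pow,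
    Submodule.ideal_span_singleton_smul] at hmem
  obtain ⟨v, hv, hv'⟩ := (Submodule.mem_smul_pointwise_iff_exists _ _ _).1 hmem
  obtain ⟨xy, hxy, κ, hκ, rfl⟩ := Submodule.mem_sup.1 hv.2
  obtain ⟨x, hx, y, hy, rfl⟩ := Submodule.mem_sup.1 hxy
  rw [← hv'] at hdiff
  have hκ : θ κ = 0 := hκ
  have hx : x ∈ B := hx
  have hy : y ∈ D := hy
  have hkey : b₁ * θ b'' - θ ϖ ^ 2 * θ x = θ c' * c₂ + θ ϖ ^ 2 * θ y := by
    apply hcancel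
    rw [Algebra.smul_def, map_pow, ← hϖ] at hdiff
    simp only [map_sub, map_mul, map_pow, map_add, hxb', hyd', hκ] at hdiff
    linear_combination hdiff
  obtain ⟨x', hx', hxx⟩ := hB (b₂ * θ b' * θ x) (mul_mem (mul_mem mBt₂ (mB _ hb')) (mB _ hx))
  obtain ⟨y', hy', hyy⟩ := hD (c₁ * θ c'' * θ y) (mul_mem (mul_mem mDt₁ (mD _ hc'')) (mD _ hy))
  rw [Algebra.smul_def, ← hθϖ] at hxx hyy
  have hsm : ∀ {B : Subalgebra R E} {x : E}, x ∈ B →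
      ϖ * x ∈ IsLocalRing.maximalIdeal R • Subalgebra.toSubmodule B := by
    intro B x hx
    rw [hϖ, ← Algebra.smul_def]
    exact Submodule.smul_mem_smul hrm hx
  obtain ⟨hu, u', hu', huu⟩ := unit_near B (b₁ := 1 - ϖ * x') B.one_mem B.one_mem (mul_one 1)
    (by rw [sub_sub_cancel_left]; exact neg_mem (hsm hx'))
  obtain ⟨hv1, v', hv', hvv⟩ := unit_near D (b₁ := 1 + ϖ * y') D.one_mem D.one_mem (mul_one 1)
    (by rw [add_sub_cancel_left]; exact hsm hy')
  have hfin : θ (f ^ N - b' * u' * (c' * (1 + ϖ * y'))) = 0 := by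
    have huuθ : (1 - θ ϖ * θ x') * θ u' = 1 := by
      have := congrArg θ huu
      simpa only [map_mul, map_sub, map_one] using this
    have key2 : b₁ * θ b'' * (1 - θ ϖ * θ x') = θ c' * c₂ * (1 + θ ϖ * θ y') := by
      rw [hxx, hyy]
      linear_combination hkey - (θ ϖ ^ 2 * θ x * b₁ * b₂) * hbbθ - (θ ϖ ^ 2 * θ x) * hbb
        - (θ ϖ ^ 2 * θ y * c₁ * c₂) * hccθ - (θ ϖ ^ 2 * θ y) * hcc
    simp only [map_sub, map_mul, map_pow, map_add, map_one, hf]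
    have e1 : b₁ * (1 - θ ϖ * θ x') = θ b' * θ c' * c₂ * (1 + θ ϖ * θ y') := by
      linear_combination θ b' * key2 - b₁ * (1 - θ ϖ * θ x') * hbbθ
    have e2 : b₁ = θ b' * θ c' * c₂ * (1 + θ ϖ * θ y') * θ u' := by
      linear_combination θ u' * e1 - b₁ * huuθ
    linear_combination c₁ * e2 + (θ b' * θ c' * (1 + θ ϖ * θ y') * θ u') * hcc
  refine ⟨N, hnn, b' * u', b'' * (1 - ϖ * x'), c' * (1 + ϖ * y'), c'' * v',
    B.mul_mem hb' hu', B.mul_mem hb'' hu, ?_, D.mul_mem hc' hv1, D.mul_mem hc'' hv', ?_, ?_⟩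
  · linear_combination (u' * (1 - ϖ * x')) * hbb' + huu
  · linear_combination ((1 + ϖ * y') * v') * hcc' + hvv
  · have e1 : f ^ N - b' * u' * (c' * (1 + ϖ * y')) =
        z + ϖ * (ϖ ^ (c₀ + 2) * e - b' * c' * u' * (x' + y')) := by
      linear_combination -hzw - (b' * c') * huu
    rw [e1] at hfin ⊢
    refine add_mem hz (hKr _ ?_)
    rw [map_add, hθζ z hz, zero_add, map_mul] at hfin
    exact hcancel _ _ (by rw [hfin, mul_zero])

/-- The main claim. -/
lemma claim {R : Type u₁} {E : Type u₂} [CommRing R] [IsNoetherianRing R] [IsLocalRing R]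
    [CommRing E] [Algebra R E] [Module.Finite R E] (p : ℕ) [Fact p.Prime] [CharP R p] [CharP E p]
    (B D : Subalgebra R E) (f f' : E) (hff : f * f' = 1)
    (hbase : ∃ q : ℕ, 0 < q ∧
      f ^ q - 1 ∈ (IsLocalRing.maximalIdeal R).map (algebraMap R E))
    (h : ∀ ζ : Ideal R, ζ.IsPrime → ζ ≠ IsLocalRing.maximalIdeal R → HypAt B D f ζ) :
    PP B D f ⊥ := by
  refine IsNoetherian.induction (R := R) (P := fun I : Ideal R => PP B D f I) ?_ ⊥
  intro (I : Ideal R) IH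
  by_cases hI : I = ⊤
  · subst hI
    exact ⟨1, one_pos, 1, 1, 1, 1, B.one_mem, B.one_mem, mul_one 1, D.one_mem, D.one_mem,
      mul_one 1, by rw [Ideal.map_top]; trivial⟩
  have hIm := IsLocalRing.le_maximalIdeal hI
  by_cases hm : I = IsLocalRing.maximalIdeal R
  · obtain ⟨q, hq, hfq⟩ := hbase
    exact ⟨q, hq, 1, 1, 1, 1, B.one_mem, B.one_mem, mul_one 1, D.one_mem, D.one_mem,
      mul_one 1, by rw [mul_one, hm]; exact hfq⟩
  by_cases hp : I.IsPrime
  · exact caseB p B D f f' hff I hm (h I hp hm) IH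
  · rw [Ideal.isPrime_iff] at hp
    push Not at hp
    obtain ⟨x, y, hxy, hx, hy⟩ := hp hI
    have key : ∀ z, z ∉ I → I < I ⊔ Ideal.span {z} := by
      intro z hz
      refine lt_of_le_of_ne le_sup_left fun h => hz ?_
      rw [h]
      exact Submodule.mem_sup_right (Ideal.mem_span_singleton_self _)
    have key2 : ∀ x y, x * y ∈ I → y ∉ I → x ∈ IsLocalRing.maximalIdeal R := by
      intro x y hxy hy
      by_contra hx
      rw [IsLocalRing.mem_maximalIdeal, mem_nonunits_iff, not_not] at hx
      exact hy ((Ideal.unit_mul_mem_iff_mem I hx).1 hxy)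
    refine caseA p B D f I (I ⊔ Ideal.span {x}) (I ⊔ Ideal.span {y}) ?_ ?_ ?_
      (IH _ (key x hx)) (IH _ (key y hy))
    · exact sup_le hIm (by rw [Ideal.span_singleton_le_iff_mem]; exact key2 x y hxy hy)
    · exact sup_le hIm (by
        rw [Ideal.span_singleton_le_iff_mem]; exact key2 y x (by rwa [mul_comm]) hx)
    · rw [Ideal.sup_mul, Ideal.mul_sup, Ideal.mul_sup, Ideal.span_singleton_mul_span_singleton]
      refine sup_le (sup_le Ideal.mul_le_left Ideal.mul_le_left) (sup_le Ideal.mul_le_right ?_)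
      rw [Ideal.span_singleton_le_iff_mem]
      exact hxy

end CaseB

section SN
universe u₁ 

/-- The property proved by Noetherian induction. -/
def SNP {R E : Type*} [CommRing R] [CommRing E] [Algebra R E] (p : ℕ) (z : E)
    (I : Ideal R) : Prop :=
  ∃ e : ℕ, ∃ r : R, z ^ p ^ e - algebraMap R E r ∈ I.map (algebraMap R E)

lemma sn_caseA {R E : Type*} [CommRing R] [IsNoetherianRing R] [CommRing E]
    [Algebra R E] [Module.Finite R E] (p : ℕ) [Fact p.Prime] [CharP E p]
    (z : E) (I J₁ J₂ : Ideal R)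
    (hJ : J₁ * J₂ ≤ I) (hP1 : SNP p z J₁) (hP2 : SNP p z J₂) : SNP p z I := by
  obtain ⟨e₁, r₁, h₁⟩ := hP1
  obtain ⟨e₂, r₂, h₂⟩ := hP2
  replace h₁ := pow_cong _ h₁ (p ^ e₂)
  replace h₂ := pow_cong _ h₂ (p ^ e₁)
  rw [← pow_mul, ← pow_add, ← map_pow] at h₁ h₂
  rw [add_comm e₂] at h₂
  generalize r₁ ^ p ^ e₂ = r₁ at *
  generalize r₂ ^ p ^ e₁ = r₂ at *
  generalize e₁ + e₂ = e at *
  have hdiff : algebraMap R E r₁ - algebraMap R E r₂ ∈ (J₁ ⊔ J₂).map (algebraMap R E) := by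
    have e : algebraMap R E r₁ - algebraMap R E r₂ = (z ^ p ^ e - algebraMap R E r₂) -
      (z ^ p ^ e - algebraMap R E r₁) := by ring
    rw [e]
    exact sub_mem (Ideal.map_mono le_sup_right h₂) (Ideal.map_mono le_sup_left h₁)
  obtain ⟨N, x, hx, y, hy, hxy⟩ := add_lemma p (⊥ : Subalgebra R E) ⊥ _ _ _
    (Subalgebra.algebraMap_mem _ r₁) (Subalgebra.algebraMap_mem _ r₂) hdiff
  rw [Submodule.sup_smul] at hx hy
  obtain ⟨x₁, hx₁, x₂, hx₂, rfl⟩ := Submodule.mem_sup.1 hx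
  obtain ⟨y₁, hy₁, y₂, hy₂, rfl⟩ := Submodule.mem_sup.1 hy
  replace h₁ := pow_cong _ h₁ (p ^ N)
  replace h₂ := pow_cong _ h₂ (p ^ N)
  rw [← pow_mul, ← pow_add] at h₁ h₂
  obtain ⟨s, hs⟩ : ∃ s : R, algebraMap R E s = algebraMap R E r₁ ^ p ^ N - x₁ - y₁ := by
    have : algebraMap R E r₁ ^ p ^ N - x₁ - y₁ ∈ (⊥ : Subalgebra R E) :=
      sub_mem (sub_mem (pow_mem (Subalgebra.algebraMap_mem _ _) _) (smul_sub_le _ _ hx₁))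
        (smul_sub_le _ _ hy₁)
    exact Algebra.mem_bot.1 this
  refine ⟨(e + N) + 1, s ^ p, ?_⟩
  rw [pow_succ, pow_mul, map_pow, ← sub_pow_char]
  obtain ⟨k, hk⟩ : ∃ k, p = k + 2 := ⟨p - 2, by have := (Fact.out : p.Prime).two_le; lia⟩
  have key : (z ^ p ^ (e + N) - algebraMap R E s) * (z ^ p ^ (e + N) - algebraMap R E s) ∈
      I.map (algebraMap R E) := by
    refine Ideal.map_mono hJ ?_
    rw [Ideal.map_mul]
    refine Ideal.mul_mem_mul ?_ ?_
    · rw [hs]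
      have := add_mem (add_mem h₁ (smul_sub_map _ _ hx₁)) (smul_sub_map _ _ hy₁)
      convert this using 1
      ring
    · rw [hs]
      have := sub_mem (sub_mem h₂ (smul_sub_map _ _ hx₂)) (smul_sub_map _ _ hy₂)
      convert this using 1
      linear_combination -hxy
  have : ∀ w : E, w * w ∈ I.map (algebraMap R E) → w ^ p ∈ I.map (algebraMap R E) := by
    intro w hw
    rw [hk, pow_add, pow_two]
    exact Ideal.mul_mem_left _ _ hw
  exact this _ key

set_option maxHeartbeats 1000000 in
lemma sn_caseB {R E : Type u₁} [CommRing R] [IsNoetherianRing R]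
    [CommRing E] [Algebra R E] [Module.Finite R E] (p : ℕ) [Fact p.Prime] [CharP R p]
    (z : E) (hz : ∀ (Ω : Type u₁) [Field Ω] (φ₁ φ₂ : E →+* Ω),
      φ₁.comp (algebraMap R E) = φ₂.comp (algebraMap R E) → φ₁ z = φ₂ z)
    (ζ : Ideal R) [ζ.IsPrime]
    (IH : ∀ J : Ideal R, ζ < J → SNP p z J) : SNP p z ζ := by
  obtain ⟨K, iK, iRK, EK, iEK, iKEK, iREK, iT, iF, θ, hchar, hker, hK, hkerθ, hsurj⟩ :=
    generic_fiber (R := R) (E := E) ζ p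
  have hmul : ∀ {ρ₁ ρ₂ : R}, ρ₁ ∉ ζ → ρ₂ ∉ ζ → ρ₁ * ρ₂ ∉ ζ := fun h1 h2 h =>
    (Ideal.IsPrime.mem_or_mem ‹_› h).elim h1 h2
  have hinv : ∀ ρ : R, ρ ∉ ζ → ∃ a : K, algebraMap R EK ρ * algebraMap K EK a = 1 := by
    intro ρ hρ
    have : algebraMap R K ρ ≠ 0 := fun h => hρ ((hker ρ).1 h)
    refine ⟨(algebraMap R K ρ)⁻¹, ?_⟩
    rw [IsScalarTower.algebraMap_apply R K EK, ← map_mul, mul_inv_cancel₀ this, map_one]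
  have hθζ : ∀ e ∈ ζ.map (algebraMap R E), θ e = 0 := by
    intro e he
    have : ζ.map (algebraMap R E) ≤ RingHom.ker θ := by
      rw [Ideal.map_le_iff_le_comap]
      intro z hz
      show θ (algebraMap R E z) = 0
      rw [AlgHom.commutes, IsScalarTower.algebraMap_apply R K EK, (hker z).2 hz, map_zero]
    exact this he
  -- a power of θ z lies in K
  obtain ⟨n, a, ha⟩ : ∃ n : ℕ, ∃ a : K, θ z ^ p ^ n = algebraMap K EK a := by
    rcases subsingleton_or_nontrivial EK with hE | hE
    · exact ⟨0, 0, Subsingleton.elim _ _⟩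
    let Ω := AlgebraicClosure K
    have hval : ∀ φ₁ φ₂ : EK →ₐ[K] Ω, φ₁ (θ z) = φ₂ (θ z) := by
      intro φ₁ φ₂
      refine hz Ω (φ₁.toRingHom.comp θ.toRingHom) (φ₂.toRingHom.comp θ.toRingHom) ?_
      ext r
      show φ₁ (θ (algebraMap R E r)) = φ₂ (θ (algebraMap R E r))
      rw [AlgHom.commutes, IsScalarTower.algebraMap_apply R K EK, AlgHom.commutes, AlgHom.commutes]
    have hp : ExpChar K p := ExpChar.prime Fact.out
    obtain ⟨n, a, hna⟩ : ∃ n : ℕ, ∃ a : K, ∀ φ : EK →ₐ[K] Ω,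
        φ (θ z ^ p ^ n - algebraMap K EK a) = 0 := by
      by_cases hne : Nonempty (EK →ₐ[K] Ω)
      · obtain ⟨φ₀⟩ := hne
        obtain ⟨n, y, hy⟩ := fix_pow (F := K) p (φ₀ (θ z)) (fun τ =>
          (hval (τ.toAlgHom.comp φ₀) φ₀))
        refine ⟨n, y, fun φ => ?_⟩
        rw [map_sub, map_pow, AlgHom.commutes, hval φ φ₀, hy, sub_self]
      · exact ⟨0, 0, fun φ => (hne ⟨φ⟩).elim⟩
    obtain ⟨k, hk⟩ := nilp_of_values _ hna
    have : CharP EK p := charP_of_injective_algebraMap (FaithfulSMul.algebraMap_injective K EK) p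
    have hlt : k < p ^ k := Nat.lt_pow_self (Fact.out : p.Prime).one_lt
    refine ⟨n + k, a ^ p ^ k, ?_⟩
    have h2 := pow_eq_zero_of_le hlt.le hk
    rw [sub_pow_char_pow, ← pow_mul, ← pow_add, sub_eq_zero] at h2
    rw [h2, map_pow]
  let N : Submodule R E := (Subalgebra.toSubmodule
    ((⊥ : Subalgebra K EK).restrictScalars R)).comap θ.toLinearMap
  obtain ⟨r₁, hr₁, hB⟩ := common_denom ζ N
    (Subalgebra.toSubmodule (⊥ : Subalgebra R E) ⊔ LinearMap.ker θ.toLinearMap)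
    (IsNoetherian.noetherian _) (by
      intro y hy
      obtain ⟨a, ha⟩ := Algebra.mem_bot.1 (show θ y ∈ (⊥ : Subalgebra K EK) from hy)
      obtain ⟨ρ, hρ, s, hs⟩ := hK a
      refine ⟨ρ, hρ, ?_⟩
      have e : ρ • y = algebraMap R E s + (ρ • y - algebraMap R E s) := by ring
      rw [e]
      refine add_mem (Submodule.mem_sup_left (Subalgebra.algebraMap_mem _ s))
        (Submodule.mem_sup_right ?_)
      rw [LinearMap.mem_ker]
      show θ _ = 0
      rw [map_sub, map_smul, AlgHom.commutes, ← ha, sub_eq_zero,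
        IsScalarTower.algebraMap_apply R K EK, ← hs, Algebra.algebraMap_eq_smul_one,
        Algebra.algebraMap_eq_smul_one, smul_assoc])
  obtain ⟨r₃, hr₃, hKr⟩ := common_denom ζ (LinearMap.ker θ.toLinearMap)
    ((ζ.map (algebraMap R E)).restrictScalars R) (IsNoetherian.noetherian _)
    (fun y hy => hkerθ y hy)
  obtain ⟨r, hr, hB, hKr⟩ : ∃ r : R, r ∉ ζ ∧
      (∀ e a, θ e = algebraMap K EK a → ∃ s : R, θ (algebraMap R E r * e) = θ (algebraMap R E s)) ∧
      (∀ e, θ e = 0 → algebraMap R E r * e ∈ ζ.map (algebraMap R E)) := by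
    refine ⟨r₁ * r₃, hmul hr₁ hr₃, ?_, ?_⟩
    · intro e a he
      obtain ⟨s, hs, k, hk, hsk⟩ := Submodule.mem_sup.1 (hB e (by
        show θ e ∈ (⊥ : Subalgebra K EK)
        rw [he]; exact Subalgebra.algebraMap_mem _ _))
      obtain ⟨s, rfl⟩ := Algebra.mem_bot.1 (show s ∈ (⊥ : Subalgebra R E) from hs)
      have hk : θ k = 0 := hk
      refine ⟨r₃ * s, ?_⟩
      have h3 : algebraMap R E (r₁ * r₃) * e = algebraMap R E r₃ * (algebraMap R E s + k) := by
        rw [hsk, Algebra.smul_def, map_mul]; ring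
      rw [h3, map_mul, map_add, hk, add_zero, map_mul, map_mul]
    · intro e he
      have h1 : r₃ • e ∈ ζ.map (algebraMap R E) := hKr e he
      rw [map_mul, mul_assoc, ← Algebra.smul_def r₃]
      exact Ideal.mul_mem_left _ _ h1
  obtain ⟨i, hi⟩ := hinv r hr
  set ϖ := algebraMap R E r with hϖ
  have hθϖ : θ ϖ = algebraMap R EK r := AlgHom.commutes _ _
  rw [← hθϖ] at hi
  obtain ⟨m, s, hm⟩ := IH (ζ ⊔ Ideal.span {r ^ 2}) (by
      refine lt_of_le_of_ne le_sup_left fun h => ?_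
      have : r ^ 2 ∈ ζ := by
        rw [h]; exact Submodule.mem_sup_right (Ideal.mem_span_singleton_self _)
      exact hr (Ideal.IsPrime.mem_of_pow_mem ‹_› _ this))
  replace hm := pow_cong _ hm (p ^ n)
  rw [← pow_mul, ← pow_add, ← map_pow] at hm
  generalize s ^ p ^ n = s at *
  replace ha : θ z ^ p ^ (m + n) = algebraMap K EK (a ^ p ^ m) := by
    rw [add_comm, pow_add, pow_mul, ha, map_pow]
  generalize a ^ p ^ m = a at *
  rw [Ideal.map_sup, Ideal.map_span, Set.image_singleton, map_pow, ← hϖ] at hm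
  obtain ⟨y, hy, w, hw, hyw⟩ := Submodule.mem_sup.1 hm
  obtain ⟨e, rfl⟩ := Ideal.mem_span_singleton.1 hw
  have hθ := congrArg θ hyw
  simp only [map_add, map_sub, map_mul, map_pow, hθζ y hy, zero_add, ha, AlgHom.commutes] at hθ
  rw [IsScalarTower.algebraMap_apply R K EK s] at hθ
  obtain ⟨s', hs'⟩ := hB e (i ^ 2 * (a - algebraMap R K s)) (by
    rw [map_mul, map_sub, map_pow]
    linear_combination (algebraMap K EK i) ^ 2 * hθ -
      θ e * (θ ϖ * algebraMap K EK i + 1) * hi)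
  refine ⟨m + n, s + r * s', ?_⟩
  have e1 : z ^ p ^ (m + n) - algebraMap R E (s + r * s') =
      y + ϖ * (ϖ * e - algebraMap R E s') := by
    rw [map_add, map_mul]
    linear_combination -hyw
  rw [e1]
  refine add_mem hy (hKr _ ?_)
  rw [map_sub, hs', sub_self]

/-- An element of a finite algebra that is constant on the fibres is, up to a
power of Frobenius, in the base ring. -/
lemma sn_lemma {R E : Type u₁} [CommRing R] [IsNoetherianRing R]
    [CommRing E] [Algebra R E] [Module.Finite R E] (p : ℕ) [Fact p.Prime] [CharP R p] [CharP E p]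
    (z : E) (hz : ∀ (Ω : Type u₁) [Field Ω] (φ₁ φ₂ : E →+* Ω),
      φ₁.comp (algebraMap R E) = φ₂.comp (algebraMap R E) → φ₁ z = φ₂ z) :
    ∃ e : ℕ, ∃ r : R, z ^ p ^ e = algebraMap R E r := by
  have : SNP p z (⊥ : Ideal R) := by
    refine IsNoetherian.induction (R := R) (P := fun I : Ideal R => SNP p z I) ?_ ⊥
    intro (I : Ideal R) IH
    by_cases hI : I = ⊤
    · subst hI
      exact ⟨0, 0, by rw [Ideal.map_top]; trivial⟩
    by_cases hp : I.IsPrime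
    · exact sn_caseB p z hz I IH
    · rw [Ideal.isPrime_iff] at hp
      push Not at hp
      obtain ⟨x, y, hxy, hx, hy⟩ := hp hI
      have key : ∀ z, z ∉ I → I < I ⊔ Ideal.span {z} := by
        intro z hz
        refine lt_of_le_of_ne le_sup_left fun h => hz ?_
        rw [h]
        exact Submodule.mem_sup_right (Ideal.mem_span_singleton_self _)
      refine sn_caseA p z I (I ⊔ Ideal.span {x}) (I ⊔ Ideal.span {y}) ?_
        (IH _ (key x hx)) (IH _ (key y hy))
      rw [Ideal.sup_mul, Ideal.mul_sup, Ideal.mul_sup, Ideal.span_singleton_mul_span_singleton]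
      refine sup_le (sup_le Ideal.mul_le_left Ideal.mul_le_left) (sup_le Ideal.mul_le_right ?_)
      rw [Ideal.span_singleton_le_iff_mem]
      exact hxy
  obtain ⟨e, r, h⟩ := this
  rw [Ideal.map_bot, Ideal.mem_bot, sub_eq_zero] at h
  exact ⟨e, r, h⟩

end SN

section Dim
open Polynomial
universe u₁

lemma icc_dim_le_one {α : Type*} [PartialOrder α] (p q : α) (h : ∀ a, p < a → a < q → False) :
    Order.krullDim (Set.Icc p q) ≤ 1 := by
  by_contra! h1
  have h2 : ((2 : ℕ) : WithBot ℕ∞) ≤ Order.krullDim (Set.Icc p q) :=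
    Order.succ_le_of_lt h1 
  obtain ⟨l, hl⟩ := Order.le_krullDim_iff.1 h2
  have h01 : l ⟨0, by lia⟩ < l ⟨1, by lia⟩ := l.strictMono (by rw [Fin.lt_def]; exact Nat.zero_lt_one)
  have h12 : l ⟨1, by lia⟩ < l ⟨2, by lia⟩ := l.strictMono (by simp)
  exact h (l ⟨1, by lia⟩) (lt_of_le_of_lt (l ⟨0, by lia⟩).2.1 h01)
    (lt_of_lt_of_le h12 (l ⟨2, by lia⟩).2.2)

lemma icc_dim_ge_three {α : Type*} [PartialOrder α] (p q a b : α) (h1 : p < a) (h2 : a < b)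
    (h3 : b < q) : ((3 : ℕ) : WithBot ℕ∞) ≤ Order.krullDim (Set.Icc p q) := by
  rw [Order.le_krullDim_iff]
  let P : Set.Icc p q := ⟨p, le_rfl, (h1.trans (h2.trans h3)).le⟩
  let A : Set.Icc p q := ⟨a, h1.le, (h2.trans h3).le⟩
  let B : Set.Icc p q := ⟨b, (h1.trans h2).le, h3.le⟩
  let Q : Set.Icc p q := ⟨q, (h1.trans (h2.trans h3)).le, le_rfl⟩
  have hPA : P < A := h1
  have hAB : A < B := h2
  have hBQ : B < Q := h3
  refine ⟨⟨3, ![P, A, B, Q], ?_⟩, rfl⟩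
  intro i
  fin_cases i
  · exact hPA
  · exact hAB
  · exact hBQ

lemma catenary_absurd {α : Type*} [PartialOrder α] (p q r a b : α)
    (hcat : Order.krullDim (Set.Icc p q) + Order.krullDim (Set.Icc q r) =
      Order.krullDim (Set.Icc p r))
    (h1 : p < a) (h2 : a < b) (h3 : b < r)
    (hpq : ∀ a, p < a → a < q → False) (hqr : ∀ a, q < a → a < r → False) : False := by
  have e1 := icc_dim_le_one p q hpq
  have e2 := icc_dim_le_one q r hqr
  have e3 := icc_dim_ge_three p r a b h1 h2 h3
  rw [← hcat] at e3
  have e4 := e3.trans (add_le_add e1 e2)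
  have : ((3 : ℕ) : WithBot ℕ∞) ≤ ((2 : ℕ) : WithBot ℕ∞) := by
    refine e4.trans (le_of_eq ?_)
    norm_num
  rw [Nat.cast_le] at this
  lia

lemma no_prime_between {D K : Type*} [CommRing D] [IsDomain D] [Field K] [Algebra D K]
    [IsFractionRing D K] (Q Q₁ : Ideal D[X]) [Q.IsPrime] [Q₁.IsPrime]
    (hQ : ∀ d : D, C d ∈ Q → d = 0) (h0 : Q₁ ≠ ⊥) (h1 : Q₁ < Q) : False := by
  let M := (nonZeroDivisors D).map (C : D →+* D[X])
  letI : Algebra D[X] K[X] := (mapRingHom (algebraMap D K)).toAlgebra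
  haveI : IsLocalization M K[X] := Polynomial.isLocalization (nonZeroDivisors D) K
  have hdis : ∀ J : Ideal D[X], J ≤ Q → Disjoint (M : Set D[X]) J := by
    intro J hJ
    rw [Set.disjoint_left]
    rintro _ ⟨d, hd, rfl⟩ h
    exact nonZeroDivisors.ne_zero hd (hQ d (hJ h))
  have p1 := IsLocalization.isPrime_of_isPrime_disjoint M K[X] Q₁ inferInstance (hdis Q₁ h1.le)
  have p2 := IsLocalization.isPrime_of_isPrime_disjoint M K[X] Q inferInstance (hdis Q le_rfl)
  have c1 := IsLocalization.under_map_of_isPrime_disjoint M K[X] (I := Q₁) inferInstance (hdis Q₁ h1.le)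
  have c2 := IsLocalization.under_map_of_isPrime_disjoint M K[X] (I := Q) inferInstance (hdis Q le_rfl)
  have hne : Q₁.map (algebraMap D[X] K[X]) ≠ ⊥ := by
    intro h
    rw [h] at c1
    apply h0
    rw [← c1, eq_bot_iff]
    intro f hf
    have : f.map (algebraMap D K) = 0 := hf
    rw [Polynomial.map_eq_zero_iff (IsFractionRing.injective D K)] at this
    exact this
  have hmax := Ring.DimensionLEOne.maximalOfPrime hne p1
  have := hmax.eq_of_le p2.ne_top (Ideal.map_mono h1.le)
  rw [this, c2] at c1
  exact h1.ne c1.symm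

lemma integral_smul_of_poly {D K : Type*} [CommRing D] [Field K] [Algebra D K]
    (a : K) (ha : a ≠ 0) (f : D[X]) (hf : aeval a⁻¹ f = 0) :
    IsIntegral D (f.coeff 0 • a) := by
  by_cases h0 : f.coeff 0 = 0
  · rw [h0, zero_smul]; exact isIntegral_zero
  letI : Invertible a⁻¹ := ⟨a, mul_inv_cancel₀ ha, inv_mul_cancel₀ ha⟩
  have h1 : aeval a f.reverse = 0 := by
    exact (Polynomial.eval₂_reverse_eq_zero_iff (algebraMap D K) a⁻¹ f).2 hf
  have h2 := isIntegral_leadingCoeff_smul f.reverse a h1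
  rwa [Polynomial.reverse_leadingCoeff, Polynomial.trailingCoeff,
    Polynomial.natTrailingDegree_eq_zero.2 (Or.inr h0)] at h2

lemma poly_of_integral_smul {D K : Type*} [CommRing D] [Field K] [Algebra D K]
    (a : K) (ha : a ≠ 0) (ρ : D) (h : IsIntegral D (ρ • a)) :
    ∃ f : D[X], aeval a⁻¹ f = 0 ∧ ∃ n, f.coeff 0 = ρ ^ n := by
  obtain ⟨F, hF, hF0⟩ := h
  letI : Invertible a := ⟨a⁻¹, inv_mul_cancel₀ ha, mul_inv_cancel₀ ha⟩
  refine ⟨(F.comp (C ρ * X)).reflect F.natDegree, ?_, F.natDegree, ?_⟩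
  · refine (Polynomial.eval₂_reflect_eq_zero_iff (algebraMap D K) a F.natDegree _ ?_).2 ?_
    · refine Polynomial.natDegree_comp_le.trans ?_
      calc F.natDegree * (C ρ * X).natDegree ≤ F.natDegree * 1 :=
            Nat.mul_le_mul_left _ ((Polynomial.natDegree_C_mul_le _ _).trans Polynomial.natDegree_X_le)
        _ = _ := mul_one _
    · rw [Polynomial.eval₂_comp, Polynomial.eval₂_mul, Polynomial.eval₂_C, Polynomial.eval₂_X,
        ← Algebra.smul_def]
      exact hF0
  · rw [Polynomial.coeff_reflect, Polynomial.revAt_le (Nat.zero_le _), Nat.sub_zero,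
      Polynomial.comp_C_mul_X_coeff]
    have : F.coeff F.natDegree = 1 := hF
    rw [this, one_mul]

/-- The dimension lemma for elements of the fraction field. -/
lemma dim_lemma {D : Type u₁} {K : Type*} [CommRing D] [IsDomain D] [IsNoetherianRing D] [Field K]
    [Algebra D K] [IsFractionRing D K] (hcat : IsCatenaryRing D[X]) (x p₁ : Ideal D) [x.IsPrime]
    [p₁.IsPrime] (h1 : ⊥ < p₁) (h2 : p₁ < x) (a : K)
    (h : ∀ v : Ideal D, v.IsPrime → v < x → ∃ ρ : D, ρ ∉ v ∧ IsIntegral D (ρ • a)) :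
    ∃ ρ : D, ρ ∉ x ∧ IsIntegral D (ρ • a) := by
  by_cases ha : a = 0
  · subst ha
    exact ⟨1, (Ideal.ne_top_iff_one x).1 (Ideal.IsPrime.ne_top ‹_›), by
      rw [smul_zero]; exact isIntegral_zero⟩
  by_contra! hcon
  let Q : Ideal D[X] := RingHom.ker (aeval a⁻¹ : D[X] →ₐ[D] K)
  have hQp : Q.IsPrime := RingHom.ker_isPrime _
  let N : Ideal D[X] := x.comap (constantCoeff (R := D))
  have hNp : N.IsPrime := Ideal.IsPrime.comap _
  have hQN : Q ≤ N := by
    intro f hf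
    by_contra hfx
    exact hcon (f.coeff 0) hfx (integral_smul_of_poly a ha f hf)
  have hmapC : ∀ v : Ideal D, v.IsPrime → (v.map (C : D →+* D[X])).IsPrime := by
    intro v hv
    haveI := hv
    exact Ideal.isPrime_map_C_of_isPrime
  have hinj : ∀ d : D, C d ∈ Q → d = 0 := by
    intro d hd
    have : aeval a⁻¹ (C d : D[X]) = 0 := hd
    rw [aeval_C] at this
    exact (map_eq_zero_iff _ (IsFractionRing.injective D K)).1 this
  have hltC : ∀ v w : Ideal D, v < w → v.map (C : D →+* D[X]) < w.map C := by
    intro v w hvw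
    refine lt_of_le_of_ne (Ideal.map_mono hvw.le) fun h => ?_
    obtain ⟨z, hz, hz'⟩ := SetLike.exists_of_lt hvw
    have h4 : (C z : D[X]) ∈ v.map C := h ▸ Ideal.mem_map_of_mem C hz
    rw [Ideal.mem_map_C_iff] at h4
    exact hz' (by simpa using h4 0)
  refine catenary_absurd (⟨⊥, Ideal.isPrime_bot⟩ : PrimeSpectrum D[X]) ⟨Q, hQp⟩ ⟨N, hNp⟩
    ⟨p₁.map C, hmapC p₁ inferInstance⟩ ⟨x.map C, hmapC x inferInstance⟩
    (hcat _ _ _ (bot_le (a := Q)) hQN) ?_ ?_ ?_ ?_ ?_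
  · show (⊥ : Ideal D[X]) < p₁.map C
    have := hltC _ _ h1
    rwa [Ideal.map_bot] at this
  · exact hltC _ _ h2
  · show x.map C < N
    refine lt_of_le_of_ne ?_ ?_
    · rw [Ideal.map_le_iff_le_comap]
      intro d hd
      show constantCoeff (C d) ∈ x
      simpa using hd
    · intro h
      have : (X : D[X]) ∈ N := by
        show constantCoeff (X : D[X]) ∈ x
        simp
      rw [← h, Ideal.mem_map_C_iff] at this
      exact (Ideal.ne_top_iff_one x).1 (Ideal.IsPrime.ne_top ‹_›) (by simpa using this 1)
  · rintro ⟨Q₁, hQ₁⟩ h3 h4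
    exact no_prime_between (K := K) Q Q₁ hinj (ne_of_gt h3) h4
  · rintro ⟨N₁, hN₁⟩ h3 h4
    have h3 : Q < N₁ := h3
    have h4 : N₁ < N := h4
    -- N is minimal over Q + (X)
    have hmin : ∀ P : Ideal D[X], P.IsPrime → Q ≤ P → X ∈ P → P ≤ N → P = N := by
      intro P hP hQP hXP hPN
      let v : Ideal D := P.comap C
      have hv : v.IsPrime := Ideal.IsPrime.comap _
      have hcc : ∀ f : D[X], f ∈ P ↔ constantCoeff f ∈ v := by
        intro f
        have e : f = C (constantCoeff f) + X * f.divX := by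
          rw [add_comm, mul_comm]; exact (Polynomial.divX_mul_X_add f).symm
        constructor
        · intro hf
          show C _ ∈ P
          rw [e] at hf
          exact (Submodule.add_mem_iff_left _ (P.mul_mem_right _ hXP)).1 hf
        · intro hf
          rw [e]
          exact P.add_mem hf (P.mul_mem_right _ hXP)
      have hvx : v ≤ x := by
        intro d hd
        have : C d ∈ N := hPN hd
        simpa [N] using this
      by_cases hvx' : v = x
      · ext f
        rw [hcc, hvx']
        rfl
      · obtain ⟨ρ, hρ, hint⟩ := h v hv (lt_of_le_of_ne hvx hvx')
        obtain ⟨f, hf, n, hfn⟩ := poly_of_integral_smul a ha ρ hint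
        have h5 := (hcc f).1 (hQP hf)
        have h6 : ρ ^ n ∈ v := hfn ▸ h5
        exact (hρ (hv.mem_of_pow_mem n h6)).elim
    let π := Ideal.Quotient.mk Q
    have hπ : Function.Surjective π := Ideal.Quotient.mk_surjective
    have hkerπ : RingHom.ker π = Q := Ideal.mk_ker
    have hcm : ∀ P : Ideal D[X], Q ≤ P → (P.map π).comap π = P := by
      intro P hP
      rw [Ideal.comap_map_of_surjective' π hπ, hkerπ, sup_eq_left]
      exact hP
    have hNm : (N.map π).IsPrime := Ideal.map_isPrime_of_surjective hπ (by rw [hkerπ]; exact hQN)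
    have hNm1 : (N₁.map π).IsPrime :=
      Ideal.map_isPrime_of_surjective hπ (by rw [hkerπ]; exact h3.le)
    have hht : (N.map π).height ≤ 1 := by
      refine Ideal.height_le_one_of_isPrincipal_of_mem_minimalPrimes (Ideal.span {π X}) _ ?_
      refine ⟨⟨hNm, ?_⟩, ?_⟩
      · rw [Ideal.span_singleton_le_iff_mem]
        refine Ideal.mem_map_of_mem π ?_
        show constantCoeff (X : D[X]) ∈ x
        simp
      · rintro P ⟨hP, hXP⟩ hPN
        have e := hmin (P.comap π) (Ideal.IsPrime.comap π) (by
            intro f hf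
            show π f ∈ P
            rw [Ideal.Quotient.eq_zero_iff_mem.2 hf]
            exact P.zero_mem) (hXP (Ideal.mem_span_singleton_self _)) (by
            rw [← hcm N hQN]
            exact Ideal.comap_mono hPN)
        rw [← e, Ideal.map_comap_of_surjective π hπ]
    have hlt : N₁.map π < N.map π := by
      refine lt_of_le_of_ne (Ideal.map_mono h4.le) fun h => h4.ne ?_
      rw [← hcm N₁ h3.le, h, hcm N hQN]
    have hlt0 : (⊥ : Ideal (D[X] ⧸ Q)) < N₁.map π := by
      rw [bot_lt_iff_ne_bot]
      intro h
      have := hcm N₁ h3.le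
      rw [h] at this
      exact h3.ne (by rw [← this]; exact hkerπ.symm)
    have hbot : (⊥ : Ideal (D[X] ⧸ Q)).IsPrime := Ideal.isPrime_bot
    have e1 := Ideal.height_strict_mono_of_isPrime_of_isPrime hlt0
    have e2 := Ideal.height_strict_mono_of_isPrime_of_isPrime hlt
    have e3 : (1 : ℕ∞) ≤ (N₁.map π).height := by
      rw [Order.one_le_iff_ne_zero]
      exact (lt_of_le_of_lt bot_le e1).ne'
    exact absurd (e3.trans_lt e2) (not_lt.2 hht)

end Dim

section Cat
open Polynomial
universe u₁

lemma cat_of_localization {A B : Type u₁} [CommRing A] [CommRing B] [Algebra A B] (M : Submonoid A)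
    [IsLocalization M B] (h : IsCatenaryRing A) : IsCatenaryRing B := by
  have key : ∀ p q : PrimeSpectrum B, p ≤ q → Order.krullDim (Set.Icc p q) =
      Order.krullDim (Set.Icc (PrimeSpectrum.comap (algebraMap A B) p)
        (PrimeSpectrum.comap (algebraMap A B) q)) := by
    intro p q hpq
    have hle : ∀ a b : PrimeSpectrum B, PrimeSpectrum.comap (algebraMap A B) a ≤
        PrimeSpectrum.comap (algebraMap A B) b ↔ a ≤ b := by
      intro a b
      constructor
      · intro hab
        show a.asIdeal ≤ b.asIdeal
        rw [← IsLocalization.map_under M B a.asIdeal, ← IsLocalization.map_under M B b.asIdeal]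
        exact Ideal.map_mono hab
      · intro hab
        exact Ideal.comap_mono hab
    let e : PrimeSpectrum B ↪o PrimeSpectrum A :=
      ⟨⟨PrimeSpectrum.comap (algebraMap A B), fun a b hab => le_antisymm
        ((hle a b).1 hab.le) ((hle b a).1 hab.ge)⟩, fun {a b} => hle a b⟩
    let F : Set.Icc p q → Set.Icc (e p) (e q) := fun a =>
      ⟨e a, e.monotone a.2.1, e.monotone a.2.2⟩
    have hF : Function.Surjective F := by
      rintro ⟨b, hb1, hb2⟩
      have hdis : Disjoint (M : Set A) b.asIdeal := by
        rw [Set.disjoint_left]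
        intro s hs hsb
        have : algebraMap A B s ∈ q.asIdeal := hb2 hsb
        exact q.2.ne_top (Ideal.eq_top_of_isUnit_mem _ this (IsLocalization.map_units B ⟨s, hs⟩))
      let c : PrimeSpectrum B := ⟨_, IsLocalization.isPrime_of_isPrime_disjoint M B b.asIdeal b.2 hdis⟩
      have hc : e c = b := PrimeSpectrum.ext
        (IsLocalization.under_map_of_isPrime_disjoint M B (I := b.asIdeal) b.2 hdis)
      refine ⟨⟨c, e.le_iff_le.1 (by rw [hc]; exact hb1), e.le_iff_le.1 (by rw [hc]; exact hb2)⟩, ?_⟩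
      exact Subtype.ext hc
    have hinj : Function.Injective F := fun a b hab =>
      Subtype.ext (e.injective (congrArg Subtype.val hab))
    exact Order.krullDim_eq_of_orderIso
      ⟨Equiv.ofBijective F ⟨hinj, hF⟩, fun {a b} => e.le_iff_le⟩
  intro p q r hpq hqr
  rw [key p q hpq, key q r hqr, key p r (hpq.trans hqr)]
  exact h _ _ _ (Ideal.comap_mono hpq) (Ideal.comap_mono hqr)

lemma cat_of_frac {A B : Type u₁} [CommRing A] [CommRing B] (f : A →+* B)
    (hf : ∀ b, ∃ s a, IsUnit (f s) ∧ f s * b = f a) (h : ∀ I : Ideal A, IsCatenaryRing (A ⧸ I)) :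
    IsCatenaryRing B := by
  letI : Algebra (A ⧸ RingHom.ker f) B := (RingHom.kerLift f).toAlgebra
  have hinj : Function.Injective (algebraMap (A ⧸ RingHom.ker f) B) := RingHom.kerLift_injective f
  haveI : IsLocalization ((IsUnit.submonoid B).comap (algebraMap (A ⧸ RingHom.ker f) B)) B := by
    constructor
    constructor
    · rintro ⟨y, hy⟩
      exact hy
    · intro b
      obtain ⟨s, a, hs, hsa⟩ := hf b
      refine ⟨⟨Ideal.Quotient.mk _ a, ⟨Ideal.Quotient.mk _ s, hs⟩⟩, ?_⟩
      show b * f s = f a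
      rw [mul_comm, hsa]
    · intro x y hxy
      exact ⟨1, by rw [hinj hxy]⟩
  exact cat_of_localization ((IsUnit.submonoid B).comap (algebraMap (A ⧸ RingHom.ker f) B)) (h (RingHom.ker f))

lemma cat_poly {A R : Type u₁} [CommRing A] [CommRing R] [Algebra A R] (M : Submonoid A)
    [IsLocalization M R] (h : IsUniversallyCatenary A) (η : Ideal R) :
    IsCatenaryRing (R ⧸ η)[X] := by
  let g : A →+* (R ⧸ η) := (Ideal.Quotient.mk η).comp (algebraMap A R)
  refine cat_of_frac (MvPolynomial.eval₂Hom ((C : (R ⧸ η) →+* _).comp g) (fun _ : Fin 1 => X)) ?_ (h 1)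
  have hu : ∀ s ∈ M, IsUnit (g s) := fun s hs => (IsLocalization.map_units R ⟨s, hs⟩).map (Ideal.Quotient.mk η)
  suffices H : ∀ b : (R ⧸ η)[X], ∃ s ∈ M, ∃ a, C (g s) * b = 
      (MvPolynomial.eval₂Hom ((C : (R ⧸ η) →+* _).comp g) (fun _ : Fin 1 => X)) a by
    intro b
    obtain ⟨s, hs, a, ha⟩ := H b
    refine ⟨MvPolynomial.C s, a, ?_, ?_⟩
    · rw [MvPolynomial.coe_eval₂Hom, MvPolynomial.eval₂_C]
      exact (hu s hs).map C
    · rw [← ha, MvPolynomial.coe_eval₂Hom, MvPolynomial.eval₂_C]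
      rfl
  intro b
  induction b using Polynomial.induction_on' with
  | add p q hp hq =>
    obtain ⟨s, hs, a, ha⟩ := hp
    obtain ⟨s', hs', a', ha'⟩ := hq
    refine ⟨s * s', M.mul_mem hs hs', MvPolynomial.C s' * a + MvPolynomial.C s * a', ?_⟩
    rw [map_add (MvPolynomial.eval₂Hom _ _), map_mul (MvPolynomial.eval₂Hom _ _),
      map_mul (MvPolynomial.eval₂Hom _ _), ← ha, ← ha']
    simp only [MvPolynomial.coe_eval₂Hom, MvPolynomial.eval₂_C, map_mul, RingHom.comp_apply]
    ring
  | monomial n r =>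
    obtain ⟨r, rfl⟩ := Ideal.Quotient.mk_surjective r
    obtain ⟨⟨a, s⟩, hsa⟩ := IsLocalization.surj M r
    refine ⟨s, s.2, MvPolynomial.C a * MvPolynomial.X 0 ^ n, ?_⟩
    rw [map_mul, map_pow, MvPolynomial.eval₂Hom_X', MvPolynomial.eval₂Hom_C]
    rw [← C_mul_X_pow_eq_monomial, ← mul_assoc, ← C_mul]
    have e : g s * Ideal.Quotient.mk η r = g a := by
      show Ideal.Quotient.mk η _ * _ = Ideal.Quotient.mk η _
      rw [← map_mul, ← hsa, mul_comm]
    rw [e]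
    rfl

lemma dim_lemma_field {D : Type u₁} {K Ω : Type*} [CommRing D] [IsDomain D] [IsNoetherianRing D]
    [Field K] [Algebra D K] [IsFractionRing D K] (hcat : IsCatenaryRing D[X]) (x p₁ : Ideal D)
    [x.IsPrime] [p₁.IsPrime] (h1 : ⊥ < p₁) (h2 : p₁ < x)
    [Field Ω] [Algebra K Ω] [Algebra D Ω] [IsScalarTower D K Ω] [Algebra.IsAlgebraic K Ω] (a : Ω)
    (h : ∀ v : Ideal D, v.IsPrime → v < x → ∃ ρ : D, ρ ∉ v ∧ IsIntegral D (ρ • a)) :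
    ∃ ρ : D, ρ ∉ x ∧ IsIntegral D (ρ • a) := by
  have haK : IsIntegral K a := Algebra.IsIntegral.isIntegral a
  have hD : Function.Injective (algebraMap D K) := IsFractionRing.injective D K
  set P := minpoly K a with hP
  have hcoef : ∀ i, i ≤ P.natDegree → ∃ ρ : D, ρ ∉ x ∧ IsIntegral D (ρ • P.coeff i) := by
    intro i hi
    refine dim_lemma hcat x p₁ h1 h2 _ fun v hv hvx => ?_
    obtain ⟨ρ, hρ, F, hF, hF0⟩ := h v hv hvx
    have hρ0 : algebraMap D K ρ ≠ 0 := by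
      intro h0
      rw [map_eq_zero_iff _ hD] at h0
      exact hρ (h0 ▸ v.zero_mem)
    have e1 : minpoly K (algebraMap D K ρ • a) = P.scaleRoots (algebraMap D K ρ) :=
      IsIntegrallyClosed.minpoly_smul hρ0 haK
    have e2 : minpoly K (algebraMap D K ρ • a) ∣ F.map (algebraMap D K) := by
      apply minpoly.dvd
      rw [aeval_map_algebraMap, algebraMap_smul]
      exact hF0
    have e3 := Polynomial.isIntegral_coeff_of_dvd F _ hF (minpoly.monic (by
      rw [algebraMap_smul]; rw [← algebraMap_smul K]; exact haK.smul _)) e2 i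
    rw [e1, coeff_scaleRoots] at e3
    refine ⟨ρ ^ (P.natDegree - i), fun hh => hρ (hv.mem_of_pow_mem _ hh), ?_⟩
    rwa [Algebra.smul_def, map_pow, mul_comm]
  have hall : ∀ n, n ≤ P.natDegree + 1 → ∃ ρ : D, ρ ∉ x ∧ ∀ i < n, IsIntegral D (ρ • P.coeff i) := by
    intro n
    induction n with
    | zero => 
      intro _
      exact ⟨1, (Ideal.ne_top_iff_one x).1 (Ideal.IsPrime.ne_top ‹_›), by simp⟩
    | succ n ih =>
      intro hn
      obtain ⟨ρ, hρ, hi⟩ := ih (by lia)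
      obtain ⟨ρ', hρ', hi'⟩ := hcoef n (by lia)
      refine ⟨ρ * ρ', fun hh => ((‹x.IsPrime›).mem_or_mem hh).elim hρ hρ', ?_⟩
      intro i hin
      rcases Nat.lt_succ_iff_lt_or_eq.1 hin with h3 | rfl
      · rw [mul_comm, mul_smul]; exact (hi i h3).smul _
      · rw [mul_smul]; exact hi'.smul _
  obtain ⟨ρ, hρ, hi⟩ := hall (P.natDegree + 1) le_rfl
  refine ⟨ρ, hρ, ?_⟩
  -- ρ a is a root of P.scaleRoots ρ with integral coefficients
  have hroot : aeval (algebraMap D K ρ • a) (P.scaleRoots (algebraMap D K ρ)) = 0 := by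
    rw [Algebra.smul_def]
    exact scaleRoots_aeval_eq_zero (minpoly.aeval K a)
  have hmon : (P.scaleRoots (algebraMap D K ρ)).Monic :=
    (monic_scaleRoots_iff _).2 (minpoly.monic haK)
  have hc : ∀ i, IsIntegral D ((P.scaleRoots (algebraMap D K ρ)).coeff i) := by
    intro i
    rw [coeff_scaleRoots]
    rcases lt_trichotomy i P.natDegree with h3 | h3 | h3
    · obtain ⟨k, hk⟩ : ∃ k, P.natDegree - i = k + 1 := ⟨P.natDegree - i - 1, by lia⟩
      rw [hk, pow_succ, mul_comm, mul_assoc, ← Algebra.smul_def]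
      exact ((isIntegral_algebraMap).pow _).mul (hi i (by lia))
    · rw [h3, Nat.sub_self, pow_zero, mul_one]
      rw [(minpoly.monic haK).coeff_natDegree]
      exact isIntegral_one
    · rw [coeff_eq_zero_of_natDegree_lt h3, zero_mul]; exact isIntegral_zero
  have : IsIntegral (integralClosure D K) (algebraMap D K ρ • a) := by
    have hl : P.scaleRoots (algebraMap D K ρ) ∈ Polynomial.lifts (algebraMap (integralClosure D K) K) := by
      rw [Polynomial.lifts_iff_coeff_lifts]
      intro n
      exact ⟨⟨_, hc n⟩, rfl⟩
    obtain ⟨G, hG, _, hGm⟩ := Polynomial.lifts_and_natDegree_eq_and_monic hl hmon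
    refine ⟨G, hGm, ?_⟩
    have e := hroot
    rw [← hG, aeval_map_algebraMap] at e
    exact e
  rw [← algebraMap_smul K]
  exact isIntegral_trans _ this

lemma dim_lemma_alg {D : Type u₁} {K E : Type*} [CommRing D] [IsDomain D] [IsNoetherianRing D]
    [Field K] [Algebra D K] [IsFractionRing D K] (hcat : IsCatenaryRing D[X]) (x p₁ : Ideal D)
    [x.IsPrime] [p₁.IsPrime] (h1 : ⊥ < p₁) (h2 : p₁ < x)
    [CommRing E] [Algebra K E] [Algebra D E] [IsScalarTower D K E] [Module.Finite K E] (g : E)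
    (h : ∀ v : Ideal D, v.IsPrime → v < x → ∃ ρ : D, ρ ∉ v ∧ IsIntegral D (ρ • g)) :
    ∃ ρ : D, ρ ∉ x ∧ IsIntegral D (ρ • g) := by
  classical
  let Ω := AlgebraicClosure K
  have hφ : ∀ φ : E →ₐ[K] Ω, ∃ ρ : D, ρ ∉ x ∧ IsIntegral D (ρ • φ g) := by
    intro φ
    refine dim_lemma_field (K := K) hcat x p₁ h1 h2 _ fun v hv hvx => ?_
    obtain ⟨ρ, hρ, hi⟩ := h v hv hvx
    refine ⟨ρ, hρ, ?_⟩
    have := hi.map (φ.restrictScalars D)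
    simpa using this
  choose ρ hρ hi using hφ
  have := Fintype.ofFinite (E →ₐ[K] Ω)
  refine ⟨∏ φ, ρ φ, ?_, ?_⟩
  · intro hh
    obtain ⟨φ, -, hh⟩ := (Ideal.IsPrime.prod_mem_iff).1 hh
    exact hρ φ hh
  · refine integral_of_values (K := K) (Ω := Ω) _ fun φ => ?_
    have e : φ ((∏ φ, ρ φ) • g) = (∏ φ, ρ φ) • φ g := by
      have := map_smul (φ.restrictScalars D) (∏ φ, ρ φ) g
      exact this
    rw [e, ← Finset.mul_prod_erase _ _ (Finset.mem_univ φ), mul_comm, mul_smul]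
    exact (hi φ).smul _

end Cat

section Upper

lemma precomplete_pi {A B J : Type*} [CommRing A] [AddCommGroup B] [Module A B] [Finite J]
    (m : Ideal A) [IsPrecomplete m B] : IsPrecomplete m (J → B) := by
  classical
  have := Fintype.ofFinite J
  refine ⟨fun f hf => ?_⟩
  have hc : ∀ j, ∀ {a b : ℕ}, a ≤ b → f a j ≡ f b j [SMOD (m ^ a • ⊤ : Submodule A B)] := by
    intro j a b hab
    have h := hf hab
    rw [SModEq.sub_mem] at h ⊢
    have h2 := Submodule.mem_map_of_mem (f := (LinearMap.proj j : (J → B) →ₗ[A] B)) h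
    rw [Submodule.map_smul''] at h2
    exact Submodule.smul_mono le_rfl le_top h2
  choose L hL using fun j => IsPrecomplete.prec (I := m) inferInstance (fun {a b} => hc j (a := a) (b := b))
  refine ⟨L, fun n => ?_⟩
  rw [SModEq.sub_mem]
  have e : f n - L = ∑ j, LinearMap.single A (fun _ : J => B) j (f n j - L j) := by
    ext i
    simp [Finset.sum_apply, Pi.single_apply]
  rw [e]
  refine Submodule.sum_mem _ fun j _ => ?_
  have h := hL j n
  rw [SModEq.sub_mem] at h
  have h2 := Submodule.mem_map_of_mem (f := LinearMap.single A (fun _ : J => B) j) h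
  rw [Submodule.map_smul''] at h2
  exact Submodule.smul_mono le_rfl le_top h2

/-- Topological Nakayama for the Frobenius-twisted module structure. -/
lemma frob_span {A B C J : Type*} [CommRing A] [CommRing B] [CommRing C] [Algebra A B] [Fintype J]
    (p e : ℕ) [Fact p.Prime] [CharP C p] (m : Ideal A) [IsPrecomplete m B] (π : B →+* C)
    (hH : ∀ c : C, (∀ n, c ∈ (m ^ n).map (π.comp (algebraMap A B))) → c = 0)
    (g : J → C)
    (hg : ∀ c : C, ∃ w : J → B, c - ∑ j, π (w j) ^ p ^ e * g j ∈
      Ideal.span ((fun a => π (algebraMap A B a) ^ p ^ e) '' (m : Set A)))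
    (c : C) : ∃ w : J → B, c = ∑ j, π (w j) ^ p ^ e * g j := by
  let φ : A →+* C := (iterateFrobenius C p e).comp (π.comp (algebraMap A B))
  have hφ : ∀ a, φ a = π (algebraMap A B a) ^ p ^ e := fun a => rfl
  letI : Module A C := Module.compHom C φ
  have hsm : ∀ (a : A) (c : C), a • c = φ a * c := fun a c => rfl
  let f : (J → B) →ₗ[A] C :=
    { toFun := fun w => ∑ j, π (w j) ^ p ^ e * g j
      map_add' := by
        intro v w
        rw [← Finset.sum_add_distrib]
        refine Finset.sum_congr rfl fun j _ => ?_
        rw [Pi.add_apply, map_add, add_pow_char_pow, add_mul]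
      map_smul' := by
        intro a w
        rw [RingHom.id_apply, hsm, Finset.mul_sum]
        refine Finset.sum_congr rfl fun j _ => ?_
        rw [Pi.smul_apply, Algebra.smul_def, map_mul, mul_pow, hφ, mul_assoc] }
  haveI := precomplete_pi (B := B) (J := J) m
  have hle : ∀ n (c : C), c ∈ (m ^ n • ⊤ : Submodule A C) →
      c ∈ (m ^ n).map (π.comp (algebraMap A B)) := by
    intro n c hc
    refine Submodule.smul_induction_on hc ?_ ?_
    · intro a ha x _
      rw [hsm, hφ]
      refine Ideal.mul_mem_right _ _ (Ideal.pow_mem_of_mem _ ?_ _ (pow_pos (Fact.out : p.Prime).pos _))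
      exact Ideal.mem_map_of_mem (π.comp (algebraMap A B)) ha
    · intro x y hx hy
      exact Ideal.add_mem _ hx hy
  haveI : IsHausdorff m C := by
    refine ⟨fun c hc => hH c fun n => ?_⟩
    have := hc n
    rw [SModEq.zero] at this
    exact hle n c this
  have hsurj : Function.Surjective f := by
    apply surjective_of_mkQ_comp_surjective (I := m)
    intro y
    obtain ⟨c, rfl⟩ := Submodule.mkQ_surjective _ y
    obtain ⟨w, hw⟩ := hg c
    refine ⟨w, ?_⟩
    rw [LinearMap.comp_apply, eq_comm, ← sub_eq_zero, ← map_sub, Submodule.mkQ_apply,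
      Submodule.Quotient.mk_eq_zero]
    change c - ∑ j, π (w j) ^ p ^ e * g j ∈ _
    refine Submodule.span_induction (p := fun z _ => z ∈ (m • ⊤ : Submodule A C)) ?_ ?_ ?_ ?_ hw
    · rintro _ ⟨a, ha, rfl⟩
      have : (fun a => π (algebraMap A B a) ^ p ^ e) a = a • (1 : C) := by
        rw [hsm, mul_one]; rfl
      rw [this]
      exact Submodule.smul_mem_smul ha trivial
    · exact Submodule.zero_mem _
    · intro x y _ _ hx hy
      exact Submodule.add_mem _ hx hy
    · intro r x _ hx
      refine Submodule.smul_induction_on hx ?_ ?_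
      · intro a ha z _
        have : r • a • z = a • (r * z) := by
          rw [hsm, hsm, smul_eq_mul]; ring
        rw [this]
        exact Submodule.smul_mem_smul ha trivial
      · intro x y hx hy
        rw [smul_add]
        exact Submodule.add_mem _ hx hy
  obtain ⟨w, hw⟩ := hsurj c
  exact ⟨w, hw.symm⟩

/-- Frobenius independence of a finite family. -/
def FrobIndep {B ι : Type*} [CommRing B] [Fintype ι] (p : ℕ) (c : ι → B) : Prop :=
  ∀ t : ι → B, ∑ i, c i * t i ^ p = 0 → ∀ i, t i = 0

lemma FrobIndep.iter {B ι : Type*} [CommRing B] [Fintype ι] (p : ℕ) [Fact p.Prime] [CharP B p]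
    (c : ι → B) (h : FrobIndep p c) (e : ℕ) :
    ∃ c' : (Fin e → ι) → B, FrobIndep (p ^ e) c' := by
  classical
  induction e with
  | zero =>
    refine ⟨fun _ => 1, fun t ht i => ?_⟩
    rw [Fintype.sum_unique] at ht
    rw [Subsingleton.elim i default]
    simpa using ht
  | succ e ih =>
    obtain ⟨c', hc'⟩ := ih
    refine ⟨fun i => c (i 0) * (c' (Fin.tail i)) ^ p, fun t ht i => ?_⟩
    have h1 : ∑ i0, c i0 * (∑ i', c' i' * t (Fin.cons i0 i') ^ p ^ e) ^ p = 0 := by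
      rw [← ht, ← (Fin.consEquiv fun _ => ι).sum_comp, Fintype.sum_prod_type]
      refine Finset.sum_congr rfl fun i0 _ => ?_
      rw [sum_pow_char p, Finset.mul_sum]
      refine Finset.sum_congr rfl fun i' _ => ?_
      simp only [Fin.consEquiv_apply, Fin.cons_zero, Fin.tail_cons]
      rw [mul_pow, ← pow_mul, ← pow_succ, mul_assoc]
      rfl
    have h2 := hc' _ (h _ h1 (i 0)) (Fin.tail i)
    rwa [Fin.cons_self_tail] at h2

/-- Frobenius independent families are not larger than Frobenius spanning families. -/
lemma FrobIndep.card_le {C ι J : Type*} [CommRing C] [IsDomain C] [Fintype ι] [Fintype J] (p e : ℕ)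
    [Fact p.Prime] [CharP C p] (c : ι → C) (h : FrobIndep (p ^ e) c) (g : J → C)
    (hg : ∀ x : C, ∃ w : J → C, x = ∑ j, w j ^ p ^ e * g j) : Fintype.card ι ≤ Fintype.card J := by
  classical
  letI : Module C C := Module.compHom C (iterateFrobenius C p e)
  have hsm : ∀ (a : C) (c : C), this.toSMul.smul a c = a ^ p ^ e * c := fun a c => rfl
  have hli : @LinearIndependent ι C C c _ _ this := by
    rw [Fintype.linearIndependent_iff]
    intro t ht i
    refine h t ?_ i
    rw [← ht]
    exact Finset.sum_congr rfl fun i _ => (mul_comm _ _).trans (hsm _ _).symm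
  have hsp : Set.range c ≤ @Submodule.span C C _ _ this (Set.range g) := by
    rintro _ ⟨i, rfl⟩
    obtain ⟨w, hw⟩ := hg (c i)
    rw [hw]
    refine Submodule.sum_mem _ fun j _ => ?_
    exact Submodule.smul_mem _ (w j) (Submodule.subset_span ⟨j, rfl⟩)
  have h1 := @linearIndependent_le_span' C C _ _ this _ ι c hli (Set.range g) _ hsp
  rw [Cardinal.mk_fintype, Nat.cast_le] at h1
  exact h1.trans (Fintype.card_range_le g)

lemma pow_growth (a b s : ℕ) (h : ∀ e : ℕ, a ^ e ≤ b ^ e * s) : a ≤ b := by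
  by_contra! hab
  rcases Nat.eq_zero_or_pos b with rfl | hb
  · have := h 1
    simp at this
    lia
  have h2 : Filter.Tendsto (fun e : ℕ => ((a : ℝ) / b) ^ e) Filter.atTop Filter.atTop :=
    tendsto_pow_atTop_atTop_of_one_lt (by rw [one_lt_div (by exact_mod_cast hb)]; exact_mod_cast hab)
  obtain ⟨e, he⟩ := (h2.eventually_gt_atTop (s : ℝ)).exists
  have h3 : ((a : ℝ) / b) ^ e ≤ s := by
    rw [div_pow, div_le_iff₀ (by positivity)]
    have := h e
    rw [mul_comm]
    exact_mod_cast this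
  linarith

end Upper

section Upper2
open TensorProduct

lemma frob_indep_fiber {A K L B ι : Type*} [CommRing A] [Field K] [Field L] [CommRing B]
    [Algebra A K] [Algebra K L] [Algebra A L] [IsScalarTower A K L] [Algebra A B] [Fintype ι]
    (p : ℕ) [hp : Fact p.Prime] (hpA : (p : A) = 0)
    (hK : ∀ a : K, ∃ s r : A, algebraMap A K s ≠ 0 ∧ s • a = algebraMap A K r)
    (b : Module.Basis ι K L) (a : ι → A) (ha : ∀ i, b i ^ p = algebraMap A L (a i))
    (Q : Ideal (L ⊗[A] B)) [Q.IsPrime] (hQ : ∀ w ∈ Q, ∃ u ∉ Q, u * w = 0)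
    (t : ι → B) (ht : (1 : L) ⊗ₜ[A] (∑ i, algebraMap A B (a i) * t i ^ p) ∈ Q) (i : ι) :
    (1 : L) ⊗ₜ[A] t i ∈ Q := by
  classical
  have hpT : (p : L ⊗[A] B) = 0 := by
    have := congrArg (algebraMap A (L ⊗[A] B)) hpA
    simpa using this
  haveI : Nontrivial (L ⊗[A] B) := ⟨⟨0, 1, fun h =>
    (Ideal.ne_top_iff_one Q).1 (Ideal.IsPrime.ne_top inferInstance) (h ▸ Q.zero_mem)⟩⟩
  haveI : CharP (L ⊗[A] B) p := (CharP.charP_iff_prime_eq_zero hp.out).2 hpT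
  have key : ∀ v : ι → B, (∑ i, b i ⊗ₜ[A] v i) ^ p =
      (1 : L) ⊗ₜ[A] (∑ i, algebraMap A B (a i) * v i ^ p) := by
    intro v
    rw [sum_pow_char p, TensorProduct.tmul_sum]
    refine Finset.sum_congr rfl fun i _ => ?_
    rw [Algebra.TensorProduct.tmul_pow, ha, Algebra.algebraMap_eq_smul_one, TensorProduct.smul_tmul,
      Algebra.smul_def]
  have rep : ∀ u : L ⊗[A] B, ∃ s : A, algebraMap A K s ≠ 0 ∧ ∃ v : ι → B,
      s • u = ∑ i, b i ⊗ₜ[A] v i := by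
    intro u
    induction u using TensorProduct.induction_on with
    | zero => exact ⟨1, by simp, 0, by simp⟩
    | tmul l c =>
      choose s r hs hr using fun i => hK (b.repr l i)
      refine ⟨∏ i, s i, ?_, fun i => ((∏ j ∈ Finset.univ.erase i, s j) * r i) • c, ?_⟩
      · rw [map_prod]
        exact Finset.prod_ne_zero_iff.2 fun i _ => hs i
      · conv_lhs => rw [← b.sum_repr l]
        rw [TensorProduct.sum_tmul, Finset.smul_sum]
        refine Finset.sum_congr rfl fun i _ => ?_
        rw [← TensorProduct.smul_tmul, TensorProduct.smul_tmul']
        congr 1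
        rw [← Finset.prod_erase_mul _ _ (Finset.mem_univ i), mul_smul, mul_smul]
        congr 1
        rw [← smul_assoc, hr, algebraMap_smul]
    | add u₁ u₂ h₁ h₂ =>
      obtain ⟨s₁, hs₁, v₁, e₁⟩ := h₁
      obtain ⟨s₂, hs₂, v₂, e₂⟩ := h₂
      refine ⟨s₁ * s₂, by rw [map_mul]; exact mul_ne_zero hs₁ hs₂, fun i => s₂ • v₁ i + s₁ • v₂ i, ?_⟩
      rw [smul_add, mul_comm, mul_smul, e₁, mul_comm, mul_smul, e₂, Finset.smul_sum, Finset.smul_sum,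
        ← Finset.sum_add_distrib]
      refine Finset.sum_congr rfl fun i _ => ?_
      rw [TensorProduct.tmul_add, TensorProduct.tmul_smul, TensorProduct.tmul_smul]
  have rep2 : ∀ u : L ⊗[A] B, u ∉ Q → ∃ u' : L ⊗[A] B, ∃ v : B, (1 : L) ⊗ₜ[A] v ∉ Q ∧
      u' * u = (1 : L) ⊗ₜ[A] v := by
    intro u hu
    obtain ⟨s, hs, v, e⟩ := rep u
    refine ⟨(algebraMap A _ s) ^ p * u ^ (p - 1), ∑ i, algebraMap A B (a i) * v i ^ p, ?_, ?_⟩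
    · rw [← key, ← e]
      intro hmem
      have h1 := Ideal.IsPrime.mem_of_pow_mem inferInstance _ hmem
      apply hu
      have h2 := Q.mul_mem_left (((algebraMap A K s)⁻¹ • (1 : L)) ⊗ₜ[A] (1 : B)) h1
      rw [Algebra.smul_def s u, ← mul_assoc] at h2
      have : (((algebraMap A K s)⁻¹ • (1 : L)) ⊗ₜ[A] (1 : B)) * algebraMap A (L ⊗[A] B) s = 1 := by
        rw [Algebra.TensorProduct.algebraMap_apply, Algebra.TensorProduct.tmul_mul_tmul,
          IsScalarTower.algebraMap_apply A K L, smul_mul_assoc, one_mul, mul_one, Algebra.smul_def, ← map_mul,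
          inv_mul_cancel₀ hs, map_one, Algebra.TensorProduct.one_def]
      rwa [this, one_mul] at h2
    · rw [← key, ← e, Algebra.smul_def, mul_pow, mul_assoc, ← pow_succ, Nat.sub_add_cancel hp.out.one_le]
  obtain ⟨u, hu, hw⟩ := hQ _ ht
  obtain ⟨u', s, hs, e⟩ := rep2 u hu
  have hw2 : ((1 : L) ⊗ₜ[A] s) * ((1 : L) ⊗ₜ[A] (∑ i, algebraMap A B (a i) * t i ^ p)) = 0 := by
    rw [← e, mul_assoc, hw, mul_zero]
  have hz : (∑ i, b i ⊗ₜ[A] (s * t i)) ^ p = 0 := by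
    rw [key]
    have : ∑ i, algebraMap A B (a i) * (s * t i) ^ p =
        s ^ (p - 1) * (s * ∑ i, algebraMap A B (a i) * t i ^ p) := by
      rw [← mul_assoc, ← pow_succ, Nat.sub_add_cancel hp.out.one_le, Finset.mul_sum]
      refine Finset.sum_congr rfl fun i _ => by ring
    rw [this]
    rw [Algebra.TensorProduct.tmul_mul_tmul, one_mul] at hw2
    rw [← one_mul (1 : L), ← Algebra.TensorProduct.tmul_mul_tmul, hw2, mul_zero]
  have hzQ : (∑ i, b i ⊗ₜ[A] (s * t i)) ∈ Q :=
    Ideal.IsPrime.mem_of_pow_mem inferInstance p (by rw [hz]; exact Q.zero_mem)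
  obtain ⟨u₂, hu₂, hw₂⟩ := hQ _ hzQ
  obtain ⟨u₂', v, hv, e₂⟩ := rep2 u₂ hu₂
  have h3 : (∑ i, b i ⊗ₜ[A] (v * (s * t i))) = 0 := by
    have : ((1 : L) ⊗ₜ[A] v) * (∑ i, b i ⊗ₜ[A] (s * t i)) = 0 := by
      rw [← e₂, mul_assoc, hw₂, mul_zero]
    rw [← this, Finset.mul_sum]
    refine Finset.sum_congr rfl fun i _ => by
      rw [Algebra.TensorProduct.tmul_mul_tmul, one_mul]
  have h4 := congrArg (((b.coord i).restrictScalars A).rTensor B) h3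
  rw [map_sum, map_zero] at h4
  have h5 : (1 : K) ⊗ₜ[A] (v * (s * t i)) = 0 := by
    rw [← h4, Finset.sum_eq_single i]
    · simp
    · intro j _ hj
      rw [LinearMap.rTensor_tmul]
      simp [hj]
    · simp
  have h6 := congrArg ((IsScalarTower.toAlgHom A K L).toLinearMap.rTensor B) h5
  rw [LinearMap.rTensor_tmul, map_zero] at h6
  have h7 : ((1 : L) ⊗ₜ[A] v) * (((1 : L) ⊗ₜ[A] s) * ((1 : L) ⊗ₜ[A] t i)) = 0 := by
    rw [Algebra.TensorProduct.tmul_mul_tmul, Algebra.TensorProduct.tmul_mul_tmul, ← h6]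
    simp
  have h8 : ((1 : L) ⊗ₜ[A] v) * (((1 : L) ⊗ₜ[A] s) * ((1 : L) ⊗ₜ[A] t i)) ∈ Q := h7 ▸ Q.zero_mem
  exact ((Ideal.IsPrime.mem_or_mem inferInstance
    ((Ideal.IsPrime.mem_or_mem inferInstance h8).resolve_left hv)).resolve_left hs)

end Upper2

section Upper3
open TensorProduct

lemma frob_gen {C σ : Type*} [CommRing C] [Fintype σ] (p e d : ℕ) [hp : Fact p.Prime] [CharP C p]
    (x : Fin d → C) (s : σ → C) (hs : ∀ c, ∃ j, ∃ y : Fin d → C, c = s j + ∑ i, x i * y i)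
    (I : Ideal C) (hI : ∀ i, x i ^ p ^ e ∈ I) (c : C) :
    ∃ w : (Fin d → Fin (p ^ e)) × σ → C,
      c - ∑ j, w j ^ p ^ e * ((∏ i, x i ^ (j.1 i : ℕ)) * s j.2) ∈ I := by
  classical
  let G : AddSubmonoid C :=
    { carrier := {c | ∃ w : (Fin d → Fin (p ^ e)) × σ → C,
        c - ∑ j, w j ^ p ^ e * ((∏ i, x i ^ (j.1 i : ℕ)) * s j.2) ∈ I}
      zero_mem' := ⟨0, by simp [hp.out.ne_zero]⟩
      add_mem' := by
        rintro a b ⟨v, hv⟩ ⟨w, hw⟩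
        refine ⟨v + w, ?_⟩
        convert I.add_mem hv hw using 1
        rw [sub_add_sub_comm, ← Finset.sum_add_distrib]
        congr 1
        refine Finset.sum_congr rfl fun j _ => ?_
        rw [Pi.add_apply, add_pow_char_pow, add_mul] }
  have hIG : ∀ c ∈ I, c ∈ G := fun c hc => ⟨0, by simpa [hp.out.ne_zero] using hc⟩
  have hbig : ∀ α : Fin d → ℕ, (∃ i, p ^ e ≤ α i) → ∀ c, (∏ i, x i ^ α i) * c ∈ I := by
    rintro α ⟨i, hi⟩ c
    rw [← Finset.mul_prod_erase _ _ (Finset.mem_univ i), mul_assoc]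
    refine I.mul_mem_right _ ?_
    rw [← Nat.sub_add_cancel hi, pow_add]
    exact I.mul_mem_left _ (hI i)
  have hmon : ∀ (α : Fin d → ℕ) j, (∏ i, x i ^ α i) * s j ∈ G := by
    intro α j
    by_cases h : ∃ i, p ^ e ≤ α i
    · exact hIG _ (hbig α h _)
    · push Not at h
      refine ⟨Pi.single (fun i => ⟨α i, h i⟩, j) 1, ?_⟩
      rw [Finset.sum_eq_single (fun i => ⟨α i, h i⟩, j)]
      · simp
      · intro b _ hb
        rw [Pi.single_eq_of_ne hb]
        simp [hp.out.ne_zero]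
      · simp
  have hall : ∀ (k : ℕ) (α : Fin d → ℕ), d * p ^ e + 1 ≤ ∑ i, α i + k → ∀ c,
      (∏ i, x i ^ α i) * c ∈ G := by
    intro k
    induction k with
    | zero =>
      intro α hα c
      refine hIG _ (hbig α ?_ c)
      by_contra! h
      have : ∑ i, α i ≤ ∑ i : Fin d, p ^ e := Finset.sum_le_sum fun i _ => (h i).le
      simp at this
      lia
    | succ k ih =>
      intro α hα c
      obtain ⟨j, y, hy⟩ := hs c
      rw [hy, mul_add, Finset.mul_sum]
      refine G.add_mem (hmon α j) (G.sum_mem fun i _ => ?_)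
      have h := ih (Function.update α i (α i + 1)) ?_ (y i)
      · rw [← Finset.mul_prod_erase _ _ (Finset.mem_univ i)] at h ⊢
        rw [Function.update_self, pow_succ] at h
        have e1 : ∏ j ∈ Finset.univ.erase i, x j ^ (Function.update α i (α i + 1)) j =
            ∏ j ∈ Finset.univ.erase i, x j ^ α j := by
          refine Finset.prod_congr rfl fun j hj => ?_
          rw [Function.update_of_ne (Finset.ne_of_mem_erase hj)]
        rw [e1] at h
        convert h using 1
        ring
      · rw [Finset.sum_update_of_mem (Finset.mem_univ i)]
        rw [← Finset.add_sum_erase _ _ (Finset.mem_univ i)] at hα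
        rw [Finset.sdiff_singleton_eq_erase]
        lia
  have := hall (d * p ^ e + 1) 0 (by simp) c
  simp only [Pi.zero_apply, pow_zero, Finset.prod_const_one, one_mul] at this
  exact this

/-- Separatedness of the completion modulo an extended ideal. -/
lemma hausdorff_quot {A : Type*} [CommRing A] [IsNoetherianRing A] (m q : Ideal A)
    (c : AdicCompletion m A)
    (h : ∀ n, c ∈ (m ^ n).map (algebraMap A (AdicCompletion m A)) ⊔
      q.map (algebraMap A (AdicCompletion m A))) :
    c ∈ q.map (algebraMap A (AdicCompletion m A)) := by
  have hex := AdicCompletion.map_exact (I := m) (f := q.subtype) (g := q.mkQ)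
    q.injective_subtype (LinearMap.exact_subtype_mkQ q) q.mkQ_surjective
  have hz : AdicCompletion.map m q.mkQ c = 0 := by
    have hq0 : ∀ y ∈ q.map (algebraMap A (AdicCompletion m A)), AdicCompletion.map m q.mkQ y = 0 := by
      intro y hy
      induction hy using Submodule.span_induction with
      | mem y hy =>
        obtain ⟨a, ha, rfl⟩ := hy
        have : algebraMap A (AdicCompletion m A) a = AdicCompletion.of m A a := rfl
        rw [this, AdicCompletion.map_of]
        rw [Submodule.mkQ_apply, (Submodule.Quotient.mk_eq_zero q).2 ha, map_zero]
      | zero => simp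
      | add x y _ _ hx hy => rw [map_add, hx, hy, add_zero]
      | smul a x _ hx => rw [map_smul, hx, smul_zero]
    have hfg : m.FG := IsNoetherian.noetherian m
    have hH : IsHausdorff m (AdicCompletion m (A ⧸ q)) := inferInstance
    refine hH.haus _ fun n => ?_
    rw [SModEq.zero]
    obtain ⟨y, hy, z, hz, rfl⟩ := Submodule.mem_sup.1 (h n)
    rw [map_add, hq0 z hz, add_zero]
    have hy' : y ∈ (m ^ n • ⊤ : Submodule A (AdicCompletion m A)) := by
      rw [Ideal.smul_top_eq_map]
      exact hy
    have h2 := Submodule.mem_map_of_mem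
      (f := (AdicCompletion.map m q.mkQ).restrictScalars A) hy'
    rw [Submodule.map_smul''] at h2
    exact Submodule.smul_mono le_rfl le_top h2
  obtain ⟨c', rfl⟩ := (hex c).1 hz
  obtain ⟨t, rfl⟩ := AdicCompletion.ofTensorProduct_surjective_of_finite m q c'
  clear h hz
  induction t using TensorProduct.induction_on with
  | zero => simp
  | tmul r y =>
    rw [AdicCompletion.ofTensorProduct_tmul, map_smul, AdicCompletion.map_of, smul_eq_mul]
    exact Ideal.mul_mem_left _ _ (Ideal.mem_map_of_mem _ y.2)
  | add a b ha hb =>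
    rw [map_add, map_add]
    exact Ideal.add_mem _ ha hb

universe u₁

lemma upper_bound {A : Type u₁} {K L : Type u₁} {ι : Type*} [CommRing A] [IsLocalRing A] [IsNoetherianRing A]
    [Field K] [Field L]
    [Algebra A K] [Algebra K L] [Algebra A L] [IsScalarTower A K L] [Fintype ι]
    (p : ℕ) [hp : Fact p.Prime] (hpA : (p : A) = 0) [Finite (IsLocalRing.ResidueField A)]
    (hK : ∀ a : K, ∃ s r : A, algebraMap A K s ≠ 0 ∧ s • a = algebraMap A K r)
    (q : Ideal A) (hq : ∀ a ∈ q, algebraMap A K a = 0)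
    (b : Module.Basis ι K L) (a : ι → A) (ha : ∀ i, b i ^ p = algebraMap A L (a i))
    (hreg : IsRegularRing (L ⊗[A] (AdicCompletion (IsLocalRing.maximalIdeal A) A)))
    (d N : ℕ) (x : Fin d → A) (hxm : ∀ i, x i ∈ IsLocalRing.maximalIdeal A)
    (hx : (IsLocalRing.maximalIdeal A) ^ N ≤ q ⊔ Ideal.span (Set.range x)) :
    Fintype.card ι ≤ p ^ d := by
  classical
  set m := IsLocalRing.maximalIdeal A with hm
  let B := AdicCompletion m A
  haveI : Module.FaithfullyFlat A B := Module.FaithfullyFlat.of_flat_of_isLocalHom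
  haveI : Nontrivial (L ⊗[A] B) := Module.FaithfullyFlat.rTensor_nontrivial A B L
  obtain ⟨Q, hQm⟩ := Ideal.nonempty_minimalPrimes (I := (⊥ : Ideal (L ⊗[A] B))) bot_ne_top
  haveI hQp : Q.IsPrime := hQm.1.1
  have hQ : ∀ w ∈ Q, ∃ u ∉ Q, u * w = 0 := by
    intro w hw
    obtain ⟨hn, hd⟩ := hreg ⟨Q, hQp⟩
    dsimp only at hn hd
    rw [IsLocalization.AtPrime.ringKrullDim_eq_height Q] at hd
    have h0 : Q.height = 0 := Ideal.height_eq_zero_iff.2 hQm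
    rw [h0] at hd
    have hd' : Module.finrank (IsLocalRing.ResidueField (Localization.AtPrime Q))
      (IsLocalRing.CotangentSpace (Localization.AtPrime Q)) = 0 := by exact_mod_cast hd.symm
    rw [IsLocalRing.finrank_cotangentSpace_eq_zero_iff] at hd'
    have h1 := IsLocalRing.isField_iff_maximalIdeal_eq.1 hd'
    have h2 : algebraMap _ (Localization.AtPrime Q) w = 0 := by
      rw [← Ideal.mem_bot, ← h1]
      exact (IsLocalization.AtPrime.to_map_mem_maximal_iff (Localization.AtPrime Q) Q w).2 hw
    obtain ⟨u, hu⟩ := (IsLocalization.map_eq_zero_iff Q.primeCompl (Localization.AtPrime Q) w).1 h2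
    exact ⟨u, u.2, hu⟩
  let φ : B →+* L ⊗[A] B := (Algebra.TensorProduct.includeRight : B →ₐ[A] L ⊗[A] B).toRingHom
  have hφ : ∀ t, φ t = 1 ⊗ₜ t := fun t => rfl
  let P0 : Ideal B := Q.comap φ
  haveI : P0.IsPrime := Ideal.comap_isPrime φ Q
  let C := B ⧸ P0
  have hpC : (p : C) = 0 := by
    have := congrArg (algebraMap A C) hpA
    simpa using this
  haveI : CharP C p := (CharP.charP_iff_prime_eq_zero hp.out).2 hpC
  have hqP0 : q.map (algebraMap A B) ≤ P0 := by
    rw [Ideal.map_le_iff_le_comap]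
    intro r hr
    rw [Ideal.mem_comap, Ideal.mem_comap, hφ, Algebra.algebraMap_eq_smul_one, ← TensorProduct.smul_tmul,
      ← Algebra.algebraMap_eq_smul_one, IsScalarTower.algebraMap_apply A K L, hq r hr, map_zero,
      TensorProduct.zero_tmul]
    exact Q.zero_mem
  have hfi : FrobIndep p (fun i => Ideal.Quotient.mk P0 (algebraMap A B (a i))) := by
    intro t ht i
    choose t' ht' using fun i => Ideal.Quotient.mk_surjective (t i)
    rw [← ht' i, Ideal.Quotient.eq_zero_iff_mem]
    refine frob_indep_fiber p hpA hK b a ha Q hQ t' ?_ i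
    have : Ideal.Quotient.mk P0 (∑ i, algebraMap A B (a i) * t' i ^ p) = 0 := by
      rw [← ht, map_sum]
      refine Finset.sum_congr rfl fun i _ => ?_
      rw [map_mul, map_pow, ht']
    exact (Ideal.Quotient.eq_zero_iff_mem (I := P0)).1 this
  let q' : Ideal B := q.map (algebraMap A B)
  haveI : Nontrivial (B ⧸ q') := Ideal.Quotient.nontrivial_iff.2 fun h =>
    Ideal.IsPrime.ne_top (inferInstance : P0.IsPrime) (top_le_iff.1 (h ▸ hqP0))
  have hpC1 : (p : B ⧸ q') = 0 := by
    have := congrArg (algebraMap A (B ⧸ q')) hpA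
    simpa using this
  haveI : CharP (B ⧸ q') p := (CharP.charP_iff_prime_eq_zero hp.out).2 hpC1
  have hmfg : m.FG := IsNoetherian.noetherian m
  haveI : Finite (A ⧸ m) := ‹Finite (IsLocalRing.ResidueField A)›
  haveI : Finite (A ⧸ m ^ N) := Ideal.finite_quotient_pow hmfg N
  haveI := Fintype.ofFinite (A ⧸ m ^ N)
  haveI : IsAdicComplete m B := AdicCompletion.isAdicComplete hmfg
  have hs : ∀ c : B ⧸ q', ∃ j : A ⧸ m ^ N, ∃ y : Fin d → B ⧸ q',
      c = Ideal.Quotient.mk q' (algebraMap A B (Quotient.out j)) +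
        ∑ i, Ideal.Quotient.mk q' (algebraMap A B (x i)) * y i := by
    intro c
    obtain ⟨c, rfl⟩ := Ideal.Quotient.mk_surjective c
    obtain ⟨a₀, ha₀⟩ := Submodule.Quotient.mk_surjective _ (AdicCompletion.eval m A N c)
    have h1 : c - algebraMap A B a₀ ∈ (m ^ N).map (algebraMap A B) := by
      have : c - algebraMap A B a₀ ∈ (m ^ N • ⊤ : Submodule A B) := by
        rw [AdicCompletion.pow_smul_top_eq_ker_eval hmfg, LinearMap.mem_ker, map_sub, ← ha₀, sub_eq_zero]
        rfl
      rw [Ideal.smul_top_eq_map] at this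
      exact this
    let j : A ⧸ m ^ N := Ideal.Quotient.mk _ a₀
    have h2 : a₀ - Quotient.out j ∈ m ^ N := by
      rw [← Ideal.Quotient.mk_eq_mk_iff_sub_mem]
      exact (Ideal.Quotient.mk_out j).symm
    have h3 : c - algebraMap A B (Quotient.out j) ∈ (m ^ N).map (algebraMap A B) := by
      have := Ideal.add_mem _ h1 (Ideal.mem_map_of_mem (algebraMap A B) h2)
      rwa [map_sub, sub_add_sub_cancel] at this
    have h4 := Ideal.mem_map_of_mem (Ideal.Quotient.mk q') (Ideal.map_mono hx h3)
    rw [Ideal.map_sup, Ideal.map_sup, Ideal.map_quotient_self, bot_sup_eq, Ideal.map_span, Ideal.map_span,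
      ← Set.range_comp, ← Set.range_comp, Ideal.mem_span_range_iff_exists_fun] at h4
    obtain ⟨y, hy⟩ := h4
    refine ⟨j, y, ?_⟩
    rw [map_sub, eq_sub_iff_add_eq, add_comm] at hy
    rw [← hy]
    congr 1
    exact Finset.sum_congr rfl fun i _ => mul_comm _ _
  refine pow_growth _ _ (Fintype.card (A ⧸ m ^ N)) fun e => ?_
  obtain ⟨c', hc'⟩ := hfi.iter p _ e
  let g : (Fin d → Fin (p ^ e)) × (A ⧸ m ^ N) → B ⧸ q' := fun j =>
    (∏ i, Ideal.Quotient.mk q' (algebraMap A B (x i)) ^ (j.1 i : ℕ)) *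
      Ideal.Quotient.mk q' (algebraMap A B (Quotient.out j.2))
  have hspan := frob_span p e m (Ideal.Quotient.mk q') (by
    intro c hc
    obtain ⟨c, rfl⟩ := Ideal.Quotient.mk_surjective c
    rw [Ideal.Quotient.eq_zero_iff_mem]
    refine hausdorff_quot m q c fun n => ?_
    have := hc n
    rw [← Ideal.map_map] at this
    rw [← Ideal.mem_quotient_iff_mem_sup]
    exact this) g (by
    intro c
    obtain ⟨w, hw⟩ := frob_gen p e d (fun i => Ideal.Quotient.mk q' (algebraMap A B (x i))) _ hs
      (Ideal.span ((fun a => Ideal.Quotient.mk q' (algebraMap A B a) ^ p ^ e) '' (m : Set A)))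
      (fun i => Ideal.subset_span ⟨x i, hxm i, rfl⟩) c
    choose w' hw' using fun j => Ideal.Quotient.mk_surjective (w j)
    refine ⟨w', ?_⟩
    simp only [hw']
    exact hw)
  have hle := FrobIndep.card_le p e c' hc' (fun j => Ideal.Quotient.factor hqP0 (g j)) (by
    intro y
    obtain ⟨y, rfl⟩ := Ideal.Quotient.mk_surjective y
    obtain ⟨w, hw⟩ := hspan (Ideal.Quotient.mk q' y)
    refine ⟨fun j => Ideal.Quotient.mk P0 (w j), ?_⟩
    have := congrArg (Ideal.Quotient.factor hqP0) hw
    rw [Ideal.Quotient.factor_mk, map_sum] at this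
    rw [this]
    refine Finset.sum_congr rfl fun j _ => ?_
    rw [map_mul, map_pow, Ideal.Quotient.factor_mk])
  simp only [Fintype.card_fun, Fintype.card_fin, Fintype.card_prod] at hle
  calc _ ≤ _ := hle
    _ = _ := by rw [← pow_mul, ← pow_mul, mul_comm d e]

end Upper3

section Upper4
open TensorProduct
universe u₁

lemma frob_field {K : Type u₁} [Field K] {ι : Type*} [Fintype ι] (p : ℕ) [hp : Fact p.Prime] [CharP K p]
    (a : ι → K) (h : FrobIndep p a) :
    ∃ (L : Type u₁) (_ : Field L) (_ : Algebra K L) (n : ℕ) (_ : Module.Basis (Fin n) K L),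
      (∀ y : L, ∃ k, y ^ p = algebraMap K L k) ∧ Fintype.card ι ≤ n := by
  classical
  let Ω := AlgebraicClosure K
  haveI : CharP Ω p := charP_of_injective_algebraMap (algebraMap K Ω).injective p
  choose r hr using fun i => IsAlgClosed.exists_pow_nat_eq (algebraMap K Ω (a i)) hp.out.pos
  let L := IntermediateField.adjoin K (Set.range r)
  haveI hfin : Module.Finite K L :=
    IntermediateField.finiteDimensional_adjoin fun x _ => (Algebra.IsAlgebraic.isAlgebraic x).isIntegral
  refine ⟨L, inferInstance, inferInstance, _, Module.finBasis K L, ?_, ?_⟩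
  · rintro ⟨y, hy⟩
    have : ∃ k, y ^ p = algebraMap K Ω k := by
      induction hy using IntermediateField.adjoin_induction with
      | mem x hx => obtain ⟨i, rfl⟩ := hx; exact ⟨a i, hr i⟩
      | algebraMap x => exact ⟨x ^ p, by rw [map_pow]⟩
      | add x y _ _ hx hy =>
        obtain ⟨k, hk⟩ := hx
        obtain ⟨l, hl⟩ := hy
        exact ⟨k + l, by rw [add_pow_char, hk, hl, map_add]⟩
      | inv x _ hx =>
        obtain ⟨k, hk⟩ := hx
        exact ⟨k⁻¹, by rw [inv_pow, hk, map_inv₀]⟩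
      | mul x y _ _ hx hy =>
        obtain ⟨k, hk⟩ := hx
        obtain ⟨l, hl⟩ := hy
        exact ⟨k * l, by rw [mul_pow, hk, hl, map_mul]⟩
    obtain ⟨k, hk⟩ := this
    exact ⟨k, Subtype.ext hk⟩
  · have hli : LinearIndependent K (fun i => (⟨r i, IntermediateField.subset_adjoin K _ ⟨i, rfl⟩⟩ : L)) := by
      rw [Fintype.linearIndependent_iff]
      intro t ht i
      refine h t ?_ i
      apply (algebraMap K Ω).injective
      have h2 : ∑ i, algebraMap K Ω (t i) * r i = 0 := by
        have := congrArg (algebraMap L Ω) ht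
        rw [map_sum, map_zero] at this
        rw [← this]
        exact Finset.sum_congr rfl fun i _ => by rw [← Algebra.smul_def]; rfl
      have h3 := congrArg (· ^ p) h2
      simp only [zero_pow hp.out.ne_zero, sum_pow_char p, mul_pow, hr] at h3
      rw [map_sum, map_zero, ← h3]
      exact Finset.sum_congr rfl fun i _ => by rw [map_mul, map_pow, mul_comm]
    exact hli.fintype_card_le_finrank

lemma params_two {A : Type*} [CommRing A] [IsLocalRing A] [IsNoetherianRing A] (q : Ideal A) [hqp : q.IsPrime]
    (hno : ¬ ∃ p₁ p₂ : Ideal A, p₁.IsPrime ∧ p₂.IsPrime ∧ q < p₁ ∧ p₁ < p₂ ∧ p₂ < IsLocalRing.maximalIdeal A) :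
    ∃ (d N : ℕ) (x : Fin d → A), d ≤ 2 ∧ (∀ i, x i ∈ IsLocalRing.maximalIdeal A) ∧
      (IsLocalRing.maximalIdeal A) ^ N ≤ q ⊔ Ideal.span (Set.range x) := by
  classical
  let D := A ⧸ q
  haveI : Nontrivial D := Ideal.Quotient.nontrivial_iff.2 hqp.ne_top
  haveI : IsLocalRing D := IsLocalRing.of_surjective' _ (Ideal.Quotient.mk_surjective (I := q))
  -- parameters
  let mD := IsLocalRing.maximalIdeal D
  have hmD : mD.comap (Ideal.Quotient.mk q) = IsLocalRing.maximalIdeal A :=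
    IsLocalRing.eq_maximalIdeal (Ideal.comap_isMaximal_of_surjective _ Ideal.Quotient.mk_surjective)
  obtain ⟨S, hS1, hS2⟩ := mD.exists_finset_card_eq_height_of_isNoetherianRing
  have hS3 : S.card ≤ 2 := by
    by_contra! h3
    obtain ⟨l, hl1, hl2⟩ := mD.exists_ltSeries_length_eq_height
    rw [← hS2] at hl2
    have hl3 : 3 ≤ l.length := by
      have : l.length = S.card := by exact_mod_cast hl2
      lia
    apply hno
    let f : PrimeSpectrum D → Ideal A := fun P => P.asIdeal.comap (Ideal.Quotient.mk q)
    have hf : ∀ P P', P < P' → f P < f P' := by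
      intro P P' hP
      refine lt_of_le_of_ne (Ideal.comap_mono hP.le) fun h => hP.ne (PrimeSpectrum.ext ?_)
      exact Ideal.comap_injective_of_surjective _ Ideal.Quotient.mk_surjective h
    have hlast : f l.last = IsLocalRing.maximalIdeal A := by rw [hl1]; exact hmD
    have h01 : l ⟨l.length - 3, by lia⟩ < l ⟨l.length - 2, by lia⟩ := l.strictMono (by
      simp only [Fin.mk_lt_mk]; lia)
    have h12 : l ⟨l.length - 2, by lia⟩ < l ⟨l.length - 1, by lia⟩ := l.strictMono (by
      simp only [Fin.mk_lt_mk]; lia)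
    have h23 : l ⟨l.length - 1, by lia⟩ < l.last := l.strictMono (by
      rw [Fin.lt_def]; simp only [Fin.val_last]; lia)
    refine ⟨f (l ⟨l.length - 2, by lia⟩), f (l ⟨l.length - 1, by lia⟩), inferInstance, inferInstance,
      ?_, hf _ _ h12, hlast ▸ hf _ _ h23⟩
    refine lt_of_le_of_lt ?_ (hf _ _ h01)
    intro x hx
    rw [Ideal.mem_comap, Ideal.Quotient.eq_zero_iff_mem.2 hx]
    exact Ideal.zero_mem _
  have hrad : mD ≤ (Ideal.span (S : Set D)).radical := by
    rw [Ideal.radical_eq_sInf]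
    refine le_sInf fun J hJ => ?_
    haveI := hJ.2
    exact hS1.2 ⟨hJ.2, hJ.1⟩ (IsLocalRing.le_maximalIdeal hJ.2.ne_top)
  obtain ⟨N, hN⟩ := Ideal.exists_pow_le_of_le_radical_of_fg hrad (IsNoetherian.noetherian _)
  let x : Fin S.card → A := fun i => Quotient.out (S.equivFin.symm i : D)
  have hx : ∀ i, Ideal.Quotient.mk q (x i) = (S.equivFin.symm i : D) := fun i => Ideal.Quotient.mk_out _
  refine ⟨S.card, N, x, hS3, ?_, ?_⟩
  · intro i
    rw [← hmD, Ideal.mem_comap, hx]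
    exact hS1.1.2 (Ideal.subset_span (S.equivFin.symm i).2)
  · intro y hy
    have h1 : Ideal.Quotient.mk q y ∈ Ideal.span (S : Set D) := by
      apply hN
      have := Ideal.mem_map_of_mem (Ideal.Quotient.mk q) hy
      rw [Ideal.map_pow, ← hmD, Ideal.map_comap_of_surjective _ Ideal.Quotient.mk_surjective] at this
      exact this
    have h2 : Ideal.span (S : Set D) = (Ideal.span (Set.range x)).map (Ideal.Quotient.mk q) := by
      rw [Ideal.map_span, ← Set.range_comp]
      congr 1
      ext z
      constructor
      · intro hz
        exact ⟨S.equivFin ⟨z, hz⟩, by simp [hx]⟩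
      · rintro ⟨i, rfl⟩
        simp [hx]
    rw [h2] at h1
    rw [sup_comm, ← Ideal.mem_quotient_iff_mem_sup]
    exact h1

lemma upper_local {A : Type u₁} [CommRing A] [IsLocalRing A] [IsNoetherianRing A]
    (H : ∀ (q : PrimeSpectrum A) (L : Type u₁) (_ : Field L)
      (_ : Algebra (FractionRing (A ⧸ q.asIdeal)) L)
      (_ : Module.Finite (FractionRing (A ⧸ q.asIdeal)) L),
      letI : Algebra A L :=
        ((algebraMap (FractionRing (A ⧸ q.asIdeal)) L).comp
          ((algebraMap (A ⧸ q.asIdeal) (FractionRing (A ⧸ q.asIdeal))).comp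
            (Ideal.Quotient.mk q.asIdeal))).toAlgebra
      IsRegularRing
        (TensorProduct A L (AdicCompletion (IsLocalRing.maximalIdeal A) A)))
    {ι : Type*} [Fintype ι]
    (p : ℕ) [hp : Fact p.Prime] (hpA : (p : A) = 0) [Finite (IsLocalRing.ResidueField A)]
    (q : Ideal A) [hqp : q.IsPrime] (a : ι → A)
    (ha : ∀ t : ι → A, ∑ i, a i * t i ^ p ∈ q → ∀ i, t i ∈ q)
    (hcard : p ^ 2 < Fintype.card ι) :
    ∃ p₁ p₂ : Ideal A, p₁.IsPrime ∧ p₂.IsPrime ∧ q < p₁ ∧ p₁ < p₂ ∧ p₂ < IsLocalRing.maximalIdeal A := by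
  classical
  by_contra hno
  let D := A ⧸ q
  let K := FractionRing D
  haveI : Nontrivial D := Ideal.Quotient.nontrivial_iff.2 hqp.ne_top
  haveI : IsLocalRing D := IsLocalRing.of_surjective' _ (Ideal.Quotient.mk_surjective (I := q))
  have hpK : (p : K) = 0 := by
    have := congrArg (algebraMap A K) hpA
    simpa using this
  haveI : CharP K p := (CharP.charP_iff_prime_eq_zero hp.out).2 hpK
  have hAK : ∀ r : A, algebraMap A K r = algebraMap D K (Ideal.Quotient.mk q r) := fun r => rfl
  have hzero : ∀ r : A, algebraMap A K r = 0 ↔ r ∈ q := by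
    intro r
    rw [hAK, map_eq_zero_iff _ (IsFractionRing.injective D K), Ideal.Quotient.eq_zero_iff_mem]
  have hK : ∀ k : K, ∃ s r : A, algebraMap A K s ≠ 0 ∧ s • k = algebraMap A K r := by
    intro k
    obtain ⟨r, s, hs, rfl⟩ := IsFractionRing.div_surjective (A := D) k
    obtain ⟨r, rfl⟩ := Ideal.Quotient.mk_surjective r
    obtain ⟨s, rfl⟩ := Ideal.Quotient.mk_surjective s
    have hs' : algebraMap A K s ≠ 0 := by
      rw [hAK]
      exact IsFractionRing.to_map_ne_zero_of_mem_nonZeroDivisors hs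
    refine ⟨s, r, hs', ?_⟩
    rw [Algebra.smul_def, ← hAK, ← hAK, mul_div_cancel₀ _ hs']
  have hfi : FrobIndep p (fun i => algebraMap A K (a i)) := by
    intro t ht i
    choose s r hs hr using fun i => hK (t i)
    have h1 : ∀ i, ((∏ j ∈ Finset.univ.erase i, s j) * r i) ∈ q := by
      refine ha _ ?_
      rw [← hzero, map_sum]
      have h2 : (∏ j, algebraMap A K (s j)) ^ p * ∑ i, algebraMap A K (a i) * t i ^ p = 0 := by
        rw [ht, mul_zero]
      rw [← h2, Finset.mul_sum]
      refine Finset.sum_congr rfl fun i _ => ?_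
      have h3 : algebraMap A K (r i) = algebraMap A K (s i) * t i := by rw [← hr, Algebra.smul_def]
      rw [map_mul, map_pow, map_mul, map_prod, h3, ← mul_assoc, Finset.prod_erase_mul _ _ (Finset.mem_univ i)]
      ring
    have h2 := h1 i
    rw [← hzero, map_mul, map_prod] at h2
    have h3 := (mul_eq_zero.1 h2).resolve_left (Finset.prod_ne_zero_iff.2 fun j _ => hs j)
    rw [← hr, Algebra.smul_def] at h3
    exact (mul_eq_zero.1 h3).resolve_left (hs i)
  obtain ⟨L, hL1, hL2, nL, b, hLp, hLr⟩ := frob_field p _ hfi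
  letI : Algebra A L :=
        ((algebraMap K L).comp
          ((algebraMap D K).comp
            (Ideal.Quotient.mk q))).toAlgebra
  haveI : IsScalarTower A K L := IsScalarTower.of_algebraMap_eq' rfl
  have hreg := H ⟨q, hqp⟩ L inferInstance inferInstance (Module.Finite.of_basis b)
  -- basis
  choose k hk using fun i => hLp (b i)
  choose s r hs hr using fun i => hK (k i)
  let b' := b.isUnitSMul (w := fun i => algebraMap A K (s i)) (fun i => (hs i).isUnit)
  have hb' : ∀ i, b' i ^ p = algebraMap A L (s i ^ (p - 1) * r i) := by
    intro i
    have : b' i = algebraMap A K (s i) • b i := Module.Basis.isUnitSMul_apply _ _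
    rw [this, smul_pow, hk, Algebra.smul_def, IsScalarTower.algebraMap_apply A K L, ← map_mul]
    congr 1
    rw [map_mul, map_pow, ← hr, Algebra.smul_def, ← mul_assoc, ← pow_succ, Nat.sub_add_cancel hp.out.one_le]
  obtain ⟨d, N, x, hd, hxm, hx⟩ := params_two q hno
  have hle := upper_bound (K := K) (L := L) p hpA hK q (fun a ha => (hzero a).2 ha) b' _ hb' hreg d N x hxm hx
  rw [Fintype.card_fin] at hle
  have := Nat.pow_le_pow_right hp.out.pos hd
  lia

lemma upper_final {A : Type u₁} [CommRing A] [IsNoetherianRing A] (H : HasGeomRegularFormalFibers A)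
    {ι : Type*} [Fintype ι] (p : ℕ) [hp : Fact p.Prime] (hpA : (p : A) = 0)
    (q P : Ideal A) [hqp : q.IsPrime] [hPp : P.IsPrime] (hqP : q ≤ P) [Finite P.ResidueField] (a : ι → A)
    (ha : ∀ t : ι → A, ∑ i, a i * t i ^ p ∈ q → ∀ i, t i ∈ q)
    (hcard : p ^ 2 < Fintype.card ι) :
    ∃ p₁ p₂ : Ideal A, p₁.IsPrime ∧ p₂.IsPrime ∧ q < p₁ ∧ p₁ < p₂ ∧ p₂ < P := by
  classical
  let AP := Localization.AtPrime P
  have hdis : Disjoint (P.primeCompl : Set A) q := Set.disjoint_left.2 fun x hx hx' => hx (hqP hx')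
  have hcm : (q.map (algebraMap A AP)).comap (algebraMap A AP) = q := IsLocalization.under_map_of_isPrime_disjoint P.primeCompl AP hqp hdis
  haveI : (q.map (algebraMap A AP)).IsPrime := IsLocalization.isPrime_of_isPrime_disjoint P.primeCompl AP q hqp hdis
  have hpAP : (p : AP) = 0 := by
    have := congrArg (algebraMap A AP) hpA
    simpa using this
  haveI : Finite (IsLocalRing.ResidueField AP) := ‹Finite P.ResidueField›
  obtain ⟨p₁, p₂, h1, h2, h3, h4, h5⟩ := upper_local (A := AP) (H ⟨P, hPp⟩) p hpAP (q.map (algebraMap A AP))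
    (fun i => algebraMap A AP (a i)) (by
      intro t ht i
      obtain ⟨s, hs⟩ := IsLocalization.exist_integer_multiples_of_finite P.primeCompl t
      choose u hu using hs
      have h1 : ∑ i, a i * u i ^ p ∈ q := by
        rw [← hcm, Ideal.mem_comap, map_sum]
        have := Ideal.mul_mem_left _ (algebraMap A AP s ^ p) ht
        rw [Finset.mul_sum] at this
        convert this using 1
        refine Finset.sum_congr rfl fun i _ => ?_
        rw [map_mul, map_pow, hu, Algebra.smul_def]
        ring
      have h2 := Ideal.mem_map_of_mem (algebraMap A AP) (ha u h1 i)
      rw [hu, Algebra.smul_def] at h2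
      exact (Ideal.unit_mul_mem_iff_mem _ (IsLocalization.map_units AP s)).1 h2) hcard
  have hmono : ∀ I J : Ideal AP, I < J → I.comap (algebraMap A AP) < J.comap (algebraMap A AP) := fun I J h =>
    (IsLocalization.orderEmbedding P.primeCompl AP).strictMono h
  refine ⟨p₁.comap (algebraMap A AP), p₂.comap (algebraMap A AP), inferInstance, inferInstance, ?_, hmono _ _ h4, ?_⟩
  · have := hmono _ _ h3
    rwa [hcm] at this
  · have := hmono _ _ h5
    rwa [show (IsLocalRing.maximalIdeal AP).comap (algebraMap A AP) = P from
      IsLocalization.AtPrime.under_maximalIdeal AP P] at this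

end Upper4

section Lower1
universe u₁

lemma len_gen {R M N : Type*} [CommRing R] [AddCommGroup M] [AddCommGroup N] [Module R M] [Module R N]
    (φ : N →ₗ[R] M) (A : Submodule R N) (C : Submodule R M) (h : C.comap φ = A) (hC : C ≤ LinearMap.range φ) :
    Module.length R (M ⧸ C) = Module.length R (N ⧸ A) + Module.length R (M ⧸ LinearMap.range φ) := by
  refine Module.length_eq_add_of_exact (Submodule.mapQ A C φ h.ge) (Submodule.factor hC) ?_
    (Submodule.factor_surjective _) ?_
  · rw [← LinearMap.ker_eq_bot, Submodule.mapQ, Submodule.ker_liftQ, LinearMap.ker_comp, Submodule.ker_mkQ, h]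
    exact Submodule.mkQ_map_self _
  · intro y
    obtain ⟨m, rfl⟩ := Submodule.mkQ_surjective _ y
    have hz : (Submodule.factor hC) (C.mkQ m) = 0 ↔ m ∈ LinearMap.range φ := by
      rw [Submodule.mkQ_apply]
      exact Submodule.Quotient.mk_eq_zero _
    rw [hz]
    constructor
    · rintro ⟨n, rfl⟩
      exact ⟨Submodule.Quotient.mk n, rfl⟩
    · rintro ⟨y, hy⟩
      obtain ⟨n, rfl⟩ := Submodule.mkQ_surjective _ y
      have : φ n - m ∈ C := by
        rw [← Submodule.Quotient.mk_eq_zero, Submodule.Quotient.mk_sub, sub_eq_zero]; exact hy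
      have h2 := hC this
      have : m = φ n - (φ n - m) := by abel
      rw [this]
      exact Submodule.sub_mem _ (LinearMap.mem_range_self φ n) h2

lemma ka_fg {R M : Type*} [CommRing R] [IsDomain R] [IsNoetherianRing R] [Ring.KrullDimLE 1 R]
    [AddCommGroup M] [Module R M] [Module.Finite R M] (htf : ∀ (r : R) (m : M), r • m = 0 → r = 0 ∨ m = 0)
    (N : ℕ) (f : (Fin N → R) →ₗ[R] M)
    (hf : Function.Injective f) (hu : ∀ m : M, ∃ u : R, u ≠ 0 ∧ u • m ∈ LinearMap.range f) (t : R) (ht : t ≠ 0) :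
    Module.length R (M ⧸ LinearMap.range (LinearMap.lsmul R M t)) ≤ N * Ring.ord R t := by
  classical
  set τ := LinearMap.lsmul R M t
  have hτ : Function.Injective τ := by
    rw [← LinearMap.ker_eq_bot, LinearMap.ker_eq_bot']
    intro m hm
    exact (htf t m hm).resolve_left ht
  let T := (LinearMap.range f).map τ
  let π : (Fin N → R) →ₗ[R] (Fin N → R ⧸ Ideal.span {t}) :=
    LinearMap.pi fun i => (Submodule.mkQ (Ideal.span {t})).comp (LinearMap.proj i)
  have hπ : Function.Surjective π := fun y => by
    choose z hz using fun i => Submodule.mkQ_surjective (Ideal.span {t}) (y i)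
    exact ⟨z, funext hz⟩
  have e1 := len_gen f (LinearMap.ker π) T (by
    ext y
    simp only [Submodule.mem_comap, LinearMap.mem_ker, T, Submodule.mem_map]
    constructor
    · rintro ⟨_, ⟨z, rfl⟩, hz⟩
      have : t • z = y := hf (by rw [map_smul]; exact hz)
      funext i
      refine (Submodule.Quotient.mk_eq_zero _).2 ?_
      rw [← this]
      exact Ideal.mem_span_singleton'.2 ⟨z i, mul_comm _ _⟩
    · intro h
      have : ∀ i, ∃ z, z * t = y i := fun i => by
        have := congrFun h i
        have := (Submodule.Quotient.mk_eq_zero _).1 this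
        exact Ideal.mem_span_singleton'.1 this
      choose z hz using this
      refine ⟨f z, ⟨z, rfl⟩, ?_⟩
      show t • f z = _
      rw [← map_smul]
      congr 1; funext i; rw [← hz, mul_comm]; rfl) (by
    rintro _ ⟨m, hm, rfl⟩
    exact Submodule.smul_mem _ _ hm)
  have e2 := len_gen τ (LinearMap.range f) T (Submodule.comap_map_eq_of_injective hτ _) (by rintro _ ⟨m, _, rfl⟩; exact ⟨m, rfl⟩)
  have e3 : Module.length R ((Fin N → R) ⧸ LinearMap.ker π) = N * Ring.ord R t := by
    rw [(π.quotKerEquivOfSurjective hπ).length_eq, Module.length_pi]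
    simp [Ring.ord]
  have e4 : Module.length R (M ⧸ LinearMap.range f) ≠ ⊤ := by
    obtain ⟨S, hS⟩ := Module.Finite.fg_top (R := R) (M := M)
    choose u hu0 hu1 using hu
    let v := ∏ m ∈ S, u m
    have hv0 : v ≠ 0 := Finset.prod_ne_zero_iff.2 fun m _ => hu0 m
    let g : (S → R) →ₗ[R] M ⧸ LinearMap.range f :=
      (Submodule.mkQ _).comp (Fintype.linearCombination R (fun s : S => (s : M)))
    have hg : Function.Surjective g := by
      refine (Submodule.mkQ_surjective _).comp ?_
      rw [← LinearMap.range_eq_top, Fintype.range_linearCombination]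
      simpa using hS
    let π' : (S → R) →ₗ[R] (S → R ⧸ Ideal.span {v}) :=
      LinearMap.pi fun i => (Submodule.mkQ (Ideal.span {v})).comp (LinearMap.proj i)
    have hπ' : Function.Surjective π' := fun y => by
      choose z hz using fun i => Submodule.mkQ_surjective (Ideal.span {v}) (y i)
      exact ⟨z, funext hz⟩
    have hker : LinearMap.ker π' ≤ LinearMap.ker g := by
      intro y hy
      have : ∀ i, ∃ z, z * v = y i := fun i => by
        have := congrFun hy i
        have := (Submodule.Quotient.mk_eq_zero _).1 this
        exact Ideal.mem_span_singleton'.1 this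
      choose z hz using this
      rw [LinearMap.mem_ker]
      show Submodule.Quotient.mk _ = _
      rw [Submodule.Quotient.mk_eq_zero, Fintype.linearCombination_apply]
      refine Submodule.sum_mem _ fun s _ => ?_
      rw [← hz, mul_smul]
      refine Submodule.smul_mem _ _ ?_
      show (∏ m ∈ S, u m) • _ ∈ _
      rw [← Finset.prod_erase_mul _ _ s.2, mul_smul]
      exact Submodule.smul_mem _ _ (hu1 _)
    have h1 : Module.length R (M ⧸ LinearMap.range f) ≤ Module.length R ((S → R) ⧸ LinearMap.ker π') := by
      refine Module.length_le_of_surjective ((LinearMap.ker π').liftQ g hker) ?_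
      rw [← LinearMap.range_eq_top, Submodule.range_liftQ, LinearMap.range_eq_top]
      exact hg
    rw [(π'.quotKerEquivOfSurjective hπ').length_eq, Module.length_pi] at h1
    refine ne_top_of_le_ne_top ?_ h1
    have := Ring.ord_ne_top (R := R) (mem_nonZeroDivisors_of_ne_zero hv0)
    rw [Ring.ord] at this
    rw [ENat.card_eq_coe_fintype_card]
    exact WithTop.mul_ne_top (ENat.natCast_ne_top _) this
  rw [e1, e3, add_comm] at e2
  have := WithTop.add_left_cancel e4 e2
  rw [this]

lemma len_fg {R Q : Type*} [CommRing R] [IsNoetherianRing R] [AddCommGroup Q] [Module R Q] (C : ℕ∞) (hC : C ≠ ⊤)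
    (h : ∀ G : Submodule R Q, G.FG → Module.length R G ≤ C) : Module.length R Q ≤ C := by
  classical
  let P : ℕ∞ → Prop := fun c => ∃ G : Submodule R Q, G.FG ∧ Module.length R G = c
  have hfin : {c | P c}.Finite := by
    refine (Set.finite_Iic (α := ℕ) (C.toNat)).image ((↑) : ℕ → ℕ∞) |>.subset ?_
    rintro c ⟨G, hG, rfl⟩
    have h1 := h G hG
    refine ⟨(Module.length R G).toNat, ?_, ENat.natCast_toNat (ne_top_of_le_ne_top hC h1)⟩
    exact ENat.toNat_le_toNat h1 hC
  obtain ⟨c, ⟨⟨G, hG, rfl⟩, hmax⟩⟩ := hfin.exists_maximal ⟨_, ⊥, Submodule.fg_bot, rfl⟩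
  have : G = ⊤ := by
    rw [eq_top_iff]
    intro q _
    let G' := G ⊔ Submodule.span R {q}
    have hG' : G'.FG := hG.sup (Submodule.fg_span_singleton q)
    by_contra hq
    have hlt : G < G' := by
      refine lt_of_le_of_ne le_sup_left fun h => hq ?_
      rw [h]; exact Submodule.mem_sup_right (Submodule.mem_span_singleton_self q)
    have hl := ne_top_of_le_ne_top hC (h G' hG')
    rw [Module.length_ne_top_iff, isFiniteLength_iff_isNoetherian_isArtinian] at hl
    haveI := hl.1
    haveI := hl.2
    have h1 := Submodule.length_lt (N := G.submoduleOf G') (by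
      rw [Ne, Submodule.submoduleOf_eq_top]; exact hlt.not_ge)
    rw [(Submodule.submoduleOfEquivOfLe hlt.le).length_eq] at h1
    exact absurd (hmax ⟨G', hG', rfl⟩ h1.le) (by simpa using h1)
  subst this
  simpa using h ⊤ hG

/-- Length bound for a torsion-free module of rank `N`. -/
lemma ka_gen {R M : Type*} [CommRing R] [IsDomain R] [IsNoetherianRing R] [Ring.KrullDimLE 1 R]
    [AddCommGroup M] [Module R M] (htf : ∀ (r : R) (m : M), r • m = 0 → r = 0 ∨ m = 0)
    (N : ℕ) (f : (Fin N → R) →ₗ[R] M)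
    (hf : Function.Injective f) (hu : ∀ m : M, ∃ u : R, u ≠ 0 ∧ u • m ∈ LinearMap.range f) (t : R) (ht : t ≠ 0) :
    Module.length R (M ⧸ LinearMap.range (LinearMap.lsmul R M t)) ≤ N * Ring.ord R t := by
  classical
  refine len_fg _ (WithTop.mul_ne_top (ENat.natCast_ne_top _) (Ring.ord_ne_top (mem_nonZeroDivisors_of_ne_zero ht)))
    fun G hG => ?_
  set π := Submodule.mkQ (LinearMap.range (LinearMap.lsmul R M t)) with hπdef
  obtain ⟨G', hG', rfl⟩ : ∃ G' : Submodule R M, G'.FG ∧ G'.map π = G := by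
    obtain ⟨S, rfl⟩ := hG
    choose z hz using Submodule.mkQ_surjective (LinearMap.range (LinearMap.lsmul R M t))
    refine ⟨Submodule.span R (S.image z), ⟨_, rfl⟩, ?_⟩
    rw [Submodule.map_span, Finset.coe_image, Set.image_image]
    simp [hπdef, hz]
  let M₀ := G' ⊔ LinearMap.range f
  have hM₀ : M₀.FG := hG'.sup (by rw [LinearMap.range_eq_map]; exact Module.Finite.fg_top.map f)
  haveI : Module.Finite R M₀ := Module.Finite.iff_fg.2 hM₀
  let f₀ : (Fin N → R) →ₗ[R] M₀ := f.codRestrict M₀ fun y => le_sup_right (a := G') ⟨y, rfl⟩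
  have h1 := ka_fg (R := R) (M := M₀) (fun r m h => by
    rcases htf r m (by simpa using congrArg Subtype.val h) with h | h
    · exact Or.inl h
    · exact Or.inr (Subtype.ext h)) N f₀ (fun a b h => hf (congrArg Subtype.val h)) (fun m => by
      obtain ⟨u, hu0, y, hy⟩ := hu m
      exact ⟨u, hu0, y, Subtype.ext hy⟩) t ht
  refine le_trans ?_ h1
  let g : M₀ →ₗ[R] M₀.map π := π.submoduleMap M₀
  have hg : Function.Surjective g := π.submoduleMap_surjective M₀
  have hk : LinearMap.range (LinearMap.lsmul R M₀ t) ≤ LinearMap.ker g := by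
    rintro _ ⟨m, rfl⟩
    rw [LinearMap.mem_ker]
    apply Subtype.ext
    show Submodule.Quotient.mk (t • (m : M)) = _
    erw [Submodule.Quotient.mk_eq_zero]
    exact ⟨m, rfl⟩
  calc Module.length R (G'.map π) ≤ Module.length R (M₀.map π) :=
        Module.length_le_of_injective (Submodule.inclusion (Submodule.map_mono le_sup_left))
          (Submodule.inclusion_injective _)
    _ ≤ _ := Module.length_le_of_surjective ((LinearMap.range (LinearMap.lsmul R M₀ t)).liftQ g hk) (by
        rw [← LinearMap.range_eq_top, Submodule.range_liftQ, LinearMap.range_eq_top]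
        exact hg)

/-- Restriction of scalars multiplies the length by at least `r`. -/
lemma len_restrict {R D : Type*} [CommRing R] [CommRing D] [IsLocalRing D] [Algebra R D] (r : ℕ)
    (h : (r : ℕ∞) ≤ Module.length R (D ⧸ IsLocalRing.maximalIdeal D))
    {Q : Type*} [AddCommGroup Q] [Module D Q] (hQ : IsFiniteLength D Q) :
    ∀ [Module R Q] [IsScalarTower R D Q],
    r * Module.length D Q ≤ Module.length R Q := by
  induction hQ with
  | of_subsingleton => intros; simp
  | @of_simple_quotient M _ _ N hs hN ih =>
    intro _ _
    have e1 := Module.length_eq_add_of_exact (R := D) N.subtype N.mkQ N.injective_subtype N.mkQ_surjective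
      (LinearMap.exact_subtype_mkQ N)
    have e2 := Module.length_eq_add_of_exact (R := R) (N.subtype.restrictScalars R) (N.mkQ.restrictScalars R)
      N.injective_subtype N.mkQ_surjective
      (LinearMap.exact_subtype_mkQ N)
    rw [e1, e2, mul_add]
    refine add_le_add ih ?_
    rw [Module.length_eq_one, mul_one]
    obtain ⟨I, hI, ⟨e⟩⟩ := isSimpleModule_iff_quot_maximal.1 hs
    obtain rfl := IsLocalRing.eq_maximalIdeal hI
    rw [(e.restrictScalars R).length_eq]
    exact h

end Lower1

section Lower2
universe u₁

lemma FrobIndep.inj' {B : Type*} [CommRing B] {ι κ : Type*} [Fintype ι] [Fintype κ] (p : ℕ) (hp : p ≠ 0)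
    {c : ι → B} (h : FrobIndep p c) (e : κ → ι) (he : Function.Injective e) : FrobIndep p (c ∘ e) := by
  classical
  intro t ht i
  let t' : ι → B := Function.extend e t 0
  have h1 : ∑ i, c i * t' i ^ p = 0 := by
    rw [← ht]
    symm
    refine Finset.sum_of_injOn e he.injOn (by simp) ?_ ?_
    · intro i _ hi
      have : t' i = 0 := by
        simp only [t']
        rw [Function.extend_apply' _ _ _ (by simpa using hi)]; rfl
      rw [this, zero_pow hp, mul_zero]
    · intro i _
      simp [t', he.extend_apply]
  simpa [t', he.extend_apply] using h t' h1 (e i)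

lemma lower_alg {R D : Type*} [CommRing R] [CommRing D] [IsDomain R] [IsDomain D] [IsNoetherianRing R]
    [IsNoetherianRing D] [Ring.KrullDimLE 1 R] [Ring.KrullDimLE 1 D] [IsLocalRing R] [IsLocalRing D] [Algebra R D]
    (p : ℕ) [hp : Fact p.Prime] [CharP D p] (σ : R ≃+* D) (hσ : ∀ r, algebraMap R D r = σ r ^ p)
    (hord : ∀ r, Ring.ord R r = Ring.ord D (σ r))
    {ι : Type*} [Fintype ι] (a : ι → D)
    (ha : ∀ t : ι → D, ∑ i, a i * t i ^ p ∈ IsLocalRing.maximalIdeal D → ∀ i, t i ∈ IsLocalRing.maximalIdeal D)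
    (π : D) (hπ0 : π ≠ 0) (hπ : π ∈ IsLocalRing.maximalIdeal D) :
    ∃ b : Fin (p * Fintype.card ι) → D, FrobIndep p b := by
  classical
  by_contra hno
  let P : ℕ → Prop := fun n => ∃ b : Fin n → D, FrobIndep p b
  have hP0 : P 0 := ⟨fun i => i.elim0, fun t _ i => i.elim0⟩
  let N := Nat.findGreatest P (p * Fintype.card ι)
  have hN : P N := Nat.findGreatest_spec (Nat.zero_le _) hP0
  have hNlt : N < p * Fintype.card ι := by
    refine lt_of_le_of_ne (Nat.findGreatest_le _) fun h => hno ?_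
    rw [← h]; exact hN
  have hN1 : ¬ P (N + 1) := Nat.findGreatest_is_greatest (Nat.lt_succ_self _) hNlt
  obtain ⟨y, hy⟩ := hN
  let f : (Fin N → R) →ₗ[R] D := Fintype.linearCombination R y
  have hf_apply : ∀ t, f t = ∑ i, y i * (σ (t i)) ^ p := fun t => by
    simp only [f, Fintype.linearCombination_apply, Algebra.smul_def, hσ, mul_comm]
  have hf : Function.Injective f := by
    rw [← LinearMap.ker_eq_bot, LinearMap.ker_eq_bot']
    intro t ht
    rw [hf_apply] at ht
    funext i
    have := hy _ ht i
    simpa using this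
  have hu : ∀ m : D, ∃ u : R, u ≠ 0 ∧ u • m ∈ LinearMap.range f := by
    intro m
    by_contra! hm
    refine hN1 ⟨Fin.cons m y, ?_⟩
    intro t ht
    rw [Fin.sum_univ_succ] at ht
    simp only [Fin.cons_zero, Fin.cons_succ] at ht
    have h0 : t 0 = 0 := by
      by_contra h0
      refine hm (σ.symm (t 0)) (by simpa using h0) ?_
      refine ⟨fun i => σ.symm (- t i.succ), ?_⟩
      rw [hf_apply, Algebra.smul_def, hσ, σ.apply_symm_apply]
      have h2 : ∑ i : Fin N, y i * (σ (σ.symm (- t i.succ))) ^ p = - ∑ i : Fin N, y i * t i.succ ^ p := by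
        rw [← Finset.sum_neg_distrib]
        refine Finset.sum_congr rfl fun i _ => ?_
        rw [σ.apply_symm_apply, ← mul_neg]
        congr 1
        have := add_pow_char (t i.succ) (- t i.succ) p
        rw [add_neg_cancel, zero_pow hp.out.ne_zero] at this
        linear_combination -this
      rw [h2]
      linear_combination -ht
    rw [h0, zero_pow hp.out.ne_zero, mul_zero, zero_add] at ht
    have := hy _ ht
    intro i
    refine Fin.cases h0 this i
  set ϖ := σ.symm π with hϖ
  have hϖ0 : ϖ ≠ 0 := by simpa [hϖ] using hπ0
  have k1 := ka_gen (R := R) (M := D) (fun r m h => by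
    rw [Algebra.smul_def, hσ] at h
    rcases mul_eq_zero.1 h with h | h
    · left; simpa using pow_eq_zero_iff hp.out.ne_zero |>.1 h
    · right; exact h) N f hf hu ϖ hϖ0
  -- lower bound
  have k2 : (Fintype.card ι : ℕ∞) ≤ Module.length R (D ⧸ IsLocalRing.maximalIdeal D) := by
    have hchar : ∀ t s : ι → D, ∑ i, a i * (t i + s i) ^ p = ∑ i, a i * t i ^ p + ∑ i, a i * s i ^ p := by
      intro t s
      rw [← Finset.sum_add_distrib]
      exact Finset.sum_congr rfl fun i _ => by rw [add_pow_char, mul_add]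
    let g : (ι → R) →ₗ[R] (D ⧸ IsLocalRing.maximalIdeal D) :=
      { toFun := fun t => Ideal.Quotient.mk _ (∑ i, a i * (σ (t i)) ^ p)
        map_add' := fun t s => by
          rw [← map_add, ← hchar]
          simp
        map_smul' := fun r t => by
          rw [Algebra.smul_def (A := D ⧸ IsLocalRing.maximalIdeal D), RingHom.id_apply]
          show _ = (Ideal.Quotient.mk _ (algebraMap R D r)) * _
          rw [← map_mul, hσ, Finset.mul_sum]
          congr 1
          refine Finset.sum_congr rfl fun i _ => ?_
          simp only [Pi.smul_apply, smul_eq_mul, map_mul, mul_pow]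
          ring }
    let q : (ι → R) →ₗ[R] (ι → R ⧸ IsLocalRing.maximalIdeal R) :=
      LinearMap.pi fun i => (Submodule.mkQ (IsLocalRing.maximalIdeal R)).comp (LinearMap.proj i)
    have hq : Function.Surjective q := fun y => by
      choose z hz using fun i => Submodule.mkQ_surjective (IsLocalRing.maximalIdeal R) (y i)
      exact ⟨z, funext hz⟩
    have hker : LinearMap.ker g ≤ LinearMap.ker q := by
      intro t ht
      have h1 := ha _ (Ideal.Quotient.eq_zero_iff_mem.1 ht)
      rw [LinearMap.mem_ker]
      funext i
      refine (Submodule.Quotient.mk_eq_zero _).2 ?_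
      have := h1 i
      rw [IsLocalRing.mem_maximalIdeal] at this ⊢
      intro hh
      exact this (hh.map σ)
    have l1 : Module.length R ((ι → R) ⧸ LinearMap.ker g) ≤ Module.length R (D ⧸ IsLocalRing.maximalIdeal D) := by
      rw [g.quotKerEquivRange.length_eq]
      exact Module.length_le_of_injective (Submodule.subtype _) (Submodule.subtype_injective _)
    have l2 : Module.length R (ι → R ⧸ IsLocalRing.maximalIdeal R) ≤ Module.length R ((ι → R) ⧸ LinearMap.ker g) := by
      refine Module.length_le_of_surjective ((LinearMap.ker g).liftQ q hker) ?_
      rw [← LinearMap.range_eq_top, Submodule.range_liftQ, LinearMap.range_eq_top]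
      exact hq
    refine le_trans ?_ (l2.trans l1)
    rw [Module.length_pi, ENat.card_eq_coe_fintype_card]
    haveI : IsSimpleModule R (R ⧸ IsLocalRing.maximalIdeal R) :=
      isSimpleModule_iff_quot_maximal.2 ⟨_, inferInstance, ⟨LinearEquiv.refl _ _⟩⟩
    rw [Module.length_eq_one, mul_one]
  have hπp : π ^ p ≠ 0 := pow_ne_zero _ hπ0
  have k3 := len_restrict (R := R) (D := D) (Fintype.card ι) k2 (Q := D ⧸ Ideal.span {π ^ p})
    (isFiniteLength_quotient_span_singleton D (mem_nonZeroDivisors_of_ne_zero hπp))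
  have k4 : Module.length R (D ⧸ Ideal.span {π ^ p}) =
      Module.length R (D ⧸ LinearMap.range (LinearMap.lsmul R D ϖ)) := by
    have : (Ideal.span {π ^ p}).restrictScalars R = LinearMap.range (LinearMap.lsmul R D ϖ) := by
      ext d
      rw [Submodule.restrictScalars_mem, Ideal.mem_span_singleton']
      constructor
      · rintro ⟨c, rfl⟩
        refine ⟨c, ?_⟩
        rw [LinearMap.lsmul_apply, Algebra.smul_def, hσ, hϖ, σ.apply_symm_apply, mul_comm]
      · rintro ⟨c, rfl⟩
        refine ⟨c, ?_⟩
        rw [LinearMap.lsmul_apply, Algebra.smul_def, hσ, hϖ, σ.apply_symm_apply, mul_comm]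
    rw [← this]
    exact (Submodule.Quotient.restrictScalarsEquiv R (Ideal.span {π ^ p})).symm.length_eq
  have k5 : Ring.ord R ϖ = Ring.ord D π := by
    rw [hord, hϖ, σ.apply_symm_apply]
  have k6 : Module.length D (D ⧸ Ideal.span {π ^ p}) = p * Ring.ord D π := by
    have := Ring.ord_pow (R := D) (mem_nonZeroDivisors_of_ne_zero hπ0) p
    simpa [Ring.ord] using this
  rw [k6, k4] at k3
  have k7 := k3.trans k1
  rw [k5] at k7
  obtain ⟨l, hl⟩ := ENat.ne_top_iff_exists.1 (Ring.ord_ne_top (R := D) (mem_nonZeroDivisors_of_ne_zero hπ0))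
  have hl0 : l ≠ 0 := by
    rintro rfl
    have h0 : Module.length D (D ⧸ Ideal.span {π}) = 0 := hl.symm
    rw [Module.length_eq_zero_iff, Submodule.Quotient.subsingleton_iff] at h0
    exact (IsLocalRing.mem_maximalIdeal _).1 hπ (Ideal.span_singleton_eq_top.1 h0)
  rw [← hl] at k7
  norm_cast at k7
  have : Fintype.card ι * p ≤ N := by
    by_contra! hlt
    have := Nat.mul_lt_mul_of_pos_right hlt (Nat.pos_of_ne_zero hl0)
    rw [mul_assoc] at this
    lia
  rw [mul_comm] at this
  lia

lemma lower_local {D : Type*} [CommRing D] [IsDomain D] 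
    [IsNoetherianRing D] [Ring.KrullDimLE 1 D] [IsLocalRing D] 
    (p : ℕ) [hp : Fact p.Prime] [CharP D p]
    {ι : Type*} [Fintype ι] (a : ι → D)
    (ha : ∀ t : ι → D, ∑ i, a i * t i ^ p ∈ IsLocalRing.maximalIdeal D → ∀ i, t i ∈ IsLocalRing.maximalIdeal D)
    (π : D) (hπ0 : π ≠ 0) (hπ : π ∈ IsLocalRing.maximalIdeal D) :
    ∃ b : Fin (p * Fintype.card ι) → D, FrobIndep p b := by
  let alg : Algebra D D := (frobenius D p).toAlgebra
  exact @lower_alg D D _ _ _ _ _ _ _ _ _ _ alg p _ _ (RingEquiv.refl D) (fun r => rfl) (fun r => rfl) ι _ a ha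
    π hπ0 hπ

/-- Frobenius independence modulo a prime. -/
def FI {A ι : Type*} [CommRing A] [Fintype ι] (p : ℕ) (q : Ideal A) (a : ι → A) : Prop :=
  ∀ t : ι → A, ∑ i, a i * t i ^ p ∈ q → ∀ i, t i ∈ q

lemma FI_localization {A B : Type*} [CommRing A] [CommRing B] [Algebra A B] {ι : Type*} [Fintype ι]
    (P : Ideal A) [P.IsPrime] [IsLocalization.AtPrime B P] (p : ℕ) (hp : p ≠ 0) (q : Ideal A) (Q : Ideal B)
    [Q.IsPrime] (hQ : Q.comap (algebraMap A B) = q) :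
    (∀ a : ι → A, FI p q a → FI p Q (fun i => algebraMap A B (a i))) ∧
    (∀ b : ι → B, FI p Q b → ∃ a : ι → A, FI p q a) := by
  classical
  have hu : ∀ s : P.primeCompl, algebraMap A B s ∉ Q := fun s hs =>
    Ideal.IsPrime.ne_top ‹_› (Ideal.eq_top_of_isUnit_mem _ hs (IsLocalization.map_units B s))
  constructor
  · intro a ha t ht
    obtain ⟨s, hs⟩ := IsLocalization.exist_integer_multiples_of_finite P.primeCompl t
    choose w hw using hs
    have h1 : ∑ i, a i * w i ^ p ∈ q := by
      rw [← hQ, Ideal.mem_comap, map_sum]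
      have : ∑ i, algebraMap A B (a i * w i ^ p) = algebraMap A B s ^ p * ∑ i, algebraMap A B (a i) * t i ^ p := by
        rw [Finset.mul_sum]
        refine Finset.sum_congr rfl fun i _ => ?_
        rw [map_mul, map_pow, hw, Algebra.smul_def, mul_pow]
        ring
      rw [this]
      exact Ideal.mul_mem_left _ _ ht
    intro i
    have h2 := ha w h1 i
    rw [← hQ, Ideal.mem_comap, hw, Algebra.smul_def] at h2
    exact (Ideal.IsPrime.mem_or_mem ‹_› h2).resolve_left (hu s)
  · intro b hb
    obtain ⟨s, hs⟩ := IsLocalization.exist_integer_multiples_of_finite P.primeCompl b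
    choose w hw using hs
    refine ⟨w, fun t ht i => ?_⟩
    rw [← hQ, Ideal.mem_comap, map_sum] at ht
    have : ∑ i, algebraMap A B (w i * t i ^ p) = algebraMap A B s * ∑ i, b i * (algebraMap A B (t i)) ^ p := by
      rw [Finset.mul_sum]
      refine Finset.sum_congr rfl fun i _ => ?_
      rw [map_mul, map_pow, hw, Algebra.smul_def]
      ring
    rw [this] at ht
    rw [← hQ]
    exact hb _ ((Ideal.IsPrime.mem_or_mem ‹_› ht).resolve_left (hu s)) i

lemma FI_quot {A D : Type*} [CommRing A] [CommRing D] {ι : Type*} [Fintype ι] (p : ℕ) (f : A →+* D)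
    (hf : Function.Surjective f) (Q : Ideal D) :
    (∀ a : ι → A, FI p (Q.comap f) a ↔ FI p Q (fun i => f (a i))) := by
  intro a
  constructor
  · intro h t ht i
    choose s hs using fun i => hf (t i)
    rw [← hs]
    refine h s ?_ i
    rw [Ideal.mem_comap, map_sum]
    simpa [hs] using ht
  · intro h t ht i
    refine h (fun i => f (t i)) ?_ i
    rw [Ideal.mem_comap, map_sum] at ht
    simpa using ht

lemma lower_adj {A : Type*} [CommRing A] [IsNoetherianRing A] {ι : Type*} [Fintype ι] (p : ℕ) [hp : Fact p.Prime]
    (hpA : (p : A) = 0) (q P : Ideal A) [hq : q.IsPrime] [P.IsPrime] (hqP : q < P)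
    (hadj : ∀ q' : Ideal A, q'.IsPrime → q < q' → q' < P → False) (a : ι → A) (ha : FI p P a) :
    ∃ b : Fin (p * Fintype.card ι) → A, FI p q b := by
  classical
  let B := Localization.AtPrime P
  have hdisj : Disjoint (P.primeCompl : Set A) q := by
    rw [Set.disjoint_left]; intro x hx hx'; exact hx (hqP.le hx')
  let Q := q.map (algebraMap A B)
  haveI hQ : Q.IsPrime := IsLocalization.isPrime_of_isPrime_disjoint P.primeCompl B q hq hdisj
  have hQq : Q.comap (algebraMap A B) = q := IsLocalization.under_map_of_isPrime_disjoint P.primeCompl B hq hdisj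
  let D := B ⧸ Q
  haveI : IsLocalRing D := IsLocalRing.of_surjective' _ (Ideal.Quotient.mk_surjective (I := Q))
  haveI : CharP D p := by
    have : (p : D) = 0 := by
      have := congrArg (algebraMap B D) (congrArg (algebraMap A B) hpA)
      simpa using this
    exact (CharP.charP_iff_prime_eq_zero hp.out).2 this
  let mk : B →+* D := Ideal.Quotient.mk Q
  have hmk : Function.Surjective mk := Ideal.Quotient.mk_surjective
  have hm : (IsLocalRing.maximalIdeal D).comap mk = IsLocalRing.maximalIdeal B :=
    IsLocalRing.eq_maximalIdeal (Ideal.comap_isMaximal_of_surjective _ hmk)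
  have hm2 : (IsLocalRing.maximalIdeal B).comap (algebraMap A B) = P :=
    IsLocalization.AtPrime.under_maximalIdeal B P
  haveI : Ring.KrullDimLE 1 D := by
    refine Ring.KrullDimLE.mk₁' fun I hI0 hI => ?_
    let J := (I.comap mk).comap (algebraMap A B)
    have hJ1 : q ≤ J := by
      rw [← hQq]
      refine Ideal.comap_mono fun x hx => ?_
      rw [Ideal.mem_comap, show mk x = 0 from Ideal.Quotient.eq_zero_iff_mem.2 hx]
      exact I.zero_mem
    have hIm : I.comap mk ≤ IsLocalRing.maximalIdeal B := IsLocalRing.le_maximalIdeal (Ideal.IsPrime.ne_top inferInstance)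
    have hJ2 : J ≤ P := by
      rw [← hm2]
      exact Ideal.comap_mono hIm
    have hmap : J.map (algebraMap A B) = I.comap mk := IsLocalization.map_under P.primeCompl B _
    by_cases h1 : J = P
    · have : I.comap mk = IsLocalRing.maximalIdeal B := by
        rw [← hmap, h1]
        exact Localization.AtPrime.map_eq_maximalIdeal
      rw [← hm] at this
      rw [Ideal.comap_injective_of_surjective mk hmk this]
      infer_instance
    by_cases h2 : q = J
    · exfalso
      apply hI0
      rw [← h2] at hmap
      rw [eq_bot_iff]
      intro y hy
      obtain ⟨b, rfl⟩ := hmk y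
      have : b ∈ Q := by
        show b ∈ q.map _
        rw [hmap]; exact hy
      exact Ideal.Quotient.eq_zero_iff_mem.2 this
    · exact (hadj J inferInstance (lt_of_le_of_ne hJ1 h2) (lt_of_le_of_ne hJ2 h1)).elim
  have h1 := (FI_localization (B := B) (ι := ι) P p hp.out.ne_zero P _ hm2).1 a ha
  rw [← hm, FI_quot p mk hmk] at h1
  obtain ⟨x, hxP, hxq⟩ := SetLike.exists_of_lt hqP
  obtain ⟨b, hb⟩ := lower_local p _ h1 (mk (algebraMap A B x)) (by
      intro h
      apply hxq
      rw [← hQq]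
      exact Ideal.mem_comap.2 (Ideal.Quotient.eq_zero_iff_mem.1 h)) (by
      rw [← Ideal.mem_comap, hm, ← Ideal.mem_comap, hm2]; exact hxP)
  choose c hc using fun i => hmk (b i)
  have h2 : FI p (⊥ : Ideal D) b := fun t ht i => hb t ht i
  have h3 : FI p Q c := by
    have := (FI_quot p mk hmk ⊥ c).2 (by simpa [hc] using h2)
    rwa [← RingHom.ker_eq_comap_bot, Ideal.mk_ker] at this
  exact (FI_localization (B := B) P p hp.out.ne_zero q Q hQq).2 c h3

lemma lower_bound {A : Type*} [CommRing A] [IsNoetherianRing A] (p : ℕ) [hp : Fact p.Prime]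
    (hpA : (p : A) = 0) (q : Ideal A) [hq : q.IsPrime] (h : ℕ∞) : ∀ (P : Ideal A) [P.IsPrime], q < P →
    P.height = h → ∀ (n : ℕ) (a : Fin n → A), FI p P a → ∃ b : Fin (p * n) → A, FI p q b := by
  induction h using WellFoundedLT.induction with
  | ind h IH =>
  intro P _ hqP hh n a ha
  obtain ⟨q', ⟨hq', hqq', hq'P⟩, hmax⟩ := set_has_maximal_iff_noetherian.2 (inferInstanceAs (IsNoetherian A A))
    {q' : Ideal A | q'.IsPrime ∧ q ≤ q' ∧ q' < P} ⟨q, hq, le_rfl, hqP⟩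
  have hx := lower_adj p hpA q' P hq'P (fun r hr h1 h2 => hmax r ⟨hr, hqq'.trans h1.le, h2⟩ h1) a ha
  rw [Fintype.card_fin] at hx
  obtain ⟨b, hb⟩ := hx
  by_cases hqe : q = q'
  · subst hqe
    exact ⟨b, hb⟩
  · have hlt : Ideal.height q' < h := by
      rw [← hh]
      exact Ideal.height_strict_mono_of_isPrime hq'P
    obtain ⟨c, hc⟩ := IH _ hlt q' (lt_of_le_of_ne hqq' hqe) rfl _ b hb
    have hle : p * n ≤ p * (p * n) := by
      have := Nat.mul_le_mul_right (p * n) hp.out.one_le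
      lia
    refine ⟨c ∘ Fin.castLE hle, ?_⟩
    · intro t ht i
      let mk := Ideal.Quotient.mk q
      have hker : (⊥ : Ideal (A ⧸ q)).comap mk = q := by rw [← RingHom.ker_eq_comap_bot, Ideal.mk_ker]
      have h1 := (FI_quot p mk Ideal.Quotient.mk_surjective ⊥ c).1 (by rwa [hker])
      have h2 := FrobIndep.inj' p hp.out.ne_zero h1 (Fin.castLE hle) (Fin.castLE_injective _)
      have h3 := (FI_quot p mk Ideal.Quotient.mk_surjective ⊥ (c ∘ Fin.castLE hle)).2 h2
      rw [hker] at h3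
      exact h3 t ht i

/-- A chain of length three below a prime forces a large Frobenius-independent family. -/
lemma lower_final {A : Type*} [CommRing A] [IsNoetherianRing A] (p : ℕ) [hp : Fact p.Prime]
    (hpA : (p : A) = 0) (q0 q1 q2 q3 : Ideal A) [hq : q0.IsPrime] [q1.IsPrime] [q2.IsPrime] [q3.IsPrime]
    (h1 : q0 < q1) (h2 : q1 < q2) (h3 : q2 < q3) : ∃ b : Fin (p * (p * p)) → A, FI p q0 b := by
  have H3 : FI p q3 (fun _ : Fin 1 => (1 : A)) := by
    intro t ht i
    simp only [one_mul, Finset.univ_unique, Finset.sum_singleton] at ht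
    have := Ideal.IsPrime.mem_of_pow_mem ‹_› _ ht
    rwa [Subsingleton.elim i default]
  obtain ⟨b2, H2⟩ := lower_bound p hpA q2 _ q3 h3 rfl _ _ H3
  obtain ⟨b1, H1⟩ := lower_bound p hpA q1 _ q2 h2 rfl _ _ H2
  have H0 := lower_bound p hpA q0 _ q1 h1 rfl _ _ H1
  rwa [mul_one] at H0

end Lower2

section DimApp

lemma prime_le_iff {X : Scheme.{u}} {U : X.Opens} (hU : IsAffineOpen U) (y z : U) :
    (hU.primeIdealOf y).asIdeal ≤ (hU.primeIdealOf z).asIdeal ↔ y.1 ⤳ z.1 := by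
  have h1 := hU.fromSpec.isOpenEmbedding.isInducing.specializes_iff (x := hU.primeIdealOf y) (y := hU.primeIdealOf z)
  rw [hU.fromSpec_primeIdealOf, hU.fromSpec_primeIdealOf] at h1
  rw [h1]
  exact PrimeSpectrum.le_iff_specializes (hU.primeIdealOf y) (hU.primeIdealOf z)

lemma prime_lt_of {X : Scheme.{u}} {U : X.Opens} (hU : IsAffineOpen U) (y z : U) (h : y.1 ⤳ z.1) (hne : y.1 ≠ z.1) :
    (hU.primeIdealOf y).asIdeal < (hU.primeIdealOf z).asIdeal := by
  refine lt_of_le_of_ne ((prime_le_iff hU y z).2 h) fun he => hne ?_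
  have := congrArg (fun w => hU.fromSpec w) (PrimeSpectrum.ext he)
  simpa only [hU.fromSpec_primeIdealOf] using this

/-- A maximal generic point is associated. -/
lemma assoc_of_generic {R : Type*} [CommRing R] [IsNoetherianRing R] [IsLocalRing R]
    (h : ∀ P : Ideal R, P.IsPrime → P = IsLocalRing.maximalIdeal R) :
    ∃ y : R, IsLocalRing.maximalIdeal R = (Submodule.span R {y}).annihilator := by
  obtain ⟨P, hP⟩ := associatedPrimes.nonempty R R
  obtain ⟨hP1, y, hy⟩ := isAssociatedPrime_iff.1 hP
  refine ⟨y, ?_⟩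
  rw [← h P hP1, hy]
  ext r
  rw [Submodule.mem_colon_singleton, Submodule.mem_annihilator_span_singleton, Submodule.mem_bot]

lemma chain_of_dim {X : Scheme.{u}} (y : X) (h : (3 : ℕ) ≤ topologicalKrullDim (closure {y} : Set X)) :
    ∃ z2 z1 z0 : X, y ⤳ z2 ∧ z2 ⤳ z1 ∧ z1 ⤳ z0 ∧ y ≠ z2 ∧ z2 ≠ z1 ∧ z1 ≠ z0 := by
  let S : Set X := closure {y}
  haveI : QuasiSober S := (isClosed_closure (s := ({y} : Set X))).isClosedEmbedding_subtypeVal.quasiSober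
  obtain ⟨l, hl⟩ := Order.le_krullDim_iff.1 h
  let Z : Fin 4 → IrreducibleCloseds S := fun i => l ⟨i.1, by lia⟩
  have hZ : ∀ i j : Fin 4, i < j → Z i < Z j := fun i j hij => l.strictMono (by
    rw [Fin.lt_def]; exact hij)
  have hg : ∀ i, ∃ z : S, closure {z} = (Z i : Set S) := fun i =>
    ⟨(Z i).isIrreducible.genericPoint, by
      rw [IsIrreducible.genericPoint_closure_eq]; exact (Z i).isClosed.closure_eq⟩
  choose z hz using hg
  have hspec : ∀ i j : Fin 4, i < j → (z j : X) ⤳ (z i : X) := by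
    intro i j hij
    have : z j ⤳ z i := by
      rw [specializes_iff_mem_closure, hz]
      refine (hZ i j hij).le ?_
      show z i ∈ (Z i : Set S)
      rw [← hz]
      exact subset_closure rfl
    exact this.map continuous_subtype_val
  have hne : ∀ i j : Fin 4, i < j → (z j : X) ≠ (z i : X) := by
    intro i j hij he
    have he' : z j = z i := Subtype.ext he
    refine (hZ i j hij).ne ?_
    apply IrreducibleCloseds.ext
    rw [← hz, ← hz, he']
  have hy3 : y ⤳ (z 3 : X) := specializes_iff_mem_closure.2 (z 3).2
  refine ⟨z 2, z 1, z 0, hy3.trans (hspec 2 3 (by decide)), hspec 1 2 (by decide), hspec 0 1 (by decide), ?_,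
    hne 1 2 (by decide), hne 0 1 (by decide)⟩
  intro he
  have h1 : (z 3 : X) ⤳ y := by rw [he]; exact hspec 2 3 (by decide)
  have h2 := h1.antisymm hy3
  exact hne 2 3 (by decide) (h2.eq.trans he)

lemma FI_transport {X : Scheme.{u}} {U W : X.Opens} (hU : IsAffineOpen U) (hW : IsAffineOpen W) (y : X)
    (hyU : y ∈ U) (hyW : y ∈ W) (p : ℕ) (hp : p ≠ 0) {ι : Type*} [Fintype ι] (b : ι → Γ(X, W))
    (hb : FI p (hW.primeIdealOf ⟨y, hyW⟩).asIdeal b) :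
    ∃ a : ι → Γ(X, U), FI p (hU.primeIdealOf ⟨y, hyU⟩).asIdeal a := by
  letI := X.presheaf.algebra_section_stalk (U := W) ⟨y, hyW⟩
  haveI : IsLocalization.AtPrime (X.presheaf.stalk y) (hW.primeIdealOf ⟨y, hyW⟩).asIdeal :=
    hW.isLocalization_stalk ⟨y, hyW⟩
  have h1 := (FI_localization (ι := ι) (B := X.presheaf.stalk y) (hW.primeIdealOf ⟨y, hyW⟩).asIdeal p hp _ 
    (IsLocalRing.maximalIdeal _) (IsLocalization.AtPrime.under_maximalIdeal _ _)).1 b hb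
  letI := X.presheaf.algebra_section_stalk (U := U) ⟨y, hyU⟩
  haveI : IsLocalization.AtPrime (X.presheaf.stalk y) (hU.primeIdealOf ⟨y, hyU⟩).asIdeal :=
    hU.isLocalization_stalk ⟨y, hyU⟩
  exact (FI_localization (ι := ι) (B := X.presheaf.stalk y) (hU.primeIdealOf ⟨y, hyU⟩).asIdeal p hp _ 
    (IsLocalRing.maximalIdeal _) (IsLocalization.AtPrime.under_maximalIdeal _ _)).2 _ h1

/-- The dimension of the local ring at a point with finite residue field is at least three along every component. -/
lemma dim_app {X : Scheme.{u}} (hexc : IsExcellentScheme X) (hdim : PureDimGE X 3) (p : ℕ) [hp : Fact p.Prime]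
    (hpX : ∀ U : X.Opens, (p : Γ(X, U)) = 0) (x : X) (hres : Finite (X.residueField x))
    {U : X.Opens} (hU : IsAffineOpen U) (hx : x ∈ U) (q : Ideal Γ(X, U)) [hq : q.IsPrime]
    (hqm : q ∈ minimalPrimes Γ(X, U))
    (hqx : q ≤ (hU.primeIdealOf ⟨x, hx⟩).asIdeal) :
    ∃ p₁ p₂ : Ideal Γ(X, U), p₁.IsPrime ∧ p₂.IsPrime ∧ q < p₁ ∧ p₁ < p₂ ∧ p₂ < (hU.primeIdealOf ⟨x, hx⟩).asIdeal := by
  haveI : IsNoetherianRing Γ(X, U) := (hexc U hU).1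
  let y : X := hU.fromSpec ⟨q, hq⟩
  have hyU : y ∈ U := (hU.range_fromSpec.le ⟨_, rfl⟩ : _)
  have hyq : hU.primeIdealOf ⟨y, hyU⟩ = ⟨q, hq⟩ := by
    apply hU.fromSpec.isOpenEmbedding.injective
    rw [hU.fromSpec_primeIdealOf]
  have hyq' : (hU.primeIdealOf ⟨y, hyU⟩).asIdeal = q := by rw [hyq]
  have hass : IsAssocPoint X y := by
    refine ⟨inferInstance, ?_⟩
    letI := X.presheaf.algebra_section_stalk (U := U) ⟨y, hyU⟩
    haveI hloc : IsLocalization.AtPrime (X.presheaf.stalk y) (hU.primeIdealOf ⟨y, hyU⟩).asIdeal :=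
      hU.isLocalization_stalk ⟨y, hyU⟩
    haveI : IsNoetherianRing (X.presheaf.stalk y) := IsLocalization.isNoetherianRing
      (hU.primeIdealOf ⟨y, hyU⟩).asIdeal.primeCompl _ inferInstance
    refine assoc_of_generic fun P hP => ?_
    have h1 : P.comap (algebraMap Γ(X, U) (X.presheaf.stalk y)) ≤ q := by
      rw [← hyq']
      refine (Ideal.comap_mono (IsLocalRing.le_maximalIdeal hP.ne_top)).trans ?_
      exact (IsLocalization.AtPrime.under_maximalIdeal (X.presheaf.stalk y) (hU.primeIdealOf ⟨y, hyU⟩).asIdeal).le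
    have h2 : P.comap (algebraMap Γ(X, U) (X.presheaf.stalk y)) = q :=
      le_antisymm h1 (hqm.2 ⟨inferInstance, bot_le⟩ h1)
    have h3 : (IsLocalRing.maximalIdeal (X.presheaf.stalk y)).comap (algebraMap Γ(X, U) (X.presheaf.stalk y)) = q := by
      rw [← hyq']
      exact (IsLocalization.AtPrime.under_maximalIdeal (X.presheaf.stalk y) (hU.primeIdealOf ⟨y, hyU⟩).asIdeal)
    rw [← IsLocalization.map_under (hU.primeIdealOf ⟨y, hyU⟩).asIdeal.primeCompl _ P,
      ← IsLocalization.map_under (hU.primeIdealOf ⟨y, hyU⟩).asIdeal.primeCompl _ (IsLocalRing.maximalIdeal (X.presheaf.stalk y))]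
    congr 1
    exact h2.trans h3.symm
  obtain ⟨d, hd, hd'⟩ := hdim
  obtain ⟨z2, z1, z0, s2, s1, s0, n2, n1, n0⟩ := chain_of_dim y (by rw [hd' y hass]; exact_mod_cast hd)
  obtain ⟨W, hW, hz0, -⟩ := exists_isAffineOpen_mem_and_subset (X := X) (U := ⊤) (x := z0) trivial
  have hz1 : z1 ∈ W := s0.mem_open W.isOpen hz0
  have hz2 : z2 ∈ W := s1.mem_open W.isOpen hz1
  have hyW : y ∈ W := s2.mem_open W.isOpen hz2
  haveI : IsNoetherianRing Γ(X, W) := (hexc W hW).1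
  obtain ⟨b, hb⟩ := lower_final p (hpX W) (hW.primeIdealOf ⟨y, hyW⟩).asIdeal (hW.primeIdealOf ⟨z2, hz2⟩).asIdeal 
    (hW.primeIdealOf ⟨z1, hz1⟩).asIdeal (hW.primeIdealOf ⟨z0, hz0⟩).asIdeal 
    (prime_lt_of hW _ _ s2 n2) (prime_lt_of hW _ _ s1 n1) (prime_lt_of hW _ _ s0 n0)
  obtain ⟨a, ha⟩ := FI_transport hU hW y hyU hyW p hp.out.ne_zero b hb
  rw [hyq'] at ha
  haveI : Finite (hU.primeIdealOf ⟨x, hx⟩).asIdeal.ResidueField := by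
    letI := X.presheaf.algebra_section_stalk (U := U) ⟨x, hx⟩
    haveI hloc : IsLocalization.AtPrime (X.presheaf.stalk x) (hU.primeIdealOf ⟨x, hx⟩).asIdeal :=
      hU.isLocalization_stalk ⟨x, hx⟩
    let e := IsLocalization.algEquiv (hU.primeIdealOf ⟨x, hx⟩).asIdeal.primeCompl (X.presheaf.stalk x)
      (Localization.AtPrime (hU.primeIdealOf ⟨x, hx⟩).asIdeal)
    let e2 := IsLocalRing.ResidueField.mapEquiv e.toRingEquiv
    haveI : Finite (IsLocalRing.ResidueField (X.presheaf.stalk x)) := hres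
    exact Finite.of_equiv _ e2.toEquiv
  refine upper_final (hexc U hU).2.2.1 p (hpX U) q _ hqx a ha ?_
  rw [Fintype.card_fin, pow_two]
  have := Nat.mul_lt_mul_of_pos_right hp.out.one_lt (Nat.mul_pos hp.out.pos hp.out.pos)
  lia

end DimApp

section RelSpec
open Scheme.AffineZariskiSite

/-- Relative spectrum of a quasi-coherent algebra. -/
lemma relSpec {X : Scheme.{u}} {F : X.AffineZariskiSiteᵒᵖ ⥤ CommRingCat.{u}}
    {α : (toOpensFunctor X).op ⋙ X.presheaf ⟶ F} (H : α.Coequifibered) :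
    ∃ (Y : Scheme.{u}) (g : Y ⟶ X) (j : ∀ U : X.AffineZariskiSite, Spec (F.obj (op U)) ⟶ Y),
      ∀ U : X.AffineZariskiSite, IsPullback (j U) (Spec.map (α.app (op U))) g U.2.fromSpec := by
  let d := relativeGluingData H
  refine ⟨d.glued, d.toBase, fun U => d.cover.f U, fun U => ?_⟩
  have h1 := (d.isPullback_natTrans_ι_toBase U).flip
  refine IsPullback.of_iso h1 (Iso.refl _) (Iso.refl _) U.2.isoSpec (Iso.refl _) ?_ ?_ ?_ ?_
  · exact (Category.comp_id _).trans (Category.id_comp _).symm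
  · refine (Category.assoc (Spec.map (α.app (op U))) U.2.isoSpec.inv U.2.isoSpec.hom).trans ?_
    refine (congrArg (fun t => Spec.map (α.app (op U)) ≫ t) U.2.isoSpec.inv_hom_id).trans ?_
    exact (Category.comp_id _).trans (Category.id_comp _).symm
  · exact (Category.comp_id _).trans (Category.id_comp _).symm
  · exact (Category.comp_id _).trans U.2.toSpecΓ_fromSpec.symm

lemma local_prop0 (P : MorphismProperty Scheme.{u}) [IsZariskiLocalAtTarget P] {X Y : Scheme.{u}}
    (g : Y ⟶ X)
    (h : ∀ z : X, ∃ (A B : Scheme.{u}) (i : A ⟶ X) (j : B ⟶ Y) (f : B ⟶ A), IsOpenImmersion i ∧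
      z ∈ Set.range i ∧ IsPullback j f g i ∧ P f) : P g := by
  apply IsZariskiLocalAtTarget.of_forall_exists_morphismRestrict
  intro z
  obtain ⟨A, B, i, j, f, hi, hz, hp, hf⟩ := h z
  refine ⟨i.opensRange, hz, ?_⟩
  rw [P.arrow_mk_iso_iff (morphismRestrictOpensRange _ _)]
  have e : Arrow.mk f ≅ Arrow.mk (Limits.pullback.snd g i) :=
    Arrow.isoMk hp.isoPullback (Iso.refl _) (by simp)
  exact (P.arrow_mk_iso_iff e).1 hf

lemma local_prop (P : MorphismProperty Scheme.{u}) [IsZariskiLocalAtTarget P] {X Y : Scheme.{u}}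
    (g : Y ⟶ X) (W : X.Opens)
    (h : ∀ z ∈ W, ∃ (A B : Scheme.{u}) (i : A ⟶ X) (j : B ⟶ Y) (f : B ⟶ A), IsOpenImmersion i ∧
      Set.range i ⊆ W ∧ z ∈ Set.range i ∧ IsPullback j f g i ∧ P f) : P (g ∣_ W) := by
  apply local_prop0
  intro z
  obtain ⟨A, B, i, j, f, hi, hr, hz, hp, hP⟩ := h (W.ι z) z.2
  let k : A ⟶ (W : Scheme) := IsOpenImmersion.lift W.ι i (by simpa using hr)
  have hk : k ≫ W.ι = i := IsOpenImmersion.lift_fac _ _ _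
  have e2 := isPullback_morphismRestrict g W
  let l : B ⟶ (g ⁻¹ᵁ W : Y.Opens) := e2.flip.lift j (f ≫ k) (by rw [Category.assoc, hk, hp.w])
  have hl1 : l ≫ (g ⁻¹ᵁ W).ι = j := e2.flip.lift_fst _ _ _
  have hl2 : l ≫ g ∣_ W = f ≫ k := e2.flip.lift_snd _ _ _
  refine ⟨A, B, k, l, f, ?_, ?_, ?_, hP⟩
  · haveI : IsOpenImmersion (k ≫ W.ι) := by rw [hk]; infer_instance
    exact IsOpenImmersion.of_comp k W.ι
  · obtain ⟨a, ha⟩ := hz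
    refine ⟨a, ?_⟩
    apply W.ι.isOpenEmbedding.injective
    rw [← Scheme.Hom.comp_apply, hk]
    exact ha
  · refine IsPullback.of_right ?_ hl2 e2.flip
    rw [hk, hl1]
    exact hp
end RelSpec

section EndAlg
variable {A C : Type*} [CommRing A] [CommRing C]

/-- The subring of elements of `C` which multiply the ideal `J` of `A` into itself. -/
def EJ (φ : A →+* C) (J : Ideal A) : Subring C where
  carrier := {c | ∀ a ∈ J, ∃ a' ∈ J, c * φ a = φ a'}
  mul_mem' := by
    intro c d hc hd a ha
    obtain ⟨a', ha', h1⟩ := hd a ha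
    obtain ⟨a'', ha'', h2⟩ := hc a' ha'
    exact ⟨a'', ha'', by rw [mul_assoc, h1, h2]⟩
  one_mem' := fun a ha => ⟨a, ha, one_mul _⟩
  add_mem' := by
    intro c d hc hd a ha
    obtain ⟨a', ha', h1⟩ := hc a ha
    obtain ⟨a'', ha'', h2⟩ := hd a ha
    exact ⟨a' + a'', J.add_mem ha' ha'', by rw [add_mul, h1, h2, map_add]⟩
  zero_mem' := fun a ha => ⟨0, J.zero_mem, by simp⟩
  neg_mem' := by
    intro c hc a ha
    obtain ⟨a', ha', h1⟩ := hc a ha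
    exact ⟨-a', J.neg_mem ha', by rw [neg_mul, h1, map_neg]⟩

lemma EJ_base (φ : A →+* C) (J : Ideal A) (a : A) : φ a ∈ EJ φ J :=
  fun b hb => ⟨a * b, J.mul_mem_left _ hb, (map_mul _ _ _).symm⟩

lemma EJ_of_span (φ : A →+* C) (s : Set A) (c : C) (h : ∀ a ∈ s, ∃ a' ∈ Ideal.span s, c * φ a = φ a') :
    c ∈ EJ φ (Ideal.span s) := by
  intro a ha
  induction ha using Submodule.span_induction with
  | mem x hx => exact h x hx
  | zero => exact ⟨0, zero_mem _, by simp⟩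
  | add x y _ _ hx hy =>
    obtain ⟨a', ha', h1⟩ := hx
    obtain ⟨a'', ha'', h2⟩ := hy
    exact ⟨a' + a'', add_mem ha' ha'', by rw [map_add, mul_add, h1, h2, map_add]⟩
  | smul r x _ hx =>
    obtain ⟨a', ha', h1⟩ := hx
    exact ⟨r * a', Ideal.mul_mem_left _ _ ha', by
      rw [smul_eq_mul, map_mul, mul_left_comm, h1, map_mul]⟩

variable {A' C' : Type*} [CommRing A'] [CommRing C']

lemma EJ_map (φ : A →+* C) (J : Ideal A) (φ' : A' →+* C') (α : A →+* A') (γ : C →+* C')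
    (hc : ∀ a, γ (φ a) = φ' (α a)) (c : C) (h : c ∈ EJ φ J) : γ c ∈ EJ φ' (J.map α) := by
  apply EJ_of_span
  rintro _ ⟨a, ha, rfl⟩
  obtain ⟨a', ha', h1⟩ := h a ha
  exact ⟨α a', Ideal.subset_span ⟨a', ha', rfl⟩, by rw [← hc, ← hc, ← map_mul, h1]⟩

lemma EJ_loc (φ : A →+* C) (J : Ideal A) (hJ : J.FG) (φ' : A' →+* C') [Algebra A A'] [Algebra C C']
    (hc : ∀ a, algebraMap C C' (φ a) = φ' (algebraMap A A' a)) (f : A) [IsLocalization.Away f A']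
    [IsLocalization.Away (φ f) C'] (c' : C') (h : c' ∈ EJ φ' (J.map (algebraMap A A'))) :
    ∃ n, ∃ c ∈ EJ φ J, c' * algebraMap C C' (φ f) ^ n = algebraMap C C' c := by
  obtain ⟨n, c, hc'⟩ := IsLocalization.Away.surj (φ f) c'
  obtain ⟨s, rfl⟩ := hJ
  have key : ∀ a ∈ (s : Set A), ∃ k, ∀ m, k ≤ m → ∃ a' ∈ Ideal.span (s : Set A), (φ f ^ m * c) * φ a = φ a' := by
    intro a ha
    obtain ⟨a', ha', h1⟩ := h (algebraMap A A' a) (Ideal.mem_map_of_mem _ (Ideal.subset_span ha))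
    obtain ⟨⟨b, t⟩, hb⟩ := (IsLocalization.mem_map_algebraMap_iff (Submonoid.powers f) A').1 ha'
    obtain ⟨t, ⟨l, rfl⟩⟩ := t
    dsimp only at hb
    have h2 : algebraMap C C' (φ f ^ l * c * φ a) = algebraMap C C' (φ f ^ n * φ b) := by
      have h3 : algebraMap C C' (φ b) = c' * φ' (algebraMap A A' a) * φ' (algebraMap A A' f) ^ l := by
        rw [hc, ← hb, map_mul, ← h1, map_pow, map_pow]
      rw [map_mul, map_mul, ← hc', map_mul, h3, map_pow, map_pow, hc, hc]
      ring
    obtain ⟨⟨_, k, rfl⟩, hk⟩ := (IsLocalization.eq_iff_exists (Submonoid.powers (φ f)) C').1 h2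
    dsimp only at hk
    refine ⟨l + k, fun m hm => ⟨f ^ (m - (l + k)) * (f ^ k * (f ^ n * b)), 
      Ideal.mul_mem_left _ _ (Ideal.mul_mem_left _ _ (Ideal.mul_mem_left _ _ b.2)), ?_⟩⟩
    obtain ⟨d, rfl⟩ := Nat.exists_eq_add_of_le hm
    rw [Nat.add_sub_cancel_left, map_mul, map_mul, map_mul, map_pow, map_pow, map_pow, ← hk]
    ring
  choose! k hk using key
  refine ⟨n + s.sup k, φ f ^ (s.sup k) * c, ?_, ?_⟩
  · apply EJ_of_span
    intro a ha
    exact hk a ha _ (Finset.le_sup ha)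
  · rw [pow_add, ← mul_assoc, hc', map_mul, map_pow, mul_comm]

lemma EJ_isLoc (φ : A →+* C) (J : Ideal A) (hJ : J.FG) (φ' : A' →+* C') [Algebra A A'] [Algebra C C']
    (hc : ∀ a, algebraMap C C' (φ a) = φ' (algebraMap A A' a)) (f : A) [IsLocalization.Away f A']
    [IsLocalization.Away (φ f) C'] (J' : Ideal A') (hJ' : J' = J.map (algebraMap A A'))
    [Algebra (EJ φ J) (EJ φ' J')] (halg : ∀ e : EJ φ J, (algebraMap (EJ φ J) (EJ φ' J') e : C') = algebraMap C C' e) :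
    IsLocalization.Away (⟨φ f, EJ_base φ J f⟩ : EJ φ J) (EJ φ' J') := by
  subst hJ'
  refine ⟨?_, ?_, ?_⟩
  · rintro ⟨_, n, rfl⟩
    rw [map_pow]
    apply IsUnit.pow
    obtain ⟨g, hg⟩ := (IsLocalization.Away.algebraMap_isUnit (S := A') f).exists_right_inv
    refine IsUnit.of_mul_eq_one ⟨φ' g, EJ_base _ _ _⟩ ?_
    apply Subtype.ext
    rw [Subring.coe_mul, halg, hc, ← map_mul, hg, map_one]
    rfl
  · rintro ⟨c', hc'⟩
    obtain ⟨n, c, hcE, h⟩ := EJ_loc φ J hJ φ' hc f c' hc'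
    refine ⟨(⟨c, hcE⟩, ⟨_, n, rfl⟩), ?_⟩
    apply Subtype.ext
    rw [Subring.coe_mul, halg, halg]
    simpa using h
  · intro x y hxy
    have h1 := congrArg Subtype.val hxy
    rw [halg, halg] at h1
    obtain ⟨⟨_, k, rfl⟩, hk⟩ := (IsLocalization.eq_iff_exists (Submonoid.powers (φ f)) C').1 h1
    refine ⟨⟨_, k, rfl⟩, Subtype.ext ?_⟩
    simpa using hk

/-- Finiteness of `EJ`. -/
lemma EJ_finite [IsNoetherianRing A] (φ : A →+* C) (J : Ideal A) (j : A) (hj : j ∈ J) (hreg : ∀ c, c * φ j = 0 → c = 0) :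
    (φ.codRestrict (EJ φ J) (EJ_base φ J)).Finite := by
  letI := (φ.codRestrict (EJ φ J) (EJ_base φ J)).toAlgebra
  change Module.Finite A (EJ φ J)
  letI := φ.toAlgebra
  let l : EJ φ J →ₗ[A] C :=
    { toFun := fun c => c.1 * φ j
      map_add' := fun a b => by simp [add_mul]
      map_smul' := fun a b => by
        simp [Algebra.smul_def, RingHom.algebraMap_toAlgebra, mul_assoc] }
  have hl : ∀ c, l c ∈ LinearMap.range (Algebra.linearMap A C) := fun c => by
    obtain ⟨a', _, h⟩ := c.2 j hj
    exact ⟨a', h.symm⟩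
  let l' := l.codRestrict _ hl
  refine Module.Finite.of_injective l' ?_
  rw [← LinearMap.ker_eq_bot, LinearMap.ker_codRestrict, LinearMap.ker_eq_bot']
  intro c hc
  exact Subtype.ext (hreg _ hc)
end EndAlg

section FJ
open Scheme.AffineZariskiSite

/-- The quasi-coherent algebra of endomorphisms of an ideal inside the normalization. -/
noncomputable def FJ {X Xb : Scheme.{u}} (ν : Xb ⟶ X) (J : X.IdealSheafData) :
    X.AffineZariskiSiteᵒᵖ ⥤ CommRingCat.{u} where
  obj U := .of (EJ (ν.app U.unop.1).hom (J.ideal ⟨U.unop.1, U.unop.2⟩))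
  map {V U} i := CommRingCat.ofHom
    ((Xb.presheaf.map (homOfLE (ν.preimage_mono (toOpens_mono i.unop.le))).op).hom.restrict _ _ fun c hc => by
      have h1 := EJ_map (ν.app V.unop.1).hom (J.ideal ⟨V.unop.1, V.unop.2⟩) (ν.app U.unop.1).hom
        (X.presheaf.map (homOfLE (toOpens_mono i.unop.le)).op).hom 
        (Xb.presheaf.map (homOfLE (ν.preimage_mono (toOpens_mono i.unop.le))).op).hom (fun a => by
          exact (congr($(ν.naturality (homOfLE (toOpens_mono i.unop.le)).op) a)).symm) c hc
      have h2 := J.map_ideal (U := ⟨U.unop.1, U.unop.2⟩) (V := ⟨V.unop.1, V.unop.2⟩) (toOpens_mono i.unop.le)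
      exact h2 ▸ h1)
  map_id U := by
    ext c
    exact congr($(Xb.presheaf.map_id _) c.1)
  map_comp i j := by
    ext c
    exact congr($(Xb.presheaf.map_comp (homOfLE (ν.preimage_mono (toOpens_mono i.unop.le))).op
      (homOfLE (ν.preimage_mono (toOpens_mono j.unop.le))).op) c.1)

noncomputable def αJ {X Xb : Scheme.{u}} (ν : Xb ⟶ X) (J : X.IdealSheafData) :
    (toOpensFunctor X).op ⋙ X.presheaf ⟶ FJ ν J where
  app U := CommRingCat.ofHom ((ν.app U.unop.1).hom.codRestrict _ (EJ_base _ _))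
  naturality {U V} i := by
    ext a
    exact Subtype.ext congr($(ν.naturality (homOfLE (toOpens_mono i.unop.le)).op) a)

lemma coeq_αJ {X Xb : Scheme.{u}} (ν : Xb ⟶ X) [IsAffineHom ν] [IsLocallyNoetherian X] (J : X.IdealSheafData) :
    (αJ ν J).Coequifibered := by
  refine coequifibered_iff_forall_isLocalizationAway.mpr fun U r ↦ ?_
  letI a1 : Algebra Γ(X, U.1) Γ(X, X.basicOpen r) :=
    (X.presheaf.map (homOfLE (X.basicOpen_le r)).op).hom.toAlgebra
  letI a2 : Algebra Γ(Xb, ν ⁻¹ᵁ U.1) Γ(Xb, ν ⁻¹ᵁ X.basicOpen r) :=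
    (Xb.presheaf.map (homOfLE (ν.preimage_mono (X.basicOpen_le r))).op).hom.toAlgebra
  haveI : IsLocalization.Away r Γ(X, X.basicOpen r) := U.2.isLocalization_basicOpen _
  haveI : IsLocalization.Away ((ν.app U.1).hom r) Γ(Xb, ν ⁻¹ᵁ X.basicOpen r) := by
    let : Algebra Γ(Xb, ν ⁻¹ᵁ U.1) Γ(Xb, Xb.basicOpen (ν.app _ r)) :=
      (Xb.presheaf.map (homOfLE (Xb.basicOpen_le _)).op).hom.toAlgebra
    dsimp +instances [a2]
    rw! (castMode := .all) [ν.preimage_basicOpen r]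
    exact (U.2.preimage ν).isLocalization_basicOpen _
  letI a3 := ((FJ ν J).map (homOfLE (U.basicOpen_le r)).op).hom.toAlgebra
  haveI : IsNoetherianRing Γ(X, U.1) := IsLocallyNoetherian.component_noetherian ⟨U.1, U.2⟩
  exact @EJ_isLoc _ _ _ _ _ _ _ _ (ν.app U.1).hom (J.ideal ⟨U.1, U.2⟩) (IsNoetherian.noetherian _)
    (ν.app (X.basicOpen r)).hom a1 a2 
    (fun a => by exact (congr($(ν.naturality (homOfLE (X.basicOpen_le r)).op) a)).symm) r _ _ (J.ideal ⟨X.basicOpen r, U.2.basicOpen r⟩)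
    (J.map_ideal (U := ⟨X.basicOpen r, U.2.basicOpen r⟩) (V := ⟨U.1, U.2⟩) (X.basicOpen_le r)).symm a3 (fun e => rfl)
end FJ

section TS2

lemma exists_specializes {T Y : Type*} [TopologicalSpace T] [TopologicalSpace Y] [NoetherianSpace T] [QuasiSober T]
    (f : T → Y) (hf : Continuous f) (z : Y) (hz : z ∈ closure (Set.range f)) : ∃ t, f t ⤳ z := by
  have h1 : Set.range f = ⋃ C ∈ irreducibleComponents T, f '' C := by
    rw [← Set.image_univ, ← Set.image_iUnion₂, ← Set.sUnion_eq_biUnion]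
    congr 1
    symm
    rw [Set.eq_univ_iff_forall]
    exact fun t => ⟨irreducibleComponent t, irreducibleComponent_mem_irreducibleComponents t, mem_irreducibleComponent⟩
  rw [h1, (NoetherianSpace.finite_irreducibleComponents (α := T)).closure_biUnion] at hz
  simp only [Set.mem_iUnion] at hz
  obtain ⟨C, hC, hz⟩ := hz
  obtain ⟨c, hc⟩ := QuasiSober.sober hC.1 (isClosed_of_mem_irreducibleComponents C hC)
  refine ⟨c, specializes_iff_mem_closure.2 ?_⟩
  have h2 : f '' C ⊆ closure {f c} := by
    rw [← hc.def]
    refine (image_closure_subset_closure_image hf).trans ?_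
    simp
  exact closure_minimal h2 isClosed_closure hz

lemma univHomeo_of_closed {X Y : Scheme.{u}} (f : X ⟶ Y) [IsClosedImmersion f] [Surjective f] : IsUnivHomeomorph f := by
  intro Z g
  have h1 := (Limits.pullback.snd f g).isClosedEmbedding
  have h2 := (Limits.pullback.snd f g).surjective
  exact (Homeomorph.isHomeomorph (h1.isEmbedding.toHomeomorphOfSurjective h2) : _)

lemma univInj_of_univHomeo {X Y : Scheme.{u}} (f : X ⟶ Y) (h : IsUnivHomeomorph f) : UniversallyInjective f := by
  constructor
  intro X' Y' i j f' hp
  have h1 := (h _ j).injective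
  have h2 : f' = hp.flip.isoPullback.hom ≫ Limits.pullback.snd f j := by simp
  change Function.Injective f'
  rw [h2]
  intro a b hab
  rw [Scheme.Hom.comp_apply, Scheme.Hom.comp_apply] at hab
  exact (Scheme.homeoOfIso hp.flip.isoPullback).injective (h1 hab)

/-- Basic facts on the normalization. -/
lemma norm_facts {Xb X : Scheme.{u}} {ν : Xb ⟶ X} (h : IsNormalization ν) [IsLocallyNoetherian X] (U : X.Opens) (hU : IsAffineOpen U) :
    (∀ a : Γ(X, U), (ν.app U).hom a = 0 ↔ IsNilpotent a) ∧
    (∀ j : Γ(X, U), (∀ q ∈ minimalPrimes Γ(X, U), j ∉ q) → ∀ c, c * (ν.app U).hom j = 0 → c = 0) ∧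
    (∀ c, ∃ j : Γ(X, U), (∀ q ∈ minimalPrimes Γ(X, U), j ∉ q) ∧ ∃ a, c * (ν.app U).hom j = (ν.app U).hom a) ∧
    (ν.app U).hom.IsIntegral := by
  obtain ⟨-, h⟩ := h
  obtain ⟨ψ, hinj, hcomp, hrange⟩ := h U hU
  have hc : ∀ a, ψ ((ν.app U).hom a) = algebraMap _ _ (Ideal.Quotient.mk (nilradical Γ(X, U)) a) := fun a =>
    congr($hcomp a)
  have hk : ∀ a : Γ(X, U), (ν.app U).hom a = 0 ↔ IsNilpotent a := by
    intro a
    rw [← map_eq_zero_iff ψ hinj, hc, map_eq_zero_iff _ (IsFractionRing.injective _ _), Ideal.Quotient.eq_zero_iff_mem,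
      mem_nilradical]
  haveI : IsNoetherianRing Γ(X, U) := IsLocallyNoetherian.component_noetherian ⟨U, hU⟩
  haveI : IsReduced (Γ(X, U) ⧸ nilradical Γ(X, U)) :=
    (Ideal.isRadical_iff_quotient_reduced _).1 (Ideal.radical_isRadical _)
  have hmin : ∀ j : Γ(X, U), (∀ q ∈ minimalPrimes Γ(X, U), j ∉ q) ↔
      Ideal.Quotient.mk (nilradical Γ(X, U)) j ∈ nonZeroDivisors _ := by
    intro j
    constructor
    · intro hj
      rw [mem_nonZeroDivisors_iff_right]
      intro y hy
      obtain ⟨y, rfl⟩ := Ideal.Quotient.mk_surjective y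
      rw [← map_mul, Ideal.Quotient.eq_zero_iff_mem] at hy
      rw [Ideal.Quotient.eq_zero_iff_mem]
      rw [nilradical, Ideal.zero_eq_bot, ← Ideal.sInf_minimalPrimes, Ideal.mem_sInf] at hy ⊢
      intro q hq
      haveI := hq.1.1
      exact (Ideal.IsPrime.mem_or_mem ‹_› (hy hq)).resolve_right (hj q hq)
    · intro hj q hq hjq
      haveI := hq.1.1
      have hle : nilradical Γ(X, U) ≤ q := nilradical_le_prime q
      have := Ideal.map_isPrime_of_surjective (f := Ideal.Quotient.mk (nilradical Γ(X, U))) Ideal.Quotient.mk_surjective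
        (I := q) (by rwa [Ideal.mk_ker])
      have hm : q.map (Ideal.Quotient.mk (nilradical Γ(X, U))) ∈ minimalPrimes _ := by
        refine ⟨⟨this, bot_le⟩, fun r hr hrq => ?_⟩
        haveI := hr.1
        have h1 : r.comap (Ideal.Quotient.mk (nilradical Γ(X, U))) ≤ q := by
          refine (Ideal.comap_mono hrq).trans ?_
          rw [Ideal.comap_map_of_surjective _ Ideal.Quotient.mk_surjective, ← RingHom.ker_eq_comap_bot, Ideal.mk_ker]
          exact sup_le le_rfl hle
        have h2 := hq.2 ⟨inferInstance, bot_le⟩ h1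
        exact Ideal.map_le_iff_le_comap.2 h2
      have h3 := Ideal.disjoint_nonZeroDivisors_of_mem_minimalPrimes hm
      exact Set.disjoint_left.1 h3 (Ideal.mem_map_of_mem _ hjq) hj
  refine ⟨hk, fun j hj c hcj => ?_, fun c => ?_, fun c => ?_⟩
  · apply hinj
    have := congrArg ψ hcj
    rw [map_mul, hc, map_zero] at this
    rw [map_zero]
    have hu := IsLocalization.map_units (FractionRing (Γ(X, U) ⧸ nilradical Γ(X, U))) (⟨_, (hmin j).1 hj⟩ : nonZeroDivisors _)
    exact hu.mul_left_eq_zero.1 this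
  · obtain ⟨⟨a, s⟩, has⟩ := IsLocalization.surj (nonZeroDivisors (Γ(X, U) ⧸ nilradical Γ(X, U))) (ψ c)
    obtain ⟨a, rfl⟩ := Ideal.Quotient.mk_surjective a
    obtain ⟨s, hs⟩ := s
    obtain ⟨s, rfl⟩ := Ideal.Quotient.mk_surjective s
    refine ⟨s, (hmin s).2 hs, a, hinj ?_⟩
    rw [map_mul, hc, hc]
    exact has
  · have h1 : ψ c ∈ integralClosure (Γ(X, U) ⧸ nilradical Γ(X, U)) (FractionRing (Γ(X, U) ⧸ nilradical Γ(X, U))) := by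
      have : ψ c ∈ ψ.range := ⟨c, rfl⟩
      rw [hrange] at this
      exact this
    have h2 : IsIntegral (Γ(X, U) ⧸ nilradical Γ(X, U)) (ψ c) := h1
    obtain ⟨P, hP, hP2⟩ := h2
    obtain ⟨Q, hQ, hQd, hQm⟩ := Polynomial.lifts_and_natDegree_eq_and_monic
      (f := Ideal.Quotient.mk (nilradical Γ(X, U))) (p := P) (by
        rw [Polynomial.lifts_iff_coeff_lifts]; intro n; exact Ideal.Quotient.mk_surjective _) hP
    refine ⟨Q, hQm, hinj ?_⟩
    rw [Polynomial.hom_eval₂, map_zero, hcomp, ← Polynomial.eval₂_map, hQ]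
    exact hP2
end TS2

section TS2a

lemma J_exists {X : Scheme.{u}} [IsLocallyNoetherian X] {U : X.Opens} (hU : IsAffineOpen U) (𝔞 : Ideal Γ(X, U)) :
    ∃ J : X.IdealSheafData, J.ideal ⟨U, hU⟩ = 𝔞 ∧ ∀ z ∈ J.support, ∃ P : PrimeSpectrum Γ(X, U), 𝔞 ≤ P.asIdeal ∧
      hU.fromSpec P ⤳ z := by
  haveI : IsNoetherianRing Γ(X, U) := IsLocallyNoetherian.component_noetherian ⟨U, hU⟩
  let f : Spec (.of (Γ(X, U) ⧸ 𝔞)) ⟶ X := Spec.map (CommRingCat.ofHom (Ideal.Quotient.mk 𝔞)) ≫ hU.fromSpec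
  haveI : IsNoetherianRing (CommRingCat.of (Γ(X, U) ⧸ 𝔞)) := inferInstanceAs (IsNoetherianRing (Γ(X, U) ⧸ 𝔞))
  haveI : QuasiCompact f := quasiCompact_of_noetherianSpace_source f
  refine ⟨f.ker, ?_, fun z hz => ?_⟩
  · rw [Scheme.Hom.ker_apply]
    ext a
    rw [RingHom.mem_ker]
    have e : f ⁻¹ᵁ U = ⊤ := by
      show Spec.map _ ⁻¹ᵁ (hU.fromSpec ⁻¹ᵁ U) = ⊤
      rw [hU.fromSpec_preimage_self]; rfl
    have h1 : f.app U = CommRingCat.ofHom (Ideal.Quotient.mk 𝔞) ≫ (Scheme.ΓSpecIso _).inv ≫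
        (Spec (.of (Γ(X, U) ⧸ 𝔞))).presheaf.map (eqToHom e).op := by
      rw [Scheme.ΓSpecIso_inv_naturality_assoc]
      simp only [f, Scheme.Hom.comp_app, hU.fromSpec_app_self, Category.assoc]
      congr 1
    have h2 : (f.app U).hom a = ((Scheme.ΓSpecIso (.of (Γ(X, U) ⧸ 𝔞))).inv ≫
        (Spec (.of (Γ(X, U) ⧸ 𝔞))).presheaf.map (eqToHom e).op).hom (Ideal.Quotient.mk 𝔞 a) := by
      rw [h1]; rfl
    rw [h2, map_eq_zero_iff _ (ConcreteCategory.bijective_of_isIso _).1, Ideal.Quotient.eq_zero_iff_mem]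
  · rw [← SetLike.mem_coe, Scheme.Hom.support_ker] at hz
    obtain ⟨t, ht⟩ := exists_specializes f f.continuous z hz
    refine ⟨Spec.map (CommRingCat.ofHom (Ideal.Quotient.mk 𝔞)) t, ?_, ht⟩
    change 𝔞 ≤ Ideal.comap (Ideal.Quotient.mk 𝔞) t.asIdeal
    rw [← Ideal.map_le_iff_le_comap, Ideal.map_quotient_self]
    exact bot_le

lemma J_codim {X : Scheme.{u}} {U : X.Opens} (hU : IsAffineOpen U) (𝔞 : Ideal Γ(X, U))
    (h2 : ∀ P : Ideal Γ(X, U), P.IsPrime → 𝔞 ≤ P → ∃ q0 q1 : Ideal Γ(X, U), q0.IsPrime ∧ q1.IsPrime ∧ q0 < q1 ∧ q1 < P)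
    (Z : Set X) (hZ : ∀ z ∈ Z, ∃ P : PrimeSpectrum Γ(X, U), 𝔞 ≤ P.asIdeal ∧ hU.fromSpec P ⤳ z) : CodimGE Z 2 := by
  have hs : ∀ P Q : PrimeSpectrum Γ(X, U), hU.fromSpec P ⤳ hU.fromSpec Q ↔ P.asIdeal ≤ Q.asIdeal := by
    intro P Q
    exact (hU.fromSpec.isOpenEmbedding.isInducing.specializes_iff).trans (PrimeSpectrum.le_iff_specializes P Q).symm
  intro z hz
  obtain ⟨P, haP, hP⟩ := hZ z hz
  obtain ⟨q0, q1, hq0, hq1, h01, h1P⟩ := h2 _ P.2 haP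
  refine ⟨![z, hU.fromSpec ⟨q1, hq1⟩, hU.fromSpec ⟨q0, hq0⟩], rfl, fun i => ?_⟩
  fin_cases i
  · refine ⟨((hs _ _).2 h1P.le).trans hP, fun h => ?_⟩
    change hU.fromSpec ⟨q1, hq1⟩ = z at h
    rw [← h] at hP
    exact h1P.not_ge ((hs _ _).1 hP)
  · refine ⟨(hs _ _).2 h01.le, fun h => ?_⟩
    exact h01.not_ge ((hs ⟨q1, hq1⟩ ⟨q0, hq0⟩).1 (specializes_of_eq h.symm))

lemma J_supp {X : Scheme.{u}} (J : X.IdealSheafData) (W : X.Opens)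
    (hW : IsAffineOpen W) (P : PrimeSpectrum Γ(X, W)) : hW.fromSpec P ∈ J.support ↔ J.ideal ⟨W, hW⟩ ≤ P.asIdeal := by
  have hyW : hW.fromSpec P ∈ W := hW.range_fromSpec.le ⟨_, rfl⟩
  rw [Scheme.IdealSheafData.mem_support_iff_of_mem (U := ⟨W, hW⟩) hyW]
  rw [Scheme.mem_zeroLocus_iff]
  have h1 : ∀ a, hW.fromSpec P ∈ X.basicOpen a ↔ a ∉ P.asIdeal := by
    intro a
    have : (P ∈ hW.fromSpec ⁻¹ᵁ X.basicOpen a) ↔ P ∈ PrimeSpectrum.basicOpen a := by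
      rw [hW.fromSpec_preimage_basicOpen]
      exact Iff.rfl
    exact this
  constructor
  · intro h a ha
    have := h a ha
    rw [h1] at this
    exact not_not.1 this
  · intro h a ha
    rw [h1]
    exact not_not.2 (h ha)

lemma J_notmin {X : Scheme.{u}} (J : X.IdealSheafData) (hc : CodimGE (J.support : Set X) 2) (W : X.Opens)
    (hW : IsAffineOpen W) (q : Ideal Γ(X, W)) (hq : q ∈ minimalPrimes Γ(X, W)) : ¬ J.ideal ⟨W, hW⟩ ≤ q := by
  intro hle
  haveI := hq.1.1
  set y := hW.fromSpec ⟨q, this⟩ with hy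
  have hyW : y ∈ W := hW.range_fromSpec.le ⟨_, rfl⟩
  have hyZ : y ∈ J.support := (J_supp J W hW ⟨q, this⟩).2 hle
  obtain ⟨c, hc0, hc⟩ := hc y hyZ
  obtain ⟨h1, h2⟩ := hc 0
  change c 1 ⤳ c 0 at h1
  change c 1 ≠ c 0 at h2
  rw [hc0] at h1 h2
  have hcW : c 1 ∈ W := h1.mem_open W.2 hyW
  obtain ⟨Q, hQ⟩ := hW.range_fromSpec.ge hcW
  rw [← hQ, hy] at h1
  rw [← hQ] at h2
  have h3 : Q.asIdeal ≤ q := (PrimeSpectrum.le_iff_specializes Q ⟨q, this⟩).2 ((hW.fromSpec.isOpenEmbedding.isInducing.specializes_iff).1 h1)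
  have h4 : q ≤ Q.asIdeal := hq.2 ⟨Q.2, bot_le⟩ h3
  exact h2 (congrArg hW.fromSpec (PrimeSpectrum.ext (le_antisymm h3 h4)))


lemma J_regular {X : Scheme.{u}} [IsLocallyNoetherian X] (J : X.IdealSheafData) (hc : CodimGE (J.support : Set X) 2)
    (W : X.Opens) (hW : IsAffineOpen W) : ∃ j ∈ J.ideal ⟨W, hW⟩, ∀ q ∈ minimalPrimes Γ(X, W), j ∉ q := by
  haveI : IsNoetherianRing Γ(X, W) := IsLocallyNoetherian.component_noetherian ⟨W, hW⟩
  by_contra hcon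
  push Not at hcon
  have hf := minimalPrimes.finite_of_isNoetherianRing Γ(X, W)
  have h1 : ((J.ideal ⟨W, hW⟩ : Ideal Γ(X, W)) : Set Γ(X, W)) ⊆ ⋃ i ∈ minimalPrimes Γ(X, W), ((id i : Ideal Γ(X, W)) : Set Γ(X, W)) := by
    intro a ha
    obtain ⟨q, hq, haq⟩ := hcon a ha
    exact Set.mem_biUnion hq haq
  replace h1 := (Ideal.subset_union_prime_finite hf (f := id) ⊤ ⊤ (fun i hi _ _ => hi.1.1)).1 h1
  obtain ⟨q, hq, hle⟩ := h1
  exact J_notmin J hc W hW q hq hle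

end TS2a

section TS2b

lemma pb_range {A B X Y : Scheme.{u}} {j : B ⟶ Y} {f : B ⟶ A} {g : Y ⟶ X} {i : A ⟶ X} (h : IsPullback j f g i)
    (η : Y) (hη : g η ∈ Set.range i) : η ∈ Set.range j := by
  rw [← h.isoPullback_hom_fst]
  have : η ∈ Set.range (Limits.pullback.fst g i) := by
    rw [Scheme.Pullback.range_fst]; exact hη
  obtain ⟨t, ht⟩ := this
  refine ⟨h.isoPullback.inv t, ?_⟩
  rw [← Scheme.Hom.comp_apply]
  simpa using ht

lemma pb_comm {A B X Y : Scheme.{u}} {j : B ⟶ Y} {f : B ⟶ A} {g : Y ⟶ X} {i : A ⟶ X} (h : IsPullback j f g i)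
    (t : B) : g (j t) = i (f t) := by
  rw [← Scheme.Hom.comp_apply, h.w, Scheme.Hom.comp_apply]

lemma pb_open {A B X Y : Scheme.{u}} {j : B ⟶ Y} {f : B ⟶ A} {g : Y ⟶ X} {i : A ⟶ X} (h : IsPullback j f g i)
    (hi : IsOpenImmersion i) : IsOpenImmersion j :=
  MorphismProperty.of_isPullback (P := @IsOpenImmersion) h.flip hi

lemma ts2_g {X Xb : Scheme.{u}} [IsLocallyNoetherian X] (hS2 : IsTopologicallyS2 X) {ν : Xb ⟶ X} (hnu : IsNormalization ν)
    (J : X.IdealSheafData) (hc : CodimGE (J.support : Set X) 2) (Y : Scheme.{u}) (g : Y ⟶ X)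
    (j : ∀ U : X.AffineZariskiSite, Spec ((FJ ν J).obj (op U)) ⟶ Y)
    (hj : ∀ U : X.AffineZariskiSite, IsPullback (j U) (Spec.map ((αJ ν J).app (op U))) g U.2.fromSpec) :
    IsUnivHomeomorph g := by
  have hex : ∀ (z : X) (O : X.Opens), z ∈ O → ∃ W : X.AffineZariskiSite, z ∈ W.1 ∧ W.1 ≤ O := by
    intro z O hz
    obtain ⟨W, hW, hzW, hWO⟩ := exists_isAffineOpen_mem_and_subset (x := z) (U := O) hz
    exact ⟨⟨W, hW⟩, hzW, hWO⟩
  apply hS2 Y g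
  · haveI : IsZariskiLocalAtTarget @IsFinite := (HasAffineProperty.iff.1 IsFinite.instHasAffinePropertyAndIsAffineFiniteCarrierObjOppositeOpensCarrierCarrierCommRingCatPresheafOpOpensTopHomAppTop).1
    apply local_prop0
    intro z
    obtain ⟨W, hzW, -⟩ := hex z ⊤ trivial
    refine ⟨_, _, W.2.fromSpec, j W, _, inferInstance, ?_, hj W, ?_⟩
    · rw [W.2.range_fromSpec]; exact hzW
    · refine (IsFinite.SpecMap_iff _).2 ?_
      obtain ⟨a, ha, ha2⟩ := J_regular J hc W.1 W.2
      haveI : IsNoetherianRing Γ(X, W.1) := IsLocallyNoetherian.component_noetherian ⟨W.1, W.2⟩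
      exact EJ_finite (ν.app W.1).hom (J.ideal ⟨W.1, W.2⟩) a ha ((norm_facts hnu W.1 W.2).2.1 a ha2)
  · refine ⟨J.support, J.support.isClosed, hc, ?_, ?_⟩
    · have key : ∀ z ∈ (⟨(J.support : Set X)ᶜ, J.support.isClosed.isOpen_compl⟩ : X.Opens), ∃ W : X.AffineZariskiSite,
          z ∈ W.1 ∧ W.1 ≤ (⟨(J.support : Set X)ᶜ, J.support.isClosed.isOpen_compl⟩ : X.Opens) ∧
          IsClosedImmersion (Spec.map ((αJ ν J).app (op W))) ∧ Surjective (Spec.map ((αJ ν J).app (op W))) := by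
        intro z hz
        obtain ⟨W, hzW, hW⟩ := hex z _ hz
        have htop : J.ideal ⟨W.1, W.2⟩ = ⊤ := by
          by_contra hne
          obtain ⟨M, hM, hle⟩ := Ideal.exists_le_maximal _ hne
          have h1 := (J_supp J W.1 W.2 ⟨M, hM.isPrime⟩).2 hle
          exact hW (W.2.range_fromSpec.le ⟨_, rfl⟩) h1
        have hsurj : Function.Surjective ((αJ ν J).app (op W)) := by
          rintro ⟨c, hc⟩
          obtain ⟨a', -, ha'⟩ := hc 1 (by change (1 : Γ(X, W.1)) ∈ J.ideal ⟨W.1, W.2⟩; rw [htop]; trivial)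
          rw [map_one, mul_one] at ha'
          exact ⟨a', Subtype.ext ha'.symm⟩
        refine ⟨W, hzW, hW, IsClosedImmersion.spec_of_surjective _ hsurj, ⟨?_⟩⟩
        rw [← Set.range_eq_univ]
        refine (range_comap_of_surjective _ _ hsurj).trans ?_
        refine Set.eq_univ_iff_forall.2 ?_
        intro P a ha
        have h1 : (ν.app W.1).hom a = 0 := congrArg Subtype.val ha
        have h2 := ((norm_facts hnu W.1 W.2).1 a).1 h1
        obtain ⟨n, hn⟩ := h2
        exact P.2.mem_of_pow_mem n (hn ▸ P.asIdeal.zero_mem)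
      haveI h1 : IsClosedImmersion (g ∣_ (⟨(J.support : Set X)ᶜ, J.support.isClosed.isOpen_compl⟩ : X.Opens)) := by
        apply local_prop
        intro z hz
        obtain ⟨W, hzW, hW, h, -⟩ := key z hz
        refine ⟨_, _, W.2.fromSpec, j W, _, inferInstance, ?_, ?_, hj W, h⟩
        · rw [W.2.range_fromSpec]; exact hW
        · rw [W.2.range_fromSpec]; exact hzW
      haveI h2 : Surjective (g ∣_ (⟨(J.support : Set X)ᶜ, J.support.isClosed.isOpen_compl⟩ : X.Opens)) := by
        apply local_prop
        intro z hz
        obtain ⟨W, hzW, hW, -, h⟩ := key z hz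
        refine ⟨_, _, W.2.fromSpec, j W, _, inferInstance, ?_, ?_, hj W, h⟩
        · rw [W.2.range_fromSpec]; exact hW
        · rw [W.2.range_fromSpec]; exact hzW
      exact univHomeo_of_closed _
    · intro η hη hgη
      obtain ⟨W, hzW, -⟩ := hex (g η) ⊤ trivial
      haveI : IsOpenImmersion (j W) := pb_open (hj W) W.2.isOpenImmersion_fromSpec
      have hr : η ∈ Set.range (j W) := pb_range (hj W) η (W.2.range_fromSpec.ge hzW)
      obtain ⟨t, rfl⟩ := hr
      have hmin : ∀ t', t' ⤳ t → t' = t := by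
        intro t' h
        exact (j W).isOpenEmbedding.injective (hη _ (h.map (j W).continuous))
      have e1 : g (j W t) = W.2.fromSpec (Spec.map ((αJ ν J).app (op W)) t) := pb_comm (hj W) t
      have h3 := (J_supp J W.1 W.2 (Spec.map ((αJ ν J).app (op W)) t)).1 (by
        rw [← e1]; exact hgη)
      obtain ⟨a, ha, ha2⟩ := J_regular J hc W.1 W.2
      have h4 := h3 ha
      let E := EJ (ν.app W.1).hom (J.ideal ⟨W.1, W.2⟩)
      let t0 : PrimeSpectrum E := t
      have h5 : (⟨(ν.app W.1).hom a, EJ_base _ _ a⟩ : E) ∈ t0.asIdeal := h4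
      have hm : t0.asIdeal ∈ minimalPrimes E := by
        refine ⟨⟨t0.2, bot_le⟩, fun r hr hrt => ?_⟩
        have h6 := hmin (⟨r, hr.1⟩ : PrimeSpectrum E) ((PrimeSpectrum.le_iff_specializes (⟨r, hr.1⟩ : PrimeSpectrum E) t0).1 hrt)
        have h7 : r = t0.asIdeal := congrArg PrimeSpectrum.asIdeal h6
        exact h7.ge
      have h8 := Ideal.disjoint_nonZeroDivisors_of_mem_minimalPrimes hm
      refine Set.disjoint_left.1 h8 h5 ?_
      show _ ∈ nonZeroDivisors _
      rw [mem_nonZeroDivisors_iff_right]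
      intro y hy
      apply Subtype.ext
      exact (norm_facts hnu W.1 W.2).2.1 a ha2 _ (congrArg Subtype.val hy)

/-- Main application of the topological S2 property. -/
lemma ts2_app {X Xb : Scheme.{u}} [IsLocallyNoetherian X] (hS2 : IsTopologicallyS2 X) {ν : Xb ⟶ X} (hnu : IsNormalization ν)
    (p : ℕ) [Fact p.Prime] (hpX : ∀ U : X.Opens, (p : Γ(X, U)) = 0) {U : X.Opens} (hU : IsAffineOpen U)
    (𝔞 : Ideal Γ(X, U))
    (h2 : ∀ P : Ideal Γ(X, U), P.IsPrime → 𝔞 ≤ P → ∃ q0 q1 : Ideal Γ(X, U), q0.IsPrime ∧ q1.IsPrime ∧ q0 < q1 ∧ q1 < P)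
    (w : Γ(Xb, ν ⁻¹ᵁ U)) (hw : w ∈ EJ (ν.app U).hom 𝔞) : ∃ e : ℕ, ∃ r : Γ(X, U), w ^ p ^ e = (ν.app U).hom r := by
  haveI : IsAffineHom ν := hnu.1
  haveI : IsNoetherianRing Γ(X, U) := IsLocallyNoetherian.component_noetherian ⟨U, hU⟩
  obtain ⟨J, hJU, hJ⟩ := J_exists hU 𝔞
  subst hJU
  have hc : CodimGE (J.support : Set X) 2 := J_codim hU _ h2 _ hJ
  obtain ⟨Y, g, j, hj⟩ := relSpec (coeq_αJ ν J)
  have hg := ts2_g hS2 hnu J hc Y g j hj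
  haveI := univInj_of_univHomeo g hg
  let W : X.AffineZariskiSite := ⟨U, hU⟩
  have hinj := ((tfae_universallyInjective (Spec.map ((αJ ν J).app (op W)))).out 0 1).1
    (MorphismProperty.of_isPullback (P := @UniversallyInjective) (hj W) inferInstance)
  obtain ⟨a, ha, ha2⟩ := J_regular J hc U hU
  have hreg := (norm_facts hnu U hU).2.1 a ha2
  letI alg := ((ν.app U).hom.codRestrict (EJ (ν.app U).hom (J.ideal ⟨U, hU⟩)) (EJ_base _ _)).toAlgebra
  haveI : Module.Finite Γ(X, U) (EJ (ν.app U).hom (J.ideal ⟨U, hU⟩)) :=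
    EJ_finite (ν.app U).hom (J.ideal ⟨U, hU⟩) a ha hreg
  rcases subsingleton_or_nontrivial Γ(Xb, ν ⁻¹ᵁ U) with hs | hs
  · exact ⟨0, 0, Subsingleton.elim _ _⟩
  haveI : Nontrivial Γ(X, U) := (ν.app U).hom.domain_nontrivial
  haveI : CharP Γ(X, U) p := (CharP.charP_iff_prime_eq_zero Fact.out).2 (hpX U)
  haveI : CharP (EJ (ν.app U).hom (J.ideal ⟨U, hU⟩)) p := (CharP.charP_iff_prime_eq_zero Fact.out).2 (by
    rw [← map_natCast (algebraMap Γ(X, U) (EJ (ν.app U).hom (J.ideal ⟨U, hU⟩))) p, hpX U, map_zero])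
  obtain ⟨e, r, her⟩ := sn_lemma (R := Γ(X, U)) (E := EJ (ν.app U).hom (J.ideal ⟨U, hU⟩)) p ⟨w, hw⟩ (by
    intro Ω _ φ₁ φ₂ h
    have h3 := @hinj Ω _ (Spec.map (CommRingCat.ofHom φ₁)) (Spec.map (CommRingCat.ofHom φ₂)) (by
      have h5 : (αJ ν J).app (op W) ≫ CommRingCat.ofHom φ₁ = (αJ ν J).app (op W) ≫ CommRingCat.ofHom φ₂ := by
        ext a
        exact congr($h a)
      exact (Spec.map_comp _ _).symm.trans ((congrArg Spec.map h5).trans (Spec.map_comp _ _)))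
    have h4 := Spec.map_injective h3
    exact congr($h4 ⟨w, hw⟩))
  exact ⟨e, r, congrArg Subtype.val her⟩
end TS2b

section Fiber
open scoped TensorProduct

lemma fiber_indep {K : Type*} {C : Type*} [Field K] [CommRing C] [Algebra K C] (β β' β0 β0' : C) (κ κ0 x y : K)
    (hκ0 : κ0 ≠ 0) (h1 : β * β' = algebraMap K C κ) (h2 : β0 * β0' = algebraMap K C κ0)
    (h3 : β * β0' = algebraMap K C x) (h4 : β0 * β' = algebraMap K C y) :
    κ • (κ0⁻¹ • (β0 ⊗ₜ[K] β0')) = β ⊗ₜ[K] β' := by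
  have e1 : κ0 • β = x • β0 := by
    rw [Algebra.smul_def, Algebra.smul_def, ← h2, ← h3]; ring
  have e2 : κ0 • β' = y • β0' := by
    rw [Algebra.smul_def, Algebra.smul_def, ← h2, ← h4]; ring
  have e3 : (x * y) • β0 = (κ * κ0) • β0 := by
    rw [Algebra.smul_def, Algebra.smul_def, map_mul, map_mul, ← h1, ← h2, ← h3, ← h4]; ring
  have e4 : (κ0 * κ0) • (β ⊗ₜ[K] β') = (κ * κ0) • (β0 ⊗ₜ[K] β0') := by
    calc (κ0 * κ0) • (β ⊗ₜ[K] β') = (κ0 • β) ⊗ₜ[K] (κ0 • β') := by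
          rw [TensorProduct.smul_tmul_smul]
      _ = ((x * y) • β0) ⊗ₜ[K] β0' := by
          rw [e1, e2, TensorProduct.smul_tmul_smul, TensorProduct.smul_tmul']
      _ = _ := by rw [e3, TensorProduct.smul_tmul']
  have e5 : β ⊗ₜ[K] β' = (κ0 * κ0)⁻¹ • ((κ0 * κ0) • (β ⊗ₜ[K] β')) := by
    rw [smul_smul, inv_mul_cancel₀ (mul_ne_zero hκ0 hκ0), one_smul]
  rw [e5, e4, smul_smul, smul_smul]
  congr 1
  field_simp

lemma tensor_scalar {K : Type*} {C : Type*} [Field K] [CommRing C] [Algebra K C] (x y : C)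
    (h : x ⊗ₜ[K] (1 : C) = 1 ⊗ₜ[K] y) : ∃ κ : K, x = algebraMap K C κ := by
  rcases subsingleton_or_nontrivial C with hs | hs
  · exact ⟨0, Subsingleton.elim _ _⟩
  have hf : ¬ ∀ f : Module.Dual K C, f 1 = 0 := fun h0 => one_ne_zero ((Module.forall_dual_apply_eq_zero_iff K (1 : C)).1 h0)
  push Not at hf
  obtain ⟨f, hf⟩ := hf
  have h1 := congrArg (TensorProduct.rid K C) (congrArg (LinearMap.lTensor C f) h)
  rw [LinearMap.lTensor_tmul, LinearMap.lTensor_tmul, TensorProduct.rid_tmul, TensorProduct.rid_tmul] at h1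
  refine ⟨(f 1)⁻¹ * f y, ?_⟩
  rw [Algebra.algebraMap_eq_smul_one, mul_smul, ← h1, smul_smul, inv_mul_cancel₀ hf, one_smul]

lemma fiberQ {R : Type u} {B : Type u} [CommRing R] [IsNoetherianRing R] [IsLocalRing R] [CommRing B] [Algebra R B]
    [Module.Finite R B] (p : ℕ) [Fact p.Prime] [CharP R p] (η p₁ : Ideal R) [η.IsPrime] [p₁.IsPrime] (h1 : η < p₁)
    (h2 : p₁ < IsLocalRing.maximalIdeal R) (hcat : IsCatenaryRing (Polynomial (R ⧸ η))) {α : Type*} (r : α → R)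
    (k : α → ℕ) (β β' : α → B) (hβ : ∀ a, β a * β' a = algebraMap R B (r a ^ k a))
    (hr : ∀ ζ : Ideal R, ζ.IsPrime → ζ ≠ IsLocalRing.maximalIdeal R → ∃ a, r a ∉ ζ)
    (hββ : ∀ a a', ∃ N : ℕ, ∃ ρ : R, algebraMap R B ((r a * r a') ^ N) * (β a * β' a') = algebraMap R B ρ) :
    ∃ (Q : Type u) (_ : CommRing Q) (_ : Algebra R Q) (l l' : B →ₐ[R] Q) (g g' : Q), IsIntegral R g ∧ IsIntegral R g' ∧
      g * g' = 1 ∧ (∀ a, r a ^ (k a + 1) • g = (r a • l (β a)) * l' (β' a)) ∧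
      (∀ (n : ℕ) (b b' c : B), l (b * b') = 1 → l b * l' c = g ^ n → ∀ a, r a ∉ η →
        ∃ ρ : R, ρ ∉ η ∧ ∃ s : R, ρ • (b' * β a ^ n) - algebraMap R B s ∈ η.map (algebraMap R B)) := by
  obtain ⟨K, _, _, C, _, _, _, _, hfin, θ, -, hker, hfrac, hθ, -⟩ := generic_fiber (R := R) (E := B) η p
  let R' := R ⧸ η
  letI a1 : Algebra R' K := (Ideal.Quotient.lift η (algebraMap R K) (fun a ha => (hker a).2 ha)).toAlgebra
  have ha1 : ∀ a : R, algebraMap R' K (Ideal.Quotient.mk η a) = algebraMap R K a := fun a => rfl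
  let Q := C ⊗[K] C
  letI a2 : Algebra R' Q := ((algebraMap K Q).comp (algebraMap R' K)).toAlgebra
  haveI : IsScalarTower R' K Q := IsScalarTower.of_algebraMap_eq fun _ => rfl
  haveI : IsScalarTower R K Q := inferInstance
  haveI : IsScalarTower R R' Q := IsScalarTower.of_algebraMap_eq fun a => by
    rw [IsScalarTower.algebraMap_apply R K Q]; rfl
  haveI : IsFractionRing R' K := by
    haveI : FaithfulSMul R' K := by
      rw [faithfulSMul_iff_algebraMap_injective, injective_iff_map_eq_zero]
      intro a ha
      obtain ⟨a, rfl⟩ := Ideal.Quotient.mk_surjective a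
      rw [Ideal.Quotient.eq_zero_iff_mem]
      exact (hker a).1 ha
    refine IsFractionRing.of_field _ _ fun z => ?_
    obtain ⟨ρ, hρ, s, hs⟩ := hfrac z
    refine ⟨Ideal.Quotient.mk η s, Ideal.Quotient.mk η ρ, ?_⟩
    have h0 : algebraMap R K ρ ≠ 0 := fun h => hρ ((hker _).1 h)
    rw [ha1, ha1, ← hs, Algebra.smul_def, mul_div_cancel_left₀ _ h0]
  have hCK : ∀ a : R, algebraMap R C a = algebraMap K C (algebraMap R K a) := IsScalarTower.algebraMap_apply R K C
  let l : B →ₐ[R] Q := { (Algebra.TensorProduct.includeLeftRingHom (R := K) (A := C) (B := C)).comp θ.toRingHom with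
    commutes' := fun a => by
      refine Eq.trans ?_ (IsScalarTower.algebraMap_apply R K Q a).symm
      show (θ (algebraMap R B a)) ⊗ₜ[K] (1 : C) = algebraMap K Q (algebraMap R K a)
      rw [AlgHom.commutes, hCK]; rfl }
  let l' : B →ₐ[R] Q := { ((Algebra.TensorProduct.includeRight (R := K) (A := C) (B := C)).toRingHom).comp θ.toRingHom with
    commutes' := fun a => by
      refine Eq.trans ?_ (IsScalarTower.algebraMap_apply R K Q a).symm
      show (1 : C) ⊗ₜ[K] (θ (algebraMap R B a)) = algebraMap K Q (algebraMap R K a)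
      rw [AlgHom.commutes, hCK]
      exact (Algebra.TensorProduct.algebraMap_apply' _).symm }
  have hl : ∀ b, l b = θ b ⊗ₜ[K] (1 : C) := fun b => rfl
  have hl' : ∀ b, l' b = (1 : C) ⊗ₜ[K] θ b := fun b => rfl
  have hll : ∀ b c, l b * l' c = θ b ⊗ₜ[K] θ c := fun b c => by
    rw [hl, hl', Algebra.TensorProduct.tmul_mul_tmul, one_mul, mul_one]
  have hηm : η ≠ IsLocalRing.maximalIdeal R := (h1.trans h2).ne
  obtain ⟨a0, ha0⟩ := hr η inferInstance hηm
  let κ : α → K := fun a => algebraMap R K (r a) ^ k a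
  have hr0 : ∀ a, r a ∉ η → algebraMap R K (r a) ≠ 0 := fun a ha h => ha ((hker _).1 h)
  have hκ : ∀ a, r a ∉ η → κ a ≠ 0 := fun a ha => pow_ne_zero _ (hr0 a ha)
  have hsc : ∀ a, θ (β a) * θ (β' a) = algebraMap K C (κ a) := by
    intro a
    rw [← map_mul, hβ, AlgHom.commutes, hCK, map_pow]
  have hsc2 : ∀ a a', r a ∉ η → r a' ∉ η → ∃ x : K, θ (β a) * θ (β' a') = algebraMap K C x := by
    intro a a' ha ha'
    obtain ⟨N, ρ, h⟩ := hββ a a'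
    have h3 := congrArg θ h
    rw [map_mul, AlgHom.commutes, AlgHom.commutes, hCK, hCK, map_mul] at h3
    have h4 : algebraMap R K ((r a * r a') ^ N) ≠ 0 := by
      rw [map_pow, map_mul]; exact pow_ne_zero _ (mul_ne_zero (hr0 a ha) (hr0 a' ha'))
    refine ⟨(algebraMap R K ((r a * r a') ^ N))⁻¹ * algebraMap R K ρ, ?_⟩
    rw [map_mul, ← h3, ← mul_assoc, ← map_mul (algebraMap K C), inv_mul_cancel₀ h4, map_one, one_mul]
  let g : Q := (κ a0)⁻¹ • (θ (β a0) ⊗ₜ[K] θ (β' a0))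
  let g' : Q := (κ a0)⁻¹ • (θ (β' a0) ⊗ₜ[K] θ (β a0))
  have hg : ∀ a, r a ∉ η → κ a • g = l (β a) * l' (β' a) := by
    intro a ha
    obtain ⟨x, hx⟩ := hsc2 a a0 ha ha0
    obtain ⟨y, hy⟩ := hsc2 a0 a ha0 ha
    rw [hll]
    exact fiber_indep _ _ _ _ (κ a) (κ a0) x y (hκ a0 ha0) (hsc a) (hsc a0) hx hy
  have hg' : ∀ a, r a ∉ η → κ a • g' = l (β' a) * l' (β a) := by
    intro a ha
    obtain ⟨x, hx⟩ := hsc2 a a0 ha ha0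
    obtain ⟨y, hy⟩ := hsc2 a0 a ha0 ha
    rw [hll]
    exact fiber_indep _ _ _ _ (κ a) (κ a0) y x (hκ a0 ha0) (by rw [mul_comm, hsc a]) (by rw [mul_comm, hsc a0])
      (by rw [mul_comm, hy]) (by rw [mul_comm, hx])
  have hint0 : ∀ b c, IsIntegral R (l b * l' c) := fun b c =>
    ((Algebra.IsIntegral.isIntegral b).map l).mul ((Algebra.IsIntegral.isIntegral c).map l')
  have hint : ∀ (G : Q) (b c : α → B), (∀ a, r a ∉ η → κ a • G = l (b a) * l' (c a)) → IsIntegral R G := by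
    intro G b c hG
    have hsm : ∀ a, κ a • G = (r a ^ k a) • G := by
      intro a
      rw [← algebraMap_smul K (r a ^ k a) G, map_pow]
    let x' := (IsLocalRing.maximalIdeal R).map (Ideal.Quotient.mk η)
    let p' := p₁.map (Ideal.Quotient.mk η)
    have hcm : ∀ I : Ideal R, η ≤ I → (I.map (Ideal.Quotient.mk η)).comap (Ideal.Quotient.mk η) = I := by
      intro I hI
      rw [Ideal.comap_map_of_surjective _ Ideal.Quotient.mk_surjective, ← RingHom.ker_eq_comap_bot, Ideal.mk_ker]
      exact sup_eq_left.2 hI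
    have hx' : x'.IsPrime := Ideal.map_isPrime_of_surjective Ideal.Quotient.mk_surjective (by
      rw [Ideal.mk_ker]; exact (h1.trans h2).le)
    have hp' : p'.IsPrime := Ideal.map_isPrime_of_surjective Ideal.Quotient.mk_surjective (by
      rw [Ideal.mk_ker]; exact h1.le)
    obtain ⟨ρ, hρ, hρi⟩ := dim_lemma_alg (D := R') (K := K) (E := Q) hcat x' p' (by
        rw [bot_lt_iff_ne_bot]
        intro h0
        have := hcm p₁ h1.le
        rw [show p₁.map (Ideal.Quotient.mk η) = ⊥ from h0, ← RingHom.ker_eq_comap_bot, Ideal.mk_ker] at this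
        exact h1.ne this) (by
        refine lt_of_le_of_ne (Ideal.map_mono h2.le) fun h0 => h2.ne ?_
        rw [← hcm p₁ h1.le, ← hcm _ (h1.trans h2).le]
        exact congrArg _ h0) G (by
      intro v hv hvx
      obtain ⟨a, ha⟩ := hr (v.comap (Ideal.Quotient.mk η)) inferInstance (by
        intro h0
        refine hvx.ne ?_
        rw [← Ideal.map_comap_of_surjective _ Ideal.Quotient.mk_surjective v, h0])
      have haη : r a ∉ η := fun h => ha (by
        rw [Ideal.mem_comap, Ideal.Quotient.eq_zero_iff_mem.2 h]; exact v.zero_mem)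
      refine ⟨Ideal.Quotient.mk η (r a) ^ k a, fun h => ha (hv.mem_of_pow_mem _ h), ?_⟩
      have : Ideal.Quotient.mk η (r a) ^ k a • G = κ a • G := by
        rw [← algebraMap_smul K (Ideal.Quotient.mk η (r a) ^ k a) G, map_pow, ha1]
      rw [this, hG a haη]
      exact (hint0 _ _).tower_top)
    obtain ⟨ρ, rfl⟩ := Ideal.Quotient.mk_surjective ρ
    have hu : IsUnit ρ := by
      by_contra hu
      exact hρ (Ideal.mem_map_of_mem _ ((IsLocalRing.mem_maximalIdeal ρ).2 hu))
    obtain ⟨u, rfl⟩ := hu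
    have hi : IsIntegral R ((u : R) • G) := by
      have h5 : Ideal.Quotient.mk η (u : R) • G = (u : R) • G := algebraMap_smul R' (u : R) G
      rw [h5] at hρi
      haveI : Algebra.IsIntegral R R' := Algebra.IsIntegral.of_surjective (Ideal.Quotient.mkₐ R η) (Ideal.Quotient.mkₐ_surjective R η)
      exact isIntegral_trans _ hρi
    have := hi.smul ((u⁻¹ : Rˣ) : R)
    rwa [smul_smul, Units.inv_mul, one_smul] at this
  refine ⟨Q, inferInstance, inferInstance, l, l', g, g', hint g _ _ hg, hint g' _ _ hg', ?_, ?_, ?_⟩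
  · show ((κ a0)⁻¹ • (θ (β a0) ⊗ₜ[K] θ (β' a0))) * ((κ a0)⁻¹ • (θ (β' a0) ⊗ₜ[K] θ (β a0))) = 1
    rw [smul_mul_smul_comm, Algebra.TensorProduct.tmul_mul_tmul, mul_comm (θ (β' a0)), hsc,
      Algebra.algebraMap_eq_smul_one, TensorProduct.smul_tmul_smul, smul_smul, ← mul_inv,
      inv_mul_cancel₀ (mul_ne_zero (hκ a0 ha0) (hκ a0 ha0)), one_smul]
    rfl
  · intro a
    by_cases ha : r a ∈ η
    · have h0 : ∀ y : Q, r a • y = 0 := by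
        intro y
        rw [← algebraMap_smul K (r a) y, (hker _).2 ha, zero_smul]
      rw [h0, zero_mul, pow_succ, mul_smul, h0, smul_zero]
    · rw [pow_succ', mul_smul, smul_mul_assoc, ← hg a ha]
      congr 1
      rw [← algebraMap_smul K (r a ^ k a) g, map_pow]
  · intro n b b' c hb hbc a ha
    have e1 : θ (β a ^ n) ⊗ₜ[K] θ (β' a ^ n) = κ a ^ n • (θ b ⊗ₜ[K] θ c) := by
      rw [← hll, ← hll, hbc, map_pow, map_pow, ← mul_pow, ← hg a ha, smul_pow]
    have e2 : (θ (b' * β a ^ n)) ⊗ₜ[K] (1 : C) = (1 : C) ⊗ₜ[K] θ (c * β a ^ n) := by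
      have hκn : κ a ^ n ≠ 0 := pow_ne_zero _ (hκ a ha)
      have h6 : κ a ^ n • ((θ (b' * β a ^ n)) ⊗ₜ[K] (1 : C)) = κ a ^ n • ((1 : C) ⊗ₜ[K] θ (c * β a ^ n)) := by
        calc κ a ^ n • ((θ (b' * β a ^ n)) ⊗ₜ[K] (1 : C)) 
            = (θ (β a ^ n) ⊗ₜ[K] θ (β' a ^ n)) * (θ b' ⊗ₜ[K] θ (β a ^ n)) := by
              have h9 : θ (β' a ^ n) * θ (β a ^ n) = κ a ^ n • (1 : C) := by
                rw [map_pow, map_pow, ← mul_pow, mul_comm, hsc, ← map_pow, Algebra.algebraMap_eq_smul_one]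
              rw [Algebra.TensorProduct.tmul_mul_tmul, h9, TensorProduct.tmul_smul, map_mul, mul_comm (θ b')]
          _ = _ := by
              rw [e1, smul_mul_assoc, Algebra.TensorProduct.tmul_mul_tmul, ← map_mul, ← map_mul,
                ← mul_one (θ (b * b')), ← one_mul (θ (c * _)), ← Algebra.TensorProduct.tmul_mul_tmul, one_mul, ← hl, hb, one_mul]
      have := congrArg ((κ a ^ n)⁻¹ • ·) h6
      simpa only [smul_smul, inv_mul_cancel₀ hκn, one_smul] using this
    obtain ⟨x, hx⟩ := tensor_scalar _ _ e2
    obtain ⟨ρ, hρ, s, hs⟩ := hfrac x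
    have h7 : θ (ρ • (b' * β a ^ n) - algebraMap R B s) = 0 := by
      rw [map_sub, map_smul, hx, AlgHom.commutes, hCK, ← hs, sub_eq_zero, Algebra.smul_def, Algebra.smul_def, hCK, map_mul]
    obtain ⟨ρ', hρ', h8⟩ := hθ _ h7
    refine ⟨ρ' * ρ, fun h => (Ideal.IsPrime.mem_or_mem inferInstance h).elim hρ' hρ, ρ' * s, ?_⟩
    rw [smul_sub, smul_smul, Algebra.smul_def ρ' (algebraMap R B s), ← map_mul] at h8
    exact h8

end Fiber

section RegClaim

lemma isIntegral_pi {R : Type*} [CommRing R] {J : Type*} [Finite J] {Q : J → Type*} [∀ j, CommRing (Q j)]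
    [∀ j, Algebra R (Q j)] (f : ∀ j, Q j) (h : ∀ j, IsIntegral R (f j)) : IsIntegral R f := by
  classical
  cases nonempty_fintype J
  choose P hP hP0 using h
  refine ⟨∏ j, P j, Polynomial.monic_prod_of_monic _ _ fun j _ => hP j, ?_⟩
  rw [← Polynomial.aeval_def]
  funext j
  have h1 : (Polynomial.aeval f (∏ j, P j)) j = Polynomial.aeval (f j) (∏ j, P j) := by
    have := Polynomial.aeval_algHom_apply (Pi.evalAlgHom R Q j) f (∏ j, P j)
    exact this.symm
  rw [h1, map_prod]
  exact Finset.prod_eq_zero (Finset.mem_univ j) (hP0 j)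

lemma fin_order {R : Type*} {E : Type*} [CommRing R] [IsLocalRing R] [Finite (IsLocalRing.ResidueField R)] [CommRing E]
    [Algebra R E] [Module.Finite R E] (f f' : E) (hff : f * f' = 1) :
    ∃ q > 0, f ^ q - 1 ∈ (IsLocalRing.maximalIdeal R).map (algebraMap R E) := by
  let m := IsLocalRing.maximalIdeal R
  let I := m.map (algebraMap R E)
  haveI : Finite (R ⧸ m) := inferInstanceAs (Finite (IsLocalRing.ResidueField R))
  haveI : Finite (E ⧸ I) := by
    letI : Module (R ⧸ m) (E ⧸ I) := inferInstance
    haveI : IsScalarTower R (R ⧸ m) (E ⧸ I) := inferInstance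
    haveI : Module.Finite R (E ⧸ I) := inferInstance
    haveI : Module.Finite (R ⧸ m) (E ⧸ I) := Module.Finite.of_restrictScalars_finite R _ _
    exact Module.finite_of_finite (R ⧸ m)
  let u : (E ⧸ I)ˣ := ⟨Ideal.Quotient.mk I f, Ideal.Quotient.mk I f', by rw [← map_mul, hff, map_one],
    by rw [← map_mul, mul_comm, hff, map_one]⟩
  refine ⟨orderOf u, orderOf_pos u, ?_⟩
  rw [← Ideal.Quotient.eq_zero_iff_mem, map_sub, map_pow, map_one, sub_eq_zero]
  exact congrArg Units.val (pow_orderOf_eq_one u)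

lemma reg_claim {R B : Type u} [CommRing R] [IsNoetherianRing R] [IsLocalRing R]
    [Finite (IsLocalRing.ResidueField R)] [CommRing B] [Algebra R B]
    [Module.Finite R B] (p : ℕ) [Fact p.Prime] [CharP R p] {J : Type u} [Finite J] (Q : J → Type u) [∀ j, CommRing (Q j)]
    [∀ j, Algebra R (Q j)] (l l' : ∀ j, B →ₐ[R] Q j) (g g' : ∀ j, Q j) (hg : ∀ j, IsIntegral R (g j))
    (hg' : ∀ j, IsIntegral R (g' j)) (hgg : ∀ j, g j * g' j = 1) {α : Type u} [Finite α] (r : α → R)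
    (k : α → ℕ) (β β' : α → B) (hβ : ∀ a, β a * β' a = algebraMap R B (r a ^ k a))
    (hr : ∀ ζ : Ideal R, ζ.IsPrime → ζ ≠ IsLocalRing.maximalIdeal R → ∃ a, r a ∉ ζ)
    (h : ∀ j a, r a ^ (k a + 1) • g j = (r a • l j (β a)) * l' j (β' a)) :
    ∃ n > 0, ∃ b b' c : B, ∀ j, l j (b * b') = 1 ∧ l j b * l' j c = g j ^ n := by
  let P := ∀ j, Q j
  let L : B →ₐ[R] P := AlgHom.pi l
  let L' : B →ₐ[R] P := AlgHom.pi l'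
  let s : Set P := (Set.range (fun a => L (β a)) ∪ Set.range (fun a => L (β' a))) ∪
    ((Set.range (fun a => L' (β a)) ∪ Set.range (fun a => L' (β' a))) ∪ {g, g'})
  have hsf : s.Finite := by
    refine ((Set.finite_range _).union (Set.finite_range _)).union (((Set.finite_range _).union (Set.finite_range _)).union ?_)
    exact Set.toFinite _
  have hsi : ∀ x ∈ s, IsIntegral R x := by
    rintro x ((⟨a, rfl⟩ | ⟨a, rfl⟩) | ((⟨a, rfl⟩ | ⟨a, rfl⟩) | (rfl | hx)))
    · exact (Algebra.IsIntegral.isIntegral _).map L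
    · exact (Algebra.IsIntegral.isIntegral _).map L
    · exact (Algebra.IsIntegral.isIntegral _).map L'
    · exact (Algebra.IsIntegral.isIntegral _).map L'
    · exact isIntegral_pi _ hg
    · rw [Set.mem_singleton_iff] at hx
      rw [hx]; exact isIntegral_pi _ hg'
  let E := Algebra.adjoin R s
  haveI : Module.Finite R E := Module.Finite.iff_fg.2 (fg_adjoin_of_finite hsf hsi)
  rcases subsingleton_or_nontrivial E with hE | hE
  · have h01 : (1 : P) = 0 := congrArg Subtype.val (Subsingleton.elim (1 : E) 0)
    refine ⟨1, one_pos, 1, 1, 1, fun j => ?_⟩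
    have h2 : (1 : Q j) = 0 := congrFun h01 j
    have h3 : ∀ x y : Q j, x = y := fun x y => by rw [← mul_one x, ← mul_one y, h2, mul_zero, mul_zero]
    exact ⟨h3 _ _, h3 _ _⟩
  haveI : CharP E p := by
    rw [CharP.charP_iff_prime_eq_zero Fact.out]
    have := congrArg (algebraMap R E) (CharP.cast_eq_zero R p)
    rwa [map_natCast, map_zero] at this
  have hL : ∀ a, L (β a) ∈ E := fun a => Algebra.subset_adjoin (Or.inl (Or.inl ⟨a, rfl⟩))
  have hL1 : ∀ a, L (β' a) ∈ E := fun a => Algebra.subset_adjoin (Or.inl (Or.inr ⟨a, rfl⟩))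
  have hL' : ∀ a, L' (β a) ∈ E := fun a => Algebra.subset_adjoin (Or.inr (Or.inl (Or.inl ⟨a, rfl⟩)))
  have hL1' : ∀ a, L' (β' a) ∈ E := fun a => Algebra.subset_adjoin (Or.inr (Or.inl (Or.inr ⟨a, rfl⟩)))
  have hgE : g ∈ E := Algebra.subset_adjoin (Or.inr (Or.inr (Or.inl rfl)))
  have hgE' : g' ∈ E := Algebra.subset_adjoin (Or.inr (Or.inr (Or.inr rfl)))
  let B' : Subalgebra R E := L.range.comap E.val
  let D' : Subalgebra R E := L'.range.comap E.val
  have hff : (⟨g, hgE⟩ : E) * ⟨g', hgE'⟩ = 1 := Subtype.ext (funext hgg)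
  have key := claim (R := R) (E := E) p B' D' ⟨g, hgE⟩ ⟨g', hgE'⟩ hff (fin_order _ _ hff) (by
    intro ζ hζ hζm
    obtain ⟨a, ha⟩ := hr ζ hζ hζm
    have hp : ∀ N, r a ^ N ∉ ζ := fun N hN => ha (hζ.mem_of_pow_mem _ hN)
    refine ⟨r a • ⟨L (β a), hL a⟩, ⟨L (β' a), hL1 a⟩, ⟨L' (β' a), hL1' a⟩, ⟨L' (β a), hL' a⟩,
      B'.smul_mem ⟨β a, rfl⟩ _, ⟨β' a, rfl⟩, ⟨β' a, rfl⟩, ⟨β a, rfl⟩, r a ^ (k a + 1), r a ^ k a, r a ^ (k a + 1),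
      hp _, hp _, hp _, ?_, ?_, ?_⟩
    · apply Subtype.ext
      show (r a • L (β a)) * L (β' a) = algebraMap R P _
      rw [smul_mul_assoc, ← map_mul, hβ, AlgHom.commutes, pow_succ', map_mul, Algebra.smul_def]
    · apply Subtype.ext
      show L' (β' a) * L' (β a) = algebraMap R P _
      rw [← map_mul, mul_comm, hβ, AlgHom.commutes]
    · apply Subtype.ext
      funext j
      exact h j a)
  obtain ⟨n, hn, b, b', c, c', ⟨b0, hb0⟩, ⟨b0', hb0'⟩, hbb, ⟨c0, hc0⟩, -, -, hfn⟩ := key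
  rw [Ideal.map_bot, Ideal.mem_bot, sub_eq_zero] at hfn
  refine ⟨n, hn, b0, b0', c0, fun j => ⟨?_, ?_⟩⟩
  · have h1 : L b0 * L b0' = 1 := by
      have := congrArg Subtype.val hbb
      rw [show L b0 = (b : P) from hb0, show L b0' = (b' : P) from hb0']; exact this
    rw [map_mul]
    exact congrFun h1 j
  · have h1 : L b0 * L' c0 = g ^ n := by
      have := congrArg Subtype.val hfn
      rw [show L b0 = (b : P) from hb0, show L' c0 = (c : P) from hc0]; exact this.symm
    exact congrFun h1 j

end RegClaim

section Core

/-- there is no chain of two strict inclusions of primes ending in `v` -/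
def Hle1 {R : Type*} [CommRing R] (v : Ideal R) : Prop :=
  ∀ q0 q1 : Ideal R, q0.IsPrime → q1.IsPrime → q0 < q1 → q1 < v → False

lemma hle1_of_min {R : Type*} [CommRing R] [IsNoetherianRing R] (c : R) (η : Ideal R)
    (hη : η ∈ (Ideal.span {c}).minimalPrimes) : Hle1 η := by
  intro q0 q1 h0 h1 h01 h1η
  haveI := hη.1.1
  have h2 := Ideal.height_le_one_of_isPrincipal_of_mem_minimalPrimes (Ideal.span {c}) η hη
  have h3 : q1.height < 1 := (Ideal.height_strict_mono_of_isPrime_of_isPrime h1η).trans_le h2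
  have h4 : q0.height < q1.height := Ideal.height_strict_mono_of_isPrime_of_isPrime h01
  rw [Order.lt_one_iff] at h3
  rw [h3] at h4
  exact not_lt_zero h4

lemma min_of_hle1 {R : Type*} [CommRing R] (I : Ideal R) (c : R) (hcI : c ∈ I) (hc : ∀ q ∈ minimalPrimes R, c ∉ q)
    (v : Ideal R) [hv : v.IsPrime] (h : Hle1 v) (hcv : I ≤ v) : v ∈ I.minimalPrimes := by
  obtain ⟨η, hη, hηv⟩ := Ideal.exists_minimalPrimes_le hcv
  rcases hηv.lt_or_eq with hlt | rfl
  · haveI := hη.1.1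
    obtain ⟨q0, hq0, hq0η⟩ := Ideal.exists_minimalPrimes_le (I := (⊥ : Ideal R)) (J := η) bot_le
    refine (h q0 η hq0.1.1 inferInstance (lt_of_le_of_ne hq0η ?_) hlt).elim
    rintro rfl
    exact hc _ hq0 (hη.1.2 hcI)
  · exact hη

lemma minpow {R : Type*} [CommRing R] [IsNoetherianRing R] (I η : Ideal R) (hη : η ∈ I.minimalPrimes) :
    ∃ N : ℕ, ∀ x ∈ η ^ N, ∃ ρ ∉ η, ρ * x ∈ I := by
  haveI := hη.1.1
  let A := Localization.AtPrime η
  have h1 := IsLocalization.AtPrime.radical_map_of_mem_minimalPrimes A η I hη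
  obtain ⟨N, hN⟩ := (I.map (algebraMap R A)).exists_radical_pow_le_of_fg (IsNoetherian.noetherian _)
  refine ⟨N, fun x hx => ?_⟩
  have h2 : algebraMap R A x ∈ I.map (algebraMap R A) := by
    apply hN
    rw [h1, ← Ideal.map_pow]
    exact Ideal.mem_map_of_mem _ hx
  rw [IsLocalization.mem_map_algebraMap_iff η.primeCompl A] at h2
  obtain ⟨⟨a, s⟩, h3⟩ := h2
  rw [← map_mul] at h3
  obtain ⟨t, ht⟩ := IsLocalization.exists_of_eq (M := η.primeCompl) h3
  refine ⟨t * s, (t * s).2, ?_⟩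
  have : (t * s : R) * x = t * a := by rw [← ht]; ring
  rw [this]
  exact I.mul_mem_left _ a.2

lemma minpow_alg {R B : Type*} [CommRing R] [CommRing B] [Algebra R B] (c : R) (η : Ideal R)
    [hηp : η.IsPrime] (N : ℕ) (hN : ∀ x ∈ η ^ N, ∃ ρ ∉ η, ρ * x ∈ Ideal.span {c}) (y : B) (hy : y ∈ η.map (algebraMap R B))
    (q : ℕ) (hq : N ≤ q) : ∃ ρ ∉ η, ∃ b : B, ρ • y ^ q = c • b := by
  have h1 : y ^ q ∈ (η ^ q).map (algebraMap R B) := by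
    rw [Ideal.map_pow]; exact Ideal.pow_mem_pow hy q
  refine Submodule.span_induction (p := fun z _ => ∃ ρ ∉ η, ∃ b : B, ρ • z = c • b) ?_ ?_ ?_ ?_ h1
  · rintro _ ⟨x, hx, rfl⟩
    obtain ⟨ρ, hρ, h⟩ := hN x (Ideal.pow_le_pow_right hq hx)
    obtain ⟨d, hd⟩ := Ideal.mem_span_singleton.1 h
    refine ⟨ρ, hρ, algebraMap R B d, ?_⟩
    rw [Algebra.smul_def, Algebra.smul_def, ← map_mul, ← map_mul, hd]
  · exact ⟨1, fun h => hηp.ne_top ((Ideal.eq_top_iff_one _).2 h), 0, by simp⟩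
  · rintro x z - - ⟨ρ, hρ, b, h⟩ ⟨ρ', hρ', b', h'⟩
    refine ⟨ρ * ρ', fun h => (hηp.mem_or_mem h).elim hρ hρ', ρ' • b + ρ • b', ?_⟩
    rw [smul_add, smul_add, mul_smul, mul_smul, smul_comm ρ ρ' x, h, h', smul_comm ρ' c, smul_comm ρ c]
  · rintro a x - ⟨ρ, hρ, b, h⟩
    refine ⟨ρ, hρ, a * b, ?_⟩
    rw [smul_eq_mul, ← mul_smul_comm, h, mul_smul_comm]

lemma conductor {R B : Type*} [CommRing R] [CommRing B] [Algebra R B] [Module.Finite R B]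
    (H2 : ∀ s : B, ∃ j : R, (∀ q ∈ minimalPrimes R, j ∉ q) ∧ ∃ a, j • s = algebraMap R B a) :
    ∃ c : R, (∀ q ∈ minimalPrimes R, c ∉ q) ∧ ∀ s : B, ∃ a, c • s = algebraMap R B a := by
  classical
  obtain ⟨t, ht⟩ := Module.Finite.fg_top (R := R) (M := B)
  choose j hj a ha using H2
  refine ⟨∏ x ∈ t, j x, ?_, ?_⟩
  · intro q hq h
    haveI := hq.1.1
    obtain ⟨x, -, hx⟩ := (Ideal.IsPrime.prod_mem_iff (p := q)).1 h
    exact hj x q hq hx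
  · intro s
    have hs : s ∈ Submodule.span R (t : Set B) := by rw [ht]; trivial
    refine Submodule.span_induction (p := fun z _ => ∃ a, (∏ x ∈ t, j x) • z = algebraMap R B a) ?_ ?_ ?_ ?_ hs
    · intro x hx
      refine ⟨(∏ y ∈ t.erase x, j y) * a x, ?_⟩
      rw [← Finset.mul_prod_erase t j hx, mul_comm, mul_smul, ha, Algebra.smul_def, map_mul]
    · exact ⟨0, by simp⟩
    · rintro x y - - ⟨a, h⟩ ⟨b, h'⟩
      exact ⟨a + b, by rw [smul_add, h, h', map_add]⟩
    · rintro b x - ⟨a, h⟩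
      exact ⟨b * a, by rw [smul_comm, h, Algebra.smul_def, map_mul]⟩

lemma unit_of_near {R B : Type*} [CommRing R] [IsLocalRing R] [CommRing B] [Algebra R B] [Algebra.IsIntegral R B] (b : B)
    (h : b - 1 ∈ (IsLocalRing.maximalIdeal R).map (algebraMap R B)) : IsUnit b := by
  by_contra hb
  obtain ⟨M, hM, hbM⟩ := exists_max_ideal_of_mem_nonunits hb
  haveI : (M.comap (algebraMap R B)).IsMaximal := Ideal.isMaximal_comap_of_isIntegral_of_isMaximal M
  have h1 : (IsLocalRing.maximalIdeal R).map (algebraMap R B) ≤ M := by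
    rw [Ideal.map_le_iff_le_comap, IsLocalRing.eq_maximalIdeal this]
  have : (1 : B) ∈ M := by
    have := M.sub_mem hbM (h1 h)
    simpa using this
  exact hM.ne_top ((Ideal.eq_top_iff_one _).2 this)

lemma im_pow {R S : Type*} [CommRing R] [CommRing S] [Algebra R S] (r : R) (w : S) (q : ℕ)
    (h : ∃ a, r • w = algebraMap R S a) : ∃ a, r ^ q • w ^ q = algebraMap R S a := by
  obtain ⟨a, h⟩ := h
  exact ⟨a ^ q, by rw [← smul_pow, h, map_pow]⟩

end Core

section Core2

lemma core {R S : Type u} [CommRing R] [IsNoetherianRing R] [IsLocalRing R]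
    [Finite (IsLocalRing.ResidueField R)] [CommRing S] [Algebra R S] [Algebra.IsIntegral R S]
    (p : ℕ) [Fact p.Prime] [CharP R p]
    (H2 : ∀ s : S, ∃ j : R, (∀ q ∈ minimalPrimes R, j ∉ q) ∧ ∃ a, j • s = algebraMap R S a)
    (H3 : ∀ η : Ideal R, η.IsPrime → Hle1 η → ∃ p₁ : Ideal R, p₁.IsPrime ∧ η < p₁ ∧ p₁ < IsLocalRing.maximalIdeal R)
    (H4 : ∀ η : Ideal R, η.IsPrime → IsCatenaryRing (Polynomial (R ⧸ η)))
    (H5 : ∀ r ∈ IsLocalRing.maximalIdeal R, ∀ w : S,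
      (∀ v : Ideal R, v.IsPrime → Hle1 v → r ∉ v → ∃ ρ ∉ v, ∃ a, ρ • w = algebraMap R S a) →
      ∃ e N : ℕ, ∃ a, r ^ N • w ^ p ^ e = algebraMap R S a)
    {α : Type u} [Finite α] (r : α → R) (hrm : ∀ a, r a ∈ IsLocalRing.maximalIdeal R)
    (k : α → ℕ) (β β' : α → S) (hβ : ∀ a, β a * β' a = algebraMap R S (r a ^ k a))
    (hr : ∀ ζ : Ideal R, ζ.IsPrime → ζ ≠ IsLocalRing.maximalIdeal R → ∃ a, r a ∉ ζ)
    (hββ : ∀ a a', ∃ N : ℕ, ∃ ρ : R, algebraMap R S ((r a * r a') ^ N) * (β a * β' a') = algebraMap R S ρ) :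
    ∃ n > 0, ∃ b b' : S, b * b' = 1 ∧ ∀ a, ∃ N : ℕ, ∃ s, r a ^ N • (b' * β a ^ n) = algebraMap R S s := by
  classical
  rcases subsingleton_or_nontrivial S with hS | hS
  · exact ⟨1, one_pos, 1, 1, Subsingleton.elim _ _, fun a => ⟨0, 0, Subsingleton.elim _ _⟩⟩
  let B := Algebra.adjoin R (Set.range β ∪ Set.range β')
  haveI : Module.Finite R B := Module.Finite.iff_fg.2 (fg_adjoin_of_finite
    ((Set.finite_range _).union (Set.finite_range _)) fun x _ => Algebra.IsIntegral.isIntegral x)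
  haveI : CharP B p := by
    rw [CharP.charP_iff_prime_eq_zero Fact.out]
    have := congrArg (algebraMap R B) (CharP.cast_eq_zero R p)
    rwa [map_natCast, map_zero] at this
  let γ : α → B := fun a => ⟨β a, Algebra.subset_adjoin (Or.inl ⟨a, rfl⟩)⟩
  let γ' : α → B := fun a => ⟨β' a, Algebra.subset_adjoin (Or.inr ⟨a, rfl⟩)⟩
  have hγ : ∀ a, γ a * γ' a = algebraMap R B (r a ^ k a) := fun a => Subtype.ext (hβ a)
  have hγγ : ∀ a a', ∃ N : ℕ, ∃ ρ : R, algebraMap R B ((r a * r a') ^ N) * (γ a * γ' a') = algebraMap R B ρ := by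
    intro a a'
    obtain ⟨N, ρ, h⟩ := hββ a a'
    exact ⟨N, ρ, Subtype.ext h⟩
  obtain ⟨c, hc, hcB⟩ := conductor (R := R) (B := B) (by
    intro s
    obtain ⟨j, hj, a, h⟩ := H2 s
    exact ⟨j, hj, a, Subtype.ext h⟩)
  let M := (Ideal.span {c}).minimalPrimes
  have hMf : M.Finite := Ideal.finite_minimalPrimes_of_isNoetherianRing R _
  haveI : Finite M := hMf
  have hQ : ∀ j : Option M, ∃ (Q : Type u) (_ : CommRing Q) (_ : Algebra R Q) (l l' : B →ₐ[R] Q) (g g' : Q),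
      IsIntegral R g ∧ IsIntegral R g' ∧
      g * g' = 1 ∧ (∀ a, r a ^ (k a + 1) • g = (r a • l (γ a)) * l' (γ' a)) ∧
      (∀ b b' : B, l (b * b') = 1 → j = none → b * b' - 1 ∈ (IsLocalRing.maximalIdeal R).map (algebraMap R B)) ∧
      (∀ (n : ℕ) (b b' c : B), l (b * b') = 1 → l b * l' c = g ^ n → ∀ η : M, j = some η → ∀ a, r a ∉ η.1 →
        ∃ ρ : R, ρ ∉ η.1 ∧ ∃ s : R, ρ • (b' * γ a ^ n) - algebraMap R B s ∈ η.1.map (algebraMap R B)) := by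
    rintro (_ | η)
    · let I := (IsLocalRing.maximalIdeal R).map (algebraMap R B)
      refine ⟨B ⧸ I, inferInstance, inferInstance, Ideal.Quotient.mkₐ R I, Ideal.Quotient.mkₐ R I, 1, 1, isIntegral_one,
        isIntegral_one, mul_one 1, ?_, ?_, ?_⟩
      · intro a
        have h0 : ∀ y : B ⧸ I, r a • y = 0 := by
          intro y
          obtain ⟨y, rfl⟩ := Ideal.Quotient.mk_surjective y
          rw [← Ideal.Quotient.mkₐ_eq_mk R, ← map_smul, Ideal.Quotient.mkₐ_eq_mk, Ideal.Quotient.eq_zero_iff_mem,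
            Algebra.smul_def]
          exact I.mul_mem_right _ (Ideal.mem_map_of_mem _ (hrm a))
        rw [h0, zero_mul, pow_succ, mul_smul, h0, smul_zero]
      · intro b b' h _
        rw [← Ideal.Quotient.eq_zero_iff_mem, map_sub, map_one, sub_eq_zero]
        exact h
      · intro n b b' c _ _ η hη
        cases hη
    · haveI := η.2.1.1
      obtain ⟨p₁, hp₁, h1, h2⟩ := H3 η.1 inferInstance (hle1_of_min c _ η.2)
      obtain ⟨Q, i1, i2, l, l', g, g', e1, e2, e3, e4, e5⟩ := fiberQ (R := R) (B := B) p η.1 p₁ h1 h2 (H4 _ inferInstance)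
        r k γ γ' hγ hr hγγ
      refine ⟨Q, i1, i2, l, l', g, g', e1, e2, e3, e4, ?_, ?_⟩
      · intro b b' _ h
        cases h
      · intro n b b' c h h' η' hη'
        cases hη'
        exact e5 n b b' c h h'
  choose Q i1 i2 l l' g g' e1 e2 e3 e4 e5 e6 using hQ
  obtain ⟨n, hn, b, b0, d, hbd⟩ := reg_claim (R := R) (B := B) p Q l l' g g' e1 e2 e3 r k γ γ' hγ hr e4
  have hu : IsUnit b := isUnit_of_mul_isUnit_left (unit_of_near (R := R) _ (e5 none b b0 (hbd none).1 rfl))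
  obtain ⟨b', hb'⟩ := hu.exists_right_inv
  let w : α → B := fun a => b' * γ a ^ n
  have hw : ∀ (η : M) a, r a ∉ η.1 → ∃ ρ : R, ρ ∉ η.1 ∧ ∃ s : R, ρ • w a - algebraMap R B s ∈ η.1.map (algebraMap R B) :=
    fun η a ha => e6 (some η) n b b' d (by rw [hb', map_one]) (hbd _).2 η rfl a ha
  have hN : ∀ η : M, ∃ N : ℕ, ∀ x ∈ η.1 ^ N, ∃ ρ ∉ η.1, ρ * x ∈ Ideal.span {c} := fun η => minpow _ _ η.2
  choose N hN using hN
  cases nonempty_fintype M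
  let e0 := ∑ η, N η
  have hNe : ∀ η, N η ≤ p ^ e0 := fun η =>
    (Finset.single_le_sum (f := N) (fun _ _ => Nat.zero_le _) (Finset.mem_univ η)).trans
      (Nat.lt_pow_self (Fact.out : p.Prime).one_lt).le
  have h5 : ∀ a, ∃ e N : ℕ, ∃ s, r a ^ N • ((w a : S) ^ p ^ e0) ^ p ^ e = algebraMap R S s := by
    intro a
    apply H5 (r a) (hrm a)
    intro v hv hv1 hav
    by_cases hcv : c ∈ v
    · have hvM : v ∈ M := min_of_hle1 _ c (Ideal.mem_span_singleton_self c) hc v hv1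
        ((Ideal.span_singleton_le_iff_mem _).2 hcv)
      obtain ⟨ρ, hρ, s, h⟩ := hw ⟨v, hvM⟩ a hav
      obtain ⟨ρ', hρ', z, hz⟩ := minpow_alg c v (N ⟨v, hvM⟩) (hN ⟨v, hvM⟩) _ h (p ^ e0) (hNe _)
      rw [sub_pow_char_pow] at hz
      obtain ⟨y, hy⟩ := hcB z
      refine ⟨ρ' * ρ ^ p ^ e0, fun h => (hv.mem_or_mem h).elim hρ' fun h => hρ (hv.mem_of_pow_mem _ h),
        ρ' * s ^ p ^ e0 + y, ?_⟩
      have h6 : (ρ' * ρ ^ p ^ e0) • w a ^ p ^ e0 = algebraMap R B (ρ' * s ^ p ^ e0 + y) := by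
        rw [map_add, ← hy, ← hz, mul_smul, ← smul_pow, smul_sub, ← map_pow, Algebra.smul_def ρ' (algebraMap R B _),
          ← map_mul, add_sub_cancel]
      exact congrArg Subtype.val h6
    · obtain ⟨y, hy⟩ := hcB (w a ^ p ^ e0)
      exact ⟨c, hcv, y, congrArg Subtype.val hy⟩
  choose e N' s hs using h5
  cases nonempty_fintype α
  let e1 := ∑ a, e a
  have he : ∀ a, e a ≤ e1 := fun a => Finset.single_le_sum (f := e) (fun _ _ => Nat.zero_le _) (Finset.mem_univ a)
  have hp0 : 0 < p := (Fact.out : p.Prime).pos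
  refine ⟨n * p ^ (e0 + e1), Nat.mul_pos hn (pow_pos hp0 _), (b : S) ^ p ^ (e0 + e1), (b' : S) ^ p ^ (e0 + e1), ?_, ?_⟩
  · rw [← mul_pow]
    have : (b : S) * b' = 1 := congrArg Subtype.val hb'
    rw [this, one_pow]
  · intro a
    obtain ⟨y, hy⟩ := im_pow _ _ (p ^ (e1 - e a)) ⟨s a, hs a⟩
    refine ⟨N' a * p ^ (e1 - e a), y, ?_⟩
    rw [← hy, ← pow_mul, ← pow_mul, ← pow_mul, ← pow_add, ← pow_add]
    have h7 : e0 + e a + (e1 - e a) = e0 + e1 := by have := he a; omega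
    rw [add_assoc] at h7
    rw [h7]
    congr 1
    show _ = ((b' : S) * β a ^ n) ^ _
    rw [mul_pow, pow_mul]

end Core2

section HFive

/-- denominators ideal of all powers of `w`. -/
def denI {A C : Type*} [CommRing A] [CommRing C] (φ : A →+* C) (w : C) : Ideal A where
  carrier := {a | ∀ k : ℕ, ∃ b, φ a * w ^ k = φ b}
  add_mem' := by
    intro a b ha hb k
    obtain ⟨x, hx⟩ := ha k
    obtain ⟨y, hy⟩ := hb k
    exact ⟨x + y, by rw [map_add, add_mul, hx, hy, map_add]⟩
  zero_mem' := fun k => ⟨0, by simp⟩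
  smul_mem' := by
    intro c a ha k
    obtain ⟨x, hx⟩ := ha k
    exact ⟨c * x, by rw [smul_eq_mul, map_mul, mul_assoc, hx, map_mul]⟩

lemma denI_EJ {A C : Type*} [CommRing A] [CommRing C] (φ : A →+* C) (w : C) : w ∈ EJ φ (denI φ w) := by
  intro a ha
  obtain ⟨a', ha'⟩ := ha 1
  refine ⟨a', fun k => ?_, by rw [mul_comm, ← ha', pow_one]⟩
  obtain ⟨b, hb⟩ := ha (k + 1)
  exact ⟨b, by rw [← hb, ← ha', pow_one, pow_succ', mul_assoc]⟩

lemma denI_pow {A C : Type*} [CommRing A] [CommRing C] (φ : A →+* C) (w : C) (hw : φ.IsIntegralElem w) :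
    ∃ d : ℕ, ∀ ρ a, φ ρ * w = φ a → ρ ^ d ∈ denI φ w := by
  obtain ⟨P, hP, hPw⟩ := hw
  refine ⟨P.natDegree, fun ρ a h => ?_⟩
  intro k
  induction k using Nat.strong_induction_on with
  | _ k ih =>
    by_cases hk : k ≤ P.natDegree
    · obtain ⟨m, hm⟩ := Nat.exists_eq_add_of_le hk
      refine ⟨ρ ^ m * a ^ k, ?_⟩
      rw [map_mul, map_pow φ a, ← h, map_pow, map_pow, mul_pow, hm, pow_add]; ring
    · obtain ⟨m, hm⟩ := Nat.exists_eq_add_of_le (not_le.1 hk).le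
      choose b hb using ih
      rw [Polynomial.eval₂_eq_sum_range, Finset.sum_range_succ, hP.coeff_natDegree, map_one, one_mul] at hPw
      have h1 : w ^ k = - ∑ i ∈ Finset.range P.natDegree, φ (P.coeff i) * w ^ (i + m) := by
        have : ∑ i ∈ Finset.range P.natDegree, φ (P.coeff i) * w ^ (i + m) =
            (∑ i ∈ Finset.range P.natDegree, φ (P.coeff i) * w ^ i) * w ^ m := by
          rw [Finset.sum_mul]
          exact Finset.sum_congr rfl fun i _ => by rw [pow_add, mul_assoc]
        rw [this, hm, pow_add]
        linear_combination w ^ m * hPw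
      refine ⟨- ∑ i ∈ (Finset.range P.natDegree).attach, P.coeff i.1 * b (i.1 + m) (by
        have := Finset.mem_range.1 i.2; omega), ?_⟩
      rw [h1, map_neg, map_sum, mul_neg, Finset.mul_sum, ← Finset.sum_attach]
      congr 1
      refine Finset.sum_congr rfl fun i _ => ?_
      rw [map_mul, ← hb, mul_left_comm]

lemma avoid {A : Type*} [CommRing A] (P : Ideal A) [hP : P.IsPrime] (s : Set (Ideal A)) (hs : s.Finite)
    (h : ∀ v ∈ s, ¬ v ≤ P) : ∃ h ∉ P, ∀ v ∈ s, h ∈ v := by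
  classical
  have : ∀ v : s, ∃ h ∈ v.1, h ∉ P := fun v => Set.not_subset.1 (h v.1 v.2)
  choose f hf hfP using this
  haveI := hs.fintype
  refine ⟨∏ v, f v, fun h => ?_, fun v hv => ?_⟩
  · obtain ⟨v, -, hv⟩ := (Ideal.IsPrime.prod_mem_iff (p := P)).1 h
    exact hfP v hv
  · rw [← Finset.mul_prod_erase _ _ (Finset.mem_univ (⟨v, hv⟩ : s))]
    exact v.mul_mem_right _ (hf ⟨v, hv⟩)

lemma loc_pre {X Xb : Scheme.{u}} {ν : Xb ⟶ X} [IsAffineHom ν] {U : X.Opens} (hU : IsAffineOpen U) (g : Γ(X, U)) :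
    letI : Algebra Γ(Xb, ν ⁻¹ᵁ U) Γ(Xb, ν ⁻¹ᵁ X.basicOpen g) :=
      (Xb.presheaf.map (homOfLE (ν.preimage_mono (X.basicOpen_le g))).op).hom.toAlgebra
    IsLocalization.Away ((ν.app U).hom g) Γ(Xb, ν ⁻¹ᵁ X.basicOpen g) := by
  let : Algebra Γ(Xb, ν ⁻¹ᵁ U) Γ(Xb, Xb.basicOpen (ν.app _ g)) :=
    (Xb.presheaf.map (homOfLE (Xb.basicOpen_le _)).op).hom.toAlgebra
  rw! (castMode := .all) [ν.preimage_basicOpen g]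
  exact (hU.preimage ν).isLocalization_basicOpen _

lemma H5A {X Xb : Scheme.{u}} [IsLocallyNoetherian X] (hS2 : IsTopologicallyS2 X) {ν : Xb ⟶ X} (hnu : IsNormalization ν)
    (p : ℕ) [Fact p.Prime] (hpX : ∀ U : X.Opens, (p : Γ(X, U)) = 0) {U : X.Opens} (hU : IsAffineOpen U)
    (P : Ideal Γ(X, U)) [P.IsPrime] (r : Γ(X, U)) (w : Γ(Xb, ν ⁻¹ᵁ U))
    (H : ∀ v : Ideal Γ(X, U), v.IsPrime → v ≤ P → Hle1 v → r ∉ v → ∃ ρ ∉ v, ∃ a, (ν.app U).hom ρ * w = (ν.app U).hom a) :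
    ∃ h ∉ P, ∃ e N : ℕ, ∃ a, (ν.app U).hom ((r * h) ^ N) * w ^ p ^ e = (ν.app U).hom a := by
  haveI : IsAffineHom ν := hnu.1
  haveI : IsNoetherianRing Γ(X, U) := IsLocallyNoetherian.component_noetherian ⟨U, hU⟩
  obtain ⟨-, -, n3, n4⟩ := norm_facts hnu U hU
  set φ := (ν.app U).hom with hφ
  let 𝔞 := denI φ w
  obtain ⟨d, hd⟩ := denI_pow φ w (n4 w)
  obtain ⟨j, hj, a0, ha0⟩ := n3 w
  have hj𝔞 : j ^ d ∈ 𝔞 := hd j a0 (by rw [mul_comm, ha0])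
  have hjm : ∀ q ∈ minimalPrimes Γ(X, U), j ^ d ∉ q := fun q hq h => hj q hq (hq.1.1.mem_of_pow_mem _ h)
  obtain ⟨h, hhP, hh⟩ := avoid P {v ∈ 𝔞.minimalPrimes | ¬ v ≤ P}
    ((Ideal.finite_minimalPrimes_of_isNoetherianRing _ 𝔞).subset fun v hv => hv.1) (fun v hv => hv.2)
  have hchain : ∀ v : Ideal Γ(X, U), v.IsPrime → 𝔞 ≤ v → r * h ∉ v → ¬ Hle1 v := by
    intro v hv h𝔞 hrh h1
    have hm : v ∈ 𝔞.minimalPrimes := min_of_hle1 𝔞 _ hj𝔞 hjm v h1 h𝔞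
    have hvP : v ≤ P := by
      by_contra hvP
      exact hrh (v.mul_mem_left _ (hh v ⟨hm, hvP⟩))
    obtain ⟨ρ, hρ, a, ha⟩ := H v hv hvP h1 (fun hr => hrh (v.mul_mem_right _ hr))
    exact hρ (hv.mem_of_pow_mem _ (h𝔞 (hd ρ a ha)))
  let g := r * h
  let U' := X.basicOpen g
  have hU' : IsAffineOpen U' := hU.basicOpen g
  have hle : U' ≤ U := X.basicOpen_le g
  letI : Algebra Γ(X, U) Γ(X, U') := (X.presheaf.map (homOfLE hle).op).hom.toAlgebra
  haveI : IsLocalization.Away g Γ(X, U') := hU.isLocalization_basicOpen g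
  letI : Algebra Γ(Xb, ν ⁻¹ᵁ U) Γ(Xb, ν ⁻¹ᵁ U') := (Xb.presheaf.map (homOfLE (ν.preimage_mono hle)).op).hom.toAlgebra
  haveI : IsLocalization.Away (φ g) Γ(Xb, ν ⁻¹ᵁ U') :=
    loc_pre hU g
  have hcomm : ∀ a, algebraMap Γ(Xb, ν ⁻¹ᵁ U) Γ(Xb, ν ⁻¹ᵁ U') (φ a) = (ν.app U').hom (algebraMap Γ(X, U) Γ(X, U') a) :=
    fun a => (congr($(ν.naturality (homOfLE hle).op) a)).symm
  obtain ⟨e, r', hr'⟩ := ts2_app hS2 hnu p hpX hU' (𝔞.map (algebraMap Γ(X, U) Γ(X, U'))) (by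
    intro Q hQ hQ𝔞
    have hd := (IsLocalization.isPrime_iff_isPrime_disjoint (Submonoid.powers g) Γ(X, U') Q).1 hQ
    have h3 : ¬ Hle1 (Q.comap (algebraMap Γ(X, U) Γ(X, U'))) := by
      refine hchain _ hd.1 (Ideal.map_le_iff_le_comap.1 hQ𝔞) fun hg => ?_
      exact Set.disjoint_left.1 hd.2 (Submonoid.mem_powers g) hg
    unfold Hle1 at h3
    push Not at h3
    obtain ⟨q0, q1, hq0, hq1, h01, h1Q, -⟩ := h3
    have d1 : Disjoint (Submonoid.powers g : Set Γ(X, U)) q1 := hd.2.mono_right h1Q.le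
    have d0 : Disjoint (Submonoid.powers g : Set Γ(X, U)) q0 := d1.mono_right h01.le
    have e1 := IsLocalization.under_map_of_isPrime_disjoint (Submonoid.powers g) Γ(X, U') hq1 d1
    have e0 := IsLocalization.under_map_of_isPrime_disjoint (Submonoid.powers g) Γ(X, U') hq0 d0
    have hQQ := IsLocalization.map_under (Submonoid.powers g) Γ(X, U') Q
    refine ⟨q0.map (algebraMap _ _), q1.map (algebraMap _ _), IsLocalization.isPrime_of_isPrime_disjoint _ _ _ hq0 d0,
      IsLocalization.isPrime_of_isPrime_disjoint _ _ _ hq1 d1, lt_of_le_of_ne (Ideal.map_mono h01.le) ?_,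
      lt_of_le_of_ne ?_ ?_⟩
    · intro h
      rw [h, e1] at e0
      exact h01.ne e0.symm
    · exact (Ideal.map_mono h1Q.le).trans hQQ.le
    · intro h
      rw [h] at e1
      exact h1Q.ne e1.symm) (algebraMap Γ(Xb, ν ⁻¹ᵁ U) Γ(Xb, ν ⁻¹ᵁ U') w) 
      (EJ_map φ 𝔞 _ _ _ hcomm w (denI_EJ φ w))
  obtain ⟨n, a, ha⟩ := IsLocalization.Away.surj g r'
  have h4 : algebraMap Γ(Xb, ν ⁻¹ᵁ U) Γ(Xb, ν ⁻¹ᵁ U') (φ (g ^ n) * w ^ p ^ e) = algebraMap _ _ (φ a) := by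
    rw [map_mul, hcomm, hcomm, ← ha, map_pow _ w, hr', map_mul, mul_comm, map_pow]
  obtain ⟨⟨_, m, rfl⟩, hm⟩ := IsLocalization.exists_of_eq (M := Submonoid.powers (φ g)) h4
  refine ⟨h, hhP, e, m + n, g ^ m * a, ?_⟩
  show φ (g ^ (m + n)) * _ = _
  rw [pow_add, map_mul, mul_assoc, map_mul, map_pow φ g m]
  exact hm

end HFive

section LocRing

lemma lr_unit {A R : Type u} [CommRing A] [CommRing R] (P : Ideal A) [P.IsPrime]
    [Algebra A R] [IsLocalization.AtPrime R P] (h : A) (hh : h ∉ P) : IsUnit (algebraMap A R h) :=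
  IsLocalization.map_units (M := P.primeCompl) R ⟨h, hh⟩

lemma lr_numR {A R : Type u} [CommRing A] [CommRing R] (P : Ideal A) [P.IsPrime]
    [Algebra A R] [IsLocalization.AtPrime R P] (r : R) : ∃ h ∉ P, ∃ a, algebraMap A R h * r = algebraMap A R a := by
  obtain ⟨⟨a, h⟩, e⟩ := IsLocalization.surj P.primeCompl r
  exact ⟨h.1, h.2, a, by rw [mul_comm]; exact e⟩

lemma lr_numS {A C R S : Type u} [CommRing A] [CommRing C] [CommRing R] [CommRing S] (φ : A →+* C) (P : Ideal A) [P.IsPrime]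
    [Algebra A R] [IsLocalization.AtPrime R P] [Algebra R S] [Algebra C S] [IsLocalization (P.primeCompl.map φ) S]
    (hcomm : ∀ a, algebraMap R S (algebraMap A R a) = algebraMap C S (φ a)) (s : S) : ∃ h ∉ P, ∃ c, algebraMap A R h • s = algebraMap C S c := by
  obtain ⟨⟨c, ⟨_, h, hh, rfl⟩⟩, e⟩ := IsLocalization.surj (P.primeCompl.map φ) s
  exact ⟨h, hh, c, by rw [Algebra.smul_def, hcomm, mul_comm]; exact e⟩

lemma lr_eq {A C S : Type u} [CommRing A] [CommRing C] [CommRing S] (φ : A →+* C) (P : Ideal A) [P.IsPrime]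
    [Algebra C S] [IsLocalization (P.primeCompl.map φ) S]
    (c d : C) (e : algebraMap C S c = algebraMap C S d) : ∃ h ∉ P, φ h * c = φ h * d := by
  obtain ⟨⟨_, h, hh, rfl⟩, e⟩ := IsLocalization.exists_of_eq (M := P.primeCompl.map φ) e
  exact ⟨h, hh, e⟩

lemma lr_integral {A C R S : Type u} [CommRing A] [CommRing C] [CommRing R] [CommRing S] (φ : A →+* C) (P : Ideal A) [P.IsPrime]
    [Algebra A R] [IsLocalization.AtPrime R P] [Algebra R S] [Algebra C S] [IsLocalization (P.primeCompl.map φ) S]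
    (hcomm : ∀ a, algebraMap R S (algebraMap A R a) = algebraMap C S (φ a)) (hφ : φ.IsIntegral) : Algebra.IsIntegral R S := by
  refine ⟨fun s => ?_⟩
  obtain ⟨h, hh, c, e⟩ := lr_numS (R := R) φ P hcomm s
  have h1 : IsIntegral R (algebraMap C S c) := by
    obtain ⟨f, hf, hfc⟩ := hφ c
    refine ⟨f.map (algebraMap A R), hf.map _, ?_⟩
    rw [Polynomial.eval₂_map]
    have : (algebraMap R S).comp (algebraMap A R) = (algebraMap C S).comp φ := RingHom.ext hcomm
    rw [this, ← Polynomial.hom_eval₂, hfc, map_zero]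
  rw [← e] at h1
  obtain ⟨u, hu⟩ := lr_unit (R := R) P h hh
  have h2 := h1.smul ((u⁻¹ : Rˣ) : R)
  rwa [← hu, smul_smul, Units.inv_mul, one_smul] at h2

lemma lr_nil {A C R S : Type u} [CommRing A] [CommRing C] [CommRing R] [CommRing S] (φ : A →+* C) (P : Ideal A) [P.IsPrime]
    [Algebra A R] [IsLocalization.AtPrime R P] [Algebra R S] [Algebra C S] [IsLocalization (P.primeCompl.map φ) S]
    (hcomm : ∀ a, algebraMap R S (algebraMap A R a) = algebraMap C S (φ a)) (hφ : ∀ a, φ a = 0 → IsNilpotent a) (r : R) (hr : algebraMap R S r = 0) : IsNilpotent r := by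
  obtain ⟨h, hh, a, e⟩ := lr_numR P r
  have h1 : algebraMap C S (φ a) = algebraMap C S 0 := by rw [← hcomm, ← e, map_mul, hr, mul_zero, map_zero]
  obtain ⟨h', hh', e'⟩ := lr_eq φ P _ _ h1
  rw [mul_zero, ← map_mul] at e'
  have h2 := (hφ _ e').map (algebraMap A R)
  rw [map_mul, ← e] at h2
  obtain ⟨n, hn⟩ := h2
  rw [mul_pow, mul_pow] at hn
  refine ⟨n, ?_⟩
  have u1 := (lr_unit (R := R) P h hh).pow n
  have u2 := (lr_unit (R := R) P h' hh').pow n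
  exact (u1.mul_right_eq_zero).1 ((u2.mul_right_eq_zero).1 hn)

lemma lr_H2 {A C R S : Type u} [CommRing A] [CommRing C] [CommRing R] [CommRing S] (φ : A →+* C) (P : Ideal A) [P.IsPrime]
    [Algebra A R] [IsLocalization.AtPrime R P] [Algebra R S] [Algebra C S] [IsLocalization (P.primeCompl.map φ) S]
    (hcomm : ∀ a, algebraMap R S (algebraMap A R a) = algebraMap C S (φ a)) (n3 : ∀ c, ∃ j : A, (∀ q ∈ minimalPrimes A, j ∉ q) ∧ ∃ a, c * φ j = φ a) (s : S) :
    ∃ j : R, (∀ q ∈ minimalPrimes R, j ∉ q) ∧ ∃ a, j • s = algebraMap R S a := by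
  obtain ⟨h, hh, c, e⟩ := lr_numS (R := R) φ P hcomm s
  obtain ⟨j, hj, a, ha⟩ := n3 c
  obtain ⟨u, hu⟩ := lr_unit (R := R) P h hh
  refine ⟨algebraMap A R j, ?_, ((u⁻¹ : Rˣ) : R) * algebraMap A R a, ?_⟩
  · intro q hq hjq
    refine hj (q.comap (algebraMap A R)) ?_ hjq
    have h1 := IsLocalization.minimalPrimes_map P.primeCompl R (⊥ : Ideal A)
    rw [Ideal.map_bot] at h1
    exact h1.le hq
  · have h2 : algebraMap A R j • (algebraMap A R h • s) = algebraMap R S (algebraMap A R a) := by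
      rw [e, Algebra.smul_def, hcomm, hcomm, mul_comm, ← map_mul, ha]
    rw [map_mul, ← Algebra.smul_def, ← h2, ← hu, smul_smul, smul_smul, mul_assoc, mul_left_comm, Units.inv_mul, mul_one]

lemma lr_disj {A : Type u} [CommRing A] (P : Ideal A) [P.IsPrime] (v : Ideal A) (hv : v ≤ P) : Disjoint (P.primeCompl : Set A) v :=
  Set.disjoint_left.2 fun _ h h' => h (hv h')

lemma lr_comap_le {A R : Type u} [CommRing A] [CommRing R] (P : Ideal A) [P.IsPrime]
    [Algebra A R] [IsLocalization.AtPrime R P] (η : Ideal R) [hη : η.IsPrime] : η.comap (algebraMap A R) ≤ P := by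
  have := (IsLocalization.isPrime_iff_isPrime_disjoint P.primeCompl R η).1 hη
  intro a ha
  by_contra h
  exact Set.disjoint_left.1 this.2 h ha

lemma lr_hle {A R : Type u} [CommRing A] [CommRing R] (P : Ideal A) [P.IsPrime]
    [Algebra A R] [IsLocalization.AtPrime R P] (v : Ideal A) (hv : v.IsPrime) (hvP : v ≤ P) (h : Hle1 v) : Hle1 (v.map (algebraMap A R)) := by
  intro q0 q1 h0 h1 h01 h1v
  have e := IsLocalization.under_map_of_isPrime_disjoint P.primeCompl R hv (lr_disj P v hvP)
  refine h (q0.comap (algebraMap A R)) (q1.comap (algebraMap A R)) inferInstance inferInstance ?_ ?_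
  · refine lt_of_le_of_ne (Ideal.comap_mono h01.le) fun e' => h01.ne ?_
    have := congrArg (Ideal.map (algebraMap A R)) e'
    rwa [IsLocalization.map_under P.primeCompl, IsLocalization.map_under P.primeCompl] at this
  · refine lt_of_le_of_ne ?_ fun e' => h1v.ne ?_
    · exact (Ideal.comap_mono h1v.le).trans e.le
    · rw [← IsLocalization.map_under P.primeCompl R q1]
      exact congrArg _ e'

lemma lr_hle' {A R : Type u} [CommRing A] [CommRing R] (P : Ideal A) [P.IsPrime]
    [Algebra A R] [IsLocalization.AtPrime R P] (η : Ideal R) [hη : η.IsPrime] (h : Hle1 η) : Hle1 (η.comap (algebraMap A R)) := by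
  intro q0 q1 h0 h1 h01 h1v
  have hP := lr_comap_le (R := R) P η
  have e1 := IsLocalization.under_map_of_isPrime_disjoint P.primeCompl R h1 (lr_disj P q1 (h1v.le.trans hP))
  have e0 := IsLocalization.under_map_of_isPrime_disjoint P.primeCompl R h0 (lr_disj P q0 ((h01.le.trans h1v.le).trans hP))
  refine h (q0.map (algebraMap A R)) (q1.map (algebraMap A R))
    (IsLocalization.isPrime_of_isPrime_disjoint P.primeCompl R _ h0 (lr_disj P q0 ((h01.le.trans h1v.le).trans hP)))
    (IsLocalization.isPrime_of_isPrime_disjoint P.primeCompl R _ h1 (lr_disj P q1 (h1v.le.trans hP))) ?_ ?_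
  · refine lt_of_le_of_ne (Ideal.map_mono h01.le) fun e' => h01.ne ?_
    rw [e', e1] at e0; exact e0.symm
  · refine lt_of_le_of_ne (Ideal.map_le_iff_le_comap.2 h1v.le) fun e' => h1v.ne ?_
    rw [e'] at e1; exact e1.symm

lemma lr_H3 {A R : Type u} [CommRing A] [CommRing R] (P : Ideal A) [P.IsPrime]
    [Algebra A R] [IsLocalization.AtPrime R P] [IsLocalRing R] (hcat : IsCatenaryRing A)
    (hd : ∀ q : Ideal A, q.IsPrime → q ∈ minimalPrimes A → q ≤ P → ∃ p₁ p₂ : Ideal A, p₁.IsPrime ∧ p₂.IsPrime ∧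
      q < p₁ ∧ p₁ < p₂ ∧ p₂ < P) (η : Ideal R) (hη : η.IsPrime) (h : Hle1 η) :
    ∃ p₁ : Ideal R, p₁.IsPrime ∧ η < p₁ ∧ p₁ < IsLocalRing.maximalIdeal R := by
  let v := η.comap (algebraMap A R)
  have hvP : v ≤ P := lr_comap_le P η
  have hv1 : Hle1 v := lr_hle' P η h
  obtain ⟨q, hq, hqv⟩ := Ideal.exists_minimalPrimes_le (I := (⊥ : Ideal A)) (J := v) bot_le
  obtain ⟨p₁, p₂, hp₁, hp₂, h1, h2, h3⟩ := hd q hq.1.1 hq (hqv.trans hvP)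
  suffices ∃ y : Ideal A, y.IsPrime ∧ v < y ∧ y < P by
    obtain ⟨y, hy, hvy, hyP⟩ := this
    have e := IsLocalization.under_map_of_isPrime_disjoint P.primeCompl R hy (lr_disj P y hyP.le)
    have em := IsLocalization.AtPrime.under_maximalIdeal R P
    refine ⟨y.map (algebraMap A R), IsLocalization.isPrime_of_isPrime_disjoint P.primeCompl R _ hy (lr_disj P y hyP.le),
      lt_of_le_of_ne ?_ ?_, lt_of_le_of_ne ?_ ?_⟩
    · rw [← IsLocalization.map_under P.primeCompl R η]
      exact Ideal.map_mono hvy.le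
    · intro h'
      rw [← h'] at e
      exact hvy.ne e
    · rw [Ideal.map_le_iff_le_comap]
      exact hyP.le.trans em.ge
    · intro h'
      rw [h'] at e
      exact hyP.ne (e.symm.trans em)
  by_contra hno
  push Not at hno
  have hvq : v ≠ q := by
    rintro e
    exact hno p₁ hp₁ (e ▸ h1) (h2.trans h3)
  have hvPne : v ≠ P := by
    rintro e
    exact hv1 q p₁ hq.1.1 hp₁ h1 (e ▸ h2.trans h3)
  exact catenary_absurd (⟨q, hq.1.1⟩ : PrimeSpectrum A) ⟨v, inferInstance⟩ ⟨P, inferInstance⟩ ⟨p₁, hp₁⟩ ⟨p₂, hp₂⟩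
    (hcat _ _ _ hqv hvP) h1 h2 h3 (fun z hz hz' => hv1 q z.asIdeal hq.1.1 z.2 hz hz')
    (fun z hz hz' => hno z.asIdeal z.2 hz hz')

end LocRing

section CoreApp

lemma lr_H5 {A C R S : Type u} [CommRing A] [CommRing C] [CommRing R] [CommRing S] (φ : A →+* C) (P : Ideal A) [P.IsPrime]
    [Algebra A R] [IsLocalization.AtPrime R P] [Algebra R S] [Algebra C S] [IsLocalization (P.primeCompl.map φ) S]
    (hcomm : ∀ a, algebraMap R S (algebraMap A R a) = algebraMap C S (φ a)) (p : ℕ)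
    (HA : ∀ (r : A) (w : C), (∀ v : Ideal A, v.IsPrime → v ≤ P → Hle1 v → r ∉ v → ∃ ρ ∉ v, ∃ a, φ ρ * w = φ a) →
      ∃ h ∉ P, ∃ e N : ℕ, ∃ a, φ ((r * h) ^ N) * w ^ p ^ e = φ a)
    (r : R) (w : S)
    (H : ∀ v : Ideal R, v.IsPrime → Hle1 v → r ∉ v → ∃ ρ ∉ v, ∃ a, ρ • w = algebraMap R S a) :
    ∃ e N : ℕ, ∃ a, r ^ N • w ^ p ^ e = algebraMap R S a := by
  obtain ⟨h0, hh0, w0, hw0⟩ := lr_numS (R := R) φ P hcomm w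
  obtain ⟨h1, hh1, r0, hr0⟩ := lr_numR P r
  obtain ⟨h, hh, e, N, a, ha⟩ := HA r0 w0 (by
    intro v hv hvP hv1 hrv
    have e1 := IsLocalization.under_map_of_isPrime_disjoint P.primeCompl R hv (lr_disj P v hvP)
    have hvR : (v.map (algebraMap A R)).IsPrime :=
      IsLocalization.isPrime_of_isPrime_disjoint P.primeCompl R _ hv (lr_disj P v hvP)
    obtain ⟨ρ, hρ, a, ha⟩ := H (v.map (algebraMap A R)) hvR (lr_hle P v hv hvP hv1) (by
      intro hr
      apply hrv
      rw [← e1]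
      show algebraMap A R r0 ∈ v.map (algebraMap A R)
      rw [← hr0]
      exact Ideal.mul_mem_left _ _ hr)
    obtain ⟨h2, hh2, ρ0, hρ0⟩ := lr_numR P ρ
    obtain ⟨h3, hh3, a0, ha0⟩ := lr_numR P a
    have h5 : algebraMap C S (φ (ρ0 * h3) * w0) = algebraMap C S (φ (a0 * h2 * h0)) := by
      rw [← hcomm, map_mul, ← hcomm, ← hw0, map_mul (algebraMap A R), map_mul (algebraMap A R), map_mul (algebraMap A R),
        ← hρ0, ← ha0, ← Algebra.smul_def, smul_smul,
        show algebraMap A R h2 * ρ * algebraMap A R h3 * algebraMap A R h0 =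
          (algebraMap A R h3 * algebraMap A R h2 * algebraMap A R h0) * ρ by ring, mul_smul, ha, Algebra.smul_def, ← map_mul]
      congr 1; ring
    obtain ⟨h4, hh4, h6⟩ := lr_eq φ P _ _ h5
    refine ⟨h4 * (ρ0 * h3), ?_, h4 * (a0 * h2 * h0), by rw [map_mul, map_mul φ h4, ← h6, mul_assoc]⟩
    have hρ0v : ρ0 ∉ v := by
      intro h
      rw [← e1] at h
      have h : algebraMap A R ρ0 ∈ v.map (algebraMap A R) := h
      rw [← hρ0] at h
      have hh2v : algebraMap A R h2 ∉ v.map (algebraMap A R) := fun h' => hh2 (hvP (by rw [← e1]; exact h'))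
      exact (hvR.mem_or_mem h).elim hh2v hρ
    exact fun h => (hv.mem_or_mem h).elim (fun h => hh4 (hvP h))
      fun h => (hv.mem_or_mem h).elim hρ0v fun h => hh3 (hvP h))
  obtain ⟨u1, hu1⟩ := (lr_unit (R := R) P h hh).pow N
  obtain ⟨u2, hu2⟩ := (lr_unit (R := R) P h0 hh0).pow (p ^ e)
  obtain ⟨u3, hu3⟩ := (lr_unit (R := R) P h1 hh1).pow N
  refine ⟨e, N, ((u1 * u2 * u3)⁻¹ : Rˣ) * algebraMap A R a, ?_⟩
  have h7 : ((u1 * u2 * u3 : Rˣ) : R) • (r ^ N • w ^ p ^ e) = algebraMap R S (algebraMap A R a) := by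
    rw [hcomm, ← ha, map_mul, ← hcomm, map_pow _ w0, ← hw0, smul_pow, mul_pow, map_mul (algebraMap A R), map_pow _ r0, ← hr0,
      map_pow _ h, ← Algebra.smul_def, smul_smul, smul_smul, mul_pow, Units.val_mul, Units.val_mul, hu1, hu2, hu3]
    congr 1; ring
  rw [map_mul, ← h7, ← Algebra.smul_def, smul_smul ((u1 * u2 * u3)⁻¹ : Rˣ).val, Units.inv_mul, one_smul]

/-- The core statement for the local ring of a scheme and its normalization. -/
lemma core_app {X Xb : Scheme.{u}} (hexc : IsExcellentScheme X) [IsLocallyNoetherian X] (hdim : PureDimGE X 3)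
    (hS2 : IsTopologicallyS2 X) {ν : Xb ⟶ X} (hnu : IsNormalization ν)
    (p : ℕ) [Fact p.Prime] (hpX : ∀ U : X.Opens, (p : Γ(X, U)) = 0) (x : X) (hres : Finite (X.residueField x))
    {U : X.Opens} (hU : IsAffineOpen U) (hx : x ∈ U) {R S : Type u} [CommRing R] [IsLocalRing R] [CommRing S]
    [Finite (IsLocalRing.ResidueField R)]
    [Algebra Γ(X, U) R] [IsLocalization.AtPrime R (hU.primeIdealOf ⟨x, hx⟩).asIdeal] [Algebra R S]
    [Algebra Γ(Xb, ν ⁻¹ᵁ U) S]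
    [IsLocalization ((hU.primeIdealOf ⟨x, hx⟩).asIdeal.primeCompl.map (ν.app U).hom) S]
    (hcomm : ∀ a, algebraMap R S (algebraMap Γ(X, U) R a) = algebraMap Γ(Xb, ν ⁻¹ᵁ U) S ((ν.app U).hom a))
    {α : Type u} [Finite α] (r : α → R) (hrm : ∀ a, r a ∈ IsLocalRing.maximalIdeal R)
    (k : α → ℕ) (β β' : α → S) (hβ : ∀ a, β a * β' a = algebraMap R S (r a ^ k a))
    (hr : ∀ ζ : Ideal R, ζ.IsPrime → ζ ≠ IsLocalRing.maximalIdeal R → ∃ a, r a ∉ ζ)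
    (hββ : ∀ a a', ∃ N : ℕ, ∃ ρ : R, algebraMap R S ((r a * r a') ^ N) * (β a * β' a') = algebraMap R S ρ) :
    (∃ n > 0, ∃ b b' : S, b * b' = 1 ∧ ∀ a, ∃ N : ℕ, ∃ s, r a ^ N • (b' * β a ^ n) = algebraMap R S s) ∧
    Algebra.IsIntegral R S ∧ (∀ r : R, algebraMap R S r = 0 → IsNilpotent r) := by
  let P := (hU.primeIdealOf ⟨x, hx⟩).asIdeal
  haveI : IsNoetherianRing Γ(X, U) := (hexc U hU).1
  obtain ⟨n1, n2, n3, n4⟩ := norm_facts hnu U hU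
  haveI hint : Algebra.IsIntegral R S := lr_integral (ν.app U).hom P hcomm n4
  refine ⟨?_, hint, lr_nil (ν.app U).hom P hcomm (fun a => (n1 a).1)⟩
  haveI : IsNoetherianRing R := IsLocalization.isNoetherianRing P.primeCompl R inferInstance
  haveI : CharP R p := by
    rw [CharP.charP_iff_prime_eq_zero Fact.out]
    have := congrArg (algebraMap Γ(X, U) R) (hpX U)
    rwa [map_natCast, map_zero] at this
  have hcat : IsCatenaryRing Γ(X, U) := by
    refine cat_of_frac (MvPolynomial.eval₂Hom (RingHom.id _) (fun _ : Fin 0 => 0)) (fun b => ⟨1, MvPolynomial.C b, ?_, ?_⟩)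
      ((hexc U hU).2.1 0)
    · rw [map_one]; exact isUnit_one
    · rw [map_one, one_mul, MvPolynomial.eval₂Hom_C]; rfl
  refine core p (lr_H2 (ν.app U).hom P hcomm n3) (lr_H3 P hcat fun q hq hqm hqP => ?_)
    (fun η _ => cat_poly P.primeCompl (hexc U hU).2.1 η)
    (fun r _ w => lr_H5 (ν.app U).hom P hcomm p (fun r w => H5A hS2 hnu p hpX hU P r w) r w)
    r hrm k β β' hβ hr hββ
  exact dim_app hexc hdim p hpX x hres hU hx q hqm hqP

end CoreApp

section Glue

lemma resU_val (X : Scheme.{u}) {U V : X.Opens} (h : V ≤ U) (s : (Γ(X, U))ˣ) :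
    ((resU X h s : (Γ(X, V))ˣ) : Γ(X, V)) = X.presheaf.map (homOfLE h).op s := rfl

lemma sepU (X : Scheme.{u}) {α : Type u} (W : α → X.Opens) (U : X.Opens) (hW : ∀ a, W a ≤ U)
    (hc : U ≤ iSup W) (s t : (Γ(X, U))ˣ) (h : ∀ a, resU X (hW a) s = resU X (hW a) t) : s = t := by
  ext
  refine X.sheaf.eq_of_locally_eq' W U (fun a => homOfLE (hW a)) hc _ _ fun a => ?_
  exact congrArg Units.val (h a)

lemma glueU (X : Scheme.{u}) {α : Type u} (W : α → X.Opens) (U : X.Opens) (hW : ∀ a, W a ≤ U)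
    (hc : U ≤ iSup W) (f : ∀ a, (Γ(X, W a))ˣ)
    (h : ∀ a b, resU X (inf_le_left : W a ⊓ W b ≤ W a) (f a) = resU X (inf_le_right : W a ⊓ W b ≤ W b) (f b)) :
    ∃ s : (Γ(X, U))ˣ, ∀ a, resU X (hW a) s = f a := by
  have key : ∀ f : ∀ a, (Γ(X, W a))ˣ, (∀ a b, resU X (inf_le_left : W a ⊓ W b ≤ W a) (f a) = resU X (inf_le_right : W a ⊓ W b ≤ W b) (f b)) →
      ∃ s : Γ(X, U), ∀ a, X.presheaf.map (homOfLE (hW a)).op s = f a := by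
    intro f h
    obtain ⟨s, hs, -⟩ := X.sheaf.existsUnique_gluing' W U (fun a => homOfLE (hW a)) hc (fun a => (f a : Γ(X, W a)))
      (fun a b => congrArg Units.val (h a b))
    exact ⟨s, hs⟩
  obtain ⟨s, hs⟩ := key f h
  obtain ⟨s', hs'⟩ := key (fun a => (f a)⁻¹) (fun a b => by rw [map_inv, map_inv, h])
  have h1 : s * s' = 1 := by
    refine X.sheaf.eq_of_locally_eq' W U (fun a => homOfLE (hW a)) hc _ _ fun a => ?_
    show X.presheaf.map (homOfLE (hW a)).op (s * s') = X.presheaf.map (homOfLE (hW a)).op 1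
    rw [map_mul, hs, hs', map_one, Units.mul_inv]
  exact ⟨⟨s, s', h1, by rw [mul_comm, h1]⟩, fun a => Units.ext (hs a)⟩

lemma t_self {X : Scheme.{u}} {V : X.Opens} (L : LineBundleOn X V) (i : L.ι) {W : X.Opens} (h : W ≤ L.U i ⊓ L.U i) :
    resU X h (L.t i i) = 1 := by
  have := L.cocycle_res i i i (W := W) (le_inf h (h.trans inf_le_left)) h h h
  exact mul_eq_left.mp this

/-- A power of a line bundle is trivial if it is so on a covering family of opens. -/
lemma triv_of_local {X : Scheme.{u}} {V : X.Opens} (L : LineBundleOn X V) {α : Type u} (D : α → X.Opens) (i : α → L.ι)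
    (hD : ∀ a, D a ≤ L.U (i a)) (hc : V ≤ iSup D) (N : ℕ) (τ : ∀ a, (Γ(X, D a))ˣ)
    (h : ∀ a b, resU X (inf_le_inf (hD a) (hD b)) (L.t (i a) (i b)) ^ N * resU X inf_le_right (τ b) = resU X inf_le_left (τ a)) :
    (L.pow N).IsTrivial := by
  have h' : ∀ a b (W : X.Opens) (h1 : W ≤ D a) (h2 : W ≤ D b) (h3 : W ≤ L.U (i a) ⊓ L.U (i b)),
      resU X h3 (L.t (i a) (i b)) ^ N * resU X h2 (τ b) = resU X h1 (τ a) := by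
    intro a b W h1 h2 h3
    have := congrArg (resU X (le_inf h1 h2)) (h a b)
    rwa [map_mul, map_pow, resU_resU, resU_resU, resU_resU] at this
  have hloc : ∀ j, ∃ s : (Γ(X, L.U j))ˣ, ∀ a, resU X (inf_le_left : L.U j ⊓ D a ≤ L.U j) s =
      resU X (inf_le_inf le_rfl (hD a)) (L.t j (i a)) ^ N * resU X inf_le_right (τ a) := by
    intro j
    refine glueU X (fun a => L.U j ⊓ D a) (L.U j) (fun a => inf_le_left) ?_ _ ?_
    · rw [← inf_iSup_eq]
      exact le_inf le_rfl ((L.le j).trans hc)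
    · intro a b
      have hWa : (L.U j ⊓ D a) ⊓ (L.U j ⊓ D b) ≤ D a := inf_le_left.trans inf_le_right
      have hWb : (L.U j ⊓ D a) ⊓ (L.U j ⊓ D b) ≤ D b := inf_le_right.trans inf_le_right
      have hWj : (L.U j ⊓ D a) ⊓ (L.U j ⊓ D b) ≤ L.U j := inf_le_left.trans inf_le_left
      rw [map_mul, map_mul, map_pow, map_pow, resU_resU, resU_resU, resU_resU, resU_resU,
        ← h' a b _ hWa hWb (le_inf (hWa.trans (hD a)) (hWb.trans (hD b))), ← mul_assoc, ← mul_pow,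
        L.cocycle_res j (i a) (i b) (le_inf (le_inf hWj (hWa.trans (hD a))) (hWb.trans (hD b)))]
  choose s hs using hloc
  have key : ∀ j l : L.ι, L.t j l ^ N = resU X inf_le_left (s j) * (resU X inf_le_right (s l))⁻¹ := by
    intro j l
    refine sepU X (fun a => L.U j ⊓ L.U l ⊓ D a) _ (fun a => inf_le_left) ?_ _ _ ?_
    · show L.U j ⊓ L.U l ≤ _
      rw [← inf_iSup_eq]
      exact le_inf le_rfl ((inf_le_left.trans (L.le j)).trans hc)
    · intro a
      have hWj : L.U j ⊓ L.U l ⊓ D a ≤ L.U j := inf_le_left.trans inf_le_left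
      have hWl : L.U j ⊓ L.U l ⊓ D a ≤ L.U l := inf_le_left.trans inf_le_right
      have hWa : L.U j ⊓ L.U l ⊓ D a ≤ D a := inf_le_right
      have e1 := congrArg (resU X (le_inf hWj hWa)) (hs j a)
      have e2 := congrArg (resU X (le_inf hWl hWa)) (hs l a)
      rw [map_mul, map_pow, resU_resU, resU_resU, resU_resU] at e1 e2
      rw [map_mul, map_inv, eq_mul_inv_iff_mul_eq, resU_resU, resU_resU, e1, e2, map_pow, ← mul_assoc, ← mul_pow,
        L.cocycle_res j l (i a) (le_inf inf_le_left (hWa.trans (hD a)))]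
  exact ⟨s, key⟩

end Glue

section Setup

lemma resS_resS (X : Scheme.{u}) {U V W : X.Opens} (h1 : W ≤ V) (h2 : V ≤ U) (z : Γ(X, U)) :
    resS X h1 (resS X h2 z) = resS X (h1.trans h2) z := by
  show (X.presheaf.map (homOfLE h1).op) ((X.presheaf.map (homOfLE h2).op) z) = _
  rw [← CategoryTheory.comp_apply, ← Functor.map_comp, ← op_comp, homOfLE_comp]
  rfl

lemma resU_coe (X : Scheme.{u}) {U V : X.Opens} (h : V ≤ U) (s : (Γ(X, U))ˣ) :
    ((resU X h s : (Γ(X, V))ˣ) : Γ(X, V)) = resS X h s := rfl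

/-- Pull-back of sections as a ring homomorphism. -/
def gS {W Y : Scheme.{u}} (g : W ⟶ Y) {U : Y.Opens} {E : W.Opens} (e : E ≤ g ⁻¹ᵁ U) : Γ(Y, U) →+* Γ(W, E) :=
  (g.appLE U E e).hom

lemma mapU_coe {W Y : Scheme.{u}} (g : W ⟶ Y) {U : Y.Opens} {E : W.Opens} (e : E ≤ g ⁻¹ᵁ U) (s : (Γ(Y, U))ˣ) :
    ((LineBundleOn.mapU g e s : (Γ(W, E))ˣ) : Γ(W, E)) = gS g e s := rfl

lemma gS_resS {W Y : Scheme.{u}} (g : W ⟶ Y) {U U' : Y.Opens} {E : W.Opens} (hU : U' ≤ U)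
    (e : E ≤ g ⁻¹ᵁ U') (e' : E ≤ g ⁻¹ᵁ U) (z : Γ(Y, U)) : gS g e (resS Y hU z) = gS g e' z := by
  show (g.appLE U' E e) ((Y.presheaf.map (homOfLE hU).op) z) = (g.appLE U E e') z
  rw [← CategoryTheory.comp_apply, Scheme.Hom.map_appLE]

lemma resS_gS {W Y : Scheme.{u}} (g : W ⟶ Y) {U : Y.Opens} {E E' : W.Opens} (e : E ≤ g ⁻¹ᵁ U)
    (h : E' ≤ E) (z : Γ(Y, U)) : resS W h (gS g e z) = gS g (h.trans e) z := by
  show (W.presheaf.map (homOfLE h).op) ((g.appLE U E e) z) = (g.appLE U E' _) z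
  rw [← CategoryTheory.comp_apply, Scheme.Hom.appLE_map]

lemma gS_top {W Y : Scheme.{u}} (g : W ⟶ Y) {E : W.Opens} (e : E ≤ g ⁻¹ᵁ ⊤) (z : Γ(Y, ⊤)) :
    gS g e z = resS W le_top (g.appTop.hom z) := rfl

lemma aff_surj {Y : Scheme.{u}} [IsAffine Y] (r : Γ(Y, ⊤)) {D : Y.Opens} (hD : D = Y.basicOpen r) (z : Γ(Y, D)) :
    ∃ (N : ℕ) (z0 : Γ(Y, ⊤)), resS Y le_top z0 = resS Y le_top r ^ N * z := by
  letI := (Y.presheaf.map (homOfLE (le_top : D ≤ ⊤)).op).hom.toAlgebra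
  haveI := (isAffineOpen_top Y).isLocalization_of_eq_basicOpen r (homOfLE (le_top : D ≤ ⊤)) hD
  obtain ⟨⟨z0, ⟨_, N, rfl⟩⟩, h⟩ := IsLocalization.surj (Submonoid.powers r) z
  refine ⟨N, z0, ?_⟩
  have h' : z * resS Y le_top (r ^ N) = resS Y le_top z0 := h
  rw [← h', map_pow, mul_comm]

lemma aff_eq {Y : Scheme.{u}} [IsAffine Y] (r : Γ(Y, ⊤)) {D : Y.Opens} (hD : D = Y.basicOpen r) (z z' : Γ(Y, ⊤))
    (h : resS Y (le_top : D ≤ ⊤) z = resS Y le_top z') : ∃ c : ℕ, r ^ c * z = r ^ c * z' := by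
  letI := (Y.presheaf.map (homOfLE (le_top : D ≤ ⊤)).op).hom.toAlgebra
  haveI := (isAffineOpen_top Y).isLocalization_of_eq_basicOpen r (homOfLE (le_top : D ≤ ⊤)) hD
  obtain ⟨⟨_, c, rfl⟩, h⟩ := (IsLocalization.eq_iff_exists (Submonoid.powers r) Γ(Y, D)).mp (show algebraMap Γ(Y, ⊤) Γ(Y, D) z = algebraMap _ _ z' from h)
  exact ⟨c, h⟩

lemma aff_unit {Y : Scheme.{u}} (r : Γ(Y, ⊤)) {D : Y.Opens} (hD : D ≤ Y.basicOpen r) : IsUnit (resS Y (le_top : D ≤ ⊤) r) := by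
  have := (RingedSpace.isUnit_res_basicOpen (X := Y.toRingedSpace) r)
  have h2 := this.map (resS Y hD)
  rw [← resS_resS Y hD le_top]
  exact h2

lemma aff_beta {W : Scheme.{u}} [IsAffine W] (r : Γ(W, ⊤)) {E : W.Opens} (hE : E = W.basicOpen r) (s : (Γ(W, E))ˣ) :
    ∃ (k m n : ℕ) (β β' : Γ(W, ⊤)), β * β' = r ^ k ∧ resS W le_top β = resS W le_top r ^ m * (s : Γ(W, E)) ∧
      resS W le_top β' = resS W le_top r ^ n * ((s⁻¹ : (Γ(W, E))ˣ) : Γ(W, E)) := by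
  obtain ⟨m, β, hβ⟩ := aff_surj r hE (s : Γ(W, E))
  obtain ⟨n, β', hβ'⟩ := aff_surj r hE ((s⁻¹ : (Γ(W, E))ˣ) : Γ(W, E))
  obtain ⟨c, hc⟩ := aff_eq r hE (β * β') (r ^ (m + n)) (by
    rw [map_mul, hβ, hβ', map_pow, mul_mul_mul_comm, Units.mul_inv, mul_one, pow_add])
  refine ⟨c + (m + n), c + m, n, r ^ c * β, β', by rw [mul_assoc, hc, ← pow_add], ?_, hβ'⟩
  rw [map_mul, hβ, map_pow, pow_add, mul_assoc]

end Setup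

section Torsion

lemma gS_res_top {W Y : Scheme.{u}} (g : W ⟶ Y) {D : Y.Opens} {E : W.Opens} (e : E ≤ g ⁻¹ᵁ D) (z : Γ(Y, ⊤)) :
    gS g e (resS Y le_top z) = resS W le_top (g.appTop.hom z) :=
  (gS_resS g le_top e (fun _ _ => trivial) z).trans (gS_top g _ z)

lemma nil_of_surj {W Y : Scheme.{u}} (g : W ⟶ Y) (hg : Function.Surjective g.base) {D : Y.Opens}
    (hD : IsCompact (D : Set Y)) {E : W.Opens} (hE : E = g ⁻¹ᵁ D) (z : Γ(Y, D)) (h : gS g hE.le z = 0) : IsNilpotent z := by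
  rw [Scheme.isNilpotent_iff_basicOpen_eq_bot_of_isCompact hD]
  have h1 := Scheme.basicOpen_appLE g E D hE.le z
  have h2 : W.basicOpen (g.appLE D E hE.le z) = ⊥ := by
    rw [show g.appLE D E hE.le z = 0 from h, Scheme.basicOpen_zero]
  rw [h2] at h1
  rw [eq_bot_iff]
  intro y hy
  obtain ⟨w, rfl⟩ := hg y
  have : w ∈ E ⊓ g ⁻¹ᵁ (Y.basicOpen z) := ⟨by rw [hE]; exact Y.basicOpen_le z hy, hy⟩
  rw [← h1] at this
  exact this.elim

/-- If the pull-back of `s` to an open is a unit there, `s` is invertible on the image. -/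
lemma unit_of_surj {W Y : Scheme.{u}} (g : W ⟶ Y) (hg : Function.Surjective g.base) {D : Y.Opens}
    {E : W.Opens} (hE : E = g ⁻¹ᵁ D) (z : Γ(Y, ⊤)) (h : IsUnit (resS W (le_top : E ≤ ⊤) (g.appTop.hom z))) :
    IsUnit (resS Y (le_top : D ≤ ⊤) z) := by
  apply aff_unit
  intro y hy
  obtain ⟨w, rfl⟩ := hg y
  have hw : w ∈ E := by rw [hE]; exact hy
  have h2 : w ∈ W.basicOpen (resS W (le_top : E ≤ ⊤) (g.appTop.hom z)) := by
    rw [Scheme.basicOpen_of_isUnit _ h]; exact hw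
  have h3 := Scheme.basicOpen_res W (g.appTop.hom z) (homOfLE (le_top : E ≤ ⊤)).op
  have h4 : w ∈ E ⊓ W.basicOpen (g.appTop.hom z) := by
    rw [← h3]; exact h2
  have h5 := h4.2
  have h6 := Scheme.preimage_basicOpen_top g z
  have h7 : w ∈ g ⁻¹ᵁ Y.basicOpen z := by rw [h6]; exact h5
  exact h7

lemma triv_res {W Y : Scheme.{u}} (g : W ⟶ Y) {V : Y.Opens} (L : LineBundleOn Y V)
    (htriv : (LineBundleOn.pullback g L).IsTrivial) :
    ∃ s : ∀ i, (Γ(W, g ⁻¹ᵁ (L.U i)))ˣ, ∀ i j (E : W.Opens) (hi : E ≤ g ⁻¹ᵁ (L.U i)) (hj : E ≤ g ⁻¹ᵁ (L.U j))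
      (D : Y.Opens) (hD : D ≤ L.U i ⊓ L.U j) (hE : E ≤ g ⁻¹ᵁ D),
      gS g hE (resS Y hD (L.t i j)) = ((resU W hi (s i) * (resU W hj (s j))⁻¹ : (Γ(W, E))ˣ) : Γ(W, E)) := by
  have htriv' : ∃ s : ∀ i : L.ι, (Γ(W, g ⁻¹ᵁ (L.U i)))ˣ, ∀ i j : L.ι,
    LineBundleOn.mapU g (LineBundleOn.preimage_inf_le g (L.U i) (L.U j)) (L.t i j) =
      resU W inf_le_left (s i) * (resU W inf_le_right (s j))⁻¹ := htriv
  obtain ⟨s, hs⟩ := htriv'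
  refine ⟨s, fun i j E hi hj D hD hE => ?_⟩
  have h1 := hs i j
  have h2 := congrArg (resU W (le_inf hi hj)) h1
  rw [map_mul, map_inv] at h2
  have h3 : resU W hi (s i) * (resU W hj (s j))⁻¹ = LineBundleOn.mapU g
      ((le_inf hi hj).trans (LineBundleOn.preimage_inf_le g (L.U i) (L.U j))) (L.t i j) := by
    refine Eq.trans ?_ (h2.symm.trans (LineBundleOn.resU_mapU _ _ _ _))
    exact congrArg₂ (fun a b => a * b⁻¹) (resU_resU W _ _ _).symm (resU_resU W _ _ _).symm
  rw [h3]
  exact gS_resS g _ _ _ _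

/-- A finite family of principal opens refining the cover. -/
lemma fin_cover {Y : Scheme.{u}} [IsAffine Y] {V : Y.Opens} (hV : IsCompact (V : Set Y)) (L : LineBundleOn Y V) :
    ∃ (α : Type u) (_ : Finite α) (r : α → Γ(Y, ⊤)) (i : α → L.ι),
      (∀ a, Y.basicOpen (r a) ≤ L.U (i a)) ∧ V ≤ iSup fun a => Y.basicOpen (r a) := by
  have h : ∀ y : V, ∃ (r : Γ(Y, ⊤)) (i : L.ι), Y.basicOpen r ≤ L.U i ∧ y.1 ∈ Y.basicOpen r := by
    intro y
    obtain ⟨i, hi⟩ := L.covers y.1 y.2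
    obtain ⟨r, h1, h2⟩ := (isAffineOpen_top Y).exists_basicOpen_le (V := L.U i) ⟨y.1, hi⟩ trivial
    exact ⟨r, i, h1, h2⟩
  choose r i h1 h2 using h
  obtain ⟨t, ht⟩ := hV.elim_finite_subcover (fun y : V => (Y.basicOpen (r y) : Set Y)) (fun y => (Y.basicOpen (r y)).2)
    (fun y hy => Set.mem_iUnion.mpr ⟨⟨y, hy⟩, h2 ⟨y, hy⟩⟩)
  refine ⟨t, inferInstance, fun a => r a, fun a => i a, fun a => h1 a, fun y hy => ?_⟩
  have := ht hy
  simp only [Set.mem_iUnion] at this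
  obtain ⟨a, ha, hya⟩ := this
  exact Opens.mem_iSup.mpr ⟨⟨a, ha⟩, hya⟩

lemma frob_eq {A : Type u} [CommRing A] (p : ℕ) [Fact p.Prime] (hp : (p : A) = 0) (z z' : A) (h : IsNilpotent (z - z')) :
    ∃ e0 : ℕ, ∀ e ≥ e0, z ^ p ^ e = z' ^ p ^ e := by
  obtain ⟨n, hn⟩ := h
  refine ⟨n, fun e he => ?_⟩
  rcases subsingleton_or_nontrivial A with h | h
  · exact Subsingleton.elim _ _
  haveI : CharP A p := (CharP.charP_iff_prime_eq_zero Fact.out).mpr hp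
  rw [← sub_eq_zero, ← sub_pow_char_pow]
  exact pow_eq_zero_of_le (he.trans (Nat.lt_pow_self (Nat.Prime.one_lt Fact.out)).le) hn

/-- Torsion from the core statement. -/
lemma torsion_of_core {W Y : Scheme.{u}} [IsAffine Y] [IsAffine W] (g : W ⟶ Y) (hg : Function.Surjective g.base)
    (p : ℕ) [Fact p.Prime] (hp : (p : Γ(Y, ⊤)) = 0) {V : Y.Opens} (hV : IsCompact (V : Set Y)) (L : LineBundleOn Y V)
    (htriv : (LineBundleOn.pullback g L).IsTrivial)
    (hcore : ∀ (α : Type u) [Finite α] (r : α → Γ(Y, ⊤)), (∀ a, Y.basicOpen (r a) ≤ V) →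
      (V ≤ iSup fun a => Y.basicOpen (r a)) → ∀ (k : α → ℕ) (β β' : α → Γ(W, ⊤)),
      (∀ a, β a * β' a = g.appTop.hom (r a ^ k a)) →
      (∀ a a', ∃ N : ℕ, ∃ ρ, g.appTop.hom ((r a * r a') ^ N) * (β a * β' a') = g.appTop.hom ρ) →
      ∃ n > 0, ∃ b b' : Γ(W, ⊤), b * b' = 1 ∧ ∀ a, ∃ N : ℕ, ∃ s, g.appTop.hom (r a ^ N) * (b' * β a ^ n) = g.appTop.hom s) :
    L.IsTorsion := by
  obtain ⟨α, _, r, i, hri, hc⟩ := fin_cover hV L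
  obtain ⟨s, hs⟩ := triv_res g L htriv
  let D : α → Y.Opens := fun a => Y.basicOpen (r a)
  let E : α → W.Opens := fun a => g ⁻¹ᵁ (D a)
  have hE : ∀ a, E a = W.basicOpen (g.appTop.hom (r a)) := fun a => Scheme.preimage_basicOpen_top g (r a)
  have hEU : ∀ a, E a ≤ g ⁻¹ᵁ (L.U (i a)) := fun a w hw => hri a hw
  let σ : ∀ a, (Γ(W, E a))ˣ := fun a => resU W (hEU a) (s (i a))
  have hDD : ∀ a a', D a ⊓ D a' = Y.basicOpen (r a * r a') := fun a a' => (Y.basicOpen_mul _ _).symm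
  have hEE : ∀ a a', E a ⊓ E a' = W.basicOpen (g.appTop.hom (r a * r a')) := fun a a' => by
    rw [map_mul, W.basicOpen_mul, hE, hE]
  have hEpre : ∀ a a', E a ⊓ E a' = g ⁻¹ᵁ (D a ⊓ D a') := fun a a' => rfl
  choose k m n β β' hβ hβ1 hβ2 using fun a => aff_beta (g.appTop.hom (r a)) (hE a) (σ a)
  have ht : ∀ a a', gS g (hEpre a a').le (resS Y (inf_le_inf (hri a) (hri a')) (L.t (i a) (i a'))) =
      ((resU W inf_le_left (σ a) * (resU W inf_le_right (σ a'))⁻¹ : (Γ(W, E a ⊓ E a'))ˣ) : Γ(W, E a ⊓ E a')) := by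
    intro a a'
    refine (hs (i a) (i a') (E a ⊓ E a') (inf_le_left.trans (hEU a)) (inf_le_right.trans (hEU a')) _ _ _).trans ?_
    rw [resU_resU, resU_resU]
  obtain ⟨N, hN, b, b', hbb, hb⟩ := hcore α r (fun a => (hri a).trans (L.le _)) hc k β β'
    (fun a => by rw [map_pow, hβ]) (by
      intro a a'
      obtain ⟨N0, τ, hτ⟩ := aff_surj (r a * r a') (hDD a a') (resS Y (inf_le_inf (hri a) (hri a')) (L.t (i a) (i a')))
      obtain ⟨c, hc⟩ := aff_eq (g.appTop.hom (r a * r a')) (hEE a a') (g.appTop.hom ((r a * r a') ^ N0) * (β a * β' a'))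
        (g.appTop.hom (τ * r a ^ m a * r a' ^ n a')) (by
          have e1 := congrArg (resS W (inf_le_left : E a ⊓ E a' ≤ E a)) (hβ1 a)
          have e2 := congrArg (resS W (inf_le_right : E a ⊓ E a' ≤ E a')) (hβ2 a')
          have e3 := congrArg (gS g (hEpre a a').le) hτ
          rw [resS_resS, map_mul, map_pow, resS_resS, ← resU_coe] at e1 e2
          rw [gS_res_top, map_mul, map_pow, gS_res_top, ht, Units.val_mul, ← map_inv] at e3
          rw [map_mul, map_mul, e1, e2, map_mul, map_mul, map_mul, map_mul, e3, map_pow, map_pow, map_pow, map_pow, map_pow, map_pow]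
          ring)
      refine ⟨c + N0, (r a * r a') ^ c * (τ * r a ^ m a * r a' ^ n a'), ?_⟩
      rw [map_mul _ (_ ^ _), map_pow _ _ c, ← hc, pow_add, map_mul, map_pow _ _ c, mul_assoc])
  choose M z hz using hb
  -- the local sections downstairs
  have hbu : ∀ O : W.Opens, IsUnit (resS W (le_top : O ≤ ⊤) b') := fun O =>
    (IsUnit.of_mul_eq_one b (by rw [mul_comm, hbb])).map _
  have hru : ∀ a, IsUnit (resS Y (le_top : D a ≤ ⊤) (r a)) := fun a => aff_unit _ le_rfl
  have hru' : ∀ a, IsUnit (resS W (le_top : E a ≤ ⊤) (g.appTop.hom (r a))) := fun a => aff_unit _ (hE a).le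
  have hz2 : ∀ a, resS W (le_top : E a ≤ ⊤) (g.appTop.hom (z a)) =
      resS W le_top (g.appTop.hom (r a)) ^ (M a + m a * N) * (resS W le_top b' * (σ a : Γ(W, E a)) ^ N) := by
    intro a
    rw [← hz, map_mul, map_mul, map_pow, map_pow, map_pow, hβ1, mul_pow, ← pow_mul, pow_add]
    ring
  have hzu : ∀ a, IsUnit (resS Y (le_top : D a ≤ ⊤) (z a)) := fun a => unit_of_surj g hg rfl _ (by
    show IsUnit (resS W (le_top : E a ≤ ⊤) (g.appTop.hom (z a)))
    rw [hz2]
    exact ((hru' a).pow _).mul ((hbu _).mul ((σ a).isUnit.pow _)))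
  let τ : ∀ a, (Γ(Y, D a))ˣ := fun a => (hzu a).unit * ((hru a).unit ^ (M a + m a * N))⁻¹
  have hτ : ∀ a, (hzu a).unit = τ a * (hru a).unit ^ (M a + m a * N) := fun a => by
    rw [inv_mul_cancel_right]
  have hτ2 : ∀ a, gS g (le_refl (E a)) (τ a : Γ(Y, D a)) = resS W le_top b' * (σ a : Γ(W, E a)) ^ N := by
    intro a
    have h1 := congrArg (fun y : (Γ(Y, D a))ˣ => gS g (le_refl (E a)) (y : Γ(Y, D a))) (hτ a)
    simp only [Units.val_mul, Units.val_pow_eq_pow_val, IsUnit.unit_spec, map_mul, map_pow] at h1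
    rw [gS_res_top, hz2, gS_res_top, mul_comm] at h1
    exact (((hru' a).pow _).mul_right_cancel h1).symm
  have hnil : ∀ a a', ∃ e0 : ℕ, ∀ e ≥ e0, ((resS Y (inf_le_inf (hri a) (hri a')) (L.t (i a) (i a'))) ^ N * resS Y inf_le_right (τ a' : Γ(Y, D a'))) ^ p ^ e
      = (resS Y inf_le_left (τ a : Γ(Y, D a))) ^ p ^ e := by
    intro a a'
    refine frob_eq p (by have := congrArg (resS Y (le_top : D a ⊓ D a' ≤ ⊤)) hp; rwa [map_natCast, map_zero] at this) _ _ ?_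
    refine nil_of_surj g hg ?_ (hEpre a a') _ ?_
    · rw [hDD]
      exact ((isAffineOpen_top Y).basicOpen _).isCompact
    · rw [map_sub, map_mul, map_pow, ht, gS_resS g _ _ (show E a ⊓ E a' ≤ g ⁻¹ᵁ (D a') from inf_le_right),
        gS_resS g _ _ (show E a ⊓ E a' ≤ g ⁻¹ᵁ (D a) from inf_le_left),
        ← resS_gS g (le_refl (E a')) inf_le_right, ← resS_gS g (le_refl (E a)) inf_le_left, hτ2, hτ2, map_mul, map_mul, map_pow, map_pow,
        resS_resS, resS_resS, ← resU_coe, ← resU_coe, ← Units.val_pow_eq_pow_val, mul_pow, Units.val_mul, inv_pow,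
        Units.val_pow_eq_pow_val, sub_eq_zero]
      rw [mul_left_comm, mul_assoc, ← Units.val_pow_eq_pow_val _ N, ← Units.val_pow_eq_pow_val _ N, Units.inv_mul, mul_one]
  choose e0 he0 using hnil
  obtain ⟨e, he⟩ : ∃ e : ℕ, ∀ a a', e0 a a' ≤ e := by
    obtain ⟨e, he⟩ := (Set.finite_range fun q : α × α => e0 q.1 q.2).bddAbove
    exact ⟨e, fun a a' => he ⟨(a, a'), rfl⟩⟩
  refine ⟨N * p ^ e, Nat.mul_pos hN (pow_pos (Nat.Prime.pos Fact.out) _), ?_⟩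
  refine triv_of_local L D i hri hc _ (fun a => τ a ^ p ^ e) fun a a' => ?_
  ext
  have := he0 a a' e (he a a')
  rw [mul_pow, ← pow_mul] at this
  rw [Units.val_mul, Units.val_pow_eq_pow_val, map_pow, map_pow, Units.val_pow_eq_pow_val, Units.val_pow_eq_pow_val]
  exact this

end Torsion

section Final

lemma loc_of_pushout {A C R S : CommRingCat.{u}} (φ : A ⟶ C) (l : A ⟶ R) (c : C ⟶ S) (m : R ⟶ S)
    (h : IsPushout φ l c m) (M : Submonoid A) (hl : @IsLocalization A _ M R _ l.hom.toAlgebra) :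
    @IsLocalization C _ (M.map φ.hom) S _ c.hom.toAlgebra := by
  letI : Algebra A C := φ.hom.toAlgebra
  letI : Algebra A R := l.hom.toAlgebra
  letI : Algebra C S := c.hom.toAlgebra
  letI : Algebra R S := m.hom.toAlgebra
  letI : Algebra A S := (c.hom.comp φ.hom).toAlgebra
  haveI : IsScalarTower A C S := IsScalarTower.of_algebraMap_eq fun _ => rfl
  haveI : IsScalarTower A R S := IsScalarTower.of_algebraMap_eq fun a => congr($(h.w).hom a)
  haveI : IsLocalization M R := hl
  have h1 : Algebra.IsPushout A C R S := CommRingCat.isPushout_iff_isPushout.mp h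
  exact (Algebra.isLocalization_iff_isPushout M R).mpr h1

lemma stalk_loc {X : Scheme.{u}} {U : X.Opens} (hU : IsAffineOpen U) (x : X) (hx : x ∈ U)
    (e : ⊤ ≤ (X.fromSpecStalk x) ⁻¹ᵁ U) :
    @IsLocalization Γ(X, U) _ (hU.primeIdealOf ⟨x, hx⟩).asIdeal.primeCompl Γ(Spec (X.presheaf.stalk x), ⊤) _
      ((X.fromSpecStalk x).appLE U ⊤ e).hom.toAlgebra := by
  letI a1 : Algebra Γ(X, U) (X.presheaf.stalk x) := (X.presheaf.germ U x hx).hom.toAlgebra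
  letI a2 : Algebra Γ(X, U) Γ(Spec (X.presheaf.stalk x), ⊤) := ((X.fromSpecStalk x).appLE U ⊤ e).hom.toAlgebra
  haveI : IsLocalization (hU.primeIdealOf ⟨x, hx⟩).asIdeal.primeCompl (X.presheaf.stalk x) := hU.isLocalization_stalk ⟨x, hx⟩
  have h : (X.fromSpecStalk x).appLE U ⊤ e = X.presheaf.germ U x hx ≫ (Scheme.ΓSpecIso (X.presheaf.stalk x)).inv := by
    rw [Scheme.Hom.appLE, Scheme.fromSpecStalk_app hx, Category.assoc, Category.assoc, ← Functor.map_comp]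
    congr 1
  refine IsLocalization.isLocalization_of_algEquiv (S := X.presheaf.stalk x) _
    (AlgEquiv.ofRingEquiv (f := (Scheme.ΓSpecIso (X.presheaf.stalk x)).symm.commRingCatIsoToRingEquiv) fun a => ?_)
  exact congr($(h.symm) a)

lemma surj_of_integral {W Y : Scheme.{u}} [IsAffine Y] [IsAffine W] (g : W ⟶ Y) (hi : g.appTop.hom.IsIntegral)
    (hn : ∀ r, g.appTop.hom r = 0 → IsNilpotent r) : Function.Surjective g.base := by
  have h1 : Function.Surjective (PrimeSpectrum.comap g.appTop.hom) := by
    have hd : DenseRange (PrimeSpectrum.comap g.appTop.hom) :=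
      (PrimeSpectrum.denseRange_comap_iff_ker_le_nilRadical _).mpr fun r hr => hn r hr
    have hc := (PrimeSpectrum.isClosedMap_comap_of_isIntegral g.appTop.hom hi).isClosed_range
    rw [← Set.range_eq_univ, ← hc.closure_eq, hd.closure_range]
  have h2 : Surjective (Spec.map g.appTop) := ⟨h1⟩
  have h3 : g = W.isoSpec.hom ≫ Spec.map g.appTop ≫ Y.isoSpec.inv := by
    rw [Scheme.isoSpec_hom_naturality_assoc, Iso.hom_inv_id, Category.comp_id]
  have h4 : Surjective (W.isoSpec.hom ≫ Spec.map g.appTop ≫ Y.isoSpec.inv) := inferInstance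
  rw [← h3] at h4
  exact h4.surj

lemma charp_X {k : Type u} [Field k] {X : Scheme.{u}} (sX : X ⟶ Spec (CommRingCat.of k)) (p : ℕ) [CharP k p] (U : X.Opens) :
    (p : Γ(X, U)) = 0 := by
  have h := congrArg (((Scheme.ΓSpecIso (CommRingCat.of k)).inv ≫ sX.appLE ⊤ U le_top).hom) (CharP.cast_eq_zero k p)
  rwa [map_natCast, map_zero] at h

lemma locNoeth {X : Scheme.{u}} (hexc : IsExcellentScheme X) : IsLocallyNoetherian X :=
  ⟨fun U => (hexc U.1 U.2).1⟩

lemma main_app {X Xb : Scheme.{u}} (hexc : IsExcellentScheme X) (hdim : PureDimGE X 3) (hS2 : IsTopologicallyS2 X)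
    (p : ℕ) [Fact p.Prime] (hpX : ∀ U : X.Opens, (p : Γ(X, U)) = 0)
    (x : X) (hres : Finite ↥(X.residueField x)) (nu : Xb ⟶ X) (hnu : IsNormalization nu)
    (V : (Spec (X.presheaf.stalk x)).Opens)
    (hV : (V : Set ↥(Spec (X.presheaf.stalk x))) = {IsLocalRing.closedPoint ↥(X.presheaf.stalk x)}ᶜ)
    (L : LineBundleOn (Spec (X.presheaf.stalk x)) V)
    (htriv : (LineBundleOn.pullback (Limits.pullback.snd nu (X.fromSpecStalk x)) L).IsTrivial) :
    L.IsTorsion := by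
  haveI := locNoeth hexc
  haveI : IsAffineHom nu := hnu.1
  haveI : IsAffineHom (Limits.pullback.snd nu (X.fromSpecStalk x)) := inferInstance
  haveI : IsAffine (Limits.pullback nu (X.fromSpecStalk x)) := isAffine_of_isAffineHom (Limits.pullback.snd nu (X.fromSpecStalk x))
  obtain ⟨U, hU, hx, -⟩ := exists_isAffineOpen_mem_and_subset (X := X) (x := x) (U := ⊤) trivial
  have hxU : x ∈ U := hx
  have eY : ⊤ ≤ (X.fromSpecStalk x) ⁻¹ᵁ U := by
    intro y _
    have h1 : X.fromSpecStalk x y ⤳ x := by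
      have : X.fromSpecStalk x y ∈ Set.range (X.fromSpecStalk x) := ⟨y, rfl⟩
      rw [Scheme.range_fromSpecStalk] at this
      exact this
    exact h1.mem_open U.2 hxU
  have H := IsPullback.of_hasPullback nu (X.fromSpecStalk x)
  have hUY : (⊤ : (Limits.pullback nu (X.fromSpecStalk x)).Opens) =
      (Limits.pullback.fst nu (X.fromSpecStalk x)) ⁻¹ᵁ (nu ⁻¹ᵁ U) ⊓ (Limits.pullback.snd nu (X.fromSpecStalk x)) ⁻¹ᵁ ⊤ := by
    refine le_antisymm (fun w _ => ⟨?_, trivial⟩) le_top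
    have h1 : X.fromSpecStalk x (Limits.pullback.snd nu (X.fromSpecStalk x) w) ∈ U := eY (x := _) trivial
    rw [← Scheme.Hom.comp_apply, ← Limits.pullback.condition, Scheme.Hom.comp_apply] at h1
    exact h1
  have hpush := (isIso_pushoutSection_iff H eY (le_refl (nu ⁻¹ᵁ U)) hUY).mp
    (isIso_pushoutSection_of_isAffineOpen H eY (le_refl (nu ⁻¹ᵁ U)) hUY hU (isAffineOpen_top _) (hU.preimage nu))
  rw [← Scheme.Hom.app_eq_appLE] at hpush
  have hl1 := stalk_loc hU x hxU eY
  have hl2 := loc_of_pushout _ _ _ _ hpush _ hl1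
  let g := Limits.pullback.snd nu (X.fromSpecStalk x)
  letI i1 : Algebra Γ(X, U) Γ(Spec (X.presheaf.stalk x), ⊤) := ((X.fromSpecStalk x).appLE U ⊤ eY).hom.toAlgebra
  letI i2 : Algebra Γ(Spec (X.presheaf.stalk x), ⊤) Γ(Limits.pullback nu (X.fromSpecStalk x), ⊤) := g.appTop.hom.toAlgebra
  letI i3 : Algebra Γ(Xb, nu ⁻¹ᵁ U) Γ(Limits.pullback nu (X.fromSpecStalk x), ⊤) :=
    ((Limits.pullback.fst nu (X.fromSpecStalk x)).appLE (nu ⁻¹ᵁ U) ⊤ (hUY.le.trans inf_le_left)).hom.toAlgebra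
  haveI i4 : IsLocalization.AtPrime Γ(Spec (X.presheaf.stalk x), ⊤) (hU.primeIdealOf ⟨x, hxU⟩).asIdeal := hl1
  haveI i5 : IsLocalization ((hU.primeIdealOf ⟨x, hxU⟩).asIdeal.primeCompl.map (nu.app U).hom)
    Γ(Limits.pullback nu (X.fromSpecStalk x), ⊤) := hl2
  have happ : g.appLE ⊤ ⊤ le_top = g.appTop := (Scheme.Hom.app_eq_appLE g).symm
  have hcomm : ∀ a, algebraMap Γ(Spec (X.presheaf.stalk x), ⊤) Γ(Limits.pullback nu (X.fromSpecStalk x), ⊤)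
      (algebraMap Γ(X, U) _ a) = algebraMap Γ(Xb, nu ⁻¹ᵁ U) _ ((nu.app U).hom a) := by
    intro a
    have h1 := congr($(hpush.w).hom a)
    have h2 : (g.appLE ⊤ ⊤ le_top).hom (algebraMap Γ(X, U) Γ(Spec (X.presheaf.stalk x), ⊤) a) =
      algebraMap Γ(Xb, nu ⁻¹ᵁ U) _ ((nu.app U).hom a) := h1.symm
    rw [happ] at h2
    exact h2
  let ψ : (X.presheaf.stalk x) ≃+* Γ(Spec (X.presheaf.stalk x), ⊤) :=
    (Scheme.ΓSpecIso (X.presheaf.stalk x)).symm.commRingCatIsoToRingEquiv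
  haveI i6 : IsLocalRing Γ(Spec (X.presheaf.stalk x), ⊤) := ψ.isLocalRing
  haveI i7 : Finite (IsLocalRing.ResidueField Γ(Spec (X.presheaf.stalk x), ⊤)) := by
    haveI : Finite (IsLocalRing.ResidueField (X.presheaf.stalk x)) := hres
    exact Finite.of_equiv _ (IsLocalRing.ResidueField.mapEquiv ψ).toEquiv
  have hp0 : (p : Γ(Spec (X.presheaf.stalk x), ⊤)) = 0 := by
    have := congrArg (algebraMap Γ(X, U) Γ(Spec (X.presheaf.stalk x), ⊤)) (hpX U)
    rwa [map_natCast, map_zero] at this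
  obtain ⟨n1, -, -, n4⟩ := norm_facts hnu U hU
  have hint : Algebra.IsIntegral Γ(Spec (X.presheaf.stalk x), ⊤) Γ(Limits.pullback nu (X.fromSpecStalk x), ⊤) :=
    lr_integral (nu.app U).hom (hU.primeIdealOf ⟨x, hxU⟩).asIdeal hcomm n4
  have hnil := lr_nil (nu.app U).hom (hU.primeIdealOf ⟨x, hxU⟩).asIdeal hcomm (fun a => (n1 a).1)
  have hsurj : Function.Surjective g.base := surj_of_integral g hint.isIntegral hnil
  haveI : IsNoetherianRing Γ(X, U) := (hexc U hU).1
  haveI : IsNoetherianRing Γ(Spec (X.presheaf.stalk x), ⊤) :=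
    IsLocalization.isNoetherianRing (hU.primeIdealOf ⟨x, hxU⟩).asIdeal.primeCompl _ inferInstance
  haveI : IsNoetherianRing (X.presheaf.stalk x) := isNoetherianRing_of_ringEquiv _ ψ.symm
  have hVc : IsCompact (V : Set (Spec (X.presheaf.stalk x))) :=
    NoetherianSpace.isCompact (α := PrimeSpectrum (X.presheaf.stalk x)) _
  refine torsion_of_core g hsurj p hp0 hVc L htriv ?_
  intro α _ r hrV hcov k β β' hβ hββ
  have hrm : ∀ a, r a ∈ IsLocalRing.maximalIdeal Γ(Spec (X.presheaf.stalk x), ⊤) := by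
    intro a
    by_contra h
    have hu : IsUnit (r a) := by
      by_contra h'
      exact h h'
    have h1 := Scheme.basicOpen_of_isUnit _ hu
    have h2 : IsLocalRing.closedPoint (X.presheaf.stalk x) ∈ (V : Set (Spec (X.presheaf.stalk x))) :=
      hrV a (by rw [h1]; trivial)
    rw [hV] at h2
    exact h2 rfl
  have hr : ∀ ζ : Ideal Γ(Spec (X.presheaf.stalk x), ⊤), ζ.IsPrime →
      ζ ≠ IsLocalRing.maximalIdeal Γ(Spec (X.presheaf.stalk x), ⊤) → ∃ a, r a ∉ ζ := by
    intro ζ hζ hζm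
    let y : Spec (X.presheaf.stalk x) := (⟨ζ.comap ψ.toRingHom, inferInstance⟩ : PrimeSpectrum (X.presheaf.stalk x))
    have hy : y ∈ V := by
      show y ∈ (V : Set (Spec (X.presheaf.stalk x)))
      rw [hV]
      intro hy
      apply hζm
      have hy' : ζ.comap ψ.toRingHom = IsLocalRing.maximalIdeal (X.presheaf.stalk x) := congrArg PrimeSpectrum.asIdeal hy
      refine ((IsLocalRing.maximalIdeal.isMaximal _).eq_of_le hζ.ne_top fun z hz => ?_).symm
      have h1 : ψ.symm z ∈ IsLocalRing.maximalIdeal (X.presheaf.stalk x) := by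
        intro hu
        have := hu.map ψ
        rw [RingEquiv.apply_symm_apply] at this
        exact hz this
      rw [← hy'] at h1
      have h2 : ψ (ψ.symm z) ∈ ζ := h1
      rwa [RingEquiv.apply_symm_apply] at h2
    obtain ⟨a, ha⟩ := Opens.mem_iSup.mp (hcov hy)
    refine ⟨a, fun hra => ?_⟩
    rw [basicOpen_eq_of_affine'] at ha
    apply ha
    show ψ (ψ.symm (r a)) ∈ ζ
    rwa [RingEquiv.apply_symm_apply]
  obtain ⟨⟨n, hn, b, b', hb, h⟩, -, -⟩ := core_app hexc hdim hS2 hnu p hpX x hres hU hxU hcomm r hrm k β β' hβ hr hββ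
  refine ⟨n, hn, b, b', hb, fun a => ?_⟩
  obtain ⟨N, s, hs⟩ := h a
  rw [Algebra.smul_def] at hs
  exact ⟨N, s, hs⟩

end Final

open LineBundleOn in
/-- Let `k` be a finite field and `X` an excellent `k`-scheme of pure dimension `≥ 3`
that is topologically `S2`. Let `x ∈ X` be a point with finite residue field, let
`ν : Xb ⟶ X` be the normalization of `X` and `x̄` the preimage of `x`. Then the kernel
of the pull-back map `π^* : Pic^loc(x, X) → Pic^loc(x̄, Xb)` consists of torsion
elements.  The local Picard group of `(x, X)` is the Picard group of the punctured
spectrum `V` of the local ring of `X` at `x`, and the punctured semilocal spectrum of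
`Xb` over `x` is realized as the preimage of `V` in `Xb ×_X Spec O_{X,x}`. -/
theorem stmt_0 (k : Type u) [Field k] [Finite k]
    (X : Scheme.{u}) (sX : X ⟶ Spec (CommRingCat.of k))
    (hexc : IsExcellentScheme X) (hdim : PureDimGE X 3) (hS2 : IsTopologicallyS2 X)
    (x : X) (hres : Finite ↥(X.residueField x))
    (Xb : Scheme.{u}) (nu : Xb ⟶ X) (hnu : IsNormalization nu)
    (V : (Spec (X.presheaf.stalk x)).Opens)
    (hV : (V : Set ↥(Spec (X.presheaf.stalk x))) =
      {IsLocalRing.closedPoint ↥(X.presheaf.stalk x)}ᶜ)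
    (L : LineBundleOn (Spec (X.presheaf.stalk x)) V)
    (htriv : (LineBundleOn.pullback
      (Limits.pullback.snd nu (X.fromSpecStalk x)) L).IsTrivial) :
    L.IsTorsion := by
  obtain ⟨p, hp⟩ := CharP.exists k
  haveI : Fact p.Prime := ⟨CharP.char_is_prime k p⟩
  exact main_app hexc hdim hS2 p (charp_X sX p) x hres nu hnu V hV L htriv

end LocalPic
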